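/- Let R be a local complete intersection ring and M, N nonzero finitely generated R-modules with λ(Tor_i^R(M,N)) < ∞ for all i ≫ 0 and depth_R(M ⊗_R N) ≥ cx_R(M,N) + 1. Then depth_R(M ⊗_R N) ≥ syz_R(M) + syz_R(N) − depth_R(R). -/

import Mathlib

open CategoryTheory

noncomputable section

universe u

variable (R : Type u) [CommRing R]

/-- The `i`-th Ext module of two `R`-modules. -/
abbrev ExtMod (i : ℕ) (M N : ModuleCat.{u} R) : ModuleCat.{u} R :=
  ((Ext R (ModuleCat.{u} R) i).obj (Opposite.op M)).obj N

/-- The `i`-th Tor module of two `R`-modules. -/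
abbrev TorMod (i : ℕ) (M N : ModuleCat.{u} R) : ModuleCat.{u} R :=
  ((Tor' (ModuleCat.{u} R) i).obj M).obj N

/-- `D^⊥`. -/
def perpSet (D : Set (ModuleCat.{u} R)) : Set (ModuleCat.{u} R) :=
  {Y | ∀ X ∈ D, ∀ i : ℕ, 0 < i → Subsingleton (ExtMod R i X Y)}

/-- `E^⊤`. -/
def topSet (E : Set (ModuleCat.{u} R)) : Set (ModuleCat.{u} R) :=
  {X | ∀ Y ∈ E, ∀ i : ℕ, 0 < i → Subsingleton (ExtMod R i X Y)}

/-- depth via maximal lengths of regular sequences in the maximal ideal. -/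
def depth [IsLocalRing R] (M : ModuleCat.{u} R) : ℕ :=
  sSup {n | ∃ rs : List R, rs.length = n ∧ (∀ r ∈ rs, r ∈ IsLocalRing.maximalIdeal R) ∧
    RingTheory.Sequence.IsRegular M rs}

/-- `pd_R M ≤ n` via free syzygies. -/
def ProjDimLE : ℕ → ModuleCat.{u} R → Prop
  | 0, M => Projective M
  | n+1, M => ∃ (K F : ModuleCat.{u} R) (f : K ⟶ F) (g : F ⟶ M) (w : f ≫ g = 0),
      Module.Free R F ∧ (ShortComplex.mk f g w).ShortExact ∧ ProjDimLE n K

/-- Projective dimension, in `ℕ∞`. -/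
def projDim (M : ModuleCat.{u} R) : ℕ∞ :=
  sInf {d : ℕ∞ | ∃ n : ℕ, d = n ∧ ProjDimLE R n M}

/-- Totally reflexive modules. -/
def TotallyReflexive (M : ModuleCat.{u} R) : Prop :=
  Function.Bijective (Module.Dual.eval R M) ∧
  (∀ i : ℕ, 0 < i → Subsingleton (ExtMod R i M (ModuleCat.of R R))) ∧
  (∀ i : ℕ, 0 < i → Subsingleton (ExtMod R i (ModuleCat.of R (Module.Dual R M)) (ModuleCat.of R R)))

/-- `G-dim_R M ≤ n` via syzygies. -/
def GdimLE : ℕ → ModuleCat.{u} R → Prop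
  | 0, M => TotallyReflexive R M
  | n+1, M => ∃ (K F : ModuleCat.{u} R) (f : K ⟶ F) (g : F ⟶ M) (w : f ≫ g = 0),
      Module.Free R F ∧ (ShortComplex.mk f g w).ShortExact ∧ GdimLE n K

/-- Gorenstein dimension, in `ℕ∞`. -/
def Gdim (M : ModuleCat.{u} R) : ℕ∞ :=
  sInf {d : ℕ∞ | ∃ n : ℕ, d = n ∧ GdimLE R n M}

/-- `M` is an `n`-th syzygy module. -/
def IsNthSyzygy : ℕ → ModuleCat.{u} R → Prop
  | 0, _ => True
  | n+1, M => ∃ (F C : ModuleCat.{u} R) (f : M ⟶ F) (g : F ⟶ C) (w : f ≫ g = 0),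
      Module.Free R F ∧ (ShortComplex.mk f g w).ShortExact ∧ IsNthSyzygy n C

/-- `syz_R M`: the largest `t ≤ depth R` such that `M` is a `t`-th syzygy. -/
def syz [IsLocalRing R] (M : ModuleCat.{u} R) : ℕ :=
  sSup {t | t ≤ depth R (ModuleCat.of R R) ∧ IsNthSyzygy R t M}

/-- Complexity of a sequence of natural numbers. -/
def seqComplexity (b : ℕ → ℕ) : ℕ :=
  sInf {r : ℕ | ∃ α : ℝ, ∀ᶠ n in Filter.atTop, (b n : ℝ) ≤ α * (n : ℝ) ^ ((r : ℝ) - 1)}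

/-- Minimal number of generators. -/
def numGen (M : ModuleCat.{u} R) : ℕ :=
  sInf {n | ∃ s : Finset M, s.card = n ∧ Submodule.span R (s : Set M) = ⊤}

/-- Complexity of a pair of modules. -/
def cx (M N : ModuleCat.{u} R) : ℕ :=
  seqComplexity (fun i => numGen R (ExtMod R i M N))

/-- Regular local ring: Noetherian local, maximal ideal generated by a regular sequence. -/
def IsRegularLocal (Q : Type u) [CommRing Q] : Prop :=
  IsLocalRing Q ∧ IsNoetherianRing Q ∧
  ∃ rs : List Q, RingTheory.Sequence.IsRegular Q rs ∧ (Ideal.span {x | x ∈ rs}).IsMaximal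

/-- Local complete intersection ring: the completion is a regular local ring
modulo a regular sequence. -/
def IsCompleteIntersectionLocal (R : Type u) [CommRing R] [IsLocalRing R] : Prop :=
  ∃ (Q : CommRingCat.{u})
    (φ : ↥Q →+* AdicCompletion (IsLocalRing.maximalIdeal R) R),
    IsRegularLocal ↥Q ∧ Function.Surjective φ ∧
    ∃ rs : List ↥Q, RingTheory.Sequence.IsRegular (↥Q) rs ∧
      RingHom.ker φ = Ideal.span {x | x ∈ rs}

/-- Gorenstein local ring: `R` has finite injective dimension over itself,
expressed via eventual vanishing of `Ext^i(-, R)`. -/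
def IsGorensteinLocal (R : Type u) [CommRing R] : Prop :=
  IsLocalRing R ∧ IsNoetherianRing R ∧
  ∃ n : ℕ, ∀ (M : ModuleCat.{u} R) (i : ℕ), n < i → Subsingleton (ExtMod R i M (ModuleCat.of R R))


set_option linter.unusedSectionVars false

namespace MatFac

set_option linter.unusedDecidableInType false


open MvPolynomial

/-- A finite free resolution given by a graded matrix together with an augmentation. -/
structure FinRes (Q : Type u) [CommRing Q] (N : Type u) [AddCommGroup N] [Module Q N]
    (ι : Type) [Fintype ι] where
  deg : ι → ℕ
  del : Matrix ι ι Q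
  aug : ι → N
  del_deg : ∀ x y, del x y ≠ 0 → deg y = deg x + 1
  del_sq : del * del = 0
  aug_deg : ∀ x, aug x ≠ 0 → deg x = 0
  aug_del : ∀ y, ∑ x, del x y • aug x = 0
  aug_span : Submodule.span Q (Set.range aug) = ⊤
  exact : ∀ v : ι → Q, del.mulVec v = 0 → ∑ x, v x • aug x = 0 → ∃ w, del.mulVec w = v

namespace FinRes

variable {Q : Type u} [CommRing Q] {N : Type u} [AddCommGroup N] [Module Q N]
  {ι : Type} [Fintype ι] (G : FinRes Q N ι)

/-- The degree `g` part of a vector. -/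
def proj (g : ℕ) (v : ι → Q) : ι → Q := fun x => if G.deg x = g then v x else 0

lemma del_proj (g : ℕ) (v : ι → Q) (hv : G.del.mulVec v = 0) :
    G.del.mulVec (G.proj g v) = 0 := by
  funext x
  by_cases h : G.deg x + 1 = g
  · rw [← hv]
    refine Finset.sum_congr rfl fun y _ => ?_
    by_cases h0 : G.del x y = 0
    · simp [h0]
    · simp [proj, G.del_deg x y h0, h]
  · refine Finset.sum_eq_zero fun y _ => ?_
    by_cases h0 : G.del x y = 0
    · simp [h0]
    · simp [proj, G.del_deg x y h0, h]

lemma aug_proj (g : ℕ) (v : ι → Q) (hv : ∑ x, v x • G.aug x = 0) :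
    ∑ x, G.proj g v x • G.aug x = 0 := by
  by_cases h : g = 0
  · rw [← hv]
    refine Finset.sum_congr rfl fun y _ => ?_
    by_cases h0 : G.aug y = 0
    · simp [h0]
    · simp [proj, G.aug_deg y h0, h]
  · refine Finset.sum_eq_zero fun y _ => ?_
    by_cases h0 : G.aug y = 0
    · simp [h0]
    · simp [proj, G.aug_deg y h0, Ne.symm h]

lemma exists_section : ∃ κ : (ι → Q) → (ι → Q),
    (∀ v, G.del.mulVec v = 0 → ∑ x, v x • G.aug x = 0 → G.del.mulVec (κ v) = v) ∧
    (∀ v x, κ v x ≠ 0 → ∃ x', G.deg x' + 1 = G.deg x ∧ v x' ≠ 0) := by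
  classical
  have hex : ∀ v : ι → Q, ∃ w, (G.del.mulVec v = 0 → ∑ x, v x • G.aug x = 0 →
      G.del.mulVec w = v) ∧ (v = 0 → w = 0) := by
    intro v
    by_cases hv : v = 0
    · exact ⟨0, by simp [hv]⟩
    · by_cases h : G.del.mulVec v = 0 ∧ ∑ x, v x • G.aug x = 0
      · obtain ⟨w, hw⟩ := G.exact v h.1 h.2
        exact ⟨w, fun _ _ => hw, fun h => absurd h hv⟩
      · exact ⟨0, fun h1 h2 => absurd ⟨h1, h2⟩ h, fun _ => rfl⟩
  choose κ hκ hκ0 using hex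
  refine ⟨fun v x => if G.deg x = 0 then 0 else κ (G.proj (G.deg x - 1) v) x, ?_, ?_⟩
  · intro v hv ha
    funext x
    have := congrFun (hκ (G.proj (G.deg x) v) (G.del_proj _ v hv) (G.aug_proj _ v ha)) x
    simp only [proj, if_true] at this
    rw [← this]
    refine Finset.sum_congr rfl fun y _ => ?_
    by_cases h0 : G.del x y = 0
    · simp [h0]
    · simp [G.del_deg x y h0]
  · intro v x hx
    by_cases h : G.deg x = 0
    · simp [h] at hx
    · by_contra! hc
      simp only [h, if_false] at hx
      apply hx
      rw [hκ0]
      · rfl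
      · funext x'
        simp only [proj, Pi.zero_apply, ite_eq_right_iff]
        intro h'
        exact hc x' (by omega)

/-- Exactness with coefficients in a module with a basis. -/
lemma exists_section_basis {V I : Type*} [AddCommGroup V] [Module Q V]
    (b : Module.Basis I Q V) (v : ι → V)
    (hv : ∀ x, ∑ y, G.del x y • v y = 0)
    (ha : ∀ i, ∑ x, b.repr (v x) i • G.aug x = 0) :
    ∃ w : ι → V, (∀ x, ∑ y, G.del x y • w y = v x) ∧
      ∀ x i, b.repr (w x) i ≠ 0 → ∃ x', G.deg x' + 1 = G.deg x ∧ b.repr (v x') i ≠ 0 := by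
  classical
  obtain ⟨κ, h1, h2⟩ := G.exists_section
  have hfin : ∀ x, (Function.support fun i => κ (fun y => b.repr (v y) i) x).Finite := by
    intro x
    refine Set.Finite.subset (Set.finite_iUnion fun y => (b.repr (v y)).hasFiniteSupport) ?_
    intro i hi
    obtain ⟨x', _, hx'⟩ := h2 _ x hi
    exact Set.mem_iUnion.2 ⟨x', hx'⟩
  refine ⟨fun x => b.repr.symm (Finsupp.ofSupportFinite _ (hfin x)), ?_, ?_⟩
  · intro x
    apply b.repr.injective
    ext i
    have := congrFun (h1 (fun y => b.repr (v y) i) ?_ (ha i)) x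
    · simpa [Matrix.mulVec, dotProduct, Finsupp.ofSupportFinite_coe] using this
    · funext x
      have := congrArg (fun t => b.repr t i) (hv x)
      simpa [Matrix.mulVec, dotProduct] using this
  · intro x i hi
    apply h2 _ x
    simpa [Finsupp.ofSupportFinite_coe] using hi

end FinRes

variable {Q : Type u} [CommRing Q] {N : Type u} [AddCommGroup N] [Module Q N]
  {ι σ : Type} [Fintype ι] [Fintype σ] [DecidableEq ι]

/-- The universal hypersurface `∑ f_j χ_j`. -/
def pot (f : σ → Q) : MvPolynomial σ Q := ∑ j, C (f j) * X j

/-- A graded matrix factorization of the universal hypersurface extending a free resolution. -/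
structure MF (f : σ → Q) (G : FinRes Q N ι) where
  A : Matrix ι ι (MvPolynomial σ Q)
  gr : ∀ x y μ, coeff μ (A x y) ≠ 0 → G.deg x + 1 = G.deg y + 2 * μ.degree
  sq : A * A = pot f • (1 : Matrix ι ι (MvPolynomial σ Q))
  zero_coeff : ∀ x y, coeff 0 (A x y) = G.del x y

lemma coeff_pot [DecidableEq σ] (f : σ → Q) (μ : σ →₀ ℕ) :
    coeff μ (pot f) = ∑ j, if Finsupp.single j 1 = μ then f j else 0 := by
  simp [pot, coeff_sum, coeff_C_mul, coeff_X]

lemma coeff_pot_degree (f : σ → Q) (μ : σ →₀ ℕ) (h : coeff μ (pot f) ≠ 0) : μ.degree = 1 := by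
  classical
  rw [coeff_pot] at h
  obtain ⟨j, _, hj⟩ := Finset.exists_ne_zero_of_sum_ne_zero h
  by_contra hc
  apply hj
  rw [if_neg]
  rintro rfl
  simp at hc

lemma coeff_mul_ne {p q : MvPolynomial σ Q} {μ : σ →₀ ℕ} (h : coeff μ (p * q) ≠ 0) :
    ∃ α β, α + β = μ ∧ coeff α p ≠ 0 ∧ coeff β q ≠ 0 := by
  classical
  rw [coeff_mul] at h
  obtain ⟨⟨a, b⟩, hm, hj⟩ := Finset.exists_ne_zero_of_sum_ne_zero h
  exact ⟨a, b, by simpa using hm, left_ne_zero_of_mul hj, right_ne_zero_of_mul hj⟩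


section existence

variable (f : σ → Q) (G : FinRes Q N ι)

/-- The matrix is graded and its constant part is the given differential. -/
structure IsGr (A : Matrix ι ι (MvPolynomial σ Q)) : Prop where
  gr : ∀ x y μ, coeff μ (A x y) ≠ 0 → G.deg x + 1 = G.deg y + 2 * μ.degree
  zero_coeff : ∀ x y, coeff 0 (A x y) = G.del x y

variable {f G}
variable {A : Matrix ι ι (MvPolynomial σ Q)}

lemma IsGr.eq_C (hA : IsGr G A) {x y : ι} (h : G.deg x + 1 ≤ G.deg y) :
    A x y = C (G.del x y) := by
  classical
  ext μ
  rw [coeff_C, ← hA.zero_coeff]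
  split_ifs with h0
  · rw [h0]
  · by_contra hc
    have := hA.gr x y μ hc
    apply h0
    rw [eq_comm, ← Finsupp.degree_eq_zero_iff]
    omega

lemma IsGr.sq_gr (hA : IsGr G A) (x y : ι) (μ : σ →₀ ℕ)
    (h : coeff μ ((A * A - pot f • (1 : Matrix ι ι (MvPolynomial σ Q))) x y) ≠ 0) :
    G.deg x + 2 = G.deg y + 2 * μ.degree := by
  rw [Matrix.sub_apply, coeff_sub] at h
  by_cases h1 : coeff μ ((A * A) x y) = 0
  · rw [h1, zero_sub, neg_ne_zero, Matrix.smul_apply, Matrix.one_apply] at h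
    split_ifs at h with hxy
    · subst hxy
      have := coeff_pot_degree f μ (by simpa using h)
      omega
    · simp at h
  · rw [Matrix.mul_apply, coeff_sum] at h1
    obtain ⟨z, _, hz⟩ := Finset.exists_ne_zero_of_sum_ne_zero h1
    obtain ⟨α, β, rfl, ha, hb⟩ := coeff_mul_ne hz
    have := hA.gr _ _ _ ha
    have := hA.gr _ _ _ hb
    rw [map_add]
    omega

lemma IsGr.aug (hA : IsGr G A) (y : ι) (μ : σ →₀ ℕ) :
    ∑ x, coeff μ (A x y) • G.aug x = 0 := by
  by_cases h : μ = 0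
  · subst h
    simp only [hA.zero_coeff, G.aug_del]
  · refine Finset.sum_eq_zero fun x _ => ?_
    by_contra hc
    have h1 := G.aug_deg x (right_ne_zero_of_smul hc)
    have h2 := hA.gr _ _ _ (left_ne_zero_of_smul hc)
    have h3 : μ.degree ≠ 0 := by rwa [Ne, Finsupp.degree_eq_zero_iff]
    omega

lemma IsGr.aug_sq (hf : ∀ j (n : N), f j • n = 0) (hA : IsGr G A) (y : ι) (μ : σ →₀ ℕ) :
    ∑ x, coeff μ ((A * A - pot f • (1 : Matrix ι ι (MvPolynomial σ Q))) x y) • G.aug x = 0 := by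
  classical
  simp only [Matrix.sub_apply, coeff_sub, sub_smul, Finset.sum_sub_distrib, Matrix.mul_apply,
    coeff_sum, coeff_mul, Finset.sum_smul]
  rw [Finset.sum_comm]
  have h1 : ∀ z, ∑ x, ∑ p ∈ Finset.HasAntidiagonal.antidiagonal μ,
      (coeff p.1 (A x z) * coeff p.2 (A z y)) • G.aug x = 0 := by
    intro z
    rw [Finset.sum_comm]
    refine Finset.sum_eq_zero fun p _ => ?_
    have := congrArg (fun t => coeff p.2 (A z y) • t) (hA.aug z p.1)
    simp only [Finset.smul_sum, smul_zero, smul_smul] at this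
    rw [← this]
    exact Finset.sum_congr rfl fun x _ => by rw [mul_comm]
  rw [Finset.sum_eq_zero fun z _ => h1 z, zero_sub, neg_eq_zero]
  refine Finset.sum_eq_zero fun x _ => ?_
  rw [Matrix.smul_apply, Matrix.one_apply]
  split_ifs
  · simp [coeff_pot, Finset.sum_smul, ite_smul, hf]
  · simp

/-- The leading part of the obstruction. -/
def obs (G : FinRes Q N ι) (o : Matrix ι ι (MvPolynomial σ Q)) (n : ℕ) :
    Matrix ι ι (MvPolynomial σ Q) :=
  fun x y => if G.deg x + 2 = G.deg y + 2 * n then o x y else 0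

lemma obs_apply (o : Matrix ι ι (MvPolynomial σ Q)) (n : ℕ) (x y : ι) :
    obs G o n x y = if G.deg x + 2 = G.deg y + 2 * n then o x y else 0 := rfl

variable (σ G) in
/-- The differential of a resolution with coefficients extended to polynomials. -/
def delP : Matrix ι ι (MvPolynomial σ Q) := G.del.map C

lemma delP_apply (x y : ι) : delP σ G x y = C (G.del x y) := rfl

lemma obs_comm (hA : IsGr G A) {o : Matrix ι ι (MvPolynomial σ Q)} (n : ℕ)
    (ho : ∀ x y, o x y ≠ 0 → G.deg y + 2 * n ≤ G.deg x + 2)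
    (hc : A * o = o * A) :
    delP σ G * obs G o n = obs G o n * delP σ G := by
  ext1 x y
  by_cases h : G.deg x + 3 = G.deg y + 2 * n
  · have h1 := congrFun (congrFun hc x) y
    convert h1 using 1
    · rw [Matrix.mul_apply, Matrix.mul_apply]
      refine Finset.sum_congr rfl fun z _ => ?_
      by_cases h0 : o z y = 0
      · simp [obs, h0]
      · have := ho _ _ h0
        rw [hA.eq_C (by omega), delP_apply]
        by_cases hd : G.del x z = 0
        · simp [hd]
        · have := G.del_deg _ _ hd
          rw [obs, if_pos (by omega)]
    · rw [Matrix.mul_apply, Matrix.mul_apply]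
      refine Finset.sum_congr rfl fun z _ => ?_
      by_cases h0 : o x z = 0
      · simp [obs, h0]
      · have := ho _ _ h0
        rw [hA.eq_C (by omega), delP_apply]
        by_cases hd : G.del z y = 0
        · simp [hd]
        · have := G.del_deg _ _ hd
          rw [obs, if_pos (by omega)]
  · rw [Matrix.mul_apply, Matrix.mul_apply, Finset.sum_eq_zero, Finset.sum_eq_zero]
    · intro z _
      rw [delP_apply]
      by_cases hd : G.del z y = 0
      · simp [hd]
      · have := G.del_deg _ _ hd
        rw [obs, if_neg (by omega), zero_mul]
    · intro z _
      rw [delP_apply]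
      by_cases hd : G.del x z = 0
      · simp [hd]
      · have := G.del_deg _ _ hd
        rw [obs, if_neg (by omega), mul_zero]

lemma del_map_sq : delP σ G * delP σ G = (0 : Matrix ι ι (MvPolynomial σ Q)) := by
  rw [delP, ← Matrix.map_mul, G.del_sq]
  ext1 x y
  simp

lemma exists_null_homotopy {o : Matrix ι ι (MvPolynomial σ Q)} {n : ℕ} (hn : 1 ≤ n)
    (hgr : ∀ x y μ, coeff μ (o x y) ≠ 0 → G.deg x + 2 = G.deg y + 2 * μ.degree)
    (hcomm : delP σ G * obs G o n = obs G o n * delP σ G)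
    (haug : ∀ y μ, ∑ x, coeff μ (o x y) • G.aug x = 0) (k : ℕ) :
    ∃ h : Matrix ι ι (MvPolynomial σ Q),
      (∀ x y μ, coeff μ (h x y) ≠ 0 → G.deg x + 1 = G.deg y + 2 * n ∧ μ.degree = n) ∧
      ∀ y, G.deg y < k → ∀ x,
        (delP σ G * h) x y + (h * delP σ G) x y = - obs G o n x y := by
  classical
  induction k with
  | zero => exact ⟨0, by simp, by simp⟩
  | succ k ih =>
    obtain ⟨h, h1, h2⟩ := ih
    have h1' : ∀ x y, h x y ≠ 0 → G.deg x + 1 = G.deg y + 2 * n := by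
      intro x y hxy
      obtain ⟨μ, hμ⟩ := MvPolynomial.ne_zero_iff.1 hxy
      exact (h1 x y μ hμ).1
    have key : ∀ y, G.deg y = k → ∃ w : ι → MvPolynomial σ Q,
        (∀ x, (∑ z, C (G.del x z) * w z) + (h * delP σ G) x y = - obs G o n x y) ∧
        (∀ x μ, coeff μ (w x) ≠ 0 → G.deg x + 1 = G.deg y + 2 * n ∧ μ.degree = n) := by
      intro y hy
      have c1 : ∀ x, ∑ z, G.del x z • (- obs G o n z y - (h * delP σ G) z y) = 0 := by
        intro x
        have e1 : (delP σ G * (- obs G o n - h * delP σ G)) x y = 0 := by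
          have e2 : ∀ w, (delP σ G * h) x w * delP σ G w y =
              (-(obs G o n) x w - (h * delP σ G) x w) * delP σ G w y := by
            intro w
            by_cases hd : G.del w y = 0
            · simp [hd, delP_apply]
            · have := G.del_deg _ _ hd
              rw [← h2 w (by omega) x]
              ring
          have e3 : (delP σ G * h * delP σ G) x y =
              ((-(obs G o n) - h * delP σ G) * delP σ G) x y := by
            rw [Matrix.mul_apply, Matrix.mul_apply]
            exact Finset.sum_congr rfl fun w _ => e2 w
          rw [Matrix.mul_sub, Matrix.sub_apply, ← Matrix.mul_assoc, e3, Matrix.sub_mul,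
            Matrix.mul_assoc h, del_map_sq, Matrix.mul_neg, hcomm, Matrix.mul_zero, Matrix.neg_mul]
          simp
        rw [Matrix.mul_apply] at e1
        simpa [← C_mul', delP_apply] using e1
      have c2 : ∀ μ, ∑ x, (basisMonomials σ Q).repr (- obs G o n x y - (h * delP σ G) x y) μ •
          G.aug x = 0 := by
        intro μ
        change ∑ x, coeff μ (- obs G o n x y - (h * delP σ G) x y) • G.aug x = 0
        have e1 : ∀ x, coeff μ (- obs G o n x y - (h * delP σ G) x y) • G.aug x =
            if G.deg y + 2 * n = 2 then - (coeff μ (o x y) • G.aug x) else 0 := by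
          intro x
          by_cases ha : G.aug x = 0
          · simp [ha]
          · have hx := G.aug_deg x ha
            have : (h * delP σ G) x y = 0 := by
              rw [Matrix.mul_apply]
              refine Finset.sum_eq_zero fun z _ => ?_
              by_cases h0 : h x z = 0
              · simp [h0]
              · have := h1' _ _ h0
                omega
            rw [this, obs, hx]
            by_cases h5 : 0 + 2 = G.deg y + 2 * n
            · rw [if_pos h5, if_pos (by omega)]
              simp
            · rw [if_neg h5, if_neg (by omega)]
              simp
        rw [Finset.sum_congr rfl fun x _ => e1 x]
        split_ifs
        · rw [Finset.sum_neg_distrib, haug, neg_zero]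
        · simp
      obtain ⟨w, hw1, hw2⟩ := G.exists_section_basis (basisMonomials σ Q)
        (fun x => - obs G o n x y - (h * delP σ G) x y) c1 c2
      refine ⟨w, fun x => ?_, fun x μ hx => ?_⟩
      · have := hw1 x
        simp only [← C_mul'] at this
        rw [this]
        ring
      · obtain ⟨x', hx1, hx2⟩ := hw2 x μ hx
        replace hx2 : coeff μ (- obs G o n x' y - (h * delP σ G) x' y) ≠ 0 := hx2
        rw [coeff_sub, coeff_neg] at hx2
        by_cases h3 : coeff μ (obs G o n x' y) = 0
        · rw [h3, neg_zero, zero_sub, neg_ne_zero, Matrix.mul_apply, coeff_sum] at hx2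
          obtain ⟨z, _, hz⟩ := Finset.exists_ne_zero_of_sum_ne_zero hx2
          rw [delP_apply, mul_comm, coeff_C_mul, mul_comm] at hz
          have a1 := h1 _ _ _ (left_ne_zero_of_mul hz)
          have a2 := G.del_deg _ _ (right_ne_zero_of_mul hz)
          omega
        · rw [obs] at h3
          split_ifs at h3 with h4
          · have := hgr _ _ _ h3
            omega
          · simp at h3
    choose w hw1 hw2 using key
    obtain ⟨h', hh⟩ : ∃ h' : Matrix ι ι (MvPolynomial σ Q), ∀ x y,
        h' x y = if hy : G.deg y = k then w y hy x else h x y :=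
      ⟨Matrix.of fun x y => if hy : G.deg y = k then w y hy x else h x y, fun _ _ => rfl⟩
    refine ⟨h', ?_, ?_⟩
    · intro x y μ
      rw [hh]
      split_ifs with hy
      · exact hw2 y hy x μ
      · exact h1 x y μ
    · intro y hy x
      have e : (h' * delP σ G) x y = (h * delP σ G) x y := by
        rw [Matrix.mul_apply, Matrix.mul_apply]
        refine Finset.sum_congr rfl fun z _ => ?_
        by_cases hd : G.del z y = 0
        · simp [hd, delP_apply]
        · have := G.del_deg _ _ hd
          rw [hh, dif_neg (by omega)]
      rw [e]
      by_cases hk : G.deg y = k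
      · rw [← hw1 y hk x, Matrix.mul_apply]
        simp [hk, hh, delP_apply]
      · rw [← h2 y (by omega) x, Matrix.mul_apply, Matrix.mul_apply]
        simp [hk, hh, Matrix.mul_apply]

lemma IsGr.step (hf : ∀ j (n : N), f j • n = 0) (hA : IsGr G A) {n : ℕ} (hn : 1 ≤ n)
    (ho : ∀ x y, (A * A - pot f • (1 : Matrix ι ι (MvPolynomial σ Q))) x y ≠ 0 →
      G.deg y + 2 * n ≤ G.deg x + 2) :
    ∃ A' : Matrix ι ι (MvPolynomial σ Q), IsGr G A' ∧
      ∀ x y, (A' * A' - pot f • (1 : Matrix ι ι (MvPolynomial σ Q))) x y ≠ 0 →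
        G.deg y + 2 * (n + 1) ≤ G.deg x + 2 := by
  classical
  set o := A * A - pot f • (1 : Matrix ι ι (MvPolynomial σ Q)) with ho_def
  have hcomm : A * o = o * A := by
    rw [ho_def]
    simp [Matrix.mul_sub, Matrix.sub_mul, Matrix.mul_assoc]
  obtain ⟨h, h1, h2⟩ := exists_null_homotopy (o := o) hn (fun x y μ => hA.sq_gr x y μ)
    (obs_comm hA n ho hcomm) (fun y μ => hA.aug_sq hf y μ) (Finset.univ.sup G.deg + 1)
  have h1' : ∀ x y, h x y ≠ 0 → G.deg x + 1 = G.deg y + 2 * n := by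
    intro x y hxy
    obtain ⟨μ, hμ⟩ := MvPolynomial.ne_zero_iff.1 hxy
    exact (h1 x y μ hμ).1
  have hA' : IsGr G (A + h) := by
    constructor
    · intro x y μ hμ
      rw [Matrix.add_apply, coeff_add] at hμ
      by_cases h0 : coeff μ (h x y) = 0
      · rw [h0, add_zero] at hμ
        exact hA.gr _ _ _ hμ
      · have := h1 _ _ _ h0
        omega
    · intro x y
      rw [Matrix.add_apply, coeff_add, hA.zero_coeff, add_eq_left]
      by_contra h0
      have := h1 _ _ _ h0
      simp at this
      omega
  refine ⟨A + h, hA', fun x y hne => ?_⟩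
  have e : (A + h) * (A + h) - pot f • (1 : Matrix ι ι (MvPolynomial σ Q)) =
      (o + (A * h + h * A)) + h * h := by
    rw [ho_def, Matrix.add_mul, Matrix.mul_add, Matrix.mul_add]
    abel
  by_contra hlt
  apply hne
  rw [e, Matrix.add_apply]
  have e4 : (h * h) x y = 0 := by
    rw [Matrix.mul_apply]
    refine Finset.sum_eq_zero fun z _ => ?_
    by_contra hc
    have := h1' _ _ (left_ne_zero_of_mul hc)
    have := h1' _ _ (right_ne_zero_of_mul hc)
    omega
  rw [e4, add_zero]
  by_cases hxy : G.deg x + 2 = G.deg y + 2 * n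
  · have e5 := h2 y (Nat.lt_succ_of_le (Finset.le_sup (Finset.mem_univ y))) x
    have e6 : (A * h) x y = (delP σ G * h) x y := by
      rw [Matrix.mul_apply, Matrix.mul_apply]
      refine Finset.sum_congr rfl fun z _ => ?_
      by_cases h0 : h z y = 0
      · simp [h0]
      · have := h1' _ _ h0
        rw [hA.eq_C (by omega), delP_apply]
    have e7 : (h * A) x y = (h * delP σ G) x y := by
      rw [Matrix.mul_apply, Matrix.mul_apply]
      refine Finset.sum_congr rfl fun z _ => ?_
      by_cases h0 : h x z = 0
      · simp [h0]
      · have := h1' _ _ h0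
        rw [hA.eq_C (by omega), delP_apply]
    rw [Matrix.add_apply, Matrix.add_apply, e6, e7, e5, obs_apply, if_pos hxy]
    simp
  · have e5 : o x y = 0 := by
      by_contra hc
      obtain ⟨μ, hμ⟩ := MvPolynomial.ne_zero_iff.1 hc
      have := ho _ _ hc
      have := hA.sq_gr x y μ hμ
      omega
    rw [Matrix.add_apply, Matrix.add_apply, e5, zero_add, Matrix.mul_apply, Matrix.mul_apply,
      Finset.sum_eq_zero, Finset.sum_eq_zero, add_zero]
    · intro z _
      by_contra hc
      have a1 := h1' _ _ (left_ne_zero_of_mul hc)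
      obtain ⟨μ, hμ⟩ := MvPolynomial.ne_zero_iff.1 (right_ne_zero_of_mul hc)
      have := hA.gr _ _ _ hμ
      omega
    · intro z _
      by_contra hc
      have a1 := h1' _ _ (right_ne_zero_of_mul hc)
      obtain ⟨μ, hμ⟩ := MvPolynomial.ne_zero_iff.1 (left_ne_zero_of_mul hc)
      have := hA.gr _ _ _ hμ
      omega

end existence

theorem MF.exists (f : σ → Q) (G : FinRes Q N ι) (hf : ∀ j (n : N), f j • n = 0) :
    Nonempty (MF f G) := by
  have key : ∀ n, ∃ A : Matrix ι ι (MvPolynomial σ Q), IsGr G A ∧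
      ∀ x y, (A * A - pot f • (1 : Matrix ι ι (MvPolynomial σ Q))) x y ≠ 0 →
        G.deg y + 2 * (n + 1) ≤ G.deg x + 2 := by
    intro n
    induction n with
    | zero =>
      have h0 : IsGr G (delP σ G) := by
        classical
        constructor
        · intro x y μ h
          rw [delP_apply, coeff_C] at h
          split_ifs at h with h0
          · subst h0
            have := G.del_deg _ _ h
            simp [this]
          · simp at h
        · intro x y
          simp [delP_apply]
      refine ⟨_, h0, fun x y hxy => ?_⟩
      obtain ⟨μ, hμ⟩ := MvPolynomial.ne_zero_iff.1 hxy
      have e := h0.sq_gr x y μ hμ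
      have : μ.degree ≠ 0 := by
        rw [Ne, Finsupp.degree_eq_zero_iff]
        rintro rfl
        rw [del_map_sq, Matrix.sub_apply, Matrix.zero_apply, zero_sub, coeff_neg, neg_ne_zero,
          Matrix.smul_apply, Matrix.one_apply] at hμ
        split_ifs at hμ
        · have := coeff_pot_degree f 0 (by simpa using hμ)
          simp at this
        · simp at hμ
      omega
    | succ n ih =>
      obtain ⟨A, hA, ho⟩ := ih
      exact hA.step hf (by omega) ho
  obtain ⟨A, hA, ho⟩ := key (Finset.univ.sup G.deg + 1)
  refine ⟨⟨A, hA.gr, ?_, hA.zero_coeff⟩⟩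
  rw [← sub_eq_zero]
  ext1 x y
  by_contra hc
  have := ho _ _ hc
  have : G.deg x ≤ Finset.univ.sup G.deg := Finset.le_sup (Finset.mem_univ x)
  omega

open MvPolynomial

section TC

variable {Q : Type u} [CommRing Q] {σ ι : Type} [Fintype ι] [Fintype σ]
  {X Y Z : Type u} [AddCommGroup X] [Module Q X] [AddCommGroup Y] [Module Q Y]
  [AddCommGroup Z] [Module Q Z]

variable (Q σ ι X) in
/-- Tuples of functionals on the polynomial ring, with values in a module. -/
abbrev TC := ι → (MvPolynomial σ Q →ₗ[Q] X)

/-- The transpose of a matrix acting on tuples of functionals. -/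
def dT {κ : Type} (A : Matrix κ ι (MvPolynomial σ Q)) : TC Q σ ι X →ₗ[Q] TC Q σ κ X where
  toFun z x := ∑ y, (z y) ∘ₗ LinearMap.mulLeft Q (A x y)
  map_add' z w := by
    funext x
    simp [LinearMap.add_comp, Finset.sum_add_distrib]
  map_smul' c z := by
    funext x
    simp [LinearMap.smul_comp, Finset.smul_sum]

lemma dT_apply {κ : Type} (A : Matrix κ ι (MvPolynomial σ Q)) (z : TC Q σ ι X) (x : κ)
    (s : MvPolynomial σ Q) : dT A z x s = ∑ y, z y (A x y * s) := by
  simp [dT]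

lemma TC.ext_mono {z w : TC Q σ ι X}
    (h : ∀ x μ, z x (monomial μ 1) = w x (monomial μ 1)) : z = w := by
  funext x
  apply (basisMonomials σ Q).ext
  intro μ
  simpa using h x μ

/-- A tuple of functionals with prescribed values at the monomials. -/
def TC.mk (c : ι → (σ →₀ ℕ) → X) : TC Q σ ι X :=
  fun x => (basisMonomials σ Q).constr Q (c x)

@[simp] lemma TC.mk_mono (c : ι → (σ →₀ ℕ) → X) (x : ι) (μ : σ →₀ ℕ) :
    (TC.mk c : TC Q σ ι X) x (monomial μ 1) = c x μ := by
  have := (basisMonomials σ Q).constr_basis Q (c x) μ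
  simpa [TC.mk] using this

lemma apply_eq_sum (z : MvPolynomial σ Q →ₗ[Q] X) (p : MvPolynomial σ Q) :
    z p = ∑ ν ∈ p.support, coeff ν p • z (monomial ν 1) := by
  conv_lhs => rw [p.as_sum, map_sum]
  refine Finset.sum_congr rfl fun ν _ => ?_
  rw [← map_smul, smul_monomial, smul_eq_mul, mul_one]

lemma apply_mul_mono (z : MvPolynomial σ Q →ₗ[Q] X) (p : MvPolynomial σ Q) (μ : σ →₀ ℕ) :
    z (p * monomial μ 1) = ∑ ν ∈ p.support, coeff ν p • z (monomial (ν + μ) 1) := by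
  conv_lhs => rw [p.as_sum, Finset.sum_mul, map_sum]
  refine Finset.sum_congr rfl fun ν _ => ?_
  rw [← map_smul, smul_monomial, smul_eq_mul, mul_one, monomial_mul, mul_one]

lemma exists_of_dT_ne {κ : Type} {A : Matrix κ ι (MvPolynomial σ Q)} {z : TC Q σ ι X} {x : κ}
    {μ : σ →₀ ℕ} (h : dT A z x (monomial μ 1) ≠ 0) :
    ∃ y ν, coeff ν (A x y) ≠ 0 ∧ z y (monomial (ν + μ) 1) ≠ 0 := by
  rw [dT_apply] at h
  obtain ⟨y, _, hy⟩ := Finset.exists_ne_zero_of_sum_ne_zero h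
  rw [apply_mul_mono] at hy
  obtain ⟨ν, _, hν⟩ := Finset.exists_ne_zero_of_sum_ne_zero hy
  exact ⟨y, ν, left_ne_zero_of_smul hν, right_ne_zero_of_smul hν⟩

lemma dT_dT {κ τ : Type} [Fintype κ] (A : Matrix τ κ (MvPolynomial σ Q))
    (B : Matrix κ ι (MvPolynomial σ Q)) (z : TC Q σ ι X) :
    dT A (dT B z) = dT (A * B) z := by
  funext x
  refine LinearMap.ext fun s => ?_
  simp only [dT_apply, Matrix.mul_apply, Finset.sum_mul, map_sum]
  rw [Finset.sum_comm]
  refine Finset.sum_congr rfl fun y _ => Finset.sum_congr rfl fun w _ => ?_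
  rw [← mul_assoc, mul_comm (B w y)]

/-- The degree `i` part, supported away from the variables in `J`. -/
def TD (deg : ι → ℕ) (J : Set σ) (i : ℕ) : Submodule Q (TC Q σ ι X) where
  carrier := {z | ∀ x μ, z x (monomial μ 1) ≠ 0 → deg x + 2 * μ.degree = i ∧ ∀ l ∈ J, μ l = 0}
  zero_mem' := by simp
  add_mem' := by
    intro z w hz hw x μ h
    by_cases h0 : z x (monomial μ 1) = 0
    · exact hw x μ (by simpa [h0] using h)
    · exact hz x μ h0
  smul_mem' := by
    intro c z hz x μ h
    exact hz x μ (right_ne_zero_of_smul (by simpa using h))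

lemma mem_TD {deg : ι → ℕ} {J : Set σ} {i : ℕ} {z : TC Q σ ι X} : z ∈ TD deg J i ↔
    ∀ x μ, z x (monomial μ 1) ≠ 0 → deg x + 2 * μ.degree = i ∧ ∀ l ∈ J, μ l = 0 := Iff.rfl

/-- Matrices lowering the degree by one, the variables having degree two. -/
def GrMat (deg : ι → ℕ) (A : Matrix ι ι (MvPolynomial σ Q)) : Prop :=
  ∀ x y μ, coeff μ (A x y) ≠ 0 → deg x + 1 = deg y + 2 * μ.degree

variable {deg : ι → ℕ} {A : Matrix ι ι (MvPolynomial σ Q)} {J : Set σ} {i : ℕ}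

lemma dT_mem (hA : GrMat deg A) {z : TC Q σ ι X} (hz : z ∈ TD deg J (i + 1)) :
    dT A z ∈ TD deg J i := by
  intro x μ h
  obtain ⟨y, ν, h1, h2⟩ := exists_of_dT_ne h
  have a1 := hA _ _ _ h1
  have a2 := hz _ _ h2
  rw [map_add] at a2
  refine ⟨by omega, fun l hl => ?_⟩
  have := a2.2 l hl
  simp at this
  exact this.2

lemma dT_zero_deg (hA : GrMat deg A) {z : TC Q σ ι X} (hz : z ∈ TD deg J 0) :
    dT A z = 0 := by
  refine TC.ext_mono fun x μ => ?_
  by_contra h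
  obtain ⟨y, ν, h1, h2⟩ := exists_of_dT_ne h
  have a1 := hA _ _ _ h1
  have a2 := hz _ _ h2
  rw [map_add] at a2
  omega

/-- Postcomposition with a linear map. -/
def mapT (g : X →ₗ[Q] Y) : TC Q σ ι X →ₗ[Q] TC Q σ ι Y where
  toFun z x := g ∘ₗ z x
  map_add' z w := by funext x; simp [LinearMap.comp_add]
  map_smul' c z := by funext x; simp [LinearMap.comp_smul]

@[simp] lemma mapT_apply (g : X →ₗ[Q] Y) (z : TC Q σ ι X) (x : ι) (s : MvPolynomial σ Q) :
    mapT g z x s = g (z x s) := rfl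

lemma dT_mapT {κ : Type} (B : Matrix κ ι (MvPolynomial σ Q)) (g : X →ₗ[Q] Y) (z : TC Q σ ι X) :
    dT B (mapT g z) = mapT g (dT B z) := by
  funext x
  refine LinearMap.ext fun s => ?_
  simp [dT_apply]

lemma mapT_mem (g : X →ₗ[Q] Y) {z : TC Q σ ι X} (hz : z ∈ TD deg J i) :
    mapT g z ∈ TD deg J i := by
  intro x μ h
  refine hz x μ fun h0 => h ?_
  simp [h0]

lemma mapT_injective {g : X →ₗ[Q] Y} (hg : Function.Injective g) :
    Function.Injective (mapT g : TC Q σ ι X →ₗ[Q] TC Q σ ι Y) := by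
  intro z w h
  refine TC.ext_mono fun x μ => hg ?_
  exact LinearMap.congr_fun (congrFun h x) _

lemma exists_mapT_eq (g : X →ₗ[Q] Y) {z : TC Q σ ι Y} (hz : z ∈ TD deg J i)
    (h : ∀ x μ, z x (monomial μ 1) ∈ LinearMap.range g) :
    ∃ w : TC Q σ ι X, w ∈ TD deg J i ∧ mapT g w = z := by
  classical
  have : ∀ x μ, ∃ v, g v = z x (monomial μ 1) ∧ (z x (monomial μ 1) = 0 → v = 0) := by
    intro x μ
    by_cases h0 : z x (monomial μ 1) = 0
    · exact ⟨0, by simp [h0]⟩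
    · obtain ⟨v, hv⟩ := h x μ
      exact ⟨v, hv, fun h => absurd h h0⟩
  choose v hv hv0 using this
  refine ⟨TC.mk v, fun x μ hx => hz x μ fun h0 => hx ?_, TC.ext_mono fun x μ => ?_⟩
  · simp [hv0 x μ h0]
  · simp [hv]

lemma exists_mapT_eq_of_surjective {g : X →ₗ[Q] Y} (hg : Function.Surjective g)
    {z : TC Q σ ι Y} (hz : z ∈ TD deg J i) :
    ∃ w : TC Q σ ι X, w ∈ TD deg J i ∧ mapT g w = z :=
  exists_mapT_eq g hz fun _ _ => hg _

lemma exists_mapT_eq_of_exact {f : X →ₗ[Q] Y} {g : Y →ₗ[Q] Z} (h : Function.Exact f g)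
    {z : TC Q σ ι Y} (hz : z ∈ TD deg J i) (h0 : mapT g z = 0) :
    ∃ w : TC Q σ ι X, w ∈ TD deg J i ∧ mapT f w = z :=
  exists_mapT_eq f hz fun x μ => (h _).1 (LinearMap.congr_fun (congrFun h0 x) _)

lemma mapT_mapT_of_exact {f : X →ₗ[Q] Y} {g : Y →ₗ[Q] Z} (h : Function.Exact f g)
    (z : TC Q σ ι X) : mapT g (mapT f z) = 0 := by
  funext x
  refine LinearMap.ext fun s => ?_
  exact (h _).2 ⟨_, rfl⟩

/-- The action of a variable. -/
def chi (l : σ) : TC Q σ ι X →ₗ[Q] TC Q σ ι X where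
  toFun z x := z x ∘ₗ LinearMap.mulLeft Q (MvPolynomial.X l)
  map_add' z w := by funext x; simp [LinearMap.add_comp]
  map_smul' c z := by funext x; simp [LinearMap.smul_comp]

lemma chi_apply (l : σ) (z : TC Q σ ι X) (x : ι) (s : MvPolynomial σ Q) :
    chi l z x s = z x (MvPolynomial.X l * s) := rfl

lemma chi_mono (l : σ) (z : TC Q σ ι X) (x : ι) (μ : σ →₀ ℕ) :
    chi l z x (monomial μ 1) = z x (monomial (Finsupp.single l 1 + μ) 1) := by
  rw [chi_apply, MvPolynomial.X, monomial_mul, mul_one]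

lemma dT_chi {κ : Type} (B : Matrix κ ι (MvPolynomial σ Q)) (l : σ) (z : TC Q σ ι X) :
    dT B (chi l z) = chi l (dT B z) := by
  funext x
  refine LinearMap.ext fun s => ?_
  simp only [dT_apply, chi_apply]
  exact Finset.sum_congr rfl fun y _ => by rw [mul_left_comm]

lemma mapT_chi (g : X →ₗ[Q] Y) (l : σ) (z : TC Q σ ι X) :
    mapT g (chi l z) = chi l (mapT g z) := rfl

lemma chi_mem (l : σ) {z : TC Q σ ι X} (hz : z ∈ TD deg J (i + 2)) : chi l z ∈ TD deg J i := by
  intro x μ h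
  rw [chi_mono] at h
  have := hz _ _ h
  rw [map_add, Finsupp.degree_single] at this
  refine ⟨by omega, fun k hk => ?_⟩
  have := this.2 k hk
  simp at this
  exact this.2

lemma chi_eq_zero_of_lt (l : σ) (hi : i < 2) {z : TC Q σ ι X} (hz : z ∈ TD deg J i) :
    chi l z = 0 := by
  refine TC.ext_mono fun x μ => ?_
  by_contra h
  rw [chi_mono] at h
  have := hz _ _ h
  rw [map_add, Finsupp.degree_single] at this
  omega

lemma exists_chi_eq {l : σ} (hl : l ∉ J) {z : TC Q σ ι X} (hz : z ∈ TD deg J i) :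
    ∃ w : TC Q σ ι X, w ∈ TD deg J (i + 2) ∧ chi l w = z := by
  classical
  refine ⟨TC.mk fun x μ => if 1 ≤ μ l then z x (monomial (μ - Finsupp.single l 1) 1) else 0,
    fun x μ h => ?_, TC.ext_mono fun x μ => ?_⟩
  · rw [TC.mk_mono] at h
    split_ifs at h with h1
    · have h2 := hz _ _ h
      have h3 : (μ - Finsupp.single l 1) + Finsupp.single l 1 = μ :=
        tsub_add_cancel_of_le (by simpa using h1)
      have h4 := congrArg Finsupp.degree h3
      rw [map_add, Finsupp.degree_single] at h4
      refine ⟨by omega, fun k hk => ?_⟩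
      have h5 := h2.2 k hk
      have : l ≠ k := by rintro rfl; exact hl hk
      simpa [Finsupp.single_apply, this] using h5
    · simp at h
  · rw [chi_mono, TC.mk_mono, if_pos (by simp), add_tsub_cancel_left]

lemma mem_TD_insert {l : σ} {z : TC Q σ ι X} :
    z ∈ TD deg (insert l J) i ↔ z ∈ TD deg J i ∧ chi l z = 0 := by
  classical
  constructor
  · intro hz
    refine ⟨fun x μ h => ⟨(hz x μ h).1, fun k hk => (hz x μ h).2 k (Or.inr hk)⟩,
      TC.ext_mono fun x μ => ?_⟩
    by_contra h
    rw [chi_mono] at h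
    have := (hz _ _ h).2 l (Or.inl rfl)
    simp at this
  · rintro ⟨hz, h0⟩ x μ h
    refine ⟨(hz x μ h).1, fun k hk => ?_⟩
    rcases hk with rfl | hk
    · by_contra hc
      apply h
      have h3 : Finsupp.single k 1 + (μ - Finsupp.single k 1) = μ :=
        add_tsub_cancel_of_le (by simpa using Nat.one_le_iff_ne_zero.2 hc)
      rw [← h3, ← chi_mono, h0]
      simp
    · exact (hz x μ h).2 k hk

lemma TD_anti {J' : Set σ} (h : J ⊆ J') : (TD deg J' i : Submodule Q (TC Q σ ι X)) ≤ TD deg J i :=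
  fun _ hz x μ hx => ⟨(hz x μ hx).1, fun l hl => (hz x μ hx).2 l (h hl)⟩

lemma chi_eq_zero_of_mem {l : σ} (hl : l ∈ J) {z : TC Q σ ι X} (hz : z ∈ TD deg J i) :
    chi l z = 0 := by
  have : z ∈ TD deg (insert l J) i := by rwa [Set.insert_eq_of_mem hl]
  exact (mem_TD_insert.1 this).2

variable [DecidableEq ι] {f : σ → Q}

lemma dT_sq (hA : A * A = pot f • (1 : Matrix ι ι (MvPolynomial σ Q))) (z : TC Q σ ι X) :
    dT A (dT A z) = ∑ j, f j • chi j z := by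
  rw [dT_dT, hA]
  funext x
  refine LinearMap.ext fun s => ?_
  rw [dT_apply, Finset.sum_eq_single x]
  · simp only [Matrix.smul_apply, Matrix.one_apply_eq, smul_eq_mul, mul_one, pot, Finset.sum_mul,
      map_sum, Finset.sum_apply, LinearMap.coe_sum, Pi.smul_apply, LinearMap.smul_apply, chi_apply]
    refine Finset.sum_congr rfl fun j _ => ?_
    rw [← map_smul, smul_eq_C_mul, mul_assoc]
  · intro y _ hy
    simp [Matrix.one_apply_ne' hy]
  · simp

lemma dT_sq_zero (hA : A * A = pot f • (1 : Matrix ι ι (MvPolynomial σ Q)))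
    (hX : ∀ j, ∀ x : X, f j • x = 0) (z : TC Q σ ι X) : dT A (dT A z) = 0 := by
  rw [dT_sq hA]
  refine Finset.sum_eq_zero fun j _ => ?_
  funext x
  refine LinearMap.ext fun s => ?_
  simp [hX]

end TC

open MvPolynomial

section chase

variable {Q : Type u} [CommRing Q] {σ ι : Type} [Fintype ι] [Fintype σ] [DecidableEq ι]
  {X F Y : Type u} [AddCommGroup X] [Module Q X] [AddCommGroup F] [Module Q F]
  [AddCommGroup Y] [Module Q Y]

/-- The boundaries of degree `i`. -/
def Bd (deg : ι → ℕ) (A : Matrix ι ι (MvPolynomial σ Q)) (J : Set σ) (i : ℕ) :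
    Submodule Q (TC Q σ ι X) :=
  (TD deg J (i + 1)).map (dT A)

lemma mem_Bd {deg : ι → ℕ} {A : Matrix ι ι (MvPolynomial σ Q)} {J : Set σ} {i : ℕ}
    {z : TC Q σ ι X} : z ∈ Bd deg A J i ↔ ∃ w ∈ TD deg J (i + 1), dT A w = z := Iff.rfl

/-- Every cycle of degree `i` is a boundary up to a power of `y`. -/
def Acyc (y : Q) (deg : ι → ℕ) (A : Matrix ι ι (MvPolynomial σ Q)) (J : Set σ)
    (X : Type u) [AddCommGroup X] [Module Q X] (i : ℕ) : Prop :=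
  ∀ z : TC Q σ ι X, z ∈ TD deg J i → dT A z = 0 → ∃ t : ℕ, y ^ t • z ∈ Bd deg A J i

variable {deg : ι → ℕ} {A : Matrix ι ι (MvPolynomial σ Q)} {J : Set σ} {i : ℕ} {y : Q}

lemma acyc_one : Acyc 1 deg A J X i ↔
    ∀ z : TC Q σ ι X, z ∈ TD deg J i → dT A z = 0 → z ∈ Bd deg A J i := by
  simp [Acyc]

lemma Acyc.of_one (h : Acyc 1 deg A J X i) (y : Q) : Acyc y deg A J X i :=
  fun z hz h0 => ⟨0, by simpa using acyc_one.1 h z hz h0⟩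

lemma Acyc.of_equiv (g : X ≃ₗ[Q] Y) (h : Acyc y deg A J X i) : Acyc y deg A J Y i := by
  intro z hz h0
  obtain ⟨t, w, hw, e⟩ := h (mapT g.symm.toLinearMap z) (mapT_mem _ hz) (by rw [dT_mapT, h0, map_zero])
  refine ⟨t, mapT g.toLinearMap w, mapT_mem _ hw, ?_⟩
  rw [dT_mapT, e]
  funext x
  refine LinearMap.ext fun s => ?_
  simp

variable {p : X →ₗ[Q] F} {q : F →ₗ[Q] Y}

lemma Acyc.left (hp : Function.Injective p) (hq : Function.Surjective q)
    (hpq : Function.Exact p q) (hgr : GrMat deg A) (hF0 : ∀ i, ∀ z ∈ (TD deg J i : Submodule Q (TC Q σ ι F)), dT A (dT A z) = 0)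
    (hF : Acyc y deg A J F i) (hY : Acyc y deg A J Y (i + 1)) : Acyc y deg A J X i := by
  intro z hz h0
  obtain ⟨t, w, hw, e⟩ := hF (mapT p z) (mapT_mem _ hz) (by rw [dT_mapT, h0, map_zero])
  obtain ⟨s, v, hv, e'⟩ := hY (mapT q w) (mapT_mem _ hw) (by
    rw [dT_mapT, e, map_smul, mapT_mapT_of_exact hpq, smul_zero])
  obtain ⟨v', hv', rfl⟩ := exists_mapT_eq_of_surjective hq hv
  obtain ⟨w', hw', e''⟩ := exists_mapT_eq_of_exact hpq
    (z := y ^ s • w - dT A v') (Submodule.sub_mem _ (Submodule.smul_mem _ _ hw) (dT_mem hgr hv'))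
    (by rw [map_sub, map_smul, ← dT_mapT, e', sub_self])
  refine ⟨s + t, w', hw', mapT_injective hp ?_⟩
  rw [← dT_mapT, e'', map_sub, map_smul, e, hF0 _ _ hv', sub_zero, map_smul, pow_add, mul_smul]

lemma Acyc.right (hp : Function.Injective p) (hq : Function.Surjective q)
    (hpq : Function.Exact p q) (hgr : GrMat deg A) (hF0 : ∀ i, ∀ z ∈ (TD deg J i : Submodule Q (TC Q σ ι F)), dT A (dT A z) = 0)
    (hF : Acyc y deg A J F (i + 1)) (hX : Acyc y deg A J X i) : Acyc y deg A J Y (i + 1) := by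
  intro z hz h0
  obtain ⟨z', hz', rfl⟩ := exists_mapT_eq_of_surjective hq hz
  rw [dT_mapT] at h0
  obtain ⟨u, hu, e⟩ := exists_mapT_eq_of_exact hpq (dT_mem hgr hz') h0
  obtain ⟨t, w, hw, e'⟩ := hX u hu (mapT_injective hp (by
    rw [← dT_mapT, e, hF0 _ _ hz', map_zero]))
  obtain ⟨s, v, hv, e''⟩ := hF (y ^ t • z' - mapT p w)
    (Submodule.sub_mem _ (Submodule.smul_mem _ _ hz') (mapT_mem _ hw))
    (by rw [map_sub, map_smul, dT_mapT, e', map_smul, e, sub_self])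
  refine ⟨s + t, mapT q v, mapT_mem _ hv, ?_⟩
  rw [dT_mapT, e'', map_smul, map_sub, mapT_mapT_of_exact hpq, sub_zero, map_smul, pow_add,
    mul_smul]

variable {l : σ} (hgr : GrMat deg A) (h0 : ∀ z : TC Q σ ι X, dT A (dT A z) = 0)
include hgr h0

lemma Acyc.insert_succ (hl : l ∉ J) (h1 : Acyc y deg A J X (i + 1)) (h2 : Acyc y deg A J X i) :
    Acyc y deg A (insert l J) X (i + 1) := by
  intro z hz hz0
  obtain ⟨hzJ, hzl⟩ := mem_TD_insert.1 hz
  obtain ⟨t, w, hw, e⟩ := h1 z hzJ hz0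
  obtain ⟨s, v, hv, e'⟩ := h2 (chi l w) (chi_mem l hw) (by
    rw [dT_chi, e, map_smul, hzl, smul_zero])
  obtain ⟨v', hv', rfl⟩ := exists_chi_eq hl hv
  refine ⟨s + t, y ^ s • w - dT A v', mem_TD_insert.2
    ⟨Submodule.sub_mem _ (Submodule.smul_mem _ _ hw) (dT_mem hgr hv'), ?_⟩, ?_⟩
  · rw [map_sub, map_smul, ← dT_chi, e', sub_self]
  · rw [map_sub, map_smul, e, h0, sub_zero, pow_add, mul_smul]

lemma Acyc.of_insert (hl : l ∉ J) (h1 : Acyc y deg A (insert l J) X (i + 1))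
    (h2 : Acyc y deg A J X (i + 2)) : Acyc y deg A J X i := by
  intro z hz hz0
  obtain ⟨z', hz', rfl⟩ := exists_chi_eq hl hz
  obtain ⟨t, w, hw, e⟩ := h1 (dT A z') (mem_TD_insert.2 ⟨dT_mem hgr hz', by
    rw [← dT_chi, hz0]⟩) (h0 _)
  obtain ⟨hwJ, hwl⟩ := mem_TD_insert.1 hw
  obtain ⟨s, v, hv, e'⟩ := h2 (y ^ t • z' - w)
    (Submodule.sub_mem _ (Submodule.smul_mem _ _ hz') hwJ)
    (by rw [map_sub, map_smul, e, sub_self])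
  refine ⟨s + t, chi l v, chi_mem l hv, ?_⟩
  rw [dT_chi, e', map_smul, map_sub, hwl, sub_zero, map_smul, pow_add, mul_smul]

/-- A cycle annihilated in homology by `I` which is not a boundary, moved to fewer variables. -/
lemma exists_socle_insert (hl : l ∉ J) {I : Set Q} {z : TC Q σ ι X} (hz : z ∈ TD deg J i)
    (hz0 : dT A z = 0) (hzb : z ∉ Bd deg A J i) (hI : ∀ y ∈ I, y • z ∈ Bd deg A J i)
    (h2 : Acyc 1 deg A J X (i + 2)) :
    ∃ z' : TC Q σ ι X, z' ∈ TD deg (insert l J) (i + 1) ∧ dT A z' = 0 ∧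
      z' ∉ Bd deg A (insert l J) (i + 1) ∧ ∀ y ∈ I, y • z' ∈ Bd deg A (insert l J) (i + 1) := by
  obtain ⟨z', hz', rfl⟩ := exists_chi_eq hl hz
  refine ⟨dT A z', mem_TD_insert.2 ⟨dT_mem hgr hz', by rw [← dT_chi, hz0]⟩, h0 _, ?_, ?_⟩
  · rintro ⟨w, hw, e⟩
    obtain ⟨hwJ, hwl⟩ := mem_TD_insert.1 hw
    obtain ⟨v, hv, e'⟩ := acyc_one.1 h2 (z' - w) (Submodule.sub_mem _ hz' hwJ)
      (by rw [map_sub, e, sub_self])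
    exact hzb ⟨chi l v, chi_mem l hv, by rw [dT_chi, e', map_sub, hwl, sub_zero]⟩
  · intro y hy
    obtain ⟨u, hu, e⟩ := hI y hy
    obtain ⟨u', hu', rfl⟩ := exists_chi_eq hl hu
    refine ⟨y • z' - dT A u', mem_TD_insert.2
      ⟨Submodule.sub_mem _ (Submodule.smul_mem _ _ hz') (dT_mem hgr hu'), ?_⟩, ?_⟩
    · rw [map_sub, map_smul, ← dT_chi, e, sub_self]
    · rw [map_sub, map_smul, h0, sub_zero]

lemma Acyc.eventually_insert (hl : l ∉ J) (h : ∃ n, ∀ i, n ≤ i → Acyc y deg A J X i) :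
    ∃ n, ∀ i, n ≤ i → Acyc y deg A (insert l J) X i := by
  obtain ⟨n, hn⟩ := h
  refine ⟨n + 1, fun i hi => ?_⟩
  obtain ⟨j, rfl⟩ : ∃ j, i = j + 1 := ⟨i - 1, by omega⟩
  exact Acyc.insert_succ hgr h0 hl (hn _ (by omega)) (hn _ (by omega))

/-- Vanishing in large degrees, together with vanishing above the number of variables when all
variables are suppressed, gives vanishing above the number of suppressed variables. -/
lemma Acyc.top (hall : ∀ i, Fintype.card σ < i → Acyc y deg A Set.univ X i)
    (h : ∃ n, ∀ i, n ≤ i → Acyc y deg A J X i) (hi : J.ncard < i) : Acyc y deg A J X i := by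
  classical
  obtain ⟨k, hk⟩ : ∃ k, k = Jᶜ.ncard := ⟨_, rfl⟩
  induction k generalizing J i with
  | zero =>
    have : J = Set.univ := by
      rw [eq_comm, Set.ncard_eq_zero (Set.toFinite _)] at hk
      simpa using hk
    subst this
    apply hall
    rwa [Set.ncard_univ, Nat.card_eq_fintype_card] at hi
  | succ k ih =>
    obtain ⟨l, hl⟩ : (Jᶜ).Nonempty := by
      rw [← Set.ncard_pos (Set.toFinite _)]
      omega
    have hc : k = ((insert l J)ᶜ).ncard := by
      have e : Jᶜ \ {l} = (insert l J)ᶜ := by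
        ext a; simp [not_or, and_comm]
      rw [← e, Set.ncard_diff_singleton_of_mem hl]
      omega
    have hl' : l ∉ J := hl
    have hcard : (insert l J).ncard = J.ncard + 1 := Set.ncard_insert_of_notMem hl'
    obtain ⟨n, hn⟩ := h
    have step : ∀ m i, J.ncard < i → n ≤ i + 2 * m → Acyc y deg A J X i := by
      intro m
      induction m with
      | zero => exact fun i _ h => hn i (by omega)
      | succ m ihm =>
        intro i hi hni
        exact Acyc.of_insert hgr h0 hl' (ih (Acyc.eventually_insert hgr h0 hl' ⟨n, hn⟩)
          (by omega) hc) (ihm (i + 2) (by omega) (by omega))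
    exact step n i hi (by omega)

end chase

open MvPolynomial

section koszul

variable {Q : Type u} [CommRing Q] {N : Type u} [AddCommGroup N] [Module Q N]
  {ι : Type} [Fintype ι] [DecidableEq ι] {e : ℕ} {f : Fin e → Q} {G : FinRes Q N ι}

/-- The variables with index at least `j`. -/
def Jge (e j : ℕ) : Set (Fin e) := {l | j ≤ l.1}

lemma Jge_zero : Jge e 0 = Set.univ := by ext; simp [Jge]

lemma Jge_self : Jge e e = ∅ := by ext l; simp [Jge]

lemma Jge_insert (j : Fin e) : insert j (Jge e (j + 1)) = Jge e j := by
  ext l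
  simp only [Jge, Set.mem_insert_iff, Set.mem_ofPred_eq, Fin.ext_iff]
  omega

lemma notMem_Jge (j : Fin e) : j ∉ Jge e (j + 1) := by simp [Jge]

lemma dT_sq_of_mem (F : MF f G) {X : Type u} [AddCommGroup X] [Module Q X] {J : Set (Fin e)}
    {i : ℕ} {z : TC Q (Fin e) ι X} (hz : z ∈ TD G.deg J i)
    (hJ : ∀ l, l ∉ J → ∀ x : X, f l • x = 0) : dT F.A (dT F.A z) = 0 := by
  rw [dT_sq F.sq]
  refine Finset.sum_eq_zero fun l _ => ?_
  by_cases hl : l ∈ J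
  · rw [chi_eq_zero_of_mem hl hz, smul_zero]
  · funext x
    refine LinearMap.ext fun s => ?_
    simp [hJ l hl]

/-- The properties of the partial quotients of a free module by the regular sequence. -/
structure Stage (m : Set Q) (F : MF f G) (j : ℕ) (X : Type u) [AddCommGroup X] [Module Q X] :
    Prop where
  kill : ∀ l : Fin e, l.1 < j → ∀ x : X, f l • x = 0
  exact : ∀ i, 1 ≤ i → Acyc 1 G.deg F.A (Jge e j) X i
  van : ∀ i, j < i → Acyc 1 G.deg F.A Set.univ X i
  nosoc : ∀ z : TC Q (Fin e) ι X, z ∈ TD G.deg Set.univ j → dT F.A z = 0 →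
    (∀ y ∈ m, y • z ∈ Bd G.deg F.A Set.univ j) → z ∈ Bd G.deg F.A Set.univ j

variable {m : Set Q} {F : MF f G} {X X' : Type u} [AddCommGroup X] [Module Q X]
  [AddCommGroup X'] [Module Q X']

lemma eq_mono_zero {i : ℕ} {z : TC Q (Fin e) ι X} (hz : z ∈ TD G.deg Set.univ i) (x : ι)
    {μ : Fin e →₀ ℕ} (h : z x (monomial μ 1) ≠ 0) : μ = 0 := by
  ext l
  exact (hz x μ h).2 l trivial

lemma dT_univ_apply {i : ℕ} {z : TC Q (Fin e) ι X} (hz : z ∈ TD G.deg Set.univ i) (x : ι) :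
    dT F.A z x (monomial 0 1) = ∑ y, G.del x y • z y (monomial 0 1) := by
  rw [dT_apply]
  refine Finset.sum_congr rfl fun y _ => ?_
  rw [apply_mul_mono, ← F.zero_coeff]
  by_cases h : coeff 0 (F.A x y) = 0
  · rw [h, zero_smul]
    refine Finset.sum_eq_zero fun ν hν => ?_
    by_contra h1
    have h2 : z y (monomial (ν + 0) 1) ≠ 0 := fun h => h1 (by rw [h, smul_zero])
    have := eq_mono_zero hz y h2
    rw [add_zero] at this
    rw [this] at hν
    exact (mem_support_iff.1 hν) h
  · refine (Finset.sum_eq_single 0 (fun ν _ hν => ?_) fun h0 => ?_)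
    · by_contra h1
      have h2 : z y (monomial (ν + 0) 1) ≠ 0 := fun h => h1 (by rw [h, smul_zero])
      exact hν (by simpa using eq_mono_zero hz y h2)
    · exact absurd (mem_support_iff.2 h) h0

lemma bd_univ_of_basis {I : Type*} (b : Module.Basis I Q X) {i : ℕ} {z : TC Q (Fin e) ι X}
    (hz : z ∈ TD G.deg Set.univ i) (hz0 : dT F.A z = 0)
    (ha : ∀ i, ∑ x, b.repr (z x (monomial 0 1)) i • G.aug x = 0) :
    z ∈ Bd G.deg F.A Set.univ i := by
  classical
  obtain ⟨w, h1, h2⟩ := G.exists_section_basis b (fun x => z x (monomial 0 1)) (fun x => by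
    rw [← dT_univ_apply (F := F) hz, hz0]; simp) ha
  have hw : TC.mk (fun x μ => if μ = 0 then w x else 0) ∈
      (TD G.deg Set.univ (i + 1) : Submodule Q (TC Q (Fin e) ι X)) := by
    intro x μ h
    rw [TC.mk_mono] at h
    split_ifs at h with h0
    · subst h0
      obtain ⟨k, hk⟩ : ∃ k, b.repr (w x) k ≠ 0 := by
        by_contra! hh
        exact h (b.repr.injective (by ext k; simpa using hh k))
      obtain ⟨x', h3, h4⟩ := h2 x k hk
      have := (hz x' 0 (fun h0 => h4 (by rw [h0]; simp))).1
      simp only [map_zero, mul_zero, add_zero] at this ⊢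
      exact ⟨by omega, by simp⟩
    · exact absurd rfl h
  refine ⟨_, hw, TC.ext_mono fun x μ => ?_⟩
  by_cases h0 : μ = 0
  · subst h0
    rw [dT_univ_apply hw, ← h1]
    simp only [TC.mk_mono, if_true]
  · trans 0
    · by_contra h
      exact h0 (eq_mono_zero (dT_mem F.gr hw) x h)
    · by_contra h
      exact h0 (eq_mono_zero hz x (Ne.symm h))

lemma Stage.zero {I : Type*} (b : Module.Basis I Q X) (hN : ∀ n : N, (∀ y ∈ m, y • n = 0) → n = 0) :
    Stage m F 0 X := by
  have h1 : ∀ i, 0 < i → Acyc 1 G.deg F.A Set.univ X i := by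
    refine fun i hi => acyc_one.2 fun z hz hz0 => bd_univ_of_basis b hz hz0 fun k => ?_
    refine Finset.sum_eq_zero fun x _ => ?_
    by_cases h : G.aug x = 0
    · rw [h, smul_zero]
    · by_cases h' : z x (monomial 0 1) = 0
      · rw [h', map_zero, Finsupp.zero_apply, zero_smul]
      · have h2 := (hz x 0 h').1
        have h3 := G.aug_deg x h
        simp at h2
        omega
  refine ⟨fun l hl => absurd hl (by omega), fun i hi => ?_, h1, fun z hz hz0 hy => ?_⟩
  · rw [Jge_zero]; exact h1 i hi
  · refine bd_univ_of_basis b hz hz0 fun k => hN _ fun y hym => ?_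
    obtain ⟨w, hw, e⟩ := hy y hym
    have h2 : ∀ x, y • z x (monomial 0 1) = ∑ x', G.del x x' • w x' (monomial 0 1) := by
      intro x
      rw [← dT_univ_apply hw, e]; rfl
    rw [Finset.smul_sum]
    have h3 : ∀ x, y • b.repr (z x (monomial 0 1)) k • G.aug x =
        ∑ x', b.repr (w x' (monomial 0 1)) k • G.del x x' • G.aug x := by
      intro x
      rw [← mul_smul, ← smul_eq_mul, ← Finsupp.smul_apply, ← map_smul, h2, map_sum]
      simp only [map_smul, Finsupp.coe_finsetSum, Finset.sum_apply, Finsupp.smul_apply,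
        Finset.sum_smul, smul_eq_mul]
      exact Finset.sum_congr rfl fun x' _ => by rw [mul_comm, mul_smul]
    simp only [h3]
    rw [Finset.sum_comm]
    refine Finset.sum_eq_zero fun x' _ => ?_
    rw [← Finset.smul_sum, G.aug_del, smul_zero]

lemma Stage.succ (j : Fin e) (h : Stage m F j X) {π : X →ₗ[Q] X'} (hπ : Function.Surjective π)
    (hreg : Function.Injective (LinearMap.lsmul Q X (f j)))
    (hex : Function.Exact (LinearMap.lsmul Q X (f j)) π) : Stage m F (j + 1) X' := by
  have hkill : ∀ l : Fin e, l.1 < j + 1 → ∀ x : X', f l • x = 0 := by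
    intro l hl x
    obtain ⟨x, rfl⟩ := hπ x
    rcases Nat.lt_succ_iff_lt_or_eq.1 hl with hl | hl
    · rw [← map_smul, h.kill l hl, map_zero]
    · obtain rfl : l = j := Fin.ext hl
      rw [← map_smul]
      exact (hex _).2 ⟨x, rfl⟩
  have hsm : ∀ z : TC Q (Fin e) ι X, mapT (LinearMap.lsmul Q X (f j)) z = f j • z := by
    intro z; rfl
  have hinj : ∀ z w : TC Q (Fin e) ι X, f j • z = f j • w → z = w := by
    intro z w hzw
    exact mapT_injective hreg hzw
  have hJ : ∀ l, l ∉ Jge e j → l.1 < j := by simp [Jge]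
  have hJ' : ∀ l, l ∉ Jge e (j + 1) → l.1 < j + 1 := by simp [Jge]
  have d1 : ∀ i, ∀ z ∈ (TD G.deg (Jge e j) i : Submodule Q (TC Q (Fin e) ι X)),
      dT F.A (dT F.A z) = 0 := fun i z hz => dT_sq_of_mem F hz fun l hl => h.kill l (hJ l hl)
  have d0 : ∀ i, ∀ z ∈ (TD G.deg Set.univ i : Submodule Q (TC Q (Fin e) ι X)),
      dT F.A (dT F.A z) = 0 := fun i z hz => dT_sq_of_mem F hz fun l hl => absurd trivial hl
  have d1' : ∀ i, ∀ z ∈ (TD G.deg (Jge e (j + 1)) i : Submodule Q (TC Q (Fin e) ι X')),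
      dT F.A (dT F.A z) = 0 := fun i z hz => dT_sq_of_mem F hz fun l hl => hkill l (hJ' l hl)
  have d2 : ∀ i, ∀ z ∈ (TD G.deg (Jge e (j + 1)) i : Submodule Q (TC Q (Fin e) ι X)),
      dT F.A (dT F.A z) = f j • chi j z := by
    intro i z hz
    rw [dT_sq F.sq]
    refine Finset.sum_eq_single j (fun l _ hl => ?_) (by simp)
    by_cases hl' : l ∈ Jge e (j + 1)
    · rw [chi_eq_zero_of_mem hl' hz, smul_zero]
    · have : l.1 < j := by
        have := hJ' l hl'
        have : l.1 ≠ j := fun h => hl (Fin.ext h)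
        omega
      funext x
      refine LinearMap.ext fun s => ?_
      simp [h.kill l this]
  have hsub : Jge e (j + 1) ⊆ Jge e j := by rw [← Jge_insert j]; exact Set.subset_insert _ _
  have hV : ∀ i, 2 ≤ i → Acyc 1 G.deg F.A (Jge e j) X' i := by
    intro i hi
    obtain ⟨i, rfl⟩ : ∃ k, i = k + 1 := ⟨i - 1, by omega⟩
    exact Acyc.right hreg hπ hex F.gr d1 (h.exact _ (by omega)) (h.exact _ (by omega))
  have fromV : ∀ {i} {z : TC Q (Fin e) ι X'} (k : TC Q (Fin e) ι X'), 2 ≤ i →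
      z ∈ TD G.deg (Jge e (j + 1)) i →
      dT F.A z = 0 → k ∈ TD G.deg (Jge e (j + 1)) (i - 1) → dT F.A k = chi j z →
      z ∈ Bd G.deg F.A (Jge e (j + 1)) i := by
    intro i z k hi hz hz0 hk hkz
    obtain ⟨k', hk', rfl⟩ := exists_chi_eq (notMem_Jge j) hk
    have e1 : i - 1 + 2 = i + 1 := by omega
    rw [e1] at hk'
    obtain ⟨w, hw, e⟩ := acyc_one.1 (hV i hi) (z - dT F.A k') (by
      rw [← Jge_insert]
      refine mem_TD_insert.2 ⟨Submodule.sub_mem _ hz (dT_mem F.gr hk'), ?_⟩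
      rw [map_sub, ← dT_chi, hkz, sub_self]) (by rw [map_sub, hz0, d1' _ _ hk', sub_zero])
    exact ⟨w + k', Submodule.add_mem _ (TD_anti hsub hw) hk', by rw [map_add, e, sub_add_cancel]⟩
  refine ⟨hkill, fun i => ?_, fun i hi => ?_, fun z hz hz0 hy => ?_⟩
  · induction i using Nat.strong_induction_on with
    | _ i ih =>
    intro hi
    rw [acyc_one]
    intro z hz hz0
    rcases (show i = 1 ∨ i = 2 ∨ 3 ≤ i by omega) with rfl | rfl | hi3
    · have hzc : z ∈ TD G.deg (Jge e j) 1 := by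
        rw [← Jge_insert]
        exact mem_TD_insert.2 ⟨hz, chi_eq_zero_of_lt j (by omega) hz⟩
      obtain ⟨z, hz', rfl⟩ := exists_mapT_eq_of_surjective hπ hzc
      rw [dT_mapT] at hz0
      obtain ⟨g, hg, e1⟩ := exists_mapT_eq_of_exact hex (dT_mem F.gr hz') hz0
      rw [hsm] at e1
      obtain ⟨g', hg', rfl⟩ := exists_chi_eq (notMem_Jge j) (TD_anti hsub hg)
      have hdg : dT F.A g' ∈ TD G.deg (Jge e (j + 1)) 1 := dT_mem F.gr hg'
      obtain ⟨w, hw, e2⟩ := acyc_one.1 (h.exact 1 le_rfl) (z - dT F.A g')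
        (Submodule.sub_mem _ hz' (by
          rw [← Jge_insert]
          exact mem_TD_insert.2 ⟨hdg, chi_eq_zero_of_lt j (by omega) hdg⟩))
        (by rw [map_sub, d2 _ _ hg', e1, sub_self])
      refine ⟨mapT π (g' + w), mapT_mem _ (Submodule.add_mem _ hg' (TD_anti hsub hw)), ?_⟩
      rw [dT_mapT, map_add, e2, add_sub_cancel]
    · have hg : chi j z ∈ TD G.deg (Jge e (j + 1)) 0 := chi_mem j hz
      obtain ⟨g, hg', e1⟩ := exists_mapT_eq_of_surjective hπ hg
      obtain ⟨g', hg2, rfl⟩ := exists_chi_eq (notMem_Jge j) hg'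
      obtain ⟨v, hv, e2⟩ := exists_mapT_eq_of_surjective hπ (z := z - mapT π g')
        (i := 2) (J := Jge e j) (deg := G.deg) (by
          rw [← Jge_insert]
          refine mem_TD_insert.2 ⟨Submodule.sub_mem _ hz (mapT_mem _ hg2), ?_⟩
          rw [map_sub, ← e1, mapT_chi, sub_self])
      have hv' := TD_anti hsub hv
      obtain ⟨p, hp, e3⟩ := exists_mapT_eq_of_exact hex (z := dT F.A (v + g')) (i := 1)
        (dT_mem F.gr (Submodule.add_mem _ hv' hg2)) (by
          rw [← dT_mapT, map_add, e2, sub_add_cancel, hz0])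
      rw [hsm] at e3
      have e4 : dT F.A p = chi j g' := by
        apply hinj
        rw [← map_smul, e3, map_add, map_add, d1 _ _ hv, d2 _ _ hg2, zero_add]
      exact fromV (mapT π p) le_rfl hz hz0 (mapT_mem _ hp) (by rw [dT_mapT, e4, e1])
    · obtain ⟨i, rfl⟩ : ∃ k, i = k + 2 := ⟨i - 2, by omega⟩
      obtain ⟨k, hk, e1⟩ := acyc_one.1 (ih i (by omega) (by omega)) (chi j z) (chi_mem j hz)
        (by rw [dT_chi, hz0, map_zero])
      exact fromV k (by omega) hz hz0 hk e1
  · obtain ⟨i, rfl⟩ : ∃ k, i = k + 1 := ⟨i - 1, by omega⟩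
    exact Acyc.right hreg hπ hex F.gr d0 (h.van _ (by omega)) (h.van _ (by omega))
  · obtain ⟨z, hz', rfl⟩ := exists_mapT_eq_of_surjective hπ hz
    rw [dT_mapT] at hz0
    obtain ⟨g, hg, e1⟩ := exists_mapT_eq_of_exact hex (dT_mem F.gr hz') hz0
    rw [hsm] at e1
    obtain ⟨q, hq, e2⟩ := h.nosoc g hg (by
      apply hinj
      rw [← map_smul, e1, d0 _ _ hz', smul_zero]) (by
      intro y hym
      obtain ⟨w, hw, e3⟩ := hy y hym
      obtain ⟨w, hw', rfl⟩ := exists_mapT_eq_of_surjective hπ hw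
      obtain ⟨p, hp, e4⟩ := exists_mapT_eq_of_exact hex (z := y • z - dT F.A w)
        (Submodule.sub_mem _ (Submodule.smul_mem _ _ hz') (dT_mem F.gr hw')) (by
        rw [map_sub, map_smul, ← e3, dT_mapT, sub_self])
      rw [hsm] at e4
      refine ⟨p, hp, hinj _ _ ?_⟩
      rw [← map_smul, e4, map_sub, map_smul, d0 _ _ hw', sub_zero, ← e1, smul_comm])
    obtain ⟨w, hw, e3⟩ := acyc_one.1 (h.van (j + 1) (by omega)) (z - f j • q)
      (Submodule.sub_mem _ hz' (Submodule.smul_mem _ _ hq)) (by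
        rw [map_sub, map_smul, e2, e1, sub_self])
    refine ⟨mapT π w, mapT_mem _ hw, ?_⟩
    rw [dT_mapT, e3, map_sub, ← hsm, mapT_mapT_of_exact hex, sub_zero]

lemma mapT_symm (g : X ≃ₗ[Q] X') (z : TC Q (Fin e) ι X') :
    mapT g.toLinearMap (mapT g.symm.toLinearMap z) = z := by
  funext x
  refine LinearMap.ext fun s => ?_
  simp

lemma bd_of_equiv (g : X ≃ₗ[Q] X') {J : Set (Fin e)} {i : ℕ} {z : TC Q (Fin e) ι X}
    (h : z ∈ Bd G.deg F.A J i) : mapT g.toLinearMap z ∈ Bd G.deg F.A J i := by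
  obtain ⟨w, hw, rfl⟩ := h
  exact ⟨_, mapT_mem _ hw, dT_mapT _ _ _⟩

lemma Stage.of_equiv {j : ℕ} (g : X ≃ₗ[Q] X') (h : Stage m F j X) : Stage m F j X' where
  kill l hl x := by
    obtain ⟨x, rfl⟩ := g.surjective x
    rw [← map_smul, h.kill l hl, map_zero]
  exact i hi := (h.exact i hi).of_equiv g
  van i hi := (h.van i hi).of_equiv g
  nosoc z hz hz0 hy := by
    rw [← mapT_symm g z]
    refine bd_of_equiv g (h.nosoc _ (mapT_mem _ hz) (by rw [dT_mapT, hz0, map_zero]) fun y hym => ?_)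
    rw [← map_smul]
    exact bd_of_equiv g.symm (hy y hym)

/-- A finite family of ring elements which is a weakly regular sequence. -/
def IsRegFam (f : Fin e → Q) : Prop :=
  ∀ j : Fin e, ∀ x : Q, f j * x ∈ Ideal.span (f '' {l | l < j}) → x ∈ Ideal.span (f '' {l | l < j})

lemma stage_quotient (hf : IsRegFam f) (hN : ∀ n : N, (∀ y ∈ m, y • n = 0) → n = 0)
    (F : MF f G) (I : Type u) (j : ℕ) (hj : j ≤ e) :
    Stage m F j (I →₀ (Q ⧸ Ideal.span (f '' {l | l.1 < j}))) := by
  induction j with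
  | zero =>
    have e1 : Ideal.span (f '' {l : Fin e | l.1 < 0}) = ⊥ := by simp
    exact (Stage.zero (Finsupp.basisSingleOne (R := Q) (ι := I)) hN).of_equiv
      (Finsupp.mapRange.linearEquiv (Submodule.quotEquivOfEqBot _ e1).symm)
  | succ j ih =>
    have e1 : Ideal.span (f '' {l : Fin e | l.1 < j + 1}) =
        Ideal.span {f ⟨j, hj⟩} ⊔ Ideal.span (f '' {l : Fin e | l.1 < j}) := by
      rw [← Ideal.span_union, Set.singleton_union, ← Set.image_insert_eq]
      congr 2
      ext l
      simp only [Set.mem_ofPred_eq, Set.mem_insert_iff, Fin.ext_iff]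
      omega
    have hle : Ideal.span (f '' {l : Fin e | l.1 < j}) ≤ Ideal.span (f '' {l : Fin e | l.1 < j + 1}) :=
      e1 ▸ le_sup_right
    set ρ := Submodule.factor hle
    have hρ : ∀ x, ρ x = 0 → ∃ y, f ⟨j, hj⟩ • y = x := by
      intro x hx
      obtain ⟨x, rfl⟩ := Submodule.mkQ_surjective _ x
      have h1 : x ∈ Ideal.span (f '' {l : Fin e | l.1 < j + 1}) := by
        rw [← Submodule.Quotient.mk_eq_zero]; exact hx
      rw [e1, Submodule.mem_sup] at h1
      obtain ⟨a, ha, b, hb, rfl⟩ := h1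
      obtain ⟨c, rfl⟩ := Ideal.mem_span_singleton'.1 ha
      refine ⟨Submodule.mkQ _ c, ?_⟩
      rw [← map_smul, map_add, smul_eq_mul, mul_comm]
      rw [(Submodule.Quotient.mk_eq_zero _).2 hb |> (fun h => (h : Submodule.mkQ _ b = 0)), add_zero]
    refine (ih (by omega)).succ ⟨j, hj⟩ (π := Finsupp.mapRange.linearMap ρ) ?_ ?_ ?_
    · exact Finsupp.mapRange_surjective _ (map_zero _) (Submodule.factor_surjective hle)
    · rw [← LinearMap.ker_eq_bot, LinearMap.ker_eq_bot']
      intro v hv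
      ext i
      have h1 : f ⟨j, hj⟩ • v i = 0 := DFunLike.congr_fun hv i
      obtain ⟨x, hx⟩ := Submodule.mkQ_surjective _ (v i)
      rw [← hx, ← map_smul] at h1
      rw [← hx]
      exact (Submodule.Quotient.mk_eq_zero _).2 (hf ⟨j, hj⟩ x ((Submodule.Quotient.mk_eq_zero _).1 h1))
    · intro v
      constructor
      · intro hv
        have h1 : ∀ i, ρ (v i) = 0 := fun i => DFunLike.congr_fun hv i
        choose y hy using fun i => hρ _ (h1 i)
        classical
        refine ⟨Finsupp.onFinset v.support (fun i => if v i = 0 then 0 else y i)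
          (fun i hi => ?_), ?_⟩
        · rw [Finsupp.mem_support_iff]
          intro h0
          simp [h0] at hi
        · ext i
          simp only [LinearMap.lsmul_apply, Finsupp.smul_apply, Finsupp.onFinset_apply]
          split_ifs with h0
          · rw [h0, smul_zero]
          · rw [hy]
      · rintro ⟨w, rfl⟩
        ext i
        obtain ⟨x, hx⟩ := Submodule.mkQ_surjective _ (w i)
        have h2 : f ⟨j, hj⟩ • x ∈ Ideal.span (f '' {l : Fin e | l.1 < j + 1}) :=
          Ideal.mul_mem_right _ _ (Ideal.subset_span ⟨⟨j, hj⟩, by simp, rfl⟩)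
        have h3 : ρ (f ⟨j, hj⟩ • w i) = 0 := by
          rw [← hx, ← map_smul]
          exact (Submodule.Quotient.mk_eq_zero _).2 h2
        exact h3

/-- The complex with coefficients in a free module over the complete intersection. -/
lemma stage_free (hf : IsRegFam f) (hN : ∀ n : N, (∀ y ∈ m, y • n = 0) → n = 0)
    (F : MF f G) (R : Type u) [CommRing R] [Algebra Q R]
    (hs : Function.Surjective (algebraMap Q R))
    (hk : RingHom.ker (algebraMap Q R) = Ideal.span (Set.range f)) (I : Type u) :
    Stage m F e (I →₀ R) := by
  have e1 : Ideal.span (f '' {l : Fin e | l.1 < e}) = LinearMap.ker (Algebra.linearMap Q R) := by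
    have : {l : Fin e | l.1 < e} = Set.univ := by ext l; simp
    rw [this, Set.image_univ, ← hk]
    rfl
  exact (stage_quotient hf hN F I e le_rfl).of_equiv (Finsupp.mapRange.linearEquiv
    ((Submodule.quotEquivOfEq _ _ e1).trans (LinearMap.quotKerEquivOfSurjective _ hs)))

end koszul

open MvPolynomial
open scoped TensorProduct

section variants

variable {Q : Type u} [CommRing Q] {σ ι : Type} [Fintype ι] [Fintype σ] [DecidableEq ι]
  {X F Y : Type u} [AddCommGroup X] [Module Q X] [AddCommGroup F] [Module Q F]
  [AddCommGroup Y] [Module Q Y] {deg : ι → ℕ} {A : Matrix ι ι (MvPolynomial σ Q)} {J : Set σ}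
  {i : ℕ} {y : Q} {p : X →ₗ[Q] F} {q : F →ₗ[Q] Y}

lemma exists_pow_smul_mem_of_mapT (hp : Function.Injective p) (hq : Function.Surjective q)
    (hpq : Function.Exact p q) (hgr : GrMat deg A)
    (hF0 : ∀ i, ∀ z ∈ (TD deg J i : Submodule Q (TC Q σ ι F)), dT A (dT A z) = 0)
    (hY : Acyc y deg A J Y (i + 1)) {z : TC Q σ ι X} (hz : mapT p z ∈ Bd deg A J i) :
    ∃ t : ℕ, y ^ t • z ∈ Bd deg A J i := by
  obtain ⟨w, hw, e⟩ := hz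
  obtain ⟨s, v, hv, e'⟩ := hY (mapT q w) (mapT_mem _ hw) (by
    rw [dT_mapT, e, mapT_mapT_of_exact hpq])
  obtain ⟨v', hv', rfl⟩ := exists_mapT_eq_of_surjective hq hv
  obtain ⟨w', hw', e''⟩ := exists_mapT_eq_of_exact hpq
    (z := y ^ s • w - dT A v') (Submodule.sub_mem _ (Submodule.smul_mem _ _ hw) (dT_mem hgr hv'))
    (by rw [map_sub, map_smul, ← dT_mapT, e', sub_self])
  refine ⟨s, w', hw', mapT_injective hp ?_⟩
  rw [← dT_mapT, e'', map_sub, map_smul, e, hF0 _ _ hv', sub_zero, map_smul]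

lemma Acyc.right_of_injective (hq : Function.Surjective q)
    (hpq : Function.Exact p q) (hgr : GrMat deg A)
    (hF : Acyc 1 deg A J F (i + 1))
    (hX : ∀ z : TC Q σ ι X, z ∈ TD deg J i → mapT p z ∈ Bd deg A J i → z ∈ Bd deg A J i) :
    Acyc 1 deg A J Y (i + 1) := by
  rw [acyc_one] at hF ⊢
  intro z hz h0
  obtain ⟨z', hz', rfl⟩ := exists_mapT_eq_of_surjective hq hz
  rw [dT_mapT] at h0
  obtain ⟨u, hu, e⟩ := exists_mapT_eq_of_exact hpq (dT_mem hgr hz') h0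
  obtain ⟨w, hw, e'⟩ := hX u hu (e ▸ ⟨z', hz', rfl⟩)
  obtain ⟨v, hv, e''⟩ := hF (z' - mapT p w)
    (Submodule.sub_mem _ hz' (mapT_mem _ hw))
    (by rw [map_sub, dT_mapT, e', e, sub_self])
  refine ⟨mapT q v, mapT_mem _ hv, ?_⟩
  rw [dT_mapT, e'', map_sub, mapT_mapT_of_exact hpq, sub_zero]

lemma Acyc.of_lt {L : ℕ} (hL : ∀ x, deg x ≤ L) (hi : L < i) : Acyc y deg A Set.univ X i := by
  intro z hz _
  refine ⟨0, ?_⟩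
  have : z = 0 := by
    refine TC.ext_mono fun x μ => ?_
    by_contra h
    have h1 := hz x μ h
    have h2 : μ = 0 := by ext l; exact h1.2 l trivial
    have h3 := hL x
    subst h2
    simp at h1
    omega
  rw [this, smul_zero]
  exact Submodule.zero_mem _

end variants

section classmap

variable {Q : Type u} [CommRing Q] {N : Type u} [AddCommGroup N] [Module Q N]
  {ι : Type} [Fintype ι] [DecidableEq ι] {σ : Type} [Fintype σ] {f : σ → Q} {G : FinRes Q N ι}
  {X X' : Type u} [AddCommGroup X] [Module Q X] [AddCommGroup X'] [Module Q X']

/-- The class in the tensor product of an element of the complex. -/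
def cl (G : FinRes Q N ι) : TC Q σ ι X →ₗ[Q] X ⊗[Q] N where
  toFun z := ∑ x, z x 1 ⊗ₜ[Q] G.aug x
  map_add' z w := by simp [TensorProduct.add_tmul, Finset.sum_add_distrib]
  map_smul' c z := by simp [TensorProduct.smul_tmul', Finset.smul_sum]

lemma cl_apply (z : TC Q σ ι X) : cl G z = ∑ x, z x 1 ⊗ₜ[Q] G.aug x := rfl

lemma cl_mapT (p : X →ₗ[Q] X') (z : TC Q σ ι X) :
    cl G (mapT p z) = p.rTensor N (cl G z) := by
  simp [cl_apply]

variable {F : MF f G} {J : Set σ}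

lemma dT_one_apply {w : TC Q σ ι X} (hw : w ∈ TD G.deg J 1) (x : ι) :
    dT F.A w x 1 = ∑ y, G.del x y • w y 1 := by
  rw [dT_apply]
  refine Finset.sum_congr rfl fun y _ => ?_
  have key : ∀ ν, w y (monomial ν 1) ≠ 0 → ν = 0 := by
    intro ν h
    have := (hw y ν h).1
    rw [← Finsupp.degree_eq_zero_iff]
    omega
  have h1 : (1 : MvPolynomial σ Q) = monomial 0 1 := rfl
  rw [h1, apply_mul_mono, ← F.zero_coeff]
  refine (Finset.sum_eq_single 0 (fun ν _ hν => ?_) fun h0 => ?_)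
  · by_contra h1
    have h2 : w y (monomial (ν + 0) 1) ≠ 0 := fun h => h1 (by rw [h, smul_zero])
    exact hν (by simpa using key _ h2)
  · rw [notMem_support_iff.1 h0, zero_smul]

lemma cl_of_bd {z : TC Q σ ι X} (hz : z ∈ Bd G.deg F.A J 0) : cl G z = 0 := by
  obtain ⟨w, hw, rfl⟩ := hz
  rw [cl_apply]
  simp only [dT_one_apply hw, TensorProduct.sum_tmul, ← TensorProduct.smul_tmul',
    ← TensorProduct.tmul_smul]
  rw [Finset.sum_comm]
  refine Finset.sum_eq_zero fun y _ => ?_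
  rw [← TensorProduct.tmul_sum, G.aug_del, TensorProduct.tmul_zero]

lemma bd_of_cl {z : TC Q σ ι X} (hz : z ∈ TD G.deg J 0) (h : cl G z = 0) :
    z ∈ Bd G.deg F.A J 0 := by
  have hdeg : ∀ x, z x 1 ≠ 0 → G.deg x = 0 := fun x hx => by
    have := (hz x 0 hx).1
    omega
  rw [cl_apply] at h
  have h' : ∑ x, G.aug x ⊗ₜ[Q] z x 1 = 0 := by
    have := congrArg (TensorProduct.comm Q X N) h
    simpa using this
  obtain ⟨κ, a, v, h1, h2⟩ :=
    TensorProduct.vanishesTrivially_of_sum_tmul_eq_zero Q G.aug_span h'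
  have h3 : ∀ k, ∃ w : ι → Q, G.del.mulVec w = fun x => if G.deg x = 0 then a x k else 0 := by
    intro k
    refine G.exact _ ?_ ?_
    · funext x
      refine Finset.sum_eq_zero fun y _ => ?_
      show G.del x y * (if G.deg y = 0 then a y k else 0) = 0
      by_cases hd : G.del x y = 0
      · rw [hd, zero_mul]
      · have := G.del_deg _ _ hd
        rw [if_neg (by omega), mul_zero]
    · rw [← h2 k]
      refine Finset.sum_congr rfl fun x _ => ?_
      split_ifs with hx
      · rfl
      · rw [not_imp_comm.1 (G.aug_deg x) hx, smul_zero, smul_zero]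
  choose w hw using h3
  have hW : (TC.mk fun x μ => if μ = 0 ∧ G.deg x = 1 then ∑ k, w k x • v k else 0) ∈
      (TD G.deg J 1 : Submodule Q (TC Q σ ι X)) := by
    intro x μ hx
    rw [TC.mk_mono] at hx
    split_ifs at hx with h0
    · obtain ⟨rfl, h0⟩ := h0
      simp [h0]
    · exact absurd rfl hx
  refine ⟨_, hW, TC.ext_mono fun x μ => ?_⟩
  by_cases hμ : μ = 0
  · subst hμ
    have e1 : (monomial 0 1 : MvPolynomial σ Q) = 1 := rfl
    rw [e1, dT_one_apply hW]
    have e2 : ∀ y, (TC.mk fun x μ => if μ = 0 ∧ G.deg x = 1 then ∑ k, w k x • v k else 0 :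
        TC Q σ ι X) y 1 = if G.deg y = 1 then ∑ k, w k y • v k else 0 := by
      intro y
      rw [← e1, TC.mk_mono]
      simp
    simp only [e2]
    by_cases hx : G.deg x = 0
    · rw [show z x 1 = ∑ j, a x j • v j from h1 x]
      have e3 : ∀ k, a x k = ∑ y, G.del x y * w k y := by
        intro k
        have := congrFun (hw k) x
        rw [if_pos hx] at this
        exact this.symm
      simp only [e3, Finset.sum_smul]
      rw [Finset.sum_comm]
      refine Finset.sum_congr rfl fun y _ => ?_
      by_cases hd : G.del x y = 0
      · simp [hd]
      · have := G.del_deg _ _ hd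
        rw [if_pos (by omega), Finset.smul_sum]
        simp only [mul_smul]
    · rw [not_imp_comm.1 (hdeg x) hx]
      refine Finset.sum_eq_zero fun y _ => ?_
      by_cases hd : G.del x y = 0
      · simp [hd]
      · have := G.del_deg _ _ hd
        rw [if_neg (by omega), smul_zero]
  · trans 0
    · by_contra h
      have := (dT_mem F.gr hW x μ h).1
      exact hμ (by rw [← Finsupp.degree_eq_zero_iff]; omega)
    · by_contra h
      have := (hz x μ (Ne.symm h)).1
      exact hμ (by rw [← Finsupp.degree_eq_zero_iff]; omega)

lemma exists_cl_eq (J : Set σ) (t : X ⊗[Q] N) :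
    ∃ z : TC Q σ ι X, z ∈ TD G.deg J 0 ∧ cl G z = t := by
  classical
  induction t using TensorProduct.induction_on with
  | zero => exact ⟨0, Submodule.zero_mem _, map_zero _⟩
  | add s t hs ht =>
    obtain ⟨z, hz, rfl⟩ := hs
    obtain ⟨w, hw, rfl⟩ := ht
    exact ⟨z + w, Submodule.add_mem _ hz hw, map_add _ _ _⟩
  | tmul v n =>
    obtain ⟨c, rfl⟩ := (Submodule.mem_span_range_iff_exists_fun Q).1
      (G.aug_span ▸ Submodule.mem_top : n ∈ _)
    refine ⟨TC.mk fun x μ => if μ = 0 ∧ G.deg x = 0 then c x • v else 0, fun x μ hx => ?_, ?_⟩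
    · rw [TC.mk_mono] at hx
      split_ifs at hx with h0
      · obtain ⟨rfl, h0⟩ := h0
        simp [h0]
      · exact absurd rfl hx
    · rw [cl_apply, TensorProduct.tmul_sum]
      refine Finset.sum_congr rfl fun x _ => ?_
      have e1 : (1 : MvPolynomial σ Q) = monomial 0 1 := rfl
      rw [e1, TC.mk_mono, TensorProduct.tmul_smul, TensorProduct.smul_tmul']
      by_cases h0 : G.deg x = 0
      · simp [h0]
      · simp [not_imp_comm.1 (G.aug_deg x) h0]

end classmap

open scoped Pointwise
open Abelian

section extvan

variable {Q : Type u} [CommRing Q] (m : Ideal Q) 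

/-- Vanishing of an Ext module out of the residue ring. -/
def EV (A : Type u) [AddCommGroup A] [Module Q A] (i : ℕ) : Prop :=
  Subsingleton (Ext (ModuleCat.of Q (Q ⧸ m)) (ModuleCat.of Q A) i)

variable {m} {A B C : Type u} [AddCommGroup A] [Module Q A] [AddCommGroup B] [Module Q B]
  [AddCommGroup C] [Module Q C] {p : A →ₗ[Q] B} {q : B →ₗ[Q] C} {i : ℕ}

/-- The short complex of an exact pair of linear maps. -/
def sc (p : A →ₗ[Q] B) (q : B →ₗ[Q] C) (h : Function.Exact p q) : ShortComplex (ModuleCat.{u} Q) :=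
  ShortComplex.mk (ModuleCat.ofHom p) (ModuleCat.ofHom q) (by
    ext x; exact h.apply_apply_eq_zero x)

lemma sc_shortExact (hp : Function.Injective p) (h : Function.Exact p q)
    (hq : Function.Surjective q) : (sc p q h).ShortExact where
  exact := (ShortComplex.ShortExact.moduleCat_exact_iff_function_exact _).2 h
  mono_f := (ModuleCat.mono_iff_injective _).2 hp
  epi_g := (ModuleCat.epi_iff_surjective _).2 hq

lemma EV.zero_iff : EV m A 0 ↔ ∀ a : A, (∀ y ∈ m, y • a = 0) → a = 0 := by
  unfold EV
  rw [Equiv.subsingleton_congr Ext.homEquiv₀]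
  constructor
  · intro hs a ha
    let g : (Q ⧸ m) →ₗ[Q] A := Submodule.liftQ m (LinearMap.toSpanSingleton Q A a) (by
      intro y hy; simpa using ha y hy)
    have h1 : ModuleCat.ofHom g = ModuleCat.ofHom 0 := Subsingleton.elim _ _
    have h2 := congrArg (fun φ => φ.hom (Submodule.Quotient.mk 1)) h1
    have h3 : g (Submodule.Quotient.mk 1) = a := by
      simp only [g]
      erw [Submodule.liftQ_apply]
      simp
    exact h3.symm.trans h2
  · intro h
    refine ⟨fun φ ψ => ?_⟩
    have : ∀ φ : (ModuleCat.of Q (Q ⧸ m)) ⟶ (ModuleCat.of Q A), φ = 0 := by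
      intro φ
      ext
      refine LinearMap.ext_ring ?_ |> fun h => DFunLike.congr_fun h _
      have := h (φ.hom (Submodule.Quotient.mk 1)) fun y hy => by
        rw [← map_smul, ← Submodule.Quotient.mk_smul, smul_eq_mul, mul_one,
          (Submodule.Quotient.mk_eq_zero m).2 hy, map_zero]
      simpa using this
    rw [this φ, this ψ]

lemma EV.left (hp : Function.Injective p) (h : Function.Exact p q)
    (hq : Function.Surjective q) (hC : EV m C i) (hB : EV m B (i + 1)) : EV m A (i + 1) := by
  have hS := sc_shortExact hp h hq
  refine subsingleton_of_forall_eq 0 fun x => ?_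
  obtain ⟨y, rfl⟩ := Ext.covariant_sequence_exact₁ _ hS x (@Subsingleton.elim _ hB _ _) rfl
  have : y = 0 := @Subsingleton.elim _ hC _ _
  rw [this, Ext.zero_comp]; rfl

lemma EV.right (hp : Function.Injective p) (h : Function.Exact p q)
    (hq : Function.Surjective q) (hB : EV m B i) (hA : EV m A (i + 1)) : EV m C i := by
  have hS := sc_shortExact hp h hq
  refine subsingleton_of_forall_eq 0 fun x => ?_
  obtain ⟨y, rfl⟩ := Ext.covariant_sequence_exact₃ _ hS x rfl (@Subsingleton.elim _ hA _ _)
  have : y = 0 := @Subsingleton.elim _ hB _ _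
  rw [this, Ext.zero_comp]; rfl

lemma EV.of_equiv (e : A ≃ₗ[Q] B) (h : EV m A i) : EV m B i := by
  refine subsingleton_of_forall_eq 0 fun x => ?_
  have h1 : x = (x.comp (Ext.mk₀ (ModuleCat.ofHom e.symm.toLinearMap)) (add_zero i)).comp
      (Ext.mk₀ (ModuleCat.ofHom e.toLinearMap)) (add_zero i) := by
    rw [Ext.comp_assoc_of_second_deg_zero, Ext.mk₀_comp_mk₀, ← ModuleCat.ofHom_comp]
    simp
  rw [h1, show x.comp (Ext.mk₀ (ModuleCat.ofHom e.symm.toLinearMap)) (add_zero i) = 0 from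
    @Subsingleton.elim _ h _ _, Ext.zero_comp]

lemma Ext.comp_mk₀_lsmul_eq_zero {y : Q} (hy : y ∈ m)
    (x : Ext (ModuleCat.of Q (Q ⧸ m)) (ModuleCat.of Q A) i) :
    x.comp (Ext.mk₀ (ModuleCat.ofHom (LinearMap.lsmul Q A y))) (add_zero i) = 0 := by
  have h1 : ModuleCat.ofHom (LinearMap.lsmul Q A y) = y • 𝟙 (ModuleCat.of Q A) := rfl
  have h2 : y • 𝟙 (ModuleCat.of Q (Q ⧸ m)) = 0 := by
    ext
    refine LinearMap.ext_ring ?_ |> fun h => DFunLike.congr_fun h _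
    change y • (Submodule.Quotient.mk 1 : Q ⧸ m) = 0
    rw [← Submodule.Quotient.mk_smul, smul_eq_mul, mul_one, (Submodule.Quotient.mk_eq_zero m).2 hy]
  rw [h1, ← Ext.smul_eq_comp_mk₀, ← Ext.mk₀_id_comp x, ← Ext.smul_comp, ← Ext.mk₀_smul, h2,
    Ext.mk₀_zero, Ext.zero_comp]

lemma EV.succ_of_regular {y : Q} (hy : y ∈ m) (hA : Function.Injective (LinearMap.lsmul Q A y))
    {q : A →ₗ[Q] C} (h : Function.Exact (LinearMap.lsmul Q A y) q) (hq : Function.Surjective q)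
    (hC : EV m C i) : EV m A (i + 1) := by
  have hS := sc_shortExact hA h hq
  refine subsingleton_of_forall_eq 0 fun x => ?_
  obtain ⟨z, rfl⟩ := Ext.covariant_sequence_exact₁ _ hS x (Ext.comp_mk₀_lsmul_eq_zero hy x) rfl
  have : z = 0 := @Subsingleton.elim _ hC _ _
  rw [this, Ext.zero_comp]; rfl

lemma EV.zero_of_regular {y : Q} (hy : y ∈ m) (hA : Function.Injective (LinearMap.lsmul Q A y)) :
    EV m A 0 := by
  rw [EV.zero_iff]
  intro a ha
  apply hA
  simpa using ha y hy

open RingTheory.Sequence in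
lemma EV.of_isWeaklyRegular (I : Type u) {rs : List Q} (hm : ∀ r ∈ rs, r ∈ m)
    (h : IsWeaklyRegular A rs) (hi : i < rs.length) : EV m (I →₀ A) i := by
  induction rs generalizing A i with
  | nil => simp at hi
  | cons r rs ih =>
    obtain ⟨h1, h2⟩ := (isWeaklyRegular_cons_iff A r rs).1 h
    have hr : r ∈ m := hm r (by simp)
    have hinj : Function.Injective (LinearMap.lsmul Q (I →₀ A) r) := by
      rw [← LinearMap.ker_eq_bot, LinearMap.ker_eq_bot']
      intro v hv
      ext k
      have h3 : r • v k = 0 := DFunLike.congr_fun hv k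
      exact h1 (h3.trans (smul_zero r).symm)
    cases i with
    | zero => exact EV.zero_of_regular hr hinj
    | succ i =>
      refine EV.succ_of_regular hr hinj (q := Finsupp.mapRange.linearMap
        (Submodule.mkQ (r • (⊤ : Submodule Q A)))) ?_ ?_
        (ih (A := QuotSMulTop r A) (fun r hr => hm r (by simp [hr])) h2 (by simpa using hi))
      · intro v
        constructor
        · intro hv
          have h3 : ∀ k, ∃ a, r • a = v k := fun k => by
            have h4 : Submodule.mkQ (r • (⊤ : Submodule Q A)) (v k) = 0 := DFunLike.congr_fun hv k
            have h5 := (Submodule.Quotient.mk_eq_zero _).1 h4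
            obtain ⟨a, _, ha⟩ := (Submodule.mem_smul_pointwise_iff_exists _ _ _).1 h5
            exact ⟨a, ha⟩
          choose a ha using h3
          classical
          refine ⟨Finsupp.onFinset v.support (fun k => if v k = 0 then 0 else a k)
            (fun k hk => ?_), ?_⟩
          · rw [Finsupp.mem_support_iff]
            intro h0
            simp [h0] at hk
          · ext k
            simp only [LinearMap.lsmul_apply, Finsupp.smul_apply, Finsupp.onFinset_apply]
            split_ifs with h0
            · rw [h0, smul_zero]
            · rw [ha]
        · rintro ⟨w, rfl⟩
          ext k
          exact (Submodule.Quotient.mk_eq_zero _).2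
            (Submodule.smul_mem_pointwise_smul _ _ _ Submodule.mem_top)
      · exact Finsupp.mapRange_surjective _ (map_zero _) (Submodule.mkQ_surjective _)

open RingTheory.Sequence in
lemma EV.of_isWeaklyRegular' {rs : List Q} (hm : ∀ r ∈ rs, r ∈ m)
    (h : IsWeaklyRegular A rs) (hi : i < rs.length) : EV m A i :=
  (EV.of_isWeaklyRegular PUnit hm h hi).of_equiv (Finsupp.uniqueLinearEquiv Q A PUnit.unit)

open RingTheory.Sequence in
lemma EV.not_of_isWeaklyRegular {rs : List Q} (hm : ∀ r ∈ rs, r ∈ m) (h : IsWeaklyRegular A rs)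
    (hs : ∃ a : A ⧸ (Ideal.ofList rs • ⊤ : Submodule Q A), a ≠ 0 ∧ ∀ y ∈ m, y • a = 0) :
    ¬ EV m A rs.length := by
  induction rs generalizing A with
  | nil =>
    intro hE
    obtain ⟨a, ha, hy⟩ := hs
    refine ha (EV.zero_iff.1 (hE.of_equiv (Submodule.quotEquivOfEqBot _ (by simp)).symm) a hy)
  | cons r rs ih =>
    obtain ⟨h1, h2⟩ := (isWeaklyRegular_cons_iff A r rs).1 h
    have hm' : ∀ r ∈ rs, r ∈ m := fun r hr => hm r (by simp [hr])
    intro hE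
    obtain ⟨a, ha, hy⟩ := hs
    let e := Submodule.quotOfListConsSMulTopEquivQuotSMulTopInner A r rs
    refine ih (A := QuotSMulTop r A) hm' h2 ⟨e a, by simpa using ha, fun y hym => by
      rw [← map_smul, hy y hym, map_zero]⟩ ?_
    refine EV.right (p := LinearMap.lsmul Q A r) (q := Submodule.mkQ (r • (⊤ : Submodule Q A)))
      h1 ?_ (Submodule.mkQ_surjective _)
      (EV.of_isWeaklyRegular' hm h (by simp)) hE
    intro v
    rw [Submodule.mkQ_apply, Submodule.Quotient.mk_eq_zero,
      Submodule.mem_smul_pointwise_iff_exists]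
    simp

end extvan

open MvPolynomial
open scoped TensorProduct

lemma eq_zero_of_pow_smul {Q A : Type u} [CommRing Q] [AddCommGroup A] [Module Q A] {m : Ideal Q}
    (hm : m.FG) (hA : ∀ a : A, (∀ y ∈ m, y • a = 0) → a = 0) {a : A}
    (ha : ∀ y ∈ m, ∃ t : ℕ, y ^ t • a = 0) : a = 0 := by
  obtain ⟨n, hn⟩ := Ideal.exists_pow_le_of_le_radical_of_fg
    (I := m) (J := LinearMap.ker (LinearMap.toSpanSingleton Q A a)) (fun y hy => by
      obtain ⟨t, ht⟩ := ha y hy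
      exact ⟨t, by simpa using ht⟩) hm
  clear ha
  induction n generalizing a with
  | zero => simpa using hn (x := 1) (by simp)
  | succ n ih =>
    refine hA a fun y hy => ih fun z hz => ?_
    have := hn (x := z * y) (by rw [pow_succ]; exact Ideal.mul_mem_mul hz hy)
    simpa [mul_smul] using this

section

variable {Q : Type u} [CommRing Q] {N : Type u} [AddCommGroup N] [Module Q N]
  {ι : Type} [Fintype ι] [DecidableEq ι] {σ : Type} [Fintype σ] {f : σ → Q} {G : FinRes Q N ι}
  {F : MF f G} {m : Ideal Q}

lemma Acyc.eventually_of_empty {X : Type u} [AddCommGroup X] [Module Q X] {y : Q}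
    (h0 : ∀ z : TC Q σ ι X, dT F.A (dT F.A z) = 0)
    (h : ∃ n, ∀ i, n ≤ i → Acyc y G.deg F.A ∅ X i) (J : Set σ) :
    ∃ n, ∀ i, n ≤ i → Acyc y G.deg F.A J X i := by
  induction J, Set.toFinite J using Set.Finite.induction_on with
  | empty => exact h
  | insert hl _ ih => exact Acyc.eventually_insert F.gr h0 hl ih

/-- A socle class in degree zero propagates to the complex with all variables suppressed. -/
lemma exists_socle_univ {X : Type u} [AddCommGroup X] [Module Q X]
    (h0 : ∀ z : TC Q σ ι X, dT F.A (dT F.A z) = 0) {J : Set σ} {d : ℕ} (hJ : J.ncard + 1 ≤ d)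
    (hgap : ∀ i, 1 ≤ i → i ≤ d → Acyc 1 G.deg F.A ∅ X i)
    (hall : ∀ i, Fintype.card σ < i → Acyc 1 G.deg F.A Set.univ X i)
    (hJe : ∃ n, ∀ i, n ≤ i → Acyc 1 G.deg F.A J X i)
    (hs : ∃ z : TC Q σ ι X, z ∈ TD G.deg ∅ 0 ∧ dT F.A z = 0 ∧ z ∉ Bd G.deg F.A ∅ 0 ∧
      ∀ y ∈ m, y • z ∈ Bd G.deg F.A ∅ 0) :
    ∃ z : TC Q σ ι X, z ∈ TD G.deg Set.univ (Fintype.card σ) ∧ dT F.A z = 0 ∧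
      z ∉ Bd G.deg F.A Set.univ (Fintype.card σ) ∧
      ∀ y ∈ m, y • z ∈ Bd G.deg F.A Set.univ (Fintype.card σ) := by
  have key : ∀ (I : Set σ) (l : σ), l ∉ I → Acyc 1 G.deg F.A I X (I.ncard + 2) →
      (∃ z : TC Q σ ι X, z ∈ TD G.deg I I.ncard ∧ dT F.A z = 0 ∧ z ∉ Bd G.deg F.A I I.ncard ∧
        ∀ y ∈ m, y • z ∈ Bd G.deg F.A I I.ncard) →
      (∃ z : TC Q σ ι X, z ∈ TD G.deg (insert l I) (insert l I).ncard ∧ dT F.A z = 0 ∧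
        z ∉ Bd G.deg F.A (insert l I) (insert l I).ncard ∧
        ∀ y ∈ m, y • z ∈ Bd G.deg F.A (insert l I) (insert l I).ncard) := by
    rintro I l hl hac ⟨z, h1, h2, h3, h4⟩
    rw [Set.ncard_insert_of_notMem hl]
    exact exists_socle_insert F.gr h0 hl h1 h2 h3 (I := m) h4 hac
  have gap : ∀ I : Set σ, I ⊆ J → ∀ i, I.ncard < i → i ≤ d → Acyc 1 G.deg F.A I X i := by
    intro I
    induction I, Set.toFinite I using Set.Finite.induction_on with
    | empty => intro _ i hi hi'; exact hgap i (by simp at hi; omega) hi'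
    | @insert l I hl _ ih =>
      intro hI i hi hi'
      rw [Set.ncard_insert_of_notMem hl] at hi
      obtain ⟨i, rfl⟩ : ∃ k, i = k + 1 := ⟨i - 1, by omega⟩
      have hI' : I ⊆ J := (Set.subset_insert _ _).trans hI
      exact Acyc.insert_succ F.gr h0 hl (ih hI' _ (by omega) hi')
        (ih hI' _ (by omega) (by omega))
  have low : ∀ I : Set σ, I ⊆ J → ∃ z : TC Q σ ι X, z ∈ TD G.deg I I.ncard ∧ dT F.A z = 0 ∧
      z ∉ Bd G.deg F.A I I.ncard ∧ ∀ y ∈ m, y • z ∈ Bd G.deg F.A I I.ncard := by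
    intro I
    induction I, Set.toFinite I using Set.Finite.induction_on with
    | empty => intro _; simpa using hs
    | @insert l I hl _ ih =>
      intro hI
      have hI' : I ⊆ J := (Set.subset_insert _ _).trans hI
      have : I.ncard < J.ncard := Set.ncard_lt_ncard
        ⟨hI', fun h => hl (h (hI (Set.mem_insert _ _)))⟩ (Set.toFinite _)
      exact key I l hl (gap I hI' _ (by omega) (by omega)) (ih hI')
  have high : ∀ T : Set σ, Disjoint T J → ∃ z : TC Q σ ι X,
      z ∈ TD G.deg (T ∪ J) (T ∪ J).ncard ∧ dT F.A z = 0 ∧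
      z ∉ Bd G.deg F.A (T ∪ J) (T ∪ J).ncard ∧
      ∀ y ∈ m, y • z ∈ Bd G.deg F.A (T ∪ J) (T ∪ J).ncard := by
    intro T
    induction T, Set.toFinite T using Set.Finite.induction_on with
    | empty => intro _; rw [Set.empty_union]; exact low J subset_rfl
    | @insert l T hl _ ih =>
      intro hT
      rw [Set.disjoint_insert_left] at hT
      rw [Set.insert_union]
      refine key _ l (by simp [hl, hT.1]) (Acyc.top F.gr h0 hall ?_ (by omega)) (ih hT.2)
      clear ih
      have hT2 := hT.2
      clear hT hl
      induction T, Set.toFinite T using Set.Finite.induction_on with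
      | empty => rw [Set.empty_union]; exact hJe
      | @insert l' T hl _ ih =>
        rw [Set.disjoint_insert_left] at hT2
        rw [Set.insert_union]
        exact Acyc.eventually_insert F.gr h0 (by simp [hl, hT2.1]) (ih ‹_› hT2.2)
  have := high Jᶜ disjoint_compl_left
  rwa [Set.compl_union_self, Set.ncard_univ, Nat.card_eq_fintype_card] at this

variable {M Fr : ℕ → Type u} [∀ j, AddCommGroup (M j)] [∀ j, Module Q (M j)]
  [∀ j, AddCommGroup (Fr j)] [∀ j, Module Q (Fr j)]
  {p : ∀ j, M j →ₗ[Q] Fr j} {q : ∀ j, Fr j →ₗ[Q] M (j + 1)} {a d L : ℕ}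

theorem core (hm : m.FG) (hL : ∀ x, G.deg x ≤ L) (hd : d < a)
    (ht : d + 1 + L ≤ a + Fintype.card σ)
    (hp : ∀ j < a, Function.Injective (p j)) (hq : ∀ j < a, Function.Surjective (q j))
    (hpq : ∀ j < a, Function.Exact (p j) (q j))
    (hMk : ∀ j ≤ a, ∀ l, ∀ x : M j, f l • x = 0)
    (hFk : ∀ j < a, ∀ l, ∀ x : Fr j, f l • x = 0)
    (hex : ∀ j < a, ∀ i, 1 ≤ i → Acyc 1 G.deg F.A ∅ (Fr j) i)
    (hvan : ∀ j < a, ∀ i, Fintype.card σ < i → Acyc 1 G.deg F.A Set.univ (Fr j) i)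
    (hnosoc : ∀ j < a, ∀ z : TC Q σ ι (Fr j), z ∈ TD G.deg Set.univ (Fintype.card σ) →
      dT F.A z = 0 → (∀ y ∈ m, y • z ∈ Bd G.deg F.A Set.univ (Fintype.card σ)) →
      z ∈ Bd G.deg F.A Set.univ (Fintype.card σ))
    (htor : ∃ n, ∀ i, n ≤ i → ∀ y ∈ m, Acyc y G.deg F.A ∅ (M 0) i)
    {J : Set σ} (hJ : J.ncard + 1 ≤ d) (hJe : ∃ n, ∀ i, n ≤ i → Acyc 1 G.deg F.A J (M 0) i)
    (hFE : ∀ j < a, ∀ i ≤ d, EV m (Fr j ⊗[Q] N) i)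
    (hME : ∀ i < d, EV m (M 0 ⊗[Q] N) i) (hMEd : ¬ EV m (M 0 ⊗[Q] N) d) : False := by
  have h0M : ∀ j ≤ a, ∀ z : TC Q σ ι (M j), dT F.A (dT F.A z) = 0 := fun j hj z =>
    dT_sq_zero F.sq (hMk j hj) z
  have h0F : ∀ j < a, ∀ z : TC Q σ ι (Fr j), dT F.A (dT F.A z) = 0 := fun j hj z =>
    dT_sq_zero F.sq (hFk j hj) z
  have hvanM : ∀ y k j i, j + k ≤ a → Fintype.card σ < i → L < i + k →
      Acyc y G.deg F.A Set.univ (M j) i := by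
    intro y k
    induction k with
    | zero => intro j i _ _ h; exact Acyc.of_lt hL h
    | succ k ih =>
      intro j i h1 h2 h3
      exact Acyc.left (hp j (by omega)) (hq j (by omega)) (hpq j (by omega)) F.gr
        (fun _ z _ => h0F j (by omega) z) ((hvan j (by omega) i h2).of_one y)
        (ih (j + 1) (i + 1) (by omega) (by omega) (by omega))
  have hvanM' : ∀ y, ∀ j ≤ d + 1, ∀ i, Fintype.card σ < i →
      Acyc y G.deg F.A Set.univ (M j) i := fun y j hj i hi =>
    hvanM y (a - j) j i (by omega) hi (by omega)
  have htorM : ∀ j ≤ d, ∀ y ∈ m, ∃ n, ∀ i, n ≤ i → Acyc y G.deg F.A ∅ (M j) i := by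
    intro j
    induction j with
    | zero => intro _ y hy; obtain ⟨n, hn⟩ := htor; exact ⟨n, fun i hi => hn i hi y hy⟩
    | succ j ih =>
      intro hj y hy
      obtain ⟨n, hn⟩ := ih (by omega) y hy
      refine ⟨n + 1, fun i hi => ?_⟩
      obtain ⟨i, rfl⟩ : ∃ k, i = k + 1 := ⟨i - 1, by omega⟩
      exact Acyc.right (hp j (by omega)) (hq j (by omega)) (hpq j (by omega)) F.gr
        (fun _ z _ => h0F j (by omega) z) ((hex j (by omega) _ (by omega)).of_one y)
        (hn i (by omega))
  have htorM' : ∀ j ≤ d, ∀ y ∈ m, ∀ i, 1 ≤ i → Acyc y G.deg F.A ∅ (M j) i :=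
    fun j hj y hy i hi => Acyc.top F.gr (h0M j (by omega)) (hvanM' y j (by omega))
      (htorM j hj y hy) (by simp; omega)
  have hinj : ∀ j < d, EV m (M j ⊗[Q] N) 0 → Function.Injective ((p j).rTensor N) := by
    intro j hj hE
    rw [injective_iff_map_eq_zero]
    intro t ht
    obtain ⟨z, hz, rfl⟩ := exists_cl_eq (G := G) (∅ : Set σ) t
    refine eq_zero_of_pow_smul hm (EV.zero_iff.1 hE) fun y hy => ?_
    have h1 : mapT (p j) z ∈ Bd G.deg F.A ∅ 0 :=
      bd_of_cl (mapT_mem _ hz) (by rw [cl_mapT, ht])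
    obtain ⟨t, ht⟩ := exists_pow_smul_mem_of_mapT (hp j (by omega)) (hq j (by omega))
      (hpq j (by omega)) F.gr (fun _ z _ => h0F j (by omega) z)
      (htorM' (j + 1) (by omega) y hy 1 le_rfl) h1
    exact ⟨t, by rw [← map_smul]; exact cl_of_bd ht⟩
  have hind : ∀ j ≤ d, (∀ i < d - j, EV m (M j ⊗[Q] N) i) ∧ ¬ EV m (M j ⊗[Q] N) (d - j) ∧
      ∀ i, 1 ≤ i → i ≤ j → Acyc 1 G.deg F.A ∅ (M j) i := by
    intro j
    induction j with
    | zero => exact fun _ => ⟨hME, hMEd, fun i h1 h2 => by omega⟩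
    | succ j ih =>
      intro hj
      obtain ⟨h1, h2, h3⟩ := ih (by omega)
      have hi := hinj j (by omega) (h1 0 (by omega))
      have hs : Function.Surjective ((q j).rTensor N) :=
        LinearMap.rTensor_surjective N (hq j (by omega))
      have he : Function.Exact ((p j).rTensor N) ((q j).rTensor N) :=
        rTensor_exact N (hpq j (by omega)) (hq j (by omega))
      refine ⟨fun i hij => EV.right hi he hs (hFE j (by omega) i (by omega))
        (h1 (i + 1) (by omega)), fun hE => h2 ?_, ?_⟩
      · have := EV.left hi he hs hE (hFE j (by omega) _ (by omega))
        rwa [show d - (j + 1) + 1 = d - j by omega] at this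
      · intro i hi1 hi2
        obtain ⟨i, rfl⟩ : ∃ k, i = k + 1 := ⟨i - 1, by omega⟩
        rcases Nat.eq_zero_or_pos i with rfl | hi0
        · refine Acyc.right_of_injective (p := p j) (hq j (by omega)) (hpq j (by omega)) F.gr
            (hex j (by omega) 1 le_rfl) fun z hz hb => bd_of_cl hz (hi ?_)
          rw [← cl_mapT, cl_of_bd hb, map_zero]
        · exact Acyc.right (hp j (by omega)) (hq j (by omega)) (hpq j (by omega)) F.gr
            (fun _ z _ => h0F j (by omega) z) (hex j (by omega) _ (by omega)) (h3 i hi0 (by omega))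
  have hJM : ∀ j ≤ d, ∃ n, ∀ i, n ≤ i → Acyc 1 G.deg F.A J (M j) i := by
    intro j
    induction j with
    | zero => exact fun _ => hJe
    | succ j ih =>
      intro hj
      obtain ⟨n, hn⟩ := ih (by omega)
      obtain ⟨n', hn'⟩ := Acyc.eventually_of_empty (h0F j (by omega))
        ⟨1, hex j (by omega)⟩ J
      refine ⟨n + n' + 1, fun i hi => ?_⟩
      obtain ⟨i, rfl⟩ : ∃ k, i = k + 1 := ⟨i - 1, by omega⟩
      exact Acyc.right (hp j (by omega)) (hq j (by omega)) (hpq j (by omega)) F.gr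
        (fun _ z _ => h0F j (by omega) z) (hn' _ (by omega)) (hn i (by omega))
  obtain ⟨-, h2, h3⟩ := hind d le_rfl
  rw [Nat.sub_self, EV.zero_iff] at h2
  push Not at h2
  obtain ⟨t, ht1, ht2⟩ := h2
  obtain ⟨z, hz, rfl⟩ := exists_cl_eq (G := G) (∅ : Set σ) t
  obtain ⟨z, hz, hz0, hzb, hzm⟩ := exists_socle_univ (m := m) (h0M d hd.le) hJ h3
    (hvanM' 1 d (by omega)) (hJM d le_rfl)
    ⟨z, hz, dT_zero_deg F.gr hz, fun hb => ht2 (cl_of_bd hb), fun y hy =>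
      bd_of_cl (Submodule.smul_mem _ _ hz) (by rw [map_smul]; exact ht1 y hy)⟩
  have h4 : mapT (p d) z ∈ Bd G.deg F.A Set.univ (Fintype.card σ) := by
    refine hnosoc d hd _ (mapT_mem _ hz) (by rw [dT_mapT, hz0, map_zero]) fun y hy => ?_
    obtain ⟨w, hw, e⟩ := hzm y hy
    exact ⟨_, mapT_mem (p d) hw, by rw [dT_mapT, e, map_smul]⟩
  obtain ⟨t, ht⟩ := exists_pow_smul_mem_of_mapT (hp d hd) (hq d hd) (hpq d hd) F.gr
    (fun _ z _ => h0F d hd z) (hvanM' 1 (d + 1) le_rfl _ (Nat.lt_succ_self _)) h4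
  rw [one_pow, one_smul] at ht
  exact hzb ht

end

open MvPolynomial
open scoped Pointwise

section

variable {Q : Type u} [CommRing Q] {σ : Type} [Fintype σ]

/-- The linear form with given coefficients. -/
def lin (c : σ → Q) : MvPolynomial σ Q := ∑ j, C (c j) * X j

lemma length_le_card [IsLocalRing Q] {U : Type u} [AddCommGroup U] [Module Q U]
    (hU : ∀ y ∈ IsLocalRing.maximalIdeal Q, ∀ x : U, y • x = 0) (s : Finset U)
    (hs : Submodule.span Q (s : Set U) = ⊤) : Module.length Q U ≤ s.card := by
  have : IsSimpleModule Q (Q ⧸ IsLocalRing.maximalIdeal Q) := by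
    rw [isSimpleModule_iff_isCoatom]
    exact Ideal.isMaximal_def.1 (IsLocalRing.maximalIdeal.isMaximal Q)
  let g : (s → Q ⧸ IsLocalRing.maximalIdeal Q) →ₗ[Q] U := ∑ x : s,
    (Submodule.liftQ _ (LinearMap.toSpanSingleton Q U x) (fun y hy => by
      simpa using hU y hy x)) ∘ₗ LinearMap.proj x
  have hg : Function.Surjective g := by
    rw [← LinearMap.range_eq_top, ← top_le_iff, ← hs, Submodule.span_le]
    intro x hx
    classical
    refine ⟨Pi.single ⟨x, hx⟩ (Ideal.Quotient.mk _ 1), ?_⟩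
    simp only [g, LinearMap.sum_apply, LinearMap.comp_apply, LinearMap.proj_apply]
    rw [Finset.sum_eq_single ⟨x, hx⟩]
    · rw [Pi.single_eq_same]
      exact (Submodule.liftQ_apply _ _ _).trans (by simp)
    · intro b _ hb
      rw [Pi.single_eq_of_ne hb, map_zero]
    · simp
  refine (Module.length_le_of_surjective g hg).trans ?_
  rw [Module.length_pi_of_fintype]
  simp [Module.length_eq_one]

lemma sub_C_mem (p : MvPolynomial σ Q) :
    p - C (coeff 0 p) ∈ Ideal.span (Set.range (X : σ → MvPolynomial σ Q)) := by
  induction p using MvPolynomial.induction_on with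
  | C a => rw [coeff_zero_C, sub_self]; exact Ideal.zero_mem _
  | add p q hp hq =>
    have : p + q - C (coeff 0 (p + q)) = (p - C (coeff 0 p)) + (q - C (coeff 0 q)) := by
      rw [coeff_add, C_add]; ring
    rw [this]
    exact Ideal.add_mem _ hp hq
  | mul_X p j _ =>
    have : coeff 0 (p * X j) = 0 := by
      rw [← constantCoeff_eq, map_mul, constantCoeff_X, mul_zero]
    rw [this, C_0, sub_zero]
    exact Ideal.mul_mem_left _ _ (Ideal.subset_span ⟨j, rfl⟩)

variable {E : Type u} [AddCommGroup E] [Module Q E] [Module (MvPolynomial σ Q) E]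
  [IsScalarTower Q (MvPolynomial σ Q) E]

lemma C_smul (a : Q) (x : E) : (C a : MvPolynomial σ Q) • x = a • x := by
  rw [← mul_one (C a), ← smul_eq_C_mul, smul_assoc, one_smul]

lemma span_le_sup (s : Set E) : (Submodule.span (MvPolynomial σ Q) s).restrictScalars Q ≤
    Submodule.span Q s ⊔ ((Ideal.span (Set.range (X : σ → MvPolynomial σ Q))) •
      Submodule.span (MvPolynomial σ Q) s).restrictScalars Q := by
  intro x hx
  rw [Submodule.restrictScalars_mem] at hx
  induction hx using Submodule.span_induction with
  | mem x hx => exact Submodule.mem_sup_left (Submodule.subset_span hx)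
  | zero => exact Submodule.zero_mem _
  | add x y _ _ hx hy => exact Submodule.add_mem _ hx hy
  | smul a x hx' hx =>
    have : a • x = coeff 0 a • x + (a - C (coeff 0 a)) • x := by
      rw [sub_smul, C_smul]; abel
    have h3 : (a - C (coeff 0 a)) • x ∈ ((Ideal.span (Set.range (X : σ → MvPolynomial σ Q))) •
        Submodule.span (MvPolynomial σ Q) s) := Submodule.smul_mem_smul (sub_C_mem a) hx'
    rw [this]
    refine Submodule.add_mem _ (Submodule.smul_mem _ _ hx) (Submodule.mem_sup_right ?_)
    rw [Submodule.restrictScalars_mem]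
    exact h3

lemma fg_of_pow_smul [IsNoetherian (MvPolynomial σ Q) E] (n : ℕ)
    (U : Submodule (MvPolynomial σ Q) E)
    (h : ∀ a ∈ (Ideal.span (Set.range (X : σ → MvPolynomial σ Q))) ^ n, ∀ x ∈ U, a • x = 0) :
    (U.restrictScalars Q).FG := by
  induction n generalizing U with
  | zero =>
    have : U = ⊥ := by
      rw [eq_bot_iff]
      intro x hx
      simpa using h 1 (by simp) x hx
    subst this
    exact Submodule.fg_bot
  | succ n ih =>
    obtain ⟨s, hs⟩ := IsNoetherian.noetherian U
    have h1 := ih ((Ideal.span (Set.range (X : σ → MvPolynomial σ Q))) • U) (by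
      intro a ha x hx
      induction hx using Submodule.smul_induction_on' with
      | smul r hr y hy =>
        rw [smul_smul]
        exact h _ (by rw [pow_succ]; exact Ideal.mul_mem_mul ha hr) _ hy
      | add x _ y _ hx hy => rw [smul_add, hx, hy, add_zero])
    have h2 : U.restrictScalars Q = Submodule.span Q (s : Set E) ⊔
        ((Ideal.span (Set.range (X : σ → MvPolynomial σ Q))) • U).restrictScalars Q := by
      apply le_antisymm
      · have h4 := span_le_sup (Q := Q) (σ := σ) (s : Set E)
        rwa [hs] at h4
      · have h4 : (Ideal.span (Set.range (X : σ → MvPolynomial σ Q))) • U ≤ U :=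
          Submodule.smul_le_right
        refine sup_le ?_ fun x hx => ?_
        · rw [Submodule.span_le]
          intro x hx
          have : x ∈ Submodule.span (MvPolynomial σ Q) (s : Set E) := Submodule.subset_span hx
          rw [hs] at this
          exact this
        · rw [Submodule.restrictScalars_mem] at hx ⊢
          exact h4 hx
    rw [h2]
    exact (Submodule.fg_span s.finite_toSet).sup h1

/-- The submodule of elements killed by a power of the ideal of the variables. -/
def gam (n : ℕ) : Submodule (MvPolynomial σ Q) E :=
  Submodule.torsionBySet _ _
    ((Ideal.span (Set.range (X : σ → MvPolynomial σ Q)) ^ n : Ideal _) : Set (MvPolynomial σ Q))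

lemma mem_gam {n : ℕ} {x : E} : x ∈ (gam n : Submodule (MvPolynomial σ Q) E) ↔
    ∀ a ∈ (Ideal.span (Set.range (X : σ → MvPolynomial σ Q))) ^ n, a • x = 0 := by
  simp [gam, Submodule.mem_torsionBySet_iff]

lemma mem_gam_succ {n : ℕ} {x : E} (h : ∀ j : σ, (X j : MvPolynomial σ Q) • x ∈
    (gam n : Submodule (MvPolynomial σ Q) E)) :
    x ∈ (gam (n + 1) : Submodule (MvPolynomial σ Q) E) := by
  rw [mem_gam]
  intro a ha
  rw [pow_succ] at ha
  induction ha using Submodule.mul_induction_on' with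
  | mem_mul_mem a ha b hb =>
    rw [mul_smul]
    have : b • x ∈ (gam n : Submodule (MvPolynomial σ Q) E) := by
      induction hb using Submodule.span_induction with
      | mem b hb => obtain ⟨j, rfl⟩ := hb; exact h j
      | zero => rw [zero_smul]; exact Submodule.zero_mem _
      | add b c _ _ hb hc => rw [add_smul]; exact Submodule.add_mem _ hb hc
      | smul r b _ hb => rw [smul_eq_mul, mul_smul]; exact Submodule.smul_mem _ _ hb
    exact mem_gam.1 this a ha
  | add a _ b _ ha hb => rw [add_smul, ha, hb, add_zero]

variable [IsLocalRing Q]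

lemma exists_lin_regular [IsNoetherianRing Q] [Infinite (IsLocalRing.ResidueField Q)]
    [Module.Finite (MvPolynomial σ Q) E]
    (hm : ∀ y ∈ IsLocalRing.maximalIdeal Q, ∀ x : E, y • x = 0)
    (hE : ∀ x : E, (∀ j : σ, (X j : MvPolynomial σ Q) • x = 0) → x = 0) :
    ∃ c : σ → Q, ∀ x : E, lin c • x = 0 → x = 0 := by
  classical
  let k := IsLocalRing.ResidueField Q
  let Sp : Ideal (MvPolynomial σ Q) → Submodule k (σ → k) := fun P =>
    { carrier := {v | ∃ c : σ → Q, (∀ j, IsLocalRing.residue Q (c j) = v j) ∧ lin c ∈ P}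
      zero_mem' := ⟨0, by simp, by simp [lin]⟩
      add_mem' := by
        rintro v w ⟨c, h1, h2⟩ ⟨d, h3, h4⟩
        refine ⟨c + d, fun j => by simp [h1, h3], ?_⟩
        have : lin (c + d) = lin c + lin d := by
          simp [lin, add_mul, Finset.sum_add_distrib]
        rw [this]
        exact P.add_mem h2 h4
      smul_mem' := by
        rintro a v ⟨c, h1, h2⟩
        obtain ⟨a, rfl⟩ := IsLocalRing.residue_surjective a
        refine ⟨a • c, fun j => by simp [h1], ?_⟩
        have : lin (a • c) = C a * lin c := by
          simp [lin, Finset.mul_sum, mul_assoc]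
        rw [this]
        exact P.mul_mem_left _ h2 }
  have hfin := associatedPrimes.finite (MvPolynomial σ Q) E
  have htop : ∀ P ∈ associatedPrimes (MvPolynomial σ Q) E, Sp P ≠ ⊤ := by
    intro P hP htop
    obtain ⟨hPp, x, hx⟩ := isAssociatedPrime_iff.1 (AssociatedPrimes.mem_iff.1 hP)
    have hxP : ∀ a, a ∈ P ↔ a • x = 0 := by
      intro a; rw [hx]; simp [Submodule.mem_colon_singleton]
    refine hPp.ne_top ((Ideal.eq_top_iff_one _).2 ((hxP 1).2 ?_))
    rw [one_smul]
    refine hE x fun j => ?_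
    have : Pi.single j 1 ∈ Sp P := by rw [htop]; trivial
    obtain ⟨c, h1, h2⟩ := this
    rw [hxP, lin, Finset.sum_smul, Finset.sum_eq_single j] at h2
    · have h3 : (c j - 1) • x = 0 := by
        refine hm _ ?_ _
        rw [← IsLocalRing.residue_eq_zero_iff, map_sub, h1]
        simp
      rw [mul_comm, mul_smul, C_smul] at h2
      rw [sub_smul, one_smul, sub_eq_zero] at h3
      rwa [h3] at h2
    · intro i _ hi
      rw [mul_comm, mul_smul, C_smul, hm _ _ x, smul_zero]
      rw [← IsLocalRing.residue_eq_zero_iff, h1, Pi.single_eq_of_ne hi]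
    · simp
  have := Subspace.biUnion_ne_univ_of_top_notMem (k := k) (E := σ → k)
    (s := hfin.toFinset.image Sp) (by
      simp only [Finset.mem_image, Set.Finite.mem_toFinset, not_exists, not_and]
      exact htop)
  rw [Set.ne_univ_iff_exists_notMem] at this
  obtain ⟨v, hv⟩ := this
  choose c hc using fun j => IsLocalRing.residue_surjective (v j)
  refine ⟨c, fun x hx => ?_⟩
  by_contra hx0
  have : lin c ∈ ⋃ p ∈ associatedPrimes (MvPolynomial σ Q) E, (p : Set (MvPolynomial σ Q)) := by
    rw [biUnion_associatedPrimes_eq_zero_divisors]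
    exact ⟨x, hx0, hx⟩
  rw [Set.mem_iUnion₂] at this
  obtain ⟨P, hP, hcP⟩ := this
  refine hv (Set.mem_biUnion (Finset.mem_coe.2 (Finset.mem_image_of_mem _
    (hfin.mem_toFinset.2 hP))) ?_)
  exact ⟨c, hc, hcP⟩

end

open MvPolynomial
open scoped Pointwise

section

variable {Q : Type u} [CommRing Q] {σ : Type} [Fintype σ]

lemma lin_smul_mem {E : Type u} [AddCommGroup E] [Module Q E] [Module (MvPolynomial σ Q) E]
    [IsScalarTower Q (MvPolynomial σ Q) E] {V : ℕ → Submodule Q E}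
    (hX : ∀ t (j : σ), ∀ x ∈ V t, (X j : MvPolynomial σ Q) • x ∈ V (t + 2)) (c : σ → Q) (t : ℕ)
    (x : E) (hx : x ∈ V t) : lin c • x ∈ V (t + 2) := by
  rw [lin, Finset.sum_smul]
  refine Submodule.sum_mem _ fun j _ => ?_
  rw [mul_smul, C_smul]
  exact Submodule.smul_mem _ _ (hX t j x hx)

lemma length_map_le {E F : Type u} [AddCommGroup E] [Module Q E] [AddCommGroup F] [Module Q F]
    (g : E →ₗ[Q] F) (V : Submodule Q E) : Module.length Q (V.map g) ≤ Module.length Q V :=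
  Module.length_le_of_surjective (g.submoduleMap V) (g.submoduleMap_surjective V)

lemma length_mono {E : Type u} [AddCommGroup E] [Module Q E] {U V : Submodule Q E} (h : U ≤ V) :
    Module.length Q U ≤ Module.length Q V :=
  Module.length_le_of_injective (Submodule.inclusion h) (Submodule.inclusion_injective h)

lemma length_add_le {E F : Type u} [AddCommGroup E] [Module Q E] [AddCommGroup F] [Module Q F]
    (g : E →ₗ[Q] F) (ℓ : E →ₗ[Q] E) (hℓ : Function.Injective ℓ) (hg : ∀ x, g (ℓ x) = 0)
    {U V : Submodule Q E} (h : ∀ x ∈ U, ℓ x ∈ V) :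
    Module.length Q (V.map g) + Module.length Q U ≤ Module.length Q V := by
  have h1 := Module.length_eq_add_of_exact (R := Q) (LinearMap.ker (g.submoduleMap V)).subtype
    (g.submoduleMap V) (Submodule.subtype_injective _) (g.submoduleMap_surjective V)
    (LinearMap.exact_subtype_ker_map _)
  rw [h1, add_comm]
  gcongr
  let φ : U →ₗ[Q] LinearMap.ker (g.submoduleMap V) :=
    LinearMap.codRestrict _ (LinearMap.codRestrict V (ℓ ∘ₗ U.subtype) fun x => h x x.2)
      (fun x => by
        rw [LinearMap.mem_ker]
        exact Subtype.ext (hg x))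
  refine Module.length_le_of_injective φ fun x y hxy => ?_
  have := congrArg (fun z => ((z : LinearMap.ker (g.submoduleMap V)) : V).1) hxy
  exact Subtype.ext (hℓ this)

lemma length_map_growth {E F : Type u} [AddCommGroup E] [Module Q E] [AddCommGroup F] [Module Q F]
    (g : E →ₗ[Q] F) (ℓ : E →ₗ[Q] E) (hℓ : Function.Injective ℓ) (hg : ∀ x, g (ℓ x) = 0)
    {V : ℕ → Submodule Q E} (hV : Monotone V) (h : ∀ t, ∀ x ∈ V t, ℓ x ∈ V (t + 2))
    (c K : ℕ) (hlen : ∀ t, Module.length Q (V t) ≤ ((K * (t + 1) ^ (c + 1) : ℕ) : ℕ∞)) (t : ℕ) :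
    Module.length Q ((V t).map g) ≤ ((K * 3 ^ (c + 1) * (t + 1) ^ c : ℕ) : ℕ∞) := by
  have key : ∀ k : ℕ, ((k : ℕ) : ℕ∞) * Module.length Q ((V t).map g) ≤
      Module.length Q (V (t + 2 * k)) := by
    intro k
    induction k with
    | zero => simp
    | succ k ih =>
      have h1 := length_add_le g ℓ hℓ hg (h (t + 2 * k))
      have h2 : Module.length Q ((V t).map g) ≤
          Module.length Q ((V (t + 2 * k + 2)).map g) :=
        length_mono (Submodule.map_mono (hV (by omega)))
      rw [Nat.cast_succ, add_mul, one_mul, add_comm]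
      exact (add_le_add h2 ih).trans h1
  have h1 := (key (t + 1)).trans (hlen _)
  have h2 : Module.length Q ((V t).map g) ≠ ⊤ :=
    ne_top_of_le_ne_top (ENat.natCast_ne_top _) ((length_map_le g (V t)).trans (hlen t))
  obtain ⟨v, hv⟩ := ENat.ne_top_iff_exists.1 h2
  rw [← hv] at h1 ⊢
  norm_cast at h1 ⊢
  have h3 : t + 2 * (t + 1) + 1 = 3 * (t + 1) := by ring
  rw [h3] at h1
  refine Nat.le_of_mul_le_mul_left (c := t + 1) ?_ (by omega)
  refine h1.trans (le_of_eq ?_)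
  rw [mul_pow]
  ring

/-- Polynomial growth of degree `c` lets one cut down to a finite `Q`-module by `c` linear
forms. -/
theorem exists_lin_cut [IsLocalRing Q] [IsNoetherianRing Q]
    [Infinite (IsLocalRing.ResidueField Q)] (c : ℕ) :
    ∀ (E : Type u) [AddCommGroup E] [Module Q E] [Module (MvPolynomial σ Q) E]
      [IsScalarTower Q (MvPolynomial σ Q) E] [Module.Finite (MvPolynomial σ Q) E]
      (_ : ∀ y ∈ IsLocalRing.maximalIdeal Q, ∀ x : E, y • x = 0)
      (V : ℕ → Submodule Q E) (_ : Monotone V)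
      (_ : ∀ t (j : σ), ∀ x ∈ V t, (X j : MvPolynomial σ Q) • x ∈ V (t + 2))
      (_ : ∀ x, ∃ t, x ∈ V t) (K : ℕ)
      (_ : ∀ t, Module.length Q (V t) ≤ ((K * (t + 1) ^ c : ℕ) : ℕ∞)),
      ∃ l : List (σ → Q), l.length ≤ c ∧ ∃ U : Submodule Q E, U.FG ∧
        ∀ x, ∃ u ∈ U, x - u ∈ Ideal.span {p | ∃ c ∈ l, p = lin c} •
          (⊤ : Submodule (MvPolynomial σ Q) E) := by
  induction c with
  | zero =>
    intro E _ _ _ _ _ hm V hV hX hU K hlen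
    refine ⟨[], le_rfl, ?_⟩
    simp only [pow_zero, mul_one] at hlen
    have hfl : ∀ t, IsFiniteLength Q (V t) := fun t =>
      Module.length_ne_top_iff.1 (ne_top_of_le_ne_top (ENat.natCast_ne_top _) (hlen t))
    choose v hv using fun t => ENat.ne_top_iff_exists.1 (Module.length_ne_top_iff.2 (hfl t))
    have hvK : ∀ t, v t ≤ K := fun t => by
      have := hlen t
      rw [← hv] at this
      exact_mod_cast this
    obtain ⟨t₀, ht₀⟩ : ∃ t₀, ∀ t, v t ≤ v t₀ := by
      have hb : (Set.range v).Finite := (Set.finite_Iic K).subset (by rintro _ ⟨t, rfl⟩; exact hvK t)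
      obtain ⟨w, ⟨t₀, rfl⟩, hw⟩ := hb.exists_maximal (Set.range_nonempty v)
      refine ⟨t₀, fun t => ?_⟩
      by_contra h
      exact h (hw ⟨t, rfl⟩ (by omega))
    have hst : ∀ t, t₀ ≤ t → V t ≤ V t₀ := by
      intro t ht
      obtain ⟨h1, h2⟩ := isFiniteLength_iff_isNoetherian_isArtinian.1 (hfl t)
      by_contra hne
      have h3 : (V t₀).comap (V t).subtype ≠ ⊤ := by
        intro h; apply hne
        intro x hx
        have : (⟨x, hx⟩ : V t) ∈ (V t₀).comap (V t).subtype := by rw [h]; trivial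
        exact this
      have h4 := Submodule.length_lt h3
      rw [(Submodule.comapSubtypeEquivOfLe (hV ht)).length_eq, ← hv, ← hv] at h4
      exact absurd (ht₀ t) (by exact_mod_cast not_le.2 h4)
    refine ⟨V t₀, ?_, fun x => ⟨x, ?_, by rw [sub_self]; exact Submodule.zero_mem _⟩⟩
    · obtain ⟨h1, h2⟩ := isFiniteLength_iff_isNoetherian_isArtinian.1 (hfl t₀)
      exact Module.Finite.iff_fg.1 inferInstance
    · obtain ⟨t, ht⟩ := hU x
      rcases le_total t t₀ with h | h
      · exact hV h ht
      · exact hst t h ht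
  | succ c ih =>
    intro E _ _ _ _ _ hm V hV hX hU K hlen
    have hnoeth : IsNoetherian (MvPolynomial σ Q) E := inferInstance
    have hgm : Monotone (fun n => (gam n : Submodule (MvPolynomial σ Q) E)) := by
      intro n m hnm x hx
      rw [mem_gam] at hx ⊢
      exact fun a ha => hx a (Ideal.pow_le_pow_right hnm ha)
    obtain ⟨n, hn⟩ := monotone_stabilizes_iff_noetherian.2 hnoeth ⟨_, hgm⟩
    let Γ : Submodule (MvPolynomial σ Q) E := gam n
    have hn1 : Γ = gam (n + 1) := hn (n + 1) (by omega)
    let E' := E ⧸ Γ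
    let p : E →ₗ[MvPolynomial σ Q] E' := Γ.mkQ
    have hp : Function.Surjective p := Γ.mkQ_surjective
    have hE' : ∀ x : E', (∀ j : σ, (X j : MvPolynomial σ Q) • x = 0) → x = 0 := by
      intro x hx
      obtain ⟨x, rfl⟩ := hp x
      rw [← LinearMap.mem_ker, Submodule.ker_mkQ, hn1]
      refine mem_gam_succ fun j => ?_
      have := hx j
      rw [← map_smul, ← LinearMap.mem_ker, Submodule.ker_mkQ] at this
      exact this
    have hm' : ∀ y ∈ IsLocalRing.maximalIdeal Q, ∀ x : E', y • x = 0 := by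
      intro y hy x
      obtain ⟨x, rfl⟩ := hp x
      rw [← C_smul (σ := σ), ← map_smul, C_smul, hm y hy, map_zero]
    obtain ⟨ℓ, hℓ⟩ := exists_lin_regular hm' hE'
    let I : Ideal (MvPolynomial σ Q) := Ideal.span {lin ℓ}
    let E'' := E' ⧸ (I • (⊤ : Submodule (MvPolynomial σ Q) E'))
    let q : E' →ₗ[MvPolynomial σ Q] E'' := (I • (⊤ : Submodule (MvPolynomial σ Q) E')).mkQ
    have hq : Function.Surjective q := Submodule.mkQ_surjective _
    let V' : ℕ → Submodule Q E' := fun t => (V t).map (p.restrictScalars Q)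
    have hV' : Monotone V' := fun s t hst => Submodule.map_mono (hV hst)
    have hX' : ∀ t (j : σ), ∀ x ∈ V' t, (X j : MvPolynomial σ Q) • x ∈ V' (t + 2) := by
      rintro t j _ ⟨x, hx, rfl⟩
      exact ⟨X j • x, hX t j x hx, p.map_smul _ _⟩
    have hlen' : ∀ t, Module.length Q (V' t) ≤ ((K * (t + 1) ^ (c + 1) : ℕ) : ℕ∞) :=
      fun t => (length_map_le _ _).trans (hlen t)
    let lℓ : E' →ₗ[Q] E' := (LinearMap.lsmul (MvPolynomial σ Q) E' (lin ℓ)).restrictScalars Q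
    have hinj : Function.Injective lℓ := by
      rw [← LinearMap.ker_eq_bot, LinearMap.ker_eq_bot']
      exact hℓ
    have hq0 : ∀ x, q.restrictScalars Q (lℓ x) = 0 := by
      intro x
      show q (lin ℓ • x) = 0
      rw [← LinearMap.mem_ker, Submodule.ker_mkQ]
      exact Submodule.smul_mem_smul (Ideal.subset_span rfl) trivial
    have hm'' : ∀ y ∈ IsLocalRing.maximalIdeal Q, ∀ x : E'', y • x = 0 := by
      intro y hy x
      obtain ⟨x, rfl⟩ := hq x
      rw [← C_smul (σ := σ), ← map_smul, C_smul, hm' y hy, map_zero]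
    obtain ⟨l, hl, U, hU1, hU2⟩ := ih E'' hm''
      (fun t => (V' t).map (q.restrictScalars Q))
      (fun s t hst => Submodule.map_mono (hV' hst))
      (by
        rintro t j _ ⟨x, hx, rfl⟩
        exact ⟨X j • x, hX' t j x hx, q.map_smul _ _⟩)
      (by
        intro x
        obtain ⟨x, rfl⟩ := hq x
        obtain ⟨x, rfl⟩ := hp x
        obtain ⟨t, ht⟩ := hU x
        exact ⟨t, Submodule.mem_map_of_mem (f := q.restrictScalars Q)
          (Submodule.mem_map_of_mem (f := p.restrictScalars Q) ht)⟩)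
      (K * 3 ^ (c + 1))
      (length_map_growth (q.restrictScalars Q) lℓ hinj hq0 hV' (lin_smul_mem hX' ℓ) c K hlen')
    let r : E →ₗ[MvPolynomial σ Q] E'' := q ∘ₗ p
    have hr : Function.Surjective r := hq.comp hp
    refine ⟨ℓ :: l, by simpa using hl, ?_⟩
    obtain ⟨s, rfl⟩ := hU1
    classical
    refine ⟨Submodule.span Q (s.image (Function.surjInv hr) : Set E) ⊔ Γ.restrictScalars Q,
      (Submodule.fg_span (Finset.finite_toSet _)).sup
        (fg_of_pow_smul n Γ fun a ha x hx => mem_gam.1 hx a ha), fun x => ?_⟩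
    obtain ⟨u, hu, hxu⟩ := hU2 (r x)
    obtain ⟨u, hu', rfl⟩ : ∃ v ∈ Submodule.span Q (s.image (Function.surjInv hr) : Set E),
        r v = u := by
      have : Submodule.span Q (s : Set E'') ≤
          (Submodule.span Q (s.image (Function.surjInv hr) : Set E)).map
            (r.restrictScalars Q) := by
        rw [Submodule.span_le]
        intro y hy
        exact ⟨Function.surjInv hr y, Submodule.subset_span (by
          simpa using ⟨y, hy, rfl⟩), Function.surjInv_eq hr y⟩
      exact this hu
    set Il := Ideal.span {p : MvPolynomial σ Q | ∃ c ∈ l, p = lin c}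
    obtain ⟨w, hw, hw'⟩ : ∃ w ∈ Il • (⊤ : Submodule (MvPolynomial σ Q) E), r w = r x - r u := by
      have h1 : Il • (⊤ : Submodule (MvPolynomial σ Q) E'') =
          (Il • (⊤ : Submodule (MvPolynomial σ Q) E)).map r := by
        rw [Submodule.map_smul'', Submodule.map_top, LinearMap.range_eq_top.2 hr]
      rw [h1] at hxu
      exact hxu
    have h2 : p (x - u - w) ∈ I • (⊤ : Submodule (MvPolynomial σ Q) E') := by
      have : q (p (x - u - w)) = 0 := by
        show r (x - u - w) = 0
        rw [map_sub, map_sub, hw', sub_self]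
      rwa [← LinearMap.mem_ker, Submodule.ker_mkQ] at this
    obtain ⟨w', hw1, hw2⟩ : ∃ w' ∈ I • (⊤ : Submodule (MvPolynomial σ Q) E),
        p w' = p (x - u - w) := by
      have h1 : I • (⊤ : Submodule (MvPolynomial σ Q) E') =
          (I • (⊤ : Submodule (MvPolynomial σ Q) E)).map p := by
        rw [Submodule.map_smul'', Submodule.map_top, LinearMap.range_eq_top.2 hp]
      rw [h1] at h2
      exact h2
    have h3 : x - u - w - w' ∈ Γ := by
      have : p (x - u - w - w') = 0 := by rw [map_sub, hw2, sub_self]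
      rwa [← LinearMap.mem_ker, Submodule.ker_mkQ] at this
    refine ⟨u + (x - u - w - w'), Submodule.add_mem _ (Submodule.mem_sup_left hu')
      (Submodule.mem_sup_right h3), ?_⟩
    have h4 : x - (u + (x - u - w - w')) = w + w' := by abel
    rw [h4]
    refine Submodule.add_mem _ (Submodule.smul_mono_left (Ideal.span_mono ?_) hw)
      (Submodule.smul_mono_left (Ideal.span_mono ?_) hw1)
    · rintro y ⟨c, hc, rfl⟩
      exact ⟨c, by simp [hc], rfl⟩
    · rintro y rfl
      exact ⟨ℓ, by simp, rfl⟩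

end

open MvPolynomial
open scoped Pointwise

section Kills

variable {A : Type u} [CommRing A] {n : Type} [Fintype n]

/-- The action of a matrix on vectors with entries in a module. -/
def mv {L : Type*} [AddCommGroup L] [Module A L] (D : Matrix n n A) (v : n → L) : n → L :=
  fun i => ∑ j, D i j • v j

/-- `s` annihilates the homology of the differential `D` with coefficients in `L`. -/
def Kills (D : Matrix n n A) (s : A) (L : Type*) [AddCommGroup L] [Module A L] : Prop :=
  ∀ v : n → L, mv D v = 0 → ∃ w, s • v = mv D w

variable {L L' : Type*} [AddCommGroup L] [Module A L] [AddCommGroup L'] [Module A L']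

lemma mv_sub (D : Matrix n n A) (v w : n → L) : mv D (v - w) = mv D v - mv D w := by
  funext i; simp [mv, smul_sub]

lemma mv_smul (D : Matrix n n A) (a : A) (v : n → L) : mv D (a • v) = a • mv D v := by
  funext i
  simp only [mv, Pi.smul_apply, Finset.smul_sum]
  exact Finset.sum_congr rfl fun j _ => smul_comm _ _ _

lemma mv_map (D : Matrix n n A) (g : L →ₗ[A] L') (v : n → L) :
    mv D (fun i => g (v i)) = fun i => g (mv D v i) := by
  funext i; simp [mv]

lemma mv_mv (D D' : Matrix n n A) (v : n → L) : mv D (mv D' v) = mv (D * D') v := by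
  funext i
  simp only [mv, Matrix.mul_apply, Finset.smul_sum, Finset.sum_smul, mul_smul]
  exact Finset.sum_comm

lemma mv_zero_mat (v : n → L) : mv (0 : Matrix n n A) v = 0 := by
  funext i; simp [mv]

lemma Kills.of_equiv {D : Matrix n n A} {s : A} (h : Kills D s L) (e : L ≃ₗ[A] L') :
    Kills D s L' := by
  intro v hv
  obtain ⟨w, hw⟩ := h (fun i => e.symm (v i)) (by
    exact (mv_map D e.symm.toLinearMap v).trans (by rw [hv]; funext i; simp))
  refine ⟨fun i => e (w i), ?_⟩
  refine Eq.trans ?_ (mv_map D e.toLinearMap w).symm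
  rw [← hw]
  funext i; simp

lemma Kills.quot {D : Matrix n n A} {s : A} (h : Kills D s L) (hD : D * D = 0) {x : A}
    (hx : IsSMulRegular L x) : Kills D (s ^ 2) (QuotSMulTop x L) := by
  intro v hv
  let π : L →ₗ[A] QuotSMulTop x L := Submodule.mkQ _
  have hπ : ∀ a, π a = 0 → ∃ b, x • b = a := by
    intro a ha
    rw [← LinearMap.mem_ker, Submodule.ker_mkQ, Submodule.mem_smul_pointwise_iff_exists] at ha
    obtain ⟨b, -, hb⟩ := ha
    exact ⟨b, hb⟩
  have hπ0 : ∀ b, π (x • b) = 0 := by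
    intro b
    rw [← LinearMap.mem_ker, Submodule.ker_mkQ]
    exact Submodule.smul_mem_pointwise_smul b x ⊤ trivial
  choose v' hv' using fun i => Submodule.mkQ_surjective _ (v i)
  obtain rfl : (fun i => π (v' i)) = v := funext hv'
  rw [mv_map] at hv
  choose y hy using fun i => hπ _ (congrFun hv i)
  have hy' : mv D v' = x • y := funext fun i => (hy i).symm
  have h0 : mv D y = 0 := by
    have h1 : x • mv D y = 0 := by
      rw [← mv_smul, ← hy', mv_mv, hD, mv_zero_mat]
    funext i
    exact (isSMulRegular_iff_right_eq_zero_of_smul.1 hx) _ (congrFun h1 i)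
  obtain ⟨w, hw⟩ := h y h0
  obtain ⟨w', hw'⟩ := h (s • v' - x • w) (by
    rw [mv_sub, mv_smul, mv_smul, ← hw, hy', smul_comm, sub_self])
  refine ⟨fun i => π (w' i), ?_⟩
  rw [mv_map, ← hw']
  funext i
  simp only [Pi.smul_apply, Pi.sub_apply, map_smul, map_sub, smul_sub, hπ0]
  rw [smul_zero, sub_zero, pow_two, mul_smul]

lemma Kills.list {D : Matrix n n A} (hD : D * D = 0) (rs : List A) :
    ∀ (L : Type u) [AddCommGroup L] [Module A L] (s : A) (_ : Kills D s L)
      (_ : RingTheory.Sequence.IsWeaklyRegular L rs),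
      ∃ k, Kills D (s ^ k) (L ⧸ Ideal.ofList rs • (⊤ : Submodule A L)) := by
  induction rs with
  | nil =>
    intro L _ _ s h _
    refine ⟨1, ?_⟩
    rw [pow_one]
    refine h.of_equiv (Submodule.quotEquivOfEqBot _ ?_).symm
    simp
  | cons r rs ih =>
    intro L _ _ s h hr
    rw [RingTheory.Sequence.isWeaklyRegular_cons_iff] at hr
    obtain ⟨k, hk⟩ := ih (QuotSMulTop r L) (s ^ 2) (h.quot hD hr.1) hr.2
    refine ⟨2 * k, ?_⟩
    rw [pow_mul]
    exact hk.of_equiv (Submodule.quotOfListConsSMulTopEquivQuotSMulTopInner L r rs).symm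

lemma Kills.of_flat {D : Matrix n n A} {s : A} (h : Kills D s A) {L : Type u} [AddCommGroup L]
    [Module A L] [Module.Flat A L] : Kills D s L := by
  classical
  intro v hv
  let x : (n → A) →ₗ[A] L := ∑ j, (LinearMap.toSpanSingleton A L (v j)) ∘ₗ LinearMap.proj j
  have hx : ∀ c, x c = ∑ j, c j • v j := by intro c; simp [x]
  have hxD : x ∘ₗ D.vecMulLinear = 0 := by
    refine LinearMap.ext fun c => ?_
    rw [LinearMap.comp_apply, hx]
    simp only [Matrix.vecMulLinear_apply, Matrix.vecMul, dotProduct, Finset.sum_smul, mul_smul]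
    rw [Finset.sum_comm]
    refine Finset.sum_eq_zero fun i _ => ?_
    rw [← Finset.smul_sum]
    have : ∑ j, D i j • v j = 0 := congrFun hv i
    rw [this, smul_zero]
  obtain ⟨k, a, y, hxy, ha⟩ := Module.Flat.exists_factorization_of_comp_eq_zero_of_free hxD
  have hrow : ∀ l : Fin k, mv D (fun j => a (Pi.single j 1) l) = 0 := by
    intro l
    funext i
    have h1 := congrArg (fun z => z l) (LinearMap.congr_fun ha (Pi.single i 1))
    simp only [LinearMap.comp_apply, Matrix.vecMulLinear_apply, LinearMap.zero_apply,
      Finsupp.coe_zero, Pi.zero_apply] at h1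
    rw [Matrix.single_one_vecMul] at h1
    have h2 : D.row i = ∑ j, D i j • Pi.single j (1 : A) := by
      funext j'
      simp [Finset.sum_apply, Pi.single_apply]
    rw [h2, map_sum, Finsupp.coe_finsetSum, Finset.sum_apply] at h1
    simpa [mv] using h1
  choose w hw using fun l => h _ (hrow l)
  refine ⟨fun j => ∑ l, w l j • y (Finsupp.single l 1), ?_⟩
  funext i
  have hv' : ∀ i, v i = ∑ l, a (Pi.single i 1) l • y (Finsupp.single l 1) := by
    intro i
    have h1 : v i = x (Pi.single i 1) := by
      rw [hx, Finset.sum_eq_single i]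
      · simp
      · intro b _ hb; simp [Pi.single_eq_of_ne hb]
      · simp
    rw [h1, hxy, LinearMap.comp_apply]
    conv_lhs => rw [← Finsupp.univ_sum_single (a (Pi.single i 1)), map_sum]
    refine Finset.sum_congr rfl fun l _ => ?_
    rw [← map_smul]; simp
  rw [Pi.smul_apply, hv', Finset.smul_sum]
  simp only [mv, Finset.smul_sum]
  rw [Finset.sum_comm]
  refine Finset.sum_congr rfl fun l _ => ?_
  have h1 := congrFun (hw l) i
  simp only [Pi.smul_apply, mv, smul_eq_mul] at h1
  rw [smul_smul, h1, Finset.sum_smul]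
  exact Finset.sum_congr rfl fun j _ => by rw [mul_smul]

/-- Kills for a ring over itself transports along a ring homomorphism making the target a module
for which it holds. -/
lemma Kills.map {B : Type u} [CommRing B] [Algebra A B] {D : Matrix n n A} {s : A}
    (h : Kills D s B) : Kills (D.map (algebraMap A B)) (algebraMap A B s) B := by
  intro v hv
  obtain ⟨w, hw⟩ := h v (by
    rw [← hv]; funext i; simp [mv, Algebra.smul_def])
  refine ⟨w, ?_⟩
  funext i
  have := congrFun hw i
  simpa [mv, Algebra.smul_def] using this

end Kills

section Special

variable {κ : Type u} [Field κ] {σ : Type} [Fintype σ]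

/-- Substitute the values `a` for the variables outside `T`. -/
def subT (a : σ → κ) (T : Set σ) : MvPolynomial σ κ →ₐ[κ] MvPolynomial σ κ := by
  classical exact aeval fun i => if i ∈ T then X i else C (a i)

lemma sub_sub_mem (a : σ → κ) (j : σ) (p : MvPolynomial σ κ) :
    ∃ q, p - subT a {j}ᶜ p = (X j - C (a j)) * q := by
  classical
  induction p using MvPolynomial.induction_on with
  | C c => exact ⟨0, by simp [subT, algHom_C]⟩
  | add p q hp hq =>
    obtain ⟨u, hu⟩ := hp
    obtain ⟨v, hv⟩ := hq
    exact ⟨u + v, by rw [map_add, mul_add, ← hu, ← hv]; ring⟩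
  | mul_X p i hp =>
    obtain ⟨u, hu⟩ := hp
    by_cases hi : i = j
    · subst hi
      refine ⟨u * C (a i) + p, ?_⟩
      have : subT a {i}ᶜ (X i) = C (a i) := by simp [subT]
      rw [map_mul, this]
      linear_combination C (a i) * hu
    · refine ⟨u * X i, ?_⟩
      have : subT a {j}ᶜ (X i) = X i := by simp [subT, hi]
      rw [map_mul, this]
      linear_combination X i * hu

lemma subT_subT (a : σ → κ) (T T' : Set σ) (p : MvPolynomial σ κ) :
    subT a T (subT a T' p) = subT a (T ∩ T') p := by
  classical
  have : (subT a T).comp (subT a T') = subT a (T ∩ T') := by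
    refine MvPolynomial.algHom_ext fun i => ?_
    by_cases h : i ∈ T' <;> by_cases h' : i ∈ T <;> simp [subT, h, h', algHom_C]
  exact AlgHom.congr_fun this p

lemma subT_univ (a : σ → κ) (p : MvPolynomial σ κ) : subT a Set.univ p = p := by
  have : subT a Set.univ = AlgHom.id κ _ := by
    refine MvPolynomial.algHom_ext fun i => ?_
    simp [subT]
  rw [this]; rfl

lemma subT_empty (a : σ → κ) (p : MvPolynomial σ κ) : subT a ∅ p = C (aeval a p) := by
  have : subT a ∅ = (Algebra.ofId κ (MvPolynomial σ κ)).comp (aeval a) := by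
    refine MvPolynomial.algHom_ext fun i => ?_
    simp [subT, Algebra.ofId_apply]
  rw [this]; rfl

variable {n : Type} [Fintype n]

lemma mulVec_map {A B : Type u} [CommRing A] [CommRing B] (g : A →+* B) (D : Matrix n n A)
    (v : n → A) : (D.map g).mulVec (fun i => g (v i)) = fun i => g (D.mulVec v i) := by
  funext i; simp [Matrix.mulVec, dotProduct]

/-- Specialising the variables at a point. -/
lemma exists_kills_subT {D : Matrix n n (MvPolynomial σ κ)} (hD : D * D = 0)
    {s : MvPolynomial σ κ} (h : Kills D s (MvPolynomial σ κ)) (a : σ → κ) (T : Set σ) :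
    ∃ k : ℕ, ∀ v : n → MvPolynomial σ κ, (∀ i, subT a Tᶜ (v i) = v i) →
      (D.map (subT a Tᶜ)).mulVec v = 0 → ∃ w, subT a Tᶜ s ^ k • v = (D.map (subT a Tᶜ)).mulVec w := by
  classical
  induction T, T.toFinite using Set.Finite.induction_on with
  | empty =>
    refine ⟨1, fun v _ hv => ?_⟩
    have h1 : D.map (subT a (∅ : Set σ)ᶜ) = D := by
      ext1 i j; simp [subT_univ]
    rw [h1] at hv ⊢
    obtain ⟨w, hw⟩ := h v (by rw [← hv]; funext i; simp [mv, Matrix.mulVec, dotProduct])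
    refine ⟨w, ?_⟩
    rw [Set.compl_empty, subT_univ, pow_one, hw]
    funext i; simp [mv, Matrix.mulVec, dotProduct]
  | @insert j T hj _ ih =>
    obtain ⟨k, hk⟩ := ih
    refine ⟨2 * k, fun v hvT hv => ?_⟩
    set U := Tᶜ with hU
    set ρ := subT a U
    set π := subT a ({j}ᶜ : Set σ)
    set x : MvPolynomial σ κ := X j - C (a j)
    have hx0 : x ≠ 0 := by
      intro h0
      have := congrArg (coeff (Finsupp.single j 1)) h0
      have hne : (0 : σ →₀ ℕ) ≠ Finsupp.single j 1 :=
        (Finsupp.single_ne_zero.2 one_ne_zero).symm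
      simp [x, coeff_C, hne] at this
    have hjU : j ∈ U := hj
    have hρx : ρ x = x := by simp [x, ρ, subT, hjU, algHom_C]
    have hπx : π x = 0 := by simp [x, π, subT, algHom_C]
    have hUj : (insert j T)ᶜ = ({j}ᶜ : Set σ) ∩ U := by
      ext i; simp [hU]
    have hUj2 : (insert j T)ᶜ = U ∩ (insert j T)ᶜ := by
      ext i; simp only [hU, Set.mem_compl_iff, Set.mem_insert_iff, Set.mem_inter_iff]; tauto
    have hUj3 : (insert j T)ᶜ = {j}ᶜ ∩ (insert j T)ᶜ := by
      ext i; simp only [Set.mem_compl_iff, Set.mem_insert_iff, Set.mem_inter_iff,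
        Set.mem_singleton_iff]; tauto
    have hπρ : ∀ p, π (ρ p) = subT a (insert j T)ᶜ p := fun p => by
      rw [hUj]; exact subT_subT _ _ _ _
    have hρρ : ∀ p, ρ (ρ p) = ρ p := fun p => by
      refine (subT_subT _ _ _ _).trans ?_
      rw [Set.inter_self]
    have hρv : ∀ i, ρ (v i) = v i := fun i => by
      rw [← hvT i]; exact (subT_subT _ _ _ _).trans (by rw [← hUj2])
    have hπv : ∀ i, π (v i) = v i := fun i => by
      rw [← hvT i]; exact (subT_subT _ _ _ _).trans (by rw [← hUj3])
    set E := D.map ρ with hE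
    have hEE : E * E = 0 := by
      rw [hE]
      have := congrArg (fun M : Matrix n n (MvPolynomial σ κ) => M.map ρ) hD
      simpa [Matrix.map_mul] using this
    have hEρ : E.map ρ = E := by ext1 i l; simp [hE, hρρ]
    have hEπ : E.map π = D.map (subT a (insert j T)ᶜ) := by ext1 i l; simp [hE, hπρ]
    have hρE : ∀ w : n → MvPolynomial σ κ, E.mulVec (fun i => ρ (w i)) =
        fun i => ρ (E.mulVec w i) := fun w => by
      conv_lhs => rw [← hEρ]
      exact mulVec_map (ρ : MvPolynomial σ κ →+* MvPolynomial σ κ) E w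
    have hπE : ∀ w : n → MvPolynomial σ κ, (D.map (subT a (insert j T)ᶜ)).mulVec
        (fun i => π (w i)) = fun i => π (E.mulVec w i) := fun w => by
      rw [← hEπ]
      exact mulVec_map (π : MvPolynomial σ κ →+* MvPolynomial σ κ) E w
    have hy : ∀ i, ∃ q, ρ q = q ∧ E.mulVec v i = x * q := by
      intro i
      obtain ⟨q, hq⟩ := sub_sub_mem a j (E.mulVec v i)
      have h1 := congrFun (hπE v) i
      simp only [hπv] at h1
      rw [hv] at h1
      have h2 : E.mulVec v i = x * q := by
        rw [← hq]
        show _ = _ - π _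
        rw [← h1, Pi.zero_apply, sub_zero]
      refine ⟨ρ q, hρρ q, ?_⟩
      have h3 := congrFun (hρE v) i
      simp only [hρv] at h3
      rw [h3, h2, map_mul, hρx]
    choose y hρy hy using hy
    have hy' : E.mulVec v = x • y := funext hy
    have h0 : E.mulVec y = 0 := by
      have h1 : x • E.mulVec y = 0 := by
        rw [← Matrix.mulVec_smul, ← hy', Matrix.mulVec_mulVec, hEE, Matrix.zero_mulVec]
      funext i
      have := congrFun h1 i
      simpa [hx0] using this
    obtain ⟨w, hw⟩ := hk y hρy h0
    have hw' : ρ s ^ k • y = E.mulVec (fun i => ρ (w i)) := by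
      rw [hρE, ← hw]
      funext i
      simp [hρρ, hρy]
    obtain ⟨w2, hw2⟩ := hk (ρ s ^ k • v - x • fun i => ρ (w i)) (by
      intro i
      simp [hρρ, hρv, hρx, map_sub]) (by
      rw [Matrix.mulVec_sub, Matrix.mulVec_smul, Matrix.mulVec_smul, ← hw', hy', smul_comm,
        sub_self])
    refine ⟨fun i => π (w2 i), ?_⟩
    rw [hπE, ← hw2]
    funext i
    simp only [Pi.smul_apply, Pi.sub_apply, smul_eq_mul, map_mul, map_sub, map_pow, hπρ, hπx,
      hπv, zero_mul, sub_zero]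
    ring

lemma exists_kills_eval {D : Matrix n n (MvPolynomial σ κ)} (hD : D * D = 0)
    {s : MvPolynomial σ κ} (h : Kills D s (MvPolynomial σ κ)) (a : σ → κ) :
    ∃ k : ℕ, ∀ v : n → κ, (D.map (aeval a : MvPolynomial σ κ →ₐ[κ] κ)).mulVec v = 0 →
      ∃ w, aeval a s ^ k • v = (D.map (aeval a : MvPolynomial σ κ →ₐ[κ] κ)).mulVec w := by
  obtain ⟨k, hk⟩ := exists_kills_subT hD h a Set.univ
  refine ⟨k, fun v hv => ?_⟩
  have hm : D.map (subT a (Set.univ : Set σ)ᶜ) =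
      (D.map (aeval a : MvPolynomial σ κ →ₐ[κ] κ)).map (C : κ →+* MvPolynomial σ κ) := by
    ext1 i j; simp [subT_empty]
  obtain ⟨w, hw⟩ := hk (fun i => C (v i)) (fun i => by simp) (by
    rw [hm, mulVec_map, hv]; funext i; simp)
  refine ⟨fun i => constantCoeff (w i), ?_⟩
  funext i
  have h1 := congrArg constantCoeff (congrFun hw i)
  rw [hm] at h1
  have h2 := congrFun (mulVec_map (constantCoeff (σ := σ) (R := κ))
    ((D.map (aeval a : MvPolynomial σ κ →ₐ[κ] κ)).map (C : κ →+* MvPolynomial σ κ)) w) i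
  have h3 : ((D.map (aeval a : MvPolynomial σ κ →ₐ[κ] κ)).map (C : κ →+* MvPolynomial σ κ)).map
      (constantCoeff (σ := σ) (R := κ)) = D.map (aeval a : MvPolynomial σ κ →ₐ[κ] κ) := by
    ext1 i j; simp
  rw [h3] at h2
  rw [h2, ← h1]
  simp [subT_empty]

end Special

open MvPolynomial
open scoped Pointwise

section

attribute [local instance] MvPolynomial.algebraMvPolynomial

lemma flat_mvPolynomial (k κ : Type u) (σ : Type) [Field k] [Field κ] [Algebra k κ] :
    Module.Flat (MvPolynomial σ k) (MvPolynomial σ κ) :=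
  Module.Flat.isBaseChange k (MvPolynomial σ k) κ (MvPolynomial σ κ)
    (Algebra.IsPushout.out (R := k) (S := MvPolynomial σ k) (R' := κ) (S' := MvPolynomial σ κ))

variable {Q : Type u} [CommRing Q] [IsLocalRing Q] {σ : Type} [Fintype σ]
  {n : Type} [Fintype n]

lemma exists_kills_field {D : Matrix n n (MvPolynomial σ Q)} (hD : D * D = 0)
    {s : MvPolynomial σ Q} (h : Kills D s (MvPolynomial σ Q)) {rs : List Q}
    (hr : RingTheory.Sequence.IsWeaklyRegular Q rs)
    (hrm : Ideal.ofList rs = IsLocalRing.maximalIdeal Q)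
    {κ : Type u} [Field κ] (θ : MvPolynomial σ Q →+* κ)
    (hθ : ∀ y ∈ IsLocalRing.maximalIdeal Q, θ (C y) = 0) :
    ∃ k : ℕ, ∀ v : n → κ, (D.map θ).mulVec v = 0 → ∃ w, θ s ^ k • v = (D.map θ).mulVec w := by
  have h1 : RingTheory.Sequence.IsWeaklyRegular (MvPolynomial σ Q)
      (rs.map (algebraMap Q (MvPolynomial σ Q))) := hr.of_flat
  obtain ⟨k, hk⟩ := Kills.list hD _ _ s h h1
  let k₀ := IsLocalRing.ResidueField Q
  let _ : Algebra k₀ κ := (Ideal.Quotient.lift (IsLocalRing.maximalIdeal Q)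
    (θ.comp (C : Q →+* MvPolynomial σ Q)) hθ).toAlgebra
  have hsurj : Function.Surjective (Algebra.linearMap (MvPolynomial σ Q) (MvPolynomial σ k₀)) :=
    MvPolynomial.map_surjective _ IsLocalRing.residue_surjective
  have hker : Ideal.ofList (rs.map (algebraMap Q (MvPolynomial σ Q))) •
      (⊤ : Submodule (MvPolynomial σ Q) (MvPolynomial σ Q)) =
      LinearMap.ker (Algebra.linearMap (MvPolynomial σ Q) (MvPolynomial σ k₀)) := by
    rw [← Ideal.map_ofList, hrm, smul_eq_mul, Ideal.mul_top]
    have := MvPolynomial.ker_map (σ := σ) (IsLocalRing.residue Q)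
    rw [IsLocalRing.ker_residue] at this
    ext p
    exact (SetLike.ext_iff.1 this p).symm
  have hk1 : Kills D (s ^ k) (MvPolynomial σ k₀) := hk.of_equiv
    ((Submodule.quotEquivOfEq _ _ hker).trans (LinearMap.quotKerEquivOfSurjective _ hsurj))
  have := flat_mvPolynomial k₀ κ σ
  have hk2 := (hk1.map.of_flat (L := MvPolynomial σ κ)).map
  have hcomp : ∀ p : MvPolynomial σ Q, aeval (fun j => θ (X j))
      (algebraMap (MvPolynomial σ k₀) (MvPolynomial σ κ)
        (algebraMap (MvPolynomial σ Q) (MvPolynomial σ k₀) p)) = θ p := by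
    intro p
    have : ((aeval (fun j => θ (X j)) : MvPolynomial σ κ →ₐ[κ] κ) :
        MvPolynomial σ κ →+* κ).comp
      ((algebraMap (MvPolynomial σ k₀) (MvPolynomial σ κ)).comp
        (algebraMap (MvPolynomial σ Q) (MvPolynomial σ k₀))) = θ := by
      refine MvPolynomial.ringHom_ext (fun r => ?_) (fun i => ?_)
      · simp only [RingHom.comp_apply, MvPolynomial.algebraMap_def, MvPolynomial.map_C]
        simp only [RingHom.coe_coe, algHom_C]
        rfl
      · simp only [RingHom.comp_apply, MvPolynomial.algebraMap_def, MvPolynomial.map_X,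
          RingHom.coe_coe, aeval_X]
    exact RingHom.congr_fun this p
  obtain ⟨k', hk'⟩ := exists_kills_eval (by
    rw [← Matrix.map_mul, ← Matrix.map_mul, hD]; ext1 i j; simp) hk2 (fun j => θ (X j))
  have hm : ((D.map (algebraMap (MvPolynomial σ Q) (MvPolynomial σ k₀))).map
      (algebraMap (MvPolynomial σ k₀) (MvPolynomial σ κ))).map
      (aeval (fun j => θ (X j)) : MvPolynomial σ κ →ₐ[κ] κ) = D.map θ := by
    ext1 i j; simp only [Matrix.map_apply, hcomp]
  rw [hm, hcomp, map_pow] at hk'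
  refine ⟨k * k', fun v hv => ?_⟩
  rw [pow_mul]
  exact hk' v hv

end

open MvPolynomial
open scoped Kronecker

section Kunneth

variable {A : Type*} [CommRing A] {m n : Type} [Fintype m] [Fintype n] [DecidableEq m]
  [DecidableEq n]

/-- The differential of the Hom complex of two (twisted) differentials. -/
def homD (ε a : Matrix m m A) (δ b : Matrix n n A) : Matrix (n × m) (n × m) A :=
  1 ⊗ₖ a + (b * δ).transpose ⊗ₖ ε

/-- The differential of the tensor product of two (twisted) differentials. -/
def tenD (ε a : Matrix m m A) (δ b : Matrix n n A) : Matrix (n × m) (n × m) A :=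
  b ⊗ₖ 1 + δ ⊗ₖ (ε * a)

variable {ε a : Matrix m m A} {δ b : Matrix n n A}

lemma homD_mulVec (φ : Matrix m n A) :
    (homD ε a δ b).mulVec φ.vec = (a * φ + ε * φ * (b * δ)).vec := by
  rw [homD, Matrix.add_mulVec, Matrix.kronecker_mulVec_vec, Matrix.kronecker_mulVec_vec,
    Matrix.vec_add, Matrix.transpose_one, Matrix.mul_one, Matrix.transpose_transpose]

lemma signed_sq {w : A} (hε : ε * ε = 1) (h : ε * a = -(a * ε)) (ha : a * a = w • 1) :
    (ε * a) * (ε * a) = -(w • 1) := by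
  rw [h, neg_mul_neg, Matrix.mul_assoc, ← Matrix.mul_assoc ε, h, Matrix.neg_mul, Matrix.mul_neg,
    Matrix.mul_assoc, hε, Matrix.mul_one, ha]

lemma homD_sq {w : A} (hε : ε * ε = 1) (h : ε * a = -(a * ε)) (ha : a * a = w • 1)
    (hδ : δ * δ = 1) (h' : δ * b = -(b * δ)) (hb : b * b = w • 1) :
    homD ε a δ b * homD ε a δ b = 0 := by
  have e1 : (b * δ) * (b * δ) = -(w • 1) := by
    rw [← neg_mul_neg, ← h', signed_sq hδ h' hb]
  rw [homD, mul_add, add_mul, add_mul, ← Matrix.mul_kronecker_mul, ← Matrix.mul_kronecker_mul,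
    ← Matrix.mul_kronecker_mul, ← Matrix.mul_kronecker_mul, ← Matrix.transpose_mul, e1, ha, hε, h,
    Matrix.one_mul, Matrix.one_mul, Matrix.mul_one, Matrix.transpose_neg, Matrix.transpose_smul,
    Matrix.transpose_one]
  ext ⟨i, i'⟩ ⟨j, j'⟩
  simp only [Matrix.add_apply, Matrix.kronecker_apply, Matrix.smul_apply, Matrix.neg_apply,
    smul_eq_mul, Matrix.zero_apply]
  ring

lemma tenD_sq {w : A} (hε : ε * ε = 1) (h : ε * a = -(a * ε)) (ha : a * a = w • 1)
    (hδ : δ * δ = 1) (h' : δ * b = -(b * δ)) (hb : b * b = w • 1) :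
    tenD ε a δ b * tenD ε a δ b = 0 := by
  rw [tenD, mul_add, add_mul, add_mul, ← Matrix.mul_kronecker_mul, ← Matrix.mul_kronecker_mul,
    ← Matrix.mul_kronecker_mul, ← Matrix.mul_kronecker_mul, signed_sq hε h ha, hb, hδ, h',
    Matrix.one_mul, Matrix.one_mul, Matrix.mul_one]
  ext ⟨i, i'⟩ ⟨j, j'⟩
  simp only [Matrix.add_apply, Matrix.kronecker_apply, Matrix.smul_apply, Matrix.neg_apply,
    smul_eq_mul, Matrix.zero_apply]
  ring

lemma tenD_contract_left (hδ : δ * δ = 1) (h' : δ * b = -(b * δ)) {k : Matrix m m A}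
    (hk : (ε * a) * k + k * (ε * a) = 1) :
    tenD ε a δ b * (δ ⊗ₖ k) + (δ ⊗ₖ k) * tenD ε a δ b = 1 := by
  rw [tenD, mul_add, add_mul, ← Matrix.mul_kronecker_mul, ← Matrix.mul_kronecker_mul,
    ← Matrix.mul_kronecker_mul, ← Matrix.mul_kronecker_mul, hδ, h', Matrix.one_mul, Matrix.mul_one,
    ← Matrix.one_kronecker_one, ← hk, Matrix.kronecker_add]
  ext ⟨i, i'⟩ ⟨j, j'⟩
  simp only [Matrix.add_apply, Matrix.kronecker_apply, Matrix.neg_apply]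
  ring

lemma tenD_contract_right (hε : ε * ε = 1) (h : ε * a = -(a * ε)) (ha : a * a = 0)
    {k : Matrix n n A} (hk : b * k + k * b = 1) :
    IsUnit (tenD ε a δ b * (k ⊗ₖ (1 : Matrix m m A)) + (k ⊗ₖ 1) * tenD ε a δ b) := by
  have h0 : (ε * a) * (ε * a) = 0 := by
    rw [signed_sq hε h (w := 0) (by rw [ha, zero_smul]), zero_smul, neg_zero]
  have : tenD ε a δ b * (k ⊗ₖ (1 : Matrix m m A)) + (k ⊗ₖ 1) * tenD ε a δ b =
      1 + (δ * k + k * δ) ⊗ₖ (ε * a) := by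
    rw [tenD, mul_add, add_mul, ← Matrix.mul_kronecker_mul, ← Matrix.mul_kronecker_mul,
      ← Matrix.mul_kronecker_mul, ← Matrix.mul_kronecker_mul, Matrix.one_mul, Matrix.mul_one,
      Matrix.one_mul, ← Matrix.one_kronecker_one, ← hk, Matrix.add_kronecker, Matrix.add_kronecker]
    abel
  rw [this]
  refine IsNilpotent.isUnit_one_add ⟨2, ?_⟩
  rw [pow_two, ← Matrix.mul_kronecker_mul, h0]
  ext ⟨i, i'⟩ ⟨j, j'⟩
  simp

end Kunneth

section Field

variable {κ : Type*} [Field κ] {m n : Type} [Fintype m] [Fintype n] [DecidableEq m]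
  [DecidableEq n]

lemma exists_contraction {a : Matrix m m κ} (ha : a * a = 0)
    (h : ∀ v, a.mulVec v = 0 → ∃ w, a.mulVec w = v) :
    ∃ k : Matrix m m κ, a * k + k * a = 1 := by
  set T : (m → κ) →ₗ[κ] (m → κ) := Matrix.toLin' a with hT
  have hTT : T ∘ₗ T = 0 := by rw [hT, ← Matrix.toLin'_mul, ha, map_zero]
  obtain ⟨g, hg⟩ := T.rangeRestrict.exists_rightInverse_of_surjective T.range_rangeRestrict
  obtain ⟨p, hp⟩ := (LinearMap.range T).subtype.exists_leftInverse_of_injective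
    (Submodule.ker_subtype _)
  have hTs : ∀ x, T (g (p x)) = p x := fun x => congrArg Subtype.val (LinearMap.congr_fun hg (p x))
  have hpr : ∀ x, T x = 0 → (p x : m → κ) = x := by
    intro x hx
    obtain ⟨w, hw⟩ := h x (by simpa [hT] using hx)
    have : x ∈ LinearMap.range T := ⟨w, by simpa [hT] using hw⟩
    exact congrArg Subtype.val (LinearMap.congr_fun hp ⟨x, this⟩)
  have hT2 : ∀ x, T (T x) = 0 := LinearMap.congr_fun hTT
  have hpT : ∀ x, (p (T x) : m → κ) = T x := fun x => hpr _ (hT2 x)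
  refine ⟨LinearMap.toMatrix' ((g ∘ₗ p) ∘ₗ (LinearMap.id - (g ∘ₗ p) ∘ₗ T)), ?_⟩
  apply Matrix.toLin'.injective
  rw [map_add, Matrix.toLin'_mul, Matrix.toLin'_mul, Matrix.toLin'_toMatrix', Matrix.toLin'_one]
  refine LinearMap.ext fun x => ?_
  have h1 : T (x - g (p (T x))) = 0 := by rw [map_sub, hTs, hpT, sub_self]
  simp only [LinearMap.add_apply, LinearMap.comp_apply, LinearMap.sub_apply, LinearMap.id_apply,
    ← hT]
  rw [hTs, hpr _ h1, hT2]
  simp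

lemma exists_functional {a : Matrix m m κ} {z : m → κ} (hz : ∀ w, a.mulVec w ≠ z) :
    ∃ c : m → κ, Matrix.vecMul c a = 0 ∧ c ⬝ᵥ z ≠ 0 := by
  obtain ⟨f, hf, hle⟩ := Submodule.exists_le_ker_of_notMem (p := LinearMap.range (Matrix.toLin' a))
    (v := z) (by rintro ⟨w, hw⟩; exact hz w (by simpa using hw))
  have hfe : ∀ v, (fun j => f (Pi.single j 1)) ⬝ᵥ v = f v := by
    intro v
    rw [LinearMap.pi_apply_eq_sum_univ f v]
    simp only [dotProduct, smul_eq_mul]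
    refine Finset.sum_congr rfl fun i _ => ?_
    rw [mul_comm]
    congr 2
    funext j
    simp [Pi.single_apply, eq_comm]
  refine ⟨fun j => f (Pi.single j 1), ?_, by rwa [hfe]⟩
  funext j
  have : (fun j => f (Pi.single j 1)) ⬝ᵥ a.mulVec (Pi.single j 1) = 0 := by
    rw [hfe]; exact hle ⟨Pi.single j 1, by simp⟩
  rw [Matrix.dotProduct_mulVec] at this
  simpa using this

variable {ε a : Matrix m m κ} {δ b : Matrix n n κ}

lemma kunneth (hδ : δ * δ = 1) (h' : δ * b = -(b * δ))
    (hb : b * b = 0)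
    (hD : ∀ v, (homD ε a δ b).mulVec v = 0 → ∃ w, (homD ε a δ b).mulVec w = v) :
    (∀ v, a.mulVec v = 0 → ∃ w, a.mulVec w = v) ∨ ∃ k, b * k + k * b = 1 := by
  by_contra hc
  push Not at hc
  obtain ⟨⟨z, hz, hz'⟩, hb'⟩ := hc
  have : ∃ r : n → κ, b.transpose.mulVec r = 0 ∧ ∀ w, b.transpose.mulVec w ≠ r := by
    by_contra hcc
    push Not at hcc
    obtain ⟨k, hk⟩ := exists_contraction (a := b.transpose)
      (by rw [← Matrix.transpose_mul, hb, Matrix.transpose_zero]) hcc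
    apply hb' k.transpose
    have := congrArg Matrix.transpose hk
    rwa [Matrix.transpose_add, Matrix.transpose_mul, Matrix.transpose_mul, Matrix.transpose_one,
      Matrix.transpose_transpose, add_comm] at this
  obtain ⟨r, hr, hr'⟩ := this
  obtain ⟨c, hc, hcz⟩ := exists_functional hz'
  obtain ⟨e, he, her⟩ := exists_functional hr'
  rw [Matrix.vecMul_transpose] at he
  rw [Matrix.mulVec_transpose] at hr
  have hbd : b * δ = -(δ * b) := by rw [h', neg_neg]
  obtain ⟨w, hw⟩ := hD (Matrix.vecMulVec z (Matrix.vecMul r δ)).vec (by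
    rw [homD_mulVec, Matrix.mul_vecMulVec, hz, Matrix.mul_assoc, Matrix.vecMulVec_mul, hbd,
      Matrix.vecMul_neg, Matrix.vecMul_vecMul, ← Matrix.mul_assoc, hδ, Matrix.one_mul, hr, neg_zero,
      show Matrix.vecMulVec z (0 : n → κ) = 0 from by ext i j; simp [Matrix.vecMulVec_apply],
      Matrix.mul_zero, add_zero,
      show ∀ y : n → κ, Matrix.vecMulVec (0 : m → κ) y = 0 from fun y => by
        ext i j; simp [Matrix.vecMulVec_apply], Matrix.vec_zero])
  obtain ⟨ψ, rfl⟩ := Matrix.vec_bijective.2 w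
  rw [homD_mulVec, Matrix.vec_inj] at hw
  have h1 := congrArg (fun M => c ⬝ᵥ M.mulVec (δ.mulVec e)) hw
  simp only [Matrix.vecMulVec_mulVec, Matrix.add_mulVec, dotProduct_add] at h1
  have h2 : c ⬝ᵥ (a * ψ).mulVec (δ.mulVec e) = 0 := by
    rw [← Matrix.mulVec_mulVec, Matrix.dotProduct_mulVec, hc, zero_dotProduct]
  have h3 : (ε * ψ * (b * δ)).mulVec (δ.mulVec e) = 0 := by
    rw [Matrix.mulVec_mulVec, Matrix.mul_assoc (ε * ψ), Matrix.mul_assoc b, hδ, Matrix.mul_one,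
      ← Matrix.mulVec_mulVec, he, Matrix.mulVec_zero]
  have h4 : Matrix.vecMul r δ ⬝ᵥ δ.mulVec e = e ⬝ᵥ r := by
    rw [Matrix.dotProduct_mulVec, Matrix.vecMul_vecMul, hδ, Matrix.vecMul_one, dotProduct_comm]
  rw [h2, h3, h4] at h1
  simp only [dotProduct_zero, add_zero, dotProduct_smul] at h1
  simp [hcz, her] at h1

lemma exists_tenD_contract (hε : ε * ε = 1) (h : ε * a = -(a * ε)) (ha : a * a = 0)
    (hδ : δ * δ = 1) (h' : δ * b = -(b * δ)) (hb : b * b = 0)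
    (hD : ∀ v, (homD ε a δ b).mulVec v = 0 → ∃ w, (homD ε a δ b).mulVec w = v) :
    ∃ H, (tenD ε a δ b * H + H * tenD ε a δ b).det ≠ 0 := by
  rcases kunneth hδ h' hb hD with h1 | ⟨k, hk⟩
  · obtain ⟨k, hk⟩ := exists_contraction (a := ε * a) (by
      rw [signed_sq hε h (w := 0) (by rw [ha, zero_smul]), zero_smul, neg_zero]) (by
      intro v hv
      rw [← Matrix.mulVec_mulVec] at hv
      have h2 := congrArg (ε.mulVec) hv
      rw [Matrix.mulVec_mulVec, hε, Matrix.one_mulVec, Matrix.mulVec_zero] at h2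
      obtain ⟨w, rfl⟩ := h1 v h2
      refine ⟨-(ε.mulVec w), ?_⟩
      rw [Matrix.mulVec_neg, Matrix.mulVec_mulVec, h, Matrix.neg_mul, Matrix.mul_assoc, hε,
        Matrix.mul_one, Matrix.neg_mulVec, neg_neg])
    exact ⟨_, by rw [tenD_contract_left hδ h' hk, Matrix.det_one]; exact one_ne_zero⟩
  · refine ⟨k ⊗ₖ 1, ?_⟩
    exact ((Matrix.isUnit_iff_isUnit_det _).1 (tenD_contract_right hε h ha hk)).ne_zero

end Field

open MvPolynomial
open scoped Kronecker

section Kill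

variable {S : Type u} [CommRing S] {n : Type} [Fintype n] [DecidableEq n]

lemma exists_lift_matrix (p : Ideal S) [p.IsPrime] (H : Matrix n n (FractionRing (S ⧸ p))) :
    ∃ (H' : Matrix n n S) (t : S), t ∉ p ∧
      H'.map (algebraMap S (FractionRing (S ⧸ p))) =
        (algebraMap S (FractionRing (S ⧸ p)) t) • H := by
  obtain ⟨b, hb⟩ := IsLocalization.exist_integer_multiples_of_finite (nonZeroDivisors (S ⧸ p))
    (fun ij : n × n => H ij.1 ij.2)
  obtain ⟨t, ht⟩ := Ideal.Quotient.mk_surjective (b : S ⧸ p)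
  choose c hc using hb
  choose e he using fun ij => Ideal.Quotient.mk_surjective (c ij)
  refine ⟨Matrix.of fun i j => e (i, j), t, fun h => ?_, ?_⟩
  · exact nonZeroDivisors.ne_zero b.2 (by rw [← ht, Ideal.Quotient.eq_zero_iff_mem.2 h])
  · ext1 i j
    have h1 := hc (i, j)
    rw [← he (i, j), Algebra.smul_def, ← ht] at h1
    rw [Matrix.map_apply, Matrix.smul_apply, smul_eq_mul,
      IsScalarTower.algebraMap_apply S (S ⧸ p) (FractionRing (S ⧸ p)),
      IsScalarTower.algebraMap_apply S (S ⧸ p) (FractionRing (S ⧸ p))]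
    exact h1

lemma exists_notMem_smul {D : Matrix n n S} (hD : D * D = 0) (p : Ideal S) [p.IsPrime]
    {H : Matrix n n (FractionRing (S ⧸ p))}
    (hH : (D.map (algebraMap S (FractionRing (S ⧸ p))) * H +
      H * D.map (algebraMap S (FractionRing (S ⧸ p)))).det ≠ 0) :
    ∃ s, s ∉ p ∧ ∀ (I : Ideal S) (v : n → S), (∀ i, D.mulVec v i ∈ I) →
      ∃ w, ∀ i, (s • v - D.mulVec w) i ∈ I := by
  obtain ⟨H', t, ht, hH'⟩ := exists_lift_matrix p H
  let K := FractionRing (S ⧸ p)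
  set U := D * H' + H' * D with hU
  have hker : ∀ x : S, algebraMap S K x = 0 ↔ x ∈ p := by
    intro x
    rw [IsScalarTower.algebraMap_apply S (S ⧸ p) K, FaithfulSMul.algebraMap_eq_zero_iff]
    exact Ideal.Quotient.eq_zero_iff_mem
  have hUm : U.map (algebraMap S K) = algebraMap S K t •
      (D.map (algebraMap S K) * H + H * D.map (algebraMap S K)) := by
    rw [hU, Matrix.map_add _ (map_add _), Matrix.map_mul, Matrix.map_mul, hH', Matrix.mul_smul,
      Matrix.smul_mul, smul_add]
  have hdet : U.det ∉ p := by
    rw [← hker, RingHom.map_det, RingHom.mapMatrix_apply, hUm, Matrix.det_smul]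
    exact mul_ne_zero (pow_ne_zero _ fun h => ht ((hker t).1 h)) hH
  have hDU : D * U = U * D := by
    rw [hU, mul_add, add_mul, ← Matrix.mul_assoc, hD, Matrix.zero_mul, zero_add, Matrix.mul_assoc H',
      hD, Matrix.mul_zero, add_zero, Matrix.mul_assoc]
  have hadj : U.det • (U.adjugate * D) = U.det • (D * U.adjugate) := by
    calc U.det • (U.adjugate * D) = U.adjugate * (D * U) * U.adjugate := by
          rw [Matrix.mul_assoc, Matrix.mul_assoc, Matrix.mul_adjugate]; simp
      _ = (U.adjugate * U) * (D * U.adjugate) := by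
          rw [hDU]; simp only [Matrix.mul_assoc]
      _ = _ := by rw [Matrix.adjugate_mul]; simp
  have hI : ∀ (I : Ideal S) (B : Matrix n n S) (x : n → S), (∀ i, x i ∈ I) →
      ∀ i, B.mulVec x i ∈ I := fun I B x hx i =>
    Ideal.sum_mem _ fun j _ => I.mul_mem_left _ (hx j)
  refine ⟨U.det * U.det, fun h => (‹p.IsPrime›.mem_or_mem h).elim hdet hdet, fun I v hv =>
    ⟨U.det • U.adjugate.mulVec (H'.mulVec v), fun i => ?_⟩⟩
  have h1 : (U.det * U.det) • v = U.det • U.adjugate.mulVec (U.mulVec v) := by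
    rw [Matrix.mulVec_mulVec, Matrix.adjugate_mul, Matrix.smul_mulVec, Matrix.one_mulVec, smul_smul]
  have h2 : U.det • U.adjugate.mulVec (U.mulVec v) =
      D.mulVec (U.det • U.adjugate.mulVec (H'.mulVec v)) +
      U.det • (U.adjugate * H').mulVec (D.mulVec v) := by
    rw [hU, Matrix.add_mulVec, Matrix.mulVec_add, smul_add, ← hU, Matrix.mulVec_smul]
    congr 1
    · have := congrArg (fun B => Matrix.mulVec B (H'.mulVec v)) hadj
      simpa only [Matrix.smul_mulVec, ← Matrix.mulVec_mulVec] using this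
    · simp only [← Matrix.mulVec_mulVec]
  rw [h1, h2, add_sub_cancel_left]
  exact I.mul_mem_left _ (hI I _ _ hv i)

end Kill

section Artin

variable {S : Type u} [CommRing S] [IsNoetherianRing S]

lemma isArtinian_of_primes {L : Type u} [AddCommGroup L] [Module S L] [Module.Finite S L]
    (h : ∀ p : Ideal S, p.IsPrime → ¬p.IsMaximal → ∃ s ∉ p, ∀ x : L, s • x = 0) :
    IsArtinian S L := by
  let I := Module.annihilator S L
  have hdim : Ring.KrullDimLE 0 (S ⧸ I) := by
    rw [Ring.krullDimLE_zero_iff]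
    intro P hP
    by_contra hmax
    have hP' : (P.comap (Ideal.Quotient.mk I)).IsPrime := hP.comap _
    obtain ⟨s, hs, hx⟩ := h _ hP' fun hm => hmax (by
      have := Ideal.map_eq_top_or_isMaximal_of_surjective (Ideal.Quotient.mk I)
        Ideal.Quotient.mk_surjective hm
      rw [Ideal.map_comap_of_surjective _ Ideal.Quotient.mk_surjective] at this
      exact this.resolve_left hP.ne_top)
    apply hs
    rw [Ideal.mem_comap, Ideal.Quotient.eq_zero_iff_mem.2 (Module.mem_annihilator.2 hx)]
    exact zero_mem _
  have : IsArtinianRing (S ⧸ I) := IsNoetherianRing.isArtinianRing_of_krullDimLE_zero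
  let _ : Module (S ⧸ I) L := Module.IsTorsionBySet.module (I := I) (fun x a =>
    Module.mem_annihilator.1 a.2 x)
  have : IsScalarTower S (S ⧸ I) L := Module.IsTorsionBySet.isScalarTower _
  have : Module.Finite (S ⧸ I) L := Module.Finite.of_restrictScalars_finite S _ _
  have hart : IsArtinian (S ⧸ I) L := inferInstance
  have : RingHomSurjective (Ideal.Quotient.mk I) := ⟨Ideal.Quotient.mk_surjective⟩
  let f : L →ₛₗ[Ideal.Quotient.mk I] L :=
    { toFun := id, map_add' := fun _ _ => rfl, map_smul' := fun _ _ => rfl }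
  exact (LinearMap.isArtinian_iff_of_bijective f Function.bijective_id).2 hart

end Artin

section Cut

variable {Q : Type u} [CommRing Q] [IsLocalRing Q] {σ : Type} [Fintype σ]

variable (Q) in
/-- The ideal generated by the maximal ideal of the coefficients and the variables in `J`. -/
def cutI (J : Set σ) : Ideal (MvPolynomial σ Q) where
  carrier := {p | ∀ μ, (∀ l ∈ J, μ l = 0) → coeff μ p ∈ IsLocalRing.maximalIdeal Q}
  zero_mem' := by intro μ _; simp
  add_mem' := by
    intro p q hp hq μ hμ
    rw [coeff_add]
    exact add_mem (hp μ hμ) (hq μ hμ)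
  smul_mem' := by
    classical
    intro c p hp μ hμ
    rw [smul_eq_mul, coeff_mul]
    refine Ideal.sum_mem _ fun x hx => Ideal.mul_mem_left _ _ (hp _ fun l hl => ?_)
    have := Finsupp.ext_iff.1 (Finset.HasAntidiagonal.mem_antidiagonal.1 hx) l
    rw [hμ l hl, Finsupp.add_apply] at this
    omega

lemma mem_cutI {J : Set σ} {p : MvPolynomial σ Q} : p ∈ cutI Q J ↔
    ∀ μ, (∀ l ∈ J, μ l = 0) → coeff μ p ∈ IsLocalRing.maximalIdeal Q := Iff.rfl

lemma C_mem_cutI (J : Set σ) {y : Q} (hy : y ∈ IsLocalRing.maximalIdeal Q) : C y ∈ cutI Q J := by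
  classical
  intro μ _
  rw [coeff_C]
  split_ifs
  · exact hy
  · exact zero_mem _

variable {n : Type} [Fintype n]

/-- The part of a vector of polynomials of degree at least `i`. -/
def trunc (deg : n → ℕ) (i : ℕ) (v : n → MvPolynomial σ Q) : n → MvPolynomial σ Q := fun x =>
  ∑ μ ∈ (v x).support with i ≤ deg x + 2 * μ.degree, monomial μ (coeff μ (v x))

lemma coeff_trunc (deg : n → ℕ) (i : ℕ) (v : n → MvPolynomial σ Q) (x : n) (μ : σ →₀ ℕ) :
    coeff μ (trunc deg i v x) = if i ≤ deg x + 2 * μ.degree then coeff μ (v x) else 0 := by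
  classical
  rw [trunc, coeff_sum]
  simp only [coeff_monomial]
  rw [Finset.sum_ite_eq']
  by_cases h : coeff μ (v x) = 0 <;> simp [h]

/-- The vectors all of whose terms have degree at least `i`. -/
def geDeg (Q : Type u) [CommRing Q] {σ : Type} [Fintype σ] (deg : n → ℕ) (i : ℕ) :
    Submodule (MvPolynomial σ Q) (n → MvPolynomial σ Q) where
  carrier := {v | ∀ x μ, coeff μ (v x) ≠ 0 → i ≤ deg x + 2 * μ.degree}
  zero_mem' := by simp
  add_mem' := by
    intro v w hv hw x μ h
    rw [Pi.add_apply, coeff_add] at h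
    by_cases h0 : coeff μ (v x) = 0
    · exact hw x μ (by rwa [h0, zero_add] at h)
    · exact hv x μ h0
  smul_mem' := by
    classical
    intro c v hv x μ h
    obtain ⟨α, β, rfl, -, h2⟩ := coeff_mul_ne h
    have := hv x β h2
    rw [map_add]
    omega

lemma trunc_mem (deg : n → ℕ) (i : ℕ) (v : n → MvPolynomial σ Q) :
    trunc deg i v ∈ geDeg Q deg i := by
  intro x μ h
  rw [coeff_trunc] at h
  by_contra hc
  exact h (if_neg hc)

lemma coeff_transpose_mulVec_ne {deg : n → ℕ} {A : Matrix n n (MvPolynomial σ Q)}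
    (hA : GrMat deg A) {v : n → MvPolynomial σ Q} {y : n} {μ : σ →₀ ℕ}
    (h : coeff μ (A.transpose.mulVec v y) ≠ 0) :
    ∃ x ν, coeff ν (v x) ≠ 0 ∧ deg y + 2 * μ.degree = deg x + 2 * ν.degree + 1 := by
  classical
  rw [Matrix.mulVec, dotProduct, coeff_sum] at h
  obtain ⟨x, -, hx⟩ := Finset.exists_ne_zero_of_sum_ne_zero h
  obtain ⟨α, β, rfl, h1, h2⟩ := coeff_mul_ne hx
  refine ⟨x, β, h2, ?_⟩
  have := hA _ _ _ h1
  rw [map_add]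
  omega

lemma trunc_cycle {deg : n → ℕ} {A : Matrix n n (MvPolynomial σ Q)} (hA : GrMat deg A) {J : Set σ}
    {v : n → MvPolynomial σ Q} (hv : ∀ y, A.transpose.mulVec v y ∈ cutI Q J) (i : ℕ) (y : n) :
    A.transpose.mulVec (trunc deg i v) y ∈ cutI Q J := by
  intro μ hμ
  by_cases h1 : coeff μ (A.transpose.mulVec (trunc deg i v) y) = 0
  · rw [h1]; exact zero_mem _
  · have h2 : coeff μ (A.transpose.mulVec (v - trunc deg i v) y) = 0 := by
      by_contra h3
      obtain ⟨x, ν, h4, h5⟩ := coeff_transpose_mulVec_ne hA h1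
      obtain ⟨x', ν', h6, h7⟩ := coeff_transpose_mulVec_ne hA h3
      have := trunc_mem deg i v x ν h4
      rw [Pi.sub_apply, coeff_sub, coeff_trunc] at h6
      split_ifs at h6 with h8
      · exact h6 (sub_self _)
      · omega
    rw [Matrix.mulVec_sub, Pi.sub_apply, coeff_sub, sub_eq_zero] at h2
    rw [← h2]
    exact hv y μ hμ

variable [IsNoetherianRing Q] [DecidableEq n]

/-- The cycles modulo the ideal `cutI`. -/
def cycI {Q : Type u} [CommRing Q] [IsLocalRing Q] {σ : Type} [Fintype σ] (A : Matrix n n (MvPolynomial σ Q))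
    (J : Set σ) : Submodule (MvPolynomial σ Q) (n → MvPolynomial σ Q) :=
  (Submodule.pi Set.univ fun _ => cutI Q J).comap A.transpose.mulVecLin

lemma mem_cycI {A : Matrix n n (MvPolynomial σ Q)} {J : Set σ} {v : n → MvPolynomial σ Q} :
    v ∈ cycI A J ↔ ∀ y, A.transpose.mulVec v y ∈ cutI Q J := by
  rw [cycI, Submodule.mem_comap, Submodule.mem_pi]
  simp only [Set.mem_univ, forall_true_left, Matrix.mulVecLin_apply]

/-- The boundaries modulo the ideal `cutI`. -/
def bdI {Q : Type u} [CommRing Q] [IsLocalRing Q] {σ : Type} [Fintype σ] (A : Matrix n n (MvPolynomial σ Q))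
    (J : Set σ) : Submodule (MvPolynomial σ Q) (n → MvPolynomial σ Q) :=
  LinearMap.range A.transpose.mulVecLin ⊔ Submodule.pi Set.univ fun _ => cutI Q J

lemma exists_cycle_degree {deg : n → ℕ} {A : Matrix n n (MvPolynomial σ Q)} {J : Set σ}
    (hp : ∀ p : Ideal (MvPolynomial σ Q), p.IsPrime → ¬p.IsMaximal → cutI Q J ≤ p →
      ∃ s ∉ p, ∀ v : n → MvPolynomial σ Q, (∀ y, A.transpose.mulVec v y ∈ cutI Q J) →
        ∃ w, ∀ i, (s • v - A.transpose.mulVec w) i ∈ cutI Q J) :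
    ∃ i₀, ∀ i ≥ i₀, cycI A J ⊓ geDeg Q deg i ≤ bdI A J ⊔ geDeg Q deg (i + 1) := by
  let L := (cycI A J).map (bdI A J).mkQ
  have hL : IsArtinian (MvPolynomial σ Q) L := by
    refine isArtinian_of_primes fun p hpp hpm => ?_
    have key : ∀ s : MvPolynomial σ Q, (∀ v ∈ cycI A J, s • v ∈ bdI A J) → ∀ x : L, s • x = 0 := by
      rintro s hs ⟨_, v, hv, rfl⟩
      refine Subtype.ext ?_
      show s • (bdI A J).mkQ v = 0
      rw [← map_smul, ← LinearMap.mem_ker, Submodule.ker_mkQ]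
      exact hs v hv
    by_cases hle : cutI Q J ≤ p
    · obtain ⟨s, hs, h⟩ := hp p hpp hpm hle
      refine ⟨s, hs, key s fun v hv => ?_⟩
      obtain ⟨w, hw⟩ := h v (mem_cycI.1 hv)
      rw [← add_sub_cancel (A.transpose.mulVec w) (s • v)]
      exact add_mem (Submodule.mem_sup_left ⟨w, rfl⟩)
        (Submodule.mem_sup_right (by simpa [Submodule.mem_pi] using hw))
    · obtain ⟨s, hs, hsp⟩ := SetLike.not_le_iff_exists.1 hle
      refine ⟨s, hsp, key s fun v _ => Submodule.mem_sup_right ?_⟩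
      rw [Submodule.mem_pi]
      exact fun i _ => Ideal.mul_mem_right _ _ hs
  let f : ℕ →o (Submodule (MvPolynomial σ Q) L)ᵒᵈ :=
    ⟨fun i => OrderDual.toDual
      (((cycI A J ⊓ geDeg Q deg i).map (bdI A J).mkQ).comap L.subtype), fun i j hij =>
      Submodule.comap_mono (Submodule.map_mono (inf_le_inf_left _ fun v hv x μ h =>
        hij.trans (hv x μ h)))⟩
  obtain ⟨i₀, hi₀⟩ := IsArtinian.monotone_stabilizes f
  refine ⟨i₀, fun i hi v hv => ?_⟩
  have h1 : f i = f (i + 1) := (hi₀ i hi).symm.trans (hi₀ (i + 1) (by omega))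
  have h2 : (⟨(bdI A J).mkQ v, v, hv.1, rfl⟩ : L) ∈ OrderDual.ofDual (f i) := ⟨v, hv, rfl⟩
  rw [h1] at h2
  obtain ⟨w, hw, hwv⟩ := h2
  have h3 : v - w ∈ bdI A J := by
    rw [← Submodule.ker_mkQ (bdI A J), LinearMap.mem_ker, map_sub, sub_eq_zero]
    exact hwv.symm
  rw [← sub_add_cancel v w]
  exact add_mem (Submodule.mem_sup_left h3) (Submodule.mem_sup_right hw.2)

end Cut

section Residue

variable {Q : Type u} [CommRing Q] [IsLocalRing Q]

lemma exists_extend_residue {U K : Type u} [AddCommGroup U] [Module Q U] [AddCommGroup K]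
    [Module Q K] (hU : ∀ y ∈ IsLocalRing.maximalIdeal Q, ∀ x : U, y • x = 0)
    (U' : Submodule Q U) (g : U' →ₗ[Q] K) : ∃ W : U →ₗ[Q] K, W ∘ₗ U'.subtype = g := by
  let _ : Module (Q ⧸ IsLocalRing.maximalIdeal Q) U :=
    Module.IsTorsionBySet.module (I := IsLocalRing.maximalIdeal Q) fun x a => hU a.1 a.2 x
  let _ : Field (Q ⧸ IsLocalRing.maximalIdeal Q) := Ideal.Quotient.field _
  have : RingHomSurjective (Ideal.Quotient.mk (IsLocalRing.maximalIdeal Q)) :=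
    ⟨Ideal.Quotient.mk_surjective⟩
  let f : U →ₛₗ[Ideal.Quotient.mk (IsLocalRing.maximalIdeal Q)] U :=
    { toFun := id, map_add' := fun _ _ => rfl, map_smul' := fun _ _ => rfl }
  let e := Submodule.orderIsoMapComapOfBijective f Function.bijective_id
  have : ComplementedLattice (Submodule Q U) := e.symm.complementedLattice
  obtain ⟨V, hV⟩ := ComplementedLattice.exists_isCompl U'
  refine ⟨LinearMap.ofIsCompl hV g 0, LinearMap.ext fun x => ?_⟩
  simp

variable {σ : Type} [Fintype σ] {n : Type} [Fintype n] [DecidableEq n] [IsNoetherianRing Q]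

lemma acyc_residue {deg : n → ℕ} {A : Matrix n n (MvPolynomial σ Q)} {J : Set σ} {i : ℕ}
    (hA : GrMat deg A)
    (h : cycI A J ⊓ geDeg Q deg i ≤ bdI A J ⊔ geDeg Q deg (i + 1)) :
    Acyc 1 deg A J (IsLocalRing.ResidueField Q) i := by
  classical
  rw [acyc_one]
  intro z hz hz0
  let Z : (n → MvPolynomial σ Q) →ₗ[Q] IsLocalRing.ResidueField Q :=
    ∑ y, (z y) ∘ₗ LinearMap.proj y
  have hZ : ∀ v, Z v = ∑ y, z y (v y) := fun v => by simp [Z]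
  have hk : ∀ y ∈ IsLocalRing.maximalIdeal Q, ∀ x : IsLocalRing.ResidueField Q, y • x = 0 := by
    intro y hy x
    rw [Algebra.smul_def, IsLocalRing.ResidueField.algebraMap_eq,
      (IsLocalRing.residue_eq_zero_iff y).2 hy, zero_mul]
  have hZA : ∀ w, Z (A.transpose.mulVec w) = 0 := by
    intro w
    have : ∑ x, dT A z x (w x) = 0 := by rw [hz0]; simp
    rw [← this, hZ]
    simp only [dT_apply, Matrix.mulVec, dotProduct, Matrix.transpose_apply, map_sum]
    exact Finset.sum_comm
  have hZI : ∀ v : n → MvPolynomial σ Q, (∀ y, v y ∈ cutI Q J) → Z v = 0 := by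
    intro v hv
    rw [hZ]
    refine Finset.sum_eq_zero fun y _ => ?_
    rw [apply_eq_sum]
    refine Finset.sum_eq_zero fun ν _ => ?_
    by_cases h0 : z y (monomial ν 1) = 0
    · rw [h0, smul_zero]
    · exact hk _ (hv y ν (hz y ν h0).2) _
  have hZd : ∀ v : n → MvPolynomial σ Q,
      (∀ x μ, coeff μ (v x) ≠ 0 → deg x + 2 * μ.degree ≠ i) → Z v = 0 := by
    intro v hv
    rw [hZ]
    refine Finset.sum_eq_zero fun y _ => ?_
    rw [apply_eq_sum]
    refine Finset.sum_eq_zero fun ν hν => ?_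
    by_cases h0 : z y (monomial ν 1) = 0
    · rw [h0, smul_zero]
    · exact absurd (hz y ν h0).1 (hv y ν (mem_support_iff.1 hν))
  have hZc : ∀ v ∈ cycI A J, Z v = 0 := by
    intro v hv
    have h1 : trunc deg i v ∈ cycI A J ⊓ geDeg Q deg i :=
      ⟨mem_cycI.2 (trunc_cycle hA (mem_cycI.1 hv) i), trunc_mem deg i v⟩
    obtain ⟨b, hb, c, hc, hbc⟩ := Submodule.mem_sup.1 (h h1)
    obtain ⟨_, ⟨w, rfl⟩, a, ha, rfl⟩ := Submodule.mem_sup.1 hb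
    have h2 : Z (v - trunc deg i v) = 0 := hZd _ fun x μ hx hd => hx (by
      rw [Pi.sub_apply, coeff_sub, coeff_trunc, if_pos hd.ge, sub_self])
    rw [map_sub, sub_eq_zero] at h2
    rw [h2, ← hbc, map_add, map_add, hZI a (by simpa [Submodule.mem_pi] using ha),
      hZd c fun x μ hx hd => by have := hc x μ hx; omega]
    rw [add_zero, add_zero]
    exact hZA w
  let P : Submodule Q (n → MvPolynomial σ Q) :=
    (Submodule.pi Set.univ fun _ => cutI Q J).restrictScalars Q
  have hP : ∀ v, v ∈ P ↔ ∀ y, v y ∈ cutI Q J := fun v => by simp [P, Submodule.mem_pi]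
  let T : (n → MvPolynomial σ Q) →ₗ[Q] (n → MvPolynomial σ Q) ⧸ P :=
    P.mkQ ∘ₗ (A.transpose.mulVecLin.restrictScalars Q)
  have hT : ∀ v, T v = 0 ↔ v ∈ cycI A J := by
    intro v
    rw [mem_cycI]
    show P.mkQ (A.transpose.mulVec v) = 0 ↔ _
    rw [← LinearMap.mem_ker, Submodule.ker_mkQ, hP]
  obtain ⟨W, hW⟩ := exists_extend_residue (K := IsLocalRing.ResidueField Q)
    (U := (n → MvPolynomial σ Q) ⧸ P) (by
      intro y hy x
      obtain ⟨v, rfl⟩ := P.mkQ_surjective x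
      rw [← map_smul, ← LinearMap.mem_ker, Submodule.ker_mkQ, hP]
      intro x
      rw [Pi.smul_apply, smul_eq_C_mul]
      exact Ideal.mul_mem_right _ _ (C_mem_cutI J hy))
    (LinearMap.range T)
    (((LinearMap.ker T).liftQ Z fun v hv => hZc v ((hT v).1 hv)) ∘ₗ
      T.quotKerEquivRange.symm.toLinearMap)
  have hWT : ∀ v, W (T v) = Z v := by
    intro v
    have := LinearMap.congr_fun hW (⟨T v, v, rfl⟩ : LinearMap.range T)
    refine this.trans ?_
    have h3 : T.quotKerEquivRange.symm ⟨T v, v, rfl⟩ = Submodule.Quotient.mk v := by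
      rw [LinearEquiv.symm_apply_eq]; rfl
    show (LinearMap.ker T).liftQ Z (fun v hv => hZc v ((hT v).1 hv)) (T.quotKerEquivRange.symm ⟨T v, v, rfl⟩) = Z v
    rw [h3]
    rfl
  let w : TC Q σ n (IsLocalRing.ResidueField Q) := fun x =>
    W ∘ₗ P.mkQ ∘ₗ LinearMap.single Q (fun _ => MvPolynomial σ Q) x
  have hw : ∀ x s, w x s = W (P.mkQ (Pi.single x s)) := fun _ _ => rfl
  have hdw : dT A w = z := by
    funext y
    refine LinearMap.ext fun s => ?_
    have h4 : Z (Pi.single y s) = z y s := by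
      rw [hZ, Finset.sum_eq_single y]
      · simp
      · intro x _ hx; simp [hx]
      · simp
    rw [← h4, ← hWT]
    show _ = W (P.mkQ (A.transpose.mulVec (Pi.single y s)))
    rw [dT_apply]
    simp only [hw]
    rw [← map_sum, ← map_sum]
    congr 2
    funext x
    rw [Finset.sum_apply, Finset.sum_eq_single x]
    · simp [mul_comm]
    · intro b _ hb; simp [hb.symm]
    · simp
  refine ⟨TC.mk fun x μ => if deg x + 2 * μ.degree = i + 1 then w x (monomial μ 1) else 0,
    fun x μ hx => ?_, TC.ext_mono fun y μ => ?_⟩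
  · rw [TC.mk_mono] at hx
    split_ifs at hx with h5
    · refine ⟨h5, ?_⟩
      by_contra h6
      push Not at h6
      obtain ⟨l, hl, hl0⟩ := h6
      apply hx
      rw [hw]
      have : (Pi.single x (monomial μ 1) : n → MvPolynomial σ Q) ∈ P := by
        rw [hP]
        intro y ν hν
        by_cases hxy : y = x
        · subst hxy
          rw [Pi.single_eq_same, coeff_monomial, if_neg]
          · exact zero_mem _
          · rintro rfl; exact hl0 (hν l hl)
        · rw [Pi.single_eq_of_ne hxy, coeff_zero]; exact zero_mem _
      rw [show P.mkQ _ = 0 from by rwa [← LinearMap.mem_ker, Submodule.ker_mkQ], map_zero]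
    · exact absurd rfl hx
  · by_cases h7 : deg y + 2 * μ.degree = i
    · rw [← hdw, dT_apply, dT_apply]
      refine Finset.sum_congr rfl fun x _ => ?_
      rw [apply_mul_mono, apply_mul_mono]
      refine Finset.sum_congr rfl fun ν hν => ?_
      have := hA _ _ _ (mem_support_iff.1 hν)
      rw [TC.mk_mono, if_pos]
      rw [map_add]; omega
    · rw [show z y (monomial μ 1) = 0 from by
        by_contra h8; exact h7 (hz y μ h8).1]
      rw [dT_apply]
      refine Finset.sum_eq_zero fun x _ => ?_
      rw [apply_mul_mono]
      refine Finset.sum_eq_zero fun ν hν => ?_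
      have := hA _ _ _ (mem_support_iff.1 hν)
      rw [TC.mk_mono, if_neg, smul_zero]
      rw [map_add]; omega

end Residue

open MvPolynomial

section Lift

variable {Q : Type u} [CommRing Q] [IsNoetherianRing Q] {σ ι : Type} [Fintype ι] [Fintype σ]
  [DecidableEq ι] {deg : ι → ℕ} {A : Matrix ι ι (MvPolynomial σ Q)} {J : Set σ} {i : ℕ}

instance isNoetherian_TD {X : Type u} [AddCommGroup X] [Module Q X] [Module.Finite Q X] :
    IsNoetherian Q (TD deg J i : Submodule Q (TC Q σ ι X)) := by
  have : Finite {μ : σ →₀ ℕ | μ.degree ≤ i} := (Finsupp.finite_of_degree_le i).to_subtype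
  let g : (TD deg J i : Submodule Q (TC Q σ ι X)) →ₗ[Q] (ι × {μ : σ →₀ ℕ | μ.degree ≤ i} → X) :=
    { toFun := fun z p => z.1 p.1 (monomial p.2.1 1)
      map_add' := fun _ _ => rfl
      map_smul' := fun _ _ => rfl }
  refine isNoetherian_of_injective g (LinearMap.ker_eq_bot.1 ?_)
  rw [Submodule.eq_bot_iff]
  intro z hz
  refine Subtype.ext (TC.ext_mono fun x μ => ?_)
  by_contra h
  have := (z.2 x μ h).1
  exact h (congrFun (LinearMap.mem_ker.1 hz) (x, ⟨μ, by show μ.degree ≤ i; omega⟩))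

lemma Acyc.of_smulRegular {X Y : Type u} [AddCommGroup X] [Module Q X] [Module.Finite Q X]
    [AddCommGroup Y] [Module Q Y] (hgr : GrMat deg A)
    (h0 : ∀ z : TC Q σ ι X, dT A (dT A z) = 0) {x : Q} (hxJ : x ∈ (⊥ : Ideal Q).jacobson)
    (hx : IsSMulRegular X x) {q : X →ₗ[Q] Y} (hq : Function.Surjective q)
    (hk : Function.Exact (LinearMap.lsmul Q X x) q)
    (h : Acyc 1 deg A J Y i) : Acyc 1 deg A J X i := by
  rw [acyc_one] at h ⊢
  let C : Submodule Q (TC Q σ ι X) := TD deg J i ⊓ LinearMap.ker (dT A)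
  have hC : C.FG := by
    have h1 := (isNoetherian_submodule.1 (inferInstance :
      IsNoetherian Q (TD deg J i : Submodule Q (TC Q σ ι X))))
    exact h1 C inf_le_left
  have key : C ≤ Bd deg A J i ⊔ Ideal.span {x} • C := by
    rintro z ⟨hz, hz0⟩
    obtain ⟨w, hw, hwz⟩ := h (mapT q z) (mapT_mem _ hz) (by
      rw [dT_mapT, LinearMap.mem_ker.1 hz0, map_zero])
    obtain ⟨w', hw', rfl⟩ := exists_mapT_eq_of_surjective hq hw
    have hd := dT_mem hgr hw'
    obtain ⟨z', hz', e⟩ := exists_mapT_eq_of_exact hk (z := z - dT A w') (sub_mem hz hd) (by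
      rw [map_sub, ← dT_mapT, hwz, sub_self])
    have h3 : dT A z' = 0 := by
      refine mapT_injective (g := LinearMap.lsmul Q X x) hx ?_
      rw [← dT_mapT, e, map_sub, LinearMap.mem_ker.1 hz0, h0, sub_zero, map_zero]
    have h4 : z = dT A w' + x • z' := by
      have : mapT (LinearMap.lsmul Q X x) z' = x • z' := by
        funext a; exact LinearMap.ext fun s => rfl
      rw [← this, e]; abel
    rw [h4]
    exact add_mem (Submodule.mem_sup_left ⟨w', hw', rfl⟩) (Submodule.mem_sup_right
      (Submodule.smul_mem_smul (Ideal.mem_span_singleton_self x) ⟨hz', h3⟩))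
  have := Submodule.le_of_le_smul_of_le_jacobson_bot hC
    ((Ideal.span_singleton_le_iff_mem _).2 hxJ) key
  exact fun z hz hz0 => this ⟨hz, hz0⟩

open scoped Pointwise in
lemma Acyc.of_quotient (hgr : GrMat deg A) (hA : A * A = 0) : ∀ (rs : List Q) {X : Type u}
    [AddCommGroup X] [Module Q X] [Module.Finite Q X] (_ : ∀ x ∈ rs, x ∈ (⊥ : Ideal Q).jacobson)
    (_ : RingTheory.Sequence.IsWeaklyRegular X rs)
    (_ : Acyc 1 deg A J (X ⧸ (Ideal.ofList rs • ⊤ : Submodule Q X)) i), Acyc 1 deg A J X i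
  | [], X, _, _, _, _, _, h => by
    refine h.of_equiv ((Submodule.quotEquivOfEqBot _ ?_))
    simp
  | x :: rs, X, _, _, _, hJ, hr, h => by
    rw [RingTheory.Sequence.isWeaklyRegular_cons_iff] at hr
    have h1 : Acyc 1 deg A J (QuotSMulTop x X) i :=
      Acyc.of_quotient hgr hA rs (fun y hy => hJ y (List.mem_cons_of_mem _ hy)) hr.2
        (h.of_equiv (Submodule.quotOfListConsSMulTopEquivQuotSMulTopInner X x rs))
    refine h1.of_smulRegular hgr (fun z => ?_) (hJ x List.mem_cons_self) hr.1
      (q := (x • (⊤ : Submodule Q X)).mkQ) (Submodule.mkQ_surjective _) ?_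
    · rw [dT_dT, hA]
      funext a
      refine LinearMap.ext fun s => ?_
      rw [dT_apply]
      simp
    · intro y
      rw [← LinearMap.mem_ker, Submodule.ker_mkQ, Submodule.mem_smul_pointwise_iff_exists]
      simp

end Lift

section Sign
open scoped Kronecker

variable {A B : Type*} [CommRing A] [CommRing B] {m n : Type} [Fintype m] [Fintype n]
  [DecidableEq m] [DecidableEq n]

/-- The parity operator. -/
def eps (A : Type*) [CommRing A] (deg : m → ℕ) : Matrix m m A :=
  Matrix.diagonal fun x => (-1) ^ deg x

lemma eps_sq (deg : m → ℕ) : eps A deg * eps A deg = 1 := by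
  rw [eps, Matrix.diagonal_mul_diagonal, ← Matrix.diagonal_one]
  congr 1
  funext x
  rw [← mul_pow, neg_one_mul, neg_neg, one_pow]

lemma eps_map (θ : A →+* B) (deg : m → ℕ) : (eps A deg).map θ = eps B deg := by
  rw [eps, Matrix.diagonal_map (map_zero θ)]
  simp [eps]

lemma homD_map (θ : A →+* B) (ε a : Matrix m m A) (δ b : Matrix n n A) :
    (homD ε a δ b).map θ = homD (ε.map θ) (a.map θ) (δ.map θ) (b.map θ) := by
  ext ⟨i, j⟩ ⟨k, l⟩
  simp [homD, Matrix.kroneckerMap_apply, Matrix.one_apply, Matrix.mul_apply, apply_ite θ]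

lemma tenD_map (θ : A →+* B) (ε a : Matrix m m A) (δ b : Matrix n n A) :
    (tenD ε a δ b).map θ = tenD (ε.map θ) (a.map θ) (δ.map θ) (b.map θ) := by
  ext ⟨i, j⟩ ⟨k, l⟩
  simp [tenD, Matrix.kroneckerMap_apply, Matrix.one_apply, Matrix.mul_apply, apply_ite θ]

variable {Q : Type u} [CommRing Q] {σ : Type}

lemma eps_anticomm {deg : m → ℕ} {a : Matrix m m (MvPolynomial σ Q)} (ha : GrMat deg a) :
    eps _ deg * a = -(a * eps _ deg) := by
  ext x y : 1
  rw [Matrix.neg_apply, eps, Matrix.diagonal_mul, Matrix.mul_diagonal]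
  by_cases h : a x y = 0
  · simp [h]
  · obtain ⟨μ, hμ⟩ := ne_zero_iff.1 h
    have := ha x y μ hμ
    have h2 : (-1 : MvPolynomial σ Q) ^ deg y = - (-1) ^ deg x := by
      have h3 : (-1 : MvPolynomial σ Q) ^ (deg x + 1) = (-1) ^ deg y := by
        rw [this, pow_add, pow_mul, neg_one_sq, one_pow, mul_one]
      rw [← h3, pow_succ, mul_neg_one]
    rw [h2]; ring

variable {dm : m → ℕ} {dn : n → ℕ} {a : Matrix m m (MvPolynomial σ Q)}
  {b : Matrix n n (MvPolynomial σ Q)}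

variable (dm dn a b) in
/-- The Hom complex of two graded matrices. -/
abbrev homM : Matrix (n × m) (n × m) (MvPolynomial σ Q) := homD (eps _ dm) a (eps _ dn) b

variable (dm dn a b) in
/-- The tensor product of two graded matrices. -/
abbrev tenM : Matrix (n × m) (n × m) (MvPolynomial σ Q) := tenD (eps _ dm) a (eps _ dn) b

lemma tenM_gr (ha : GrMat dm a) (hb : GrMat dn b) :
    GrMat (fun x : n × m => dn x.1 + dm x.2) (tenM dm dn a b) := by
  rintro ⟨i, j⟩ ⟨k, l⟩ μ h
  show dn i + dm j + 1 = dn k + dm l + _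
  rw [tenM, tenD, Matrix.add_apply, coeff_add] at h
  have : coeff μ ((b ⊗ₖ (1 : Matrix m m (MvPolynomial σ Q))) (i, j) (k, l)) ≠ 0 ∨
      coeff μ ((eps (MvPolynomial σ Q) dn ⊗ₖ (eps _ dm * a)) (i, j) (k, l)) ≠ 0 := by
    by_contra hc
    push Not at hc
    exact h (by rw [hc.1, hc.2, add_zero])
  rcases this with h1 | h1
  · rw [Matrix.kroneckerMap_apply, Matrix.one_apply] at h1
    split_ifs at h1 with hjl
    · subst hjl
      rw [mul_one] at h1
      have := hb i k μ h1
      show dn i + dm j + 1 = dn k + dm j + _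
      omega
    · simp at h1
  · rw [Matrix.kroneckerMap_apply, eps, Matrix.diagonal_apply, eps, Matrix.diagonal_mul] at h1
    split_ifs at h1 with hik
    · subst hik
      have h2 : coeff μ (a j l) ≠ 0 := by
        intro h3
        apply h1
        rw [← mul_assoc, ← pow_add]
        rcases neg_one_pow_eq_or (MvPolynomial σ Q) (dn i + dm j) with h4 | h4
        · rw [h4, one_mul, h3]
        · rw [h4, neg_one_mul, coeff_neg, h3, neg_zero]
      have := ha j l μ h2
      show dn i + dm j + 1 = dn i + dm l + _
      omega
    · simp at h1

lemma homM_sq {w : MvPolynomial σ Q} (ha : GrMat dm a) (hb : GrMat dn b) (ha2 : a * a = w • 1)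
    (hb2 : b * b = w • 1) : homM dm dn a b * homM dm dn a b = 0 :=
  homD_sq (eps_sq _) (eps_anticomm ha) ha2 (eps_sq _) (eps_anticomm hb) hb2

lemma tenM_sq {w : MvPolynomial σ Q} (ha : GrMat dm a) (hb : GrMat dn b) (ha2 : a * a = w • 1)
    (hb2 : b * b = w • 1) : tenM dm dn a b * tenM dm dn a b = 0 :=
  tenD_sq (eps_sq _) (eps_anticomm ha) ha2 (eps_sq _) (eps_anticomm hb) hb2

end Sign

section Tensor

variable {Q : Type u} [CommRing Q] [IsLocalRing Q] [IsNoetherianRing Q] {σ : Type} [Fintype σ]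
  {m n : Type} [Fintype m] [Fintype n] [DecidableEq m] [DecidableEq n]
  {dm : m → ℕ} {dn : n → ℕ} {a : Matrix m m (MvPolynomial σ Q)}
  {b : Matrix n n (MvPolynomial σ Q)}

theorem tenM_acyc {w : MvPolynomial σ Q} (ha : GrMat dm a) (hb : GrMat dn b) (ha2 : a * a = w • 1)
    (hb2 : b * b = w • 1) {J : Set σ} (hw : w ∈ cutI Q J) {rs : List Q}
    (hr : RingTheory.Sequence.IsWeaklyRegular Q rs)
    (hrm : Ideal.ofList rs = IsLocalRing.maximalIdeal Q)
    (hp : ∀ p : Ideal (MvPolynomial σ Q), p.IsPrime → ¬p.IsMaximal → cutI Q J ≤ p →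
      ∃ s ∉ p, Kills (homM dm dn a b) s (MvPolynomial σ Q)) :
    ∃ i₀, ∀ i ≥ i₀, Acyc 1 (fun x : n × m => dn x.1 + dm x.2) (tenM dm dn a b) J Q i := by
  have hT := tenM_sq ha hb ha2 hb2
  obtain ⟨i₀, h⟩ := exists_cycle_degree (J := J) (deg := fun x : n × m => dn x.1 + dm x.2)
    (A := tenM dm dn a b) (by
    intro p hpp hpm hJp
    obtain ⟨s, hs, hk⟩ := hp p hpp hpm hJp
    let θ : MvPolynomial σ Q →+* FractionRing (MvPolynomial σ Q ⧸ p) :=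
      algebraMap (MvPolynomial σ Q) (FractionRing (MvPolynomial σ Q ⧸ p))
    have hθ : ∀ q, θ q = 0 ↔ q ∈ p := by
      intro q
      rw [show θ q = algebraMap (MvPolynomial σ Q ⧸ p) (FractionRing (MvPolynomial σ Q ⧸ p))
        (Ideal.Quotient.mk p q) from rfl]
      rw [← Ideal.Quotient.eq_zero_iff_mem]
      exact map_eq_zero_iff _ (IsFractionRing.injective _ _)
    have hsq : ∀ {k : Type} [Fintype k] [DecidableEq k] {c : Matrix k k (MvPolynomial σ Q)},
        c * c = w • 1 → c.map θ * c.map θ = 0 := by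
      intro k _ _ c hc
      rw [← Matrix.map_mul, hc]
      ext i j
      rw [Matrix.map_apply, Matrix.smul_apply, smul_eq_mul, map_mul, (hθ w).2 (hJp hw), zero_mul,
        Matrix.zero_apply]
    have hanti : ∀ {k : Type} [Fintype k] [DecidableEq k] {c : Matrix k k (MvPolynomial σ Q)}
        {dk : k → ℕ}, GrMat dk c → eps _ dk * c.map θ = -(c.map θ * eps _ dk) := by
      intro k _ _ c dk hc
      rw [← eps_map θ, ← Matrix.map_mul, ← Matrix.map_mul, eps_anticomm hc, Matrix.map_neg]
      exact map_neg θ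
    obtain ⟨k, hk⟩ := exists_kills_field (homM_sq ha hb ha2 hb2) hk hr hrm θ
      fun y hy => (hθ _).2 (hJp (C_mem_cutI J hy))
    rw [homM, homD_map, eps_map, eps_map] at hk
    obtain ⟨H, hH⟩ := exists_tenD_contract (eps_sq dm) (hanti ha) (hsq ha2) (eps_sq dn) (hanti hb)
      (hsq hb2) (by
        intro v hv
        obtain ⟨u, hu⟩ := hk v hv
        refine ⟨(θ s ^ k)⁻¹ • u, ?_⟩
        rw [Matrix.mulVec_smul, ← hu, smul_smul, inv_mul_cancel₀, one_smul]
        exact pow_ne_zero _ fun h0 => hs ((hθ s).1 h0))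
    rw [← eps_map θ, ← eps_map θ, ← tenD_map] at hH
    obtain ⟨t, ht, htk⟩ := exists_notMem_smul (D := (tenM dm dn a b).transpose) (by
      rw [← Matrix.transpose_mul, hT, Matrix.transpose_zero]) p (H := H.transpose) (by
      rw [Matrix.transpose_map, ← Matrix.transpose_mul, ← Matrix.transpose_mul,
        ← Matrix.transpose_add, Matrix.det_transpose, add_comm]
      exact hH)
    exact ⟨t, ht, fun v hv => htk _ v hv⟩)
  refine ⟨i₀, fun i hi => ?_⟩
  have h1 := acyc_residue (tenM_gr ha hb) (h i hi)
  refine Acyc.of_quotient (tenM_gr ha hb) hT rs (fun x hx => ?_) hr (h1.of_equiv ?_)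
  · rw [IsLocalRing.jacobson_eq_maximalIdeal ⊥ bot_ne_top, ← hrm]
    exact Ideal.subset_span hx
  · refine Submodule.quotEquivOfEq _ _ ?_
    rw [hrm]; simp

end Tensor

open MvPolynomial

section Pert

lemma exists_of_perturbation {ι U : Type*} [AddCommGroup U] {deg : ι → ℕ} {L : ℕ}
    (hL : ∀ x, deg x ≤ L) {D del : (ι → U) →+ (ι → U)} {C₀ C₁ : AddSubgroup (ι → U)}
    {P : (ι → U) → Prop}
    (hD : ∀ g z, (∀ x, deg x < g + 1 → z x = 0) → ∀ x, deg x ≤ g → D z x = del z x)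
    (hdel : ∀ g z, (∀ x, deg x < g + 1 → z x = 0) → ∀ x, deg x < g → del z x = 0)
    (hC : ∀ u ∈ C₁, D u ∈ C₀ ∧ D (D u) = 0)
    (hex : ∀ g, ∀ z ∈ C₀, (∀ x, deg x < g → z x = 0) → (∀ x, deg x + 1 = g → del z x = 0) →
      (g = 0 → P z) → ∃ u ∈ C₁, (∀ x, deg x < g + 1 → u x = 0) ∧ ∀ x, deg x = g → del u x = z x)
    {z : ι → U} (hz : z ∈ C₀) (hz0 : D z = 0) (hP : P z) :
    ∃ u ∈ C₁, (∀ x, deg x = 0 → u x = 0) ∧ D u = z := by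
  suffices H : ∀ k g, L + 1 ≤ g + k → ∀ z ∈ C₀, (∀ x, deg x < g → z x = 0) → D z = 0 →
      (g = 0 → P z) → ∃ u ∈ C₁, (∀ x, deg x = 0 → u x = 0) ∧ D u = z from
    H (L + 1) 0 (by omega) z hz (fun x hx => absurd hx (by omega)) hz0 fun _ => hP
  intro k
  induction k with
  | zero =>
    intro g hg z _ hs _ _
    have : z = 0 := funext fun x => hs x (by have := hL x; omega)
    exact ⟨0, zero_mem _, fun _ _ => rfl, by rw [map_zero, this]⟩
  | succ k ih =>
    intro g hg z hz hs h0 hP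
    obtain ⟨u, hu, hus, hud⟩ := hex g z hz hs (fun x hx => by
      subst hx
      rw [← hD (deg x) z hs x le_rfl, h0]; rfl) hP
    obtain ⟨v, hv, hv0, hvd⟩ := ih (g + 1) (by omega) (z - D u) (sub_mem hz (hC u hu).1) (by
      intro x hx
      rw [Pi.sub_apply, hD g u hus x (by omega)]
      rcases Nat.lt_succ_iff_lt_or_eq.1 hx with h | h
      · rw [hs x h, hdel g u hus x h, sub_zero]
      · rw [hud x h, sub_self]) (by rw [map_sub, h0, (hC u hu).2, sub_zero])
      (fun h => absurd h (by omega))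
    refine ⟨u + v, add_mem hu hv, fun x hx => ?_, by rw [map_add, hvd]; abel⟩
    rw [Pi.add_apply, hus x (by omega), hv0 x hx, add_zero]

variable {Q : Type u} [CommRing Q] {N : Type u} [AddCommGroup N] [Module Q N]
  {ι σ : Type} [Fintype ι] [Fintype σ] [DecidableEq ι]

lemma FinRes.exists_section_deg (G : FinRes Q N ι) (g : ℕ) : ∃ κ : (ι → Q) → (ι → Q),
    (∀ v, (∀ x, G.deg x + 1 = g → ∑ y, G.del x y * v y = 0) →
      (g = 0 → ∑ x, v x • G.aug x = 0) → ∀ x, G.deg x = g → ∑ y, G.del x y * κ v y = v x) ∧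
    (∀ v x, κ v x ≠ 0 → G.deg x = g + 1 ∧ ∃ x', G.deg x' = g ∧ v x' ≠ 0) := by
  obtain ⟨κ, h1, h2⟩ := G.exists_section
  refine ⟨fun v => κ (G.proj g v), fun v hv ha x hx => ?_, fun v x hx => ?_⟩
  · refine (congrFun (h1 (G.proj g v) (funext fun x => ?_) ?_) x).trans (by simp [proj, hx])
    · by_cases h : G.deg x + 1 = g
      · rw [Pi.zero_apply, ← hv x h]
        refine Finset.sum_congr rfl fun y _ => ?_
        by_cases h0 : G.del x y = 0
        · simp [h0]
        · simp [proj, G.del_deg x y h0, h]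
      · refine Finset.sum_eq_zero fun y _ => ?_
        by_cases h0 : G.del x y = 0
        · simp [h0]
        · simp [proj, G.del_deg x y h0, h]
    · by_cases h : g = 0
      · exact G.aug_proj g v (ha h)
      · refine Finset.sum_eq_zero fun y _ => ?_
        by_cases h0 : G.aug y = 0
        · simp [h0]
        · simp [proj, G.aug_deg y h0, Ne.symm h]
  · obtain ⟨x', hx', h⟩ := h2 _ x hx
    simp only [proj] at h
    split_ifs at h with h3
    · exact ⟨by omega, x', h3, h⟩
    · exact absurd rfl h

lemma MF.eq_C {f : σ → Q} {G : FinRes Q N ι} (F : MF f G) {x y : ι} (h : G.deg x < G.deg y) :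
    F.A x y = C (G.del x y) := by
  classical
  ext μ
  rw [coeff_C]
  split_ifs with h0
  · rw [← h0, F.zero_coeff]
  · by_contra hc
    have := F.gr x y μ hc
    have h2 : μ.degree ≠ 0 := fun h => h0 ((Finsupp.degree_eq_zero_iff _).1 h).symm
    omega

end Pert

section TensorPert

variable {Q : Type u} [CommRing Q] {σ : Type} [Fintype σ]
  {m n : Type} [Fintype m] [Fintype n] [DecidableEq m] [DecidableEq n]
  {dm : m → ℕ} {dn : n → ℕ} {a : Matrix m m (MvPolynomial σ Q)}
  {b : Matrix n n (MvPolynomial σ Q)} {X : Type u} [AddCommGroup X] [Module Q X]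

lemma dT_tenM (z : TC Q σ (n × m) X) (x : n) (y : m) (s : MvPolynomial σ Q) :
    dT (tenM dm dn a b) z (x, y) s = ∑ x', z (x', y) (b x x' * s) +
      ∑ y', z (x, y') ((-1) ^ dn x * ((-1) ^ dm y * a y y') * s) := by
  rw [dT_apply]
  simp only [tenM, tenD, Matrix.add_apply, Matrix.kroneckerMap_apply, add_mul, map_add,
    Finset.sum_add_distrib]
  congr 1
  · rw [Fintype.sum_prod_type]
    refine Finset.sum_congr rfl fun x' _ => ?_
    rw [Finset.sum_eq_single y]
    · simp
    · intro y' _ h; simp [h.symm]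
    · simp
  · rw [Fintype.sum_prod_type_right]
    refine Finset.sum_congr rfl fun y' _ => ?_
    rw [Finset.sum_eq_single x]
    · simp [eps, Matrix.diagonal_mul]
    · intro x' _ h; simp [eps, h.symm]
    · simp

end TensorPert

section TensorAug

variable {Q : Type u} [CommRing Q] {M : Type u} [AddCommGroup M] [Module Q M] {σ : Type}
  [Fintype σ] {m n : Type} [Fintype m] [Fintype n] [DecidableEq m] [DecidableEq n]
  {f : σ → Q} {G : FinRes Q M n} (F : MF f G)
  {dm : m → ℕ} {a : Matrix m m (MvPolynomial σ Q)} {J : Set σ} {i : ℕ}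

variable (m σ G) in
/-- The augmentation in the first tensor factor. -/
def augT : TC Q σ (n × m) Q →ₗ[Q] TC Q σ m M where
  toFun z y := ∑ x, LinearMap.toSpanSingleton Q M (G.aug x) ∘ₗ z (x, y)
  map_add' z w := by
    funext y
    simp [LinearMap.comp_add, Finset.sum_add_distrib]
  map_smul' c z := by
    funext y
    simp [LinearMap.comp_smul, Finset.smul_sum]

lemma augT_apply (z : TC Q σ (n × m) Q) (y : m) (s : MvPolynomial σ Q) :
    augT σ m G z y s = ∑ x, z (x, y) s • G.aug x := by
  simp [augT]

lemma augT_mem {z : TC Q σ (n × m) Q} (hz : z ∈ TD (fun x : n × m => G.deg x.1 + dm x.2) J i) :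
    augT σ m G z ∈ TD dm J i := by
  intro y μ h
  rw [augT_apply] at h
  obtain ⟨x, _, hx⟩ := Finset.exists_ne_zero_of_sum_ne_zero h
  have h1 := G.aug_deg x (right_ne_zero_of_smul hx)
  have h2 := hz (x, y) μ (left_ne_zero_of_smul hx)
  simp only [h1, zero_add] at h2
  exact h2

include F in
lemma augT_dT (z : TC Q σ (n × m) Q) :
    augT σ m G (dT (tenM dm G.deg a F.A) z) = dT (eps _ dm * a) (augT σ m G z) := by
  funext y
  refine LinearMap.ext fun s => ?_
  rw [augT_apply, dT_apply]
  simp only [dT_tenM, augT_apply, add_smul, Finset.sum_add_distrib]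
  have h1 : ∑ x, (∑ x', z (x', y) (F.A x x' * s)) • G.aug x = 0 := by
    simp only [Finset.sum_smul]
    rw [Finset.sum_comm]
    refine Finset.sum_eq_zero fun x' _ => ?_
    by_cases hx' : G.deg x' = 0
    · refine Finset.sum_eq_zero fun x _ => ?_
      by_cases h : G.aug x = 0
      · rw [h, smul_zero]
      · have : F.A x x' = 0 := by
          ext μ
          by_contra hc
          have := F.gr x x' μ hc
          have := G.aug_deg x h
          omega
        rw [this, zero_mul, map_zero, zero_smul]
    · rw [← smul_zero (z (x', y) s), ← G.aug_del x', Finset.smul_sum]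
      refine Finset.sum_congr rfl fun x _ => ?_
      by_cases h : G.aug x = 0
      · rw [h, smul_zero, smul_zero, smul_zero]
      · rw [F.eq_C (by rw [G.aug_deg x h]; omega), ← smul_eq_C_mul, map_smul, smul_eq_mul,
          smul_smul, mul_comm]
  rw [h1, zero_add]
  simp only [Finset.sum_smul]
  rw [Finset.sum_comm]
  refine Finset.sum_congr rfl fun y' _ => Finset.sum_congr rfl fun x _ => ?_
  by_cases h : G.aug x = 0
  · rw [h, smul_zero, smul_zero]
  · rw [G.aug_deg x h, pow_zero, one_mul, eps, Matrix.diagonal_mul]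

include F in
lemma exists_dT_tenM_eq (ha : GrMat dm a) (ha2 : a * a = pot f • 1) {z : TC Q σ (n × m) Q}
    (hz : z ∈ TD (fun x : n × m => G.deg x.1 + dm x.2) J i)
    (h0 : dT (tenM dm G.deg a F.A) z = 0) (hP : augT σ m G z = 0) :
    ∃ u ∈ TD (fun x : n × m => G.deg x.1 + dm x.2) J (i + 1), augT σ m G u = 0 ∧
      dT (tenM dm G.deg a F.A) u = z := by
  have hgr := tenM_gr (dm := dm) (dn := G.deg) ha F.gr
  have hT := tenM_sq (dm := dm) (dn := G.deg) ha F.gr ha2 F.sq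
  let dF : TC Q σ (n × m) Q →ₗ[Q] TC Q σ (n × m) Q :=
    { toFun := fun z p => ∑ x', G.del p.1 x' • z (x', p.2)
      map_add' := fun z w => by funext p; simp [Finset.sum_add_distrib]
      map_smul' := fun c z => by funext p; simp [Finset.smul_sum, smul_comm c] }
  have hdF : ∀ z x y, dF z (x, y) = ∑ x', G.del x x' • z (x', y) := fun _ _ _ => rfl
  suffices H : ∃ u ∈ (TD (fun x : n × m => G.deg x.1 + dm x.2) J (i + 1)).toAddSubgroup,
      (∀ x : n × m, G.deg x.1 = 0 → u x = 0) ∧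
      (dT (tenM dm G.deg a F.A)).toAddMonoidHom u = z by
    obtain ⟨u, hu, hu0, huz⟩ := H
    refine ⟨u, hu, ?_, huz⟩
    funext y
    refine LinearMap.ext fun s => ?_
    rw [augT_apply]
    refine Finset.sum_eq_zero fun x _ => ?_
    by_cases h : G.aug x = 0
    · rw [h, smul_zero]
    · rw [hu0 (x, y) (G.aug_deg x h), LinearMap.zero_apply, zero_smul]
  refine exists_of_perturbation (deg := fun x : n × m => G.deg x.1)
    (L := Finset.univ.sup G.deg) (fun x => Finset.le_sup (f := G.deg) (Finset.mem_univ x.1))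
    (D := (dT (tenM dm G.deg a F.A)).toAddMonoidHom) (del := dF.toAddMonoidHom)
    (C₀ := (TD (fun x : n × m => G.deg x.1 + dm x.2) J i).toAddSubgroup)
    (C₁ := (TD (fun x : n × m => G.deg x.1 + dm x.2) J (i + 1)).toAddSubgroup)
    (P := fun z => augT σ m G z = 0) ?_ ?_ ?_ ?_ hz h0 hP
  · rintro g z hz ⟨x, y⟩ hx
    change G.deg x ≤ g at hx
    refine LinearMap.ext fun s => ?_
    show dT (tenM dm G.deg a F.A) z (x, y) s = dF z (x, y) s
    rw [dT_tenM, hdF, LinearMap.sum_apply]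
    have h2 : ∀ y', z (x, y') = 0 := fun y' => hz (x, y') (Nat.lt_succ_of_le hx)
    rw [Finset.sum_eq_zero (s := Finset.univ (α := m)) fun y' _ => by
      rw [h2, LinearMap.zero_apply], add_zero]
    refine Finset.sum_congr rfl fun x' _ => ?_
    by_cases h : G.deg x' < g + 1
    · rw [hz (x', y) h]; simp
    · rw [F.eq_C (by omega), ← smul_eq_C_mul, map_smul, LinearMap.smul_apply]
  · rintro g z hz ⟨x, y⟩ hx
    change G.deg x < g at hx
    show dF z (x, y) = 0
    rw [hdF]
    refine Finset.sum_eq_zero fun x' _ => ?_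
    by_cases h : G.del x x' = 0
    · rw [h, zero_smul]
    · rw [hz (x', y) (by show G.deg x' < _; rw [G.del_deg x x' h]; omega), smul_zero]
  · intro u hu
    refine ⟨dT_mem hgr hu, ?_⟩
    show dT _ (dT _ u) = 0
    rw [dT_dT, hT]
    funext a
    refine LinearMap.ext fun s => ?_
    rw [dT_apply]
    simp
  · intro g z hz _ hz1 hP
    obtain ⟨κ, h1, h2⟩ := G.exists_section_deg g
    refine ⟨TC.mk fun p μ => κ (fun x' => z (x', p.2) (monomial μ 1)) p.1, ?_, ?_, ?_⟩
    · rintro ⟨x, y⟩ μ h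
      rw [TC.mk_mono] at h
      obtain ⟨h3, x', h4, h5⟩ := h2 _ _ h
      have h6 := hz (x', y) μ h5
      refine ⟨?_, h6.2⟩
      have := h6.1
      simp only at this h3 ⊢
      omega
    · rintro ⟨x, y⟩ hx
      change G.deg x < _ at hx
      apply (basisMonomials σ Q).ext
      intro μ
      rw [coe_basisMonomials, TC.mk_mono, LinearMap.zero_apply]
      by_contra hc
      have : G.deg x = g + 1 := (h2 _ _ hc).1
      omega
    · rintro ⟨x, y⟩ hx
      apply (basisMonomials σ Q).ext
      intro μ
      rw [coe_basisMonomials]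
      show dF _ (x, y) _ = _
      rw [hdF, LinearMap.sum_apply]
      simp only [LinearMap.smul_apply, TC.mk_mono, smul_eq_mul]
      refine h1 _ (fun x₁ hx₁ => ?_) (fun hg => ?_) x hx
      · have := LinearMap.congr_fun (hz1 (x₁, y) hx₁) (monomial μ 1)
        change dF z (x₁, y) _ = 0 at this
        rw [hdF, LinearMap.sum_apply] at this
        exact this
      · rw [← augT_apply, hP hg]; rfl

include F in
theorem acyc_of_tenM (ha : GrMat dm a) (ha2 : a * a = pot f • 1)
    (h : Acyc 1 (fun x : n × m => G.deg x.1 + dm x.2) (tenM dm G.deg a F.A) J Q i) :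
    Acyc 1 dm a J M i := by
  classical
  rw [acyc_one] at h ⊢
  intro w hw hw0
  have hc : ∀ v : M, ∃ c : n → Q, ∑ x, c x • G.aug x = v ∧ ∀ x, c x ≠ 0 → G.deg x = 0 ∧ v ≠ 0 := by
    intro v
    by_cases hv : v = 0
    · exact ⟨0, by simp [hv], by simp⟩
    obtain ⟨c, rfl⟩ := (Submodule.mem_span_range_iff_exists_fun Q).1
      (G.aug_span ▸ Submodule.mem_top : v ∈ Submodule.span Q (Set.range G.aug))
    refine ⟨fun x => if G.deg x = 0 then c x else 0, Finset.sum_congr rfl fun x _ => ?_,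
      fun x hx => ⟨?_, hv⟩⟩
    · by_cases h : G.aug x = 0
      · simp [h]
      · simp [G.aug_deg x h]
    · by_contra h
      simp [h] at hx
  choose c hc1 hc2 using hc
  let z : TC Q σ (n × m) Q := TC.mk fun p μ => c (w p.2 (monomial μ 1)) p.1
  have hz : z ∈ TD (fun x : n × m => G.deg x.1 + dm x.2) J i := by
    rintro ⟨x, y⟩ μ hx
    rw [TC.mk_mono] at hx
    obtain ⟨h1, h2⟩ := hc2 _ _ hx
    have := hw y μ h2
    simp only [h1, zero_add]
    exact this
  have hzw : augT σ m G z = w := by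
    refine TC.ext_mono fun y μ => ?_
    rw [augT_apply]
    simp only [z, TC.mk_mono]
    exact hc1 _
  have hgr := tenM_gr (dm := dm) (dn := G.deg) ha F.gr
  have hT := tenM_sq (dm := dm) (dn := G.deg) ha F.gr ha2 F.sq
  have hTT : ∀ z : TC Q σ (n × m) Q,
      dT (tenM dm G.deg a F.A) (dT (tenM dm G.deg a F.A) z) = 0 := by
    intro z
    rw [dT_dT, hT]
    funext a
    refine LinearMap.ext fun s => ?_
    rw [dT_apply]
    simp
  obtain ⟨u, hu, hu0, huz⟩ : ∃ u ∈ TD (fun x : n × m => G.deg x.1 + dm x.2) J i,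
      augT σ m G u = 0 ∧ dT (tenM dm G.deg a F.A) u = dT (tenM dm G.deg a F.A) z := by
    cases i with
    | zero => exact ⟨0, zero_mem _, map_zero _, by rw [map_zero, dT_zero_deg hgr hz]⟩
    | succ i =>
      refine exists_dT_tenM_eq F ha ha2 (dT_mem hgr hz) (hTT z) ?_
      rw [augT_dT, hzw, ← dT_dT, hw0, map_zero]
  obtain ⟨v, hv, hvz⟩ := h (z - u) (sub_mem hz hu) (by rw [map_sub, huz, sub_self])
  refine ⟨dT (-eps _ dm) (augT σ m G v), ?_, ?_⟩
  · have h1 := augT_mem hv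
    intro y μ hy
    apply h1 y μ
    intro h2
    apply hy
    rw [dT_apply]
    refine Finset.sum_eq_zero fun y' _ => ?_
    rw [Matrix.neg_apply, eps, Matrix.diagonal_apply]
    split_ifs with hyy
    · subst hyy
      rcases neg_one_pow_eq_or (MvPolynomial σ Q) (dm y) with h4 | h4 <;> simp [h4, h2]
    · simp
  · rw [dT_dT, Matrix.mul_neg, ← eps_anticomm ha, ← augT_dT F, hvz, map_sub, hu0, hzw, sub_zero]

end TensorAug

open MvPolynomial

section HomPert

variable {Q : Type u} [CommRing Q] {σ : Type} [Fintype σ]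
  {m n : Type} [Fintype m] [Fintype n] [DecidableEq m] [DecidableEq n]

lemma homM_mulVec {dm : m → ℕ} {dn : n → ℕ} (a : Matrix m m (MvPolynomial σ Q))
    (b : Matrix n n (MvPolynomial σ Q)) (φ : n × m → MvPolynomial σ Q) (x : n) (y : m) :
    (homM dm dn a b).mulVec φ (x, y) = ∑ y', a y y' * φ (x, y') +
      (-1) ^ dm y * ((-1) ^ dn x * ∑ x', b x' x * φ (x', y)) := by
  rw [Matrix.mulVec, dotProduct]
  simp only [homD, Matrix.add_apply, Matrix.kroneckerMap_apply, add_mul, Finset.sum_add_distrib]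
  congr 1
  · rw [Fintype.sum_prod_type_right]
    refine Finset.sum_congr rfl fun y' _ => ?_
    rw [Finset.sum_eq_single x]
    · simp
    · intro x' _ h; simp [h.symm]
    · simp
  · rw [Fintype.sum_prod_type, Finset.mul_sum, Finset.mul_sum]
    refine Finset.sum_congr rfl fun x' _ => ?_
    rw [Finset.sum_eq_single y]
    · simp only [eps, Matrix.transpose_apply, Matrix.mul_diagonal, Matrix.diagonal_apply_eq]
      ring
    · intro y' _ h; simp [eps, h.symm]
    · simp

variable (Q σ) in
/-- The part of degree `k - p` of the Hom complex. -/
def HB (dm : m → ℕ) (dn : n → ℕ) (p k : ℕ) : Submodule Q (n × m → MvPolynomial σ Q) where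
  carrier := {φ | ∀ x y μ, coeff μ (φ (x, y)) ≠ 0 → dn x + 2 * μ.degree + p = k + dm y}
  zero_mem' := by simp
  add_mem' := by
    intro z w hz hw x y μ h
    by_cases h0 : coeff μ (z (x, y)) = 0
    · exact hw x y μ (by simpa [h0] using h)
    · exact hz x y μ h0
  smul_mem' := by
    intro c z hz x y μ h
    exact hz x y μ (right_ne_zero_of_mul (by simpa using h))

lemma exists_of_coeff_sum_mul {τ : Type} [Fintype τ] {g h : τ → MvPolynomial σ Q} {μ : σ →₀ ℕ}
    (hc : coeff μ (∑ t, g t * h t) ≠ 0) :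
    ∃ t ν ξ, coeff ν (g t) ≠ 0 ∧ coeff ξ (h t) ≠ 0 ∧ μ.degree = ν.degree + ξ.degree := by
  classical
  rw [coeff_sum] at hc
  obtain ⟨t, _, ht⟩ := Finset.exists_ne_zero_of_sum_ne_zero hc
  rw [coeff_mul] at ht
  obtain ⟨⟨ν, ξ⟩, hp, h⟩ := Finset.exists_ne_zero_of_sum_ne_zero ht
  exact ⟨t, ν, ξ, left_ne_zero_of_mul h, right_ne_zero_of_mul h, by
    rw [← Finset.HasAntidiagonal.mem_antidiagonal.1 hp, map_add]⟩

variable {dm : m → ℕ} {dn : n → ℕ} {a : Matrix m m (MvPolynomial σ Q)}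
  {b : Matrix n n (MvPolynomial σ Q)}

lemma homM_mem (ha : GrMat dm a) (hb : GrMat dn b) {p k : ℕ} {φ : n × m → MvPolynomial σ Q}
    (hφ : φ ∈ HB Q σ dm dn (p + 1) k) : (homM dm dn a b).mulVec φ ∈ HB Q σ dm dn p k := by
  intro x y μ h
  rw [homM_mulVec, coeff_add] at h
  by_cases h1 : coeff μ (∑ y', a y y' * φ (x, y')) = 0
  · rw [h1, zero_add] at h
    have h2 : coeff μ (∑ x', b x' x * φ (x', y)) ≠ 0 := by
      intro h3
      apply h
      rcases neg_one_pow_eq_or (MvPolynomial σ Q) (dm y) with h4 | h4 <;>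
      rcases neg_one_pow_eq_or (MvPolynomial σ Q) (dn x) with h5 | h5 <;>
      simp only [h4, h5, one_mul, neg_one_mul, coeff_neg, h3, neg_zero]
    obtain ⟨x', ν, ξ, hν, hξ, e⟩ := exists_of_coeff_sum_mul h2
    have := hb _ _ _ hν
    have := hφ _ _ _ hξ
    omega
  · obtain ⟨y', ν, ξ, hν, hξ, e⟩ := exists_of_coeff_sum_mul h1
    have := ha _ _ _ hν
    have := hφ _ _ _ hξ
    omega

variable {N : Type u} [AddCommGroup N] [Module Q N] {f : σ → Q} {G : FinRes Q N m} (A : MF f G)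

include A in
lemma exists_homM_eq (hb : GrMat dn b) (hb2 : b * b = pot f • 1) {p k : ℕ}
    {z : n × m → MvPolynomial σ Q} (hz : z ∈ HB Q σ G.deg dn p k)
    (h0 : (homM G.deg dn A.A b).mulVec z = 0)
    (hP : ∀ x μ, ∑ y, coeff μ (z (x, y)) • G.aug y = 0) :
    ∃ u ∈ HB Q σ G.deg dn (p + 1) k, (∀ x y, G.deg y = 0 → u (x, y) = 0) ∧
      (homM G.deg dn A.A b).mulVec u = z := by
  have hT := homM_sq (dm := G.deg) (dn := dn) A.gr hb A.sq hb2
  let dF : (n × m → MvPolynomial σ Q) →ₗ[Q] (n × m → MvPolynomial σ Q) :=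
    { toFun := fun z p => ∑ y', C (G.del p.2 y') * z (p.1, y')
      map_add' := fun z w => by funext p; simp [Finset.sum_add_distrib, mul_add]
      map_smul' := fun c z => by funext p; simp [Finset.smul_sum] }
  have hdF : ∀ z x y, dF z (x, y) = ∑ y', C (G.del y y') * z (x, y') := fun _ _ _ => rfl
  suffices H : ∃ u ∈ (HB Q σ G.deg dn (p + 1) k).toAddSubgroup,
      (∀ x : n × m, G.deg x.2 = 0 → u x = 0) ∧
      (homM G.deg dn A.A b).mulVecLin.toAddMonoidHom u = z by
    obtain ⟨u, hu, hu0, huz⟩ := H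
    exact ⟨u, hu, fun x y h => hu0 (x, y) h, huz⟩
  refine exists_of_perturbation (deg := fun x : n × m => G.deg x.2)
    (L := Finset.univ.sup G.deg) (fun x => Finset.le_sup (f := G.deg) (Finset.mem_univ x.2))
    (D := (homM G.deg dn A.A b).mulVecLin.toAddMonoidHom) (del := dF.toAddMonoidHom)
    (C₀ := (HB Q σ G.deg dn p k).toAddSubgroup)
    (C₁ := (HB Q σ G.deg dn (p + 1) k).toAddSubgroup)
    (P := fun z => ∀ x μ, ∑ y, coeff μ (z (x, y)) • G.aug y = 0) ?_ ?_ ?_ ?_ hz h0 hP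
  · rintro g z hz ⟨x, y⟩ hy
    change G.deg y ≤ g at hy
    show (homM G.deg dn A.A b).mulVec z (x, y) = dF z (x, y)
    rw [homM_mulVec, hdF]
    have h2 : ∀ x', z (x', y) = 0 := fun x' => hz (x', y) (Nat.lt_succ_of_le hy)
    rw [Finset.sum_eq_zero (s := Finset.univ (α := n)) fun x' _ => by
      rw [h2, mul_zero], mul_zero, mul_zero, add_zero]
    refine Finset.sum_congr rfl fun y' _ => ?_
    by_cases h : G.deg y' < g + 1
    · rw [hz (x, y') h]; simp
    · rw [A.eq_C (by omega)]
  · rintro g z hz ⟨x, y⟩ hy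
    change G.deg y < g at hy
    show dF z (x, y) = 0
    rw [hdF]
    refine Finset.sum_eq_zero fun y' _ => ?_
    by_cases h : G.del y y' = 0
    · rw [h, C_0, zero_mul]
    · rw [hz (x, y') (by show G.deg y' < _; rw [G.del_deg y y' h]; omega), mul_zero]
  · intro u hu
    refine ⟨homM_mem A.gr hb hu, ?_⟩
    show (homM G.deg dn A.A b).mulVec ((homM G.deg dn A.A b).mulVec u) = 0
    rw [Matrix.mulVec_mulVec, hT, Matrix.zero_mulVec]
  · intro g z hz _ hz1 hP
    obtain ⟨κ, h1, h2⟩ := G.exists_section_deg g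
    have hfin : ∀ p : n × m, (Function.support fun μ =>
        κ (fun y' => coeff μ (z (p.1, y'))) p.2).Finite := by
      intro p
      refine Set.Finite.subset (Set.finite_iUnion fun y' =>
        (z (p.1, y')).support.finite_toSet) fun μ hμ => ?_
      obtain ⟨_, y', _, h⟩ := h2 _ _ hμ
      exact Set.mem_iUnion.2 ⟨y', by simpa using h⟩
    let u : n × m → MvPolynomial σ Q := fun p =>
      (basisMonomials σ Q).repr.symm (Finsupp.ofSupportFinite _ (hfin p))
    have hu : ∀ x y μ, coeff μ (u (x, y)) = κ (fun y' => coeff μ (z (x, y'))) y := by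
      intro x y μ
      have : coeff μ (u (x, y)) = (basisMonomials σ Q).repr (u (x, y)) μ := rfl
      rw [this, LinearEquiv.apply_symm_apply]
      rfl
    refine ⟨u, ?_, ?_, ?_⟩
    · intro x y μ h
      rw [hu] at h
      obtain ⟨h3, y', h4, h5⟩ := h2 _ _ h
      have h6 := hz x y' μ h5
      omega
    · rintro ⟨x, y⟩ hy
      change G.deg y < _ at hy
      ext μ
      rw [hu, coeff_zero]
      by_contra hc
      have : G.deg y = g + 1 := (h2 _ _ hc).1
      omega
    · rintro ⟨x, y⟩ hy
      show dF u (x, y) = _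
      ext μ
      rw [hdF, coeff_sum]
      simp only [coeff_C_mul, hu]
      refine h1 _ (fun y₁ hy₁ => ?_) (fun hg => hP hg x μ) y hy
      have := congrArg (coeff μ) (hz1 (x, y₁) hy₁)
      change coeff μ (dF z (x, y₁)) = _ at this
      rw [hdF, coeff_sum, coeff_zero] at this
      simpa only [coeff_C_mul] using this

end HomPert

open MvPolynomial

section Cochain

variable {Q : Type u} [CommRing Q] {σ : Type} [Fintype σ]
  {m n : Type} [Fintype m] [Fintype n] [DecidableEq m] [DecidableEq n]
  {R : Type u} [CommRing R] [Algebra Q R]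
  {N : Type u} [AddCommGroup N] [Module Q N] [Module R N] [IsScalarTower Q R N]

variable (Q σ R) in
/-- The terms of the complex of tuples of functionals with values in an algebra. -/
def TR (dn : n → ℕ) (i : ℕ) : Submodule R (TC Q σ n R) where
  carrier := {z | z ∈ TD dn ∅ i}
  zero_mem' := Submodule.zero_mem (TD dn ∅ i)
  add_mem' := fun h h' => Submodule.add_mem (TD dn ∅ i) h h'
  smul_mem' := by
    intro c z hz x μ h
    exact hz x μ fun h0 => h (by simp [h0])

lemma mem_TR {dn : n → ℕ} {i : ℕ} {z : TC Q σ n R} :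
    z ∈ TR Q σ R dn i ↔ z ∈ TD dn ∅ i := Iff.rfl

/-- The differential of the complex of tuples of functionals with values in an algebra. -/
def dR {dn : n → ℕ} {b : Matrix n n (MvPolynomial σ Q)} (hb : GrMat dn b) (i : ℕ) :
    TR Q σ R dn (i + 1) →ₗ[R] TR Q σ R dn i where
  toFun z := ⟨dT b z.1, dT_mem hb z.2⟩
  map_add' z w := by ext1; exact map_add _ _ _
  map_smul' c z := by
    ext1
    funext x
    refine LinearMap.ext fun s => ?_
    simp only [Submodule.coe_smul, dT_apply, Pi.smul_apply, LinearMap.smul_apply,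
      Finset.smul_sum, RingHom.id_apply]

lemma dR_coe {dn : n → ℕ} {b : Matrix n n (MvPolynomial σ Q)} (hb : GrMat dn b) (i : ℕ)
    (z : TR Q σ R dn (i + 1)) : (dR hb i z).1 = dT b z.1 := rfl

/-- The cochain defined by a matrix of polynomials and elements of a module. -/
def alp (g : m → N) (φ : n × m → MvPolynomial σ Q) : TC Q σ n R →ₗ[R] N where
  toFun z := ∑ x, ∑ y, z x (φ (x, y)) • g y
  map_add' z w := by simp [add_smul, Finset.sum_add_distrib]
  map_smul' c z := by simp [Finset.smul_sum, mul_smul]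

lemma alp_apply (g : m → N) (φ : n × m → MvPolynomial σ Q) (z : TC Q σ n R) :
    alp g φ z = ∑ x, ∑ y, z x (φ (x, y)) • g y := rfl

lemma alp_add (g : m → N) (φ φ' : n × m → MvPolynomial σ Q) :
    (alp g (φ + φ') : TC Q σ n R →ₗ[R] N) = alp g φ + alp g φ' := by
  refine LinearMap.ext fun z => ?_
  simp [alp_apply, add_smul, Finset.sum_add_distrib]

lemma alp_smul (g : m → N) (c : Q) (φ : n × m → MvPolynomial σ Q) :
    (alp g (c • φ) : TC Q σ n R →ₗ[R] N) = c • alp g φ := by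
  refine LinearMap.ext fun z => ?_
  simp [alp_apply, Finset.smul_sum]

lemma alp_sum {τ : Type} (T : Finset τ) (g : m → N) (φ : τ → n × m → MvPolynomial σ Q) :
    (alp g (∑ t ∈ T, φ t) : TC Q σ n R →ₗ[R] N) = ∑ t ∈ T, alp g (φ t) := by
  classical
  induction T using Finset.induction_on with
  | empty =>
    refine LinearMap.ext fun z => ?_
    simp [alp_apply]
  | insert t T ht ih => rw [Finset.sum_insert ht, Finset.sum_insert ht, alp_add, ih]

lemma sign_smul {dn : n → ℕ} {i : ℕ} {z : TC Q σ n R} (hz : z ∈ TD dn ∅ i) (x : n)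
    (s : MvPolynomial σ Q) : z x ((-1) ^ dn x * s) = (-1) ^ i * z x s := by
  have h1 : ((-1) ^ dn x * s : MvPolynomial σ Q) = ((-1 : Q) ^ dn x) • s := by
    rw [smul_eq_C_mul]; simp
  rw [h1, map_smul, apply_eq_sum (z x) s, Finset.smul_sum, Finset.mul_sum]
  refine Finset.sum_congr rfl fun μ _ => ?_
  by_cases h : z x (monomial μ 1) = 0
  · simp [h]
  · have := (hz x μ h).1
    have h2 : (-1 : R) ^ i = (-1) ^ dn x := by
      rw [← this, pow_add, pow_mul]; simp
    rw [h2, Algebra.smul_def ((-1 : Q) ^ dn x)]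
    simp

lemma alp_homM {f : σ → Q} {G : FinRes Q N m} (A : MF f G) {dn : n → ℕ}
    (b : Matrix n n (MvPolynomial σ Q)) (φ : n × m → MvPolynomial σ Q) {i : ℕ}
    {z : TC Q σ n R} (hz : z ∈ TD dn ∅ i) :
    alp G.aug ((homM G.deg dn A.A b).mulVec φ) z = (-1 : R) ^ i • alp G.aug φ (dT b z) := by
  have h1 : ∀ x y y', z x (A.A y y' * φ (x, y')) • G.aug y =
      z x (φ (x, y')) • (G.del y y' • G.aug y) := by
    intro x y y'
    by_cases hy : G.aug y = 0
    · simp [hy]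
    have hy0 := G.aug_deg y hy
    have : A.A y y' = C (G.del y y') := by
      by_cases h : G.deg y < G.deg y'
      · exact A.eq_C h
      · have h2 : A.A y y' = 0 := by
          ext μ
          by_contra hc
          have := A.gr y y' μ (by simpa using hc)
          omega
        have h3 : G.del y y' = 0 := by
          by_contra hc
          have := G.del_deg y y' hc
          omega
        rw [h2, h3, C_0]
    rw [this, ← smul_eq_C_mul, map_smul, smul_assoc, smul_comm]
  have h2 : ∀ x, ∑ y, z x (∑ y', A.A y y' * φ (x, y')) • G.aug y = 0 := by
    intro x
    simp only [map_sum, Finset.sum_smul, h1]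
    rw [Finset.sum_comm]
    refine Finset.sum_eq_zero fun y' _ => ?_
    rw [← Finset.smul_sum, G.aug_del, smul_zero]
  have h3 : ∀ x y, z x ((-1) ^ G.deg y * ((-1) ^ dn x * ∑ x', b x' x * φ (x', y))) • G.aug y =
      (-1 : R) ^ i • ∑ x', z x (b x' x * φ (x', y)) • G.aug y := by
    intro x y
    by_cases hy : G.aug y = 0
    · simp [hy]
    rw [G.aug_deg y hy, pow_zero, one_mul, sign_smul hz, mul_smul, map_sum, Finset.sum_smul]
  rw [alp_apply, alp_apply]
  simp only [homM_mulVec, map_add, add_smul, Finset.sum_add_distrib, h2, h3]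
  simp only [Finset.sum_const_zero, zero_add, ← Finset.smul_sum]
  congr 1
  simp only [dT_apply, Finset.sum_smul]
  calc ∑ x, ∑ y, ∑ x', z x (b x' x * φ (x', y)) • G.aug y
      = ∑ x, ∑ x', ∑ y, z x (b x' x * φ (x', y)) • G.aug y :=
        Finset.sum_congr rfl fun x _ => Finset.sum_comm
    _ = ∑ x', ∑ x, ∑ y, z x (b x' x * φ (x', y)) • G.aug y := Finset.sum_comm
    _ = _ := Finset.sum_congr rfl fun x _ => Finset.sum_comm

end Cochain

section Cochain

variable {Q : Type u} [CommRing Q] {σ : Type} [Fintype σ]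
  {m n : Type} [Fintype m] [Fintype n] [DecidableEq m] [DecidableEq n]
  {R : Type u} [CommRing R] [Algebra Q R]
  {N : Type u} [AddCommGroup N] [Module Q N] [Module R N] [IsScalarTower Q R N]

open Classical in
variable (Q R) in
/-- The tuple dual to a monomial. -/
def unitT (x : n) (μ : σ →₀ ℕ) : TC Q σ n R :=
  TC.mk fun x' μ' => if x' = x ∧ μ' = μ then 1 else 0

lemma unitT_mono (x x' : n) (μ μ' : σ →₀ ℕ) [Decidable (x' = x ∧ μ' = μ)] :
    unitT Q R x μ x' (monomial μ' 1) = if x' = x ∧ μ' = μ then 1 else 0 := by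
  rw [unitT, TC.mk_mono]
  congr

lemma unitT_apply (x x' : n) (μ : σ →₀ ℕ) (p : MvPolynomial σ Q) :
    unitT Q R x μ x' p = if x' = x then algebraMap Q R (coeff μ p) else 0 := by
  classical
  rw [apply_eq_sum]
  simp only [unitT_mono]
  split_ifs with h
  · simp only [h, true_and]
    simp only [smul_ite, smul_zero, Finset.sum_ite_eq', mem_support_iff]
    split_ifs with h'
    · rw [Algebra.smul_def, mul_one]
    · rw [not_not.1 h', map_zero]
  · simp [h]

lemma unitT_mem {dn : n → ℕ} {i : ℕ} {x : n} {μ : σ →₀ ℕ} (h : dn x + 2 * μ.degree = i) :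
    unitT Q R x μ ∈ TR Q σ R dn i := by
  classical
  intro x' μ' h'
  rw [unitT_mono] at h'
  obtain ⟨rfl, rfl⟩ := (ite_ne_right_iff.1 h').1
  exact ⟨h, by simp⟩

variable (σ) in
/-- The pairs of given degree. -/
abbrev Idx (dn : n → ℕ) (i : ℕ) := {p : n × (σ →₀ ℕ) // dn p.1 + 2 * p.2.degree = i}

instance (dn : n → ℕ) (i : ℕ) : Finite (Idx σ dn i) := by
  have h : {p : n × (σ →₀ ℕ) | dn p.1 + 2 * p.2.degree = i}.Finite := by
    refine Set.Finite.subset (Set.Finite.prod (Set.finite_univ (α := n))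
      (Finsupp.finite_of_degree_le (σ := σ) i)) ?_
    rintro ⟨x, μ⟩ h
    simp only [Set.mem_ofPred_eq] at h
    refine ⟨trivial, ?_⟩
    show μ.degree ≤ i
    omega
  exact h

lemma exists_mem_TR (dn : n → ℕ) (i : ℕ) (c : Idx σ dn i → R) :
    ∃ z ∈ TR Q σ R dn i, ∀ p : Idx σ dn i, z p.1.1 (monomial p.1.2 1) = c p := by
  classical
  refine ⟨TC.mk fun x μ => if h : dn x + 2 * μ.degree = i then c ⟨(x, μ), h⟩ else 0, ?_, ?_⟩
  · intro x μ h
    rw [TC.mk_mono] at h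
    refine ⟨?_, fun _ h' => h'.elim⟩
    by_contra hc
    exact h (dif_neg hc)
  · intro p
    rw [TC.mk_mono]
    exact dif_pos p.2

variable (Q σ R) in
/-- The values at the monomials of given degree. -/
def valTR (dn : n → ℕ) (i : ℕ) : TR Q σ R dn i →ₗ[R] (Idx σ dn i → R) where
  toFun z p := z.1 p.1.1 (monomial p.1.2 1)
  map_add' _ _ := rfl
  map_smul' _ _ := rfl

lemma valTR_bijective (dn : n → ℕ) (i : ℕ) : Function.Bijective (valTR Q σ R dn i) := by
  constructor
  · intro z w h
    ext1
    refine TC.ext_mono fun x μ => ?_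
    by_cases hx : dn x + 2 * μ.degree = i
    · exact congrFun h ⟨(x, μ), hx⟩
    · have h1 : z.1 x (monomial μ 1) = 0 := by
        by_contra hc; exact hx (z.2 x μ hc).1
      have h2 : w.1 x (monomial μ 1) = 0 := by
        by_contra hc; exact hx (w.2 x μ hc).1
      rw [h1, h2]
  · intro c
    obtain ⟨z, hz, h⟩ := exists_mem_TR (Q := Q) dn i c
    exact ⟨⟨z, hz⟩, funext h⟩

variable (Q σ R) in
/-- The terms of the complex of tuples of functionals are free. -/
def equivTR (dn : n → ℕ) (i : ℕ) : TR Q σ R dn i ≃ₗ[R] (Idx σ dn i → R) :=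
  LinearEquiv.ofBijective _ (valTR_bijective dn i)

instance (dn : n → ℕ) (i : ℕ) : Module.Free R (TR Q σ R dn i) :=
  Module.Free.of_equiv (equivTR Q σ R dn i).symm

instance (dn : n → ℕ) (i : ℕ) : Module.Finite R (TR Q σ R dn i) :=
  Module.Finite.equiv (equivTR Q σ R dn i).symm

variable {dm : m → ℕ} {dn : n → ℕ}

lemma exists_alp {g : m → N}
    (hg : ∀ y, g y ≠ 0 → dm y = 0) (hg' : Submodule.span Q (Set.range g) = ⊤) (p i : ℕ)
    (Ψ : TR Q σ R dn i →ₗ[R] N) :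
    ∃ φ ∈ HB Q σ dm dn p (i + p), ∀ z : TR Q σ R dn i, alp g φ z.1 = Ψ z := by
  classical
  have := Fintype.ofFinite (Idx σ dn i)
  have hc : ∀ v : N, ∃ c : m → Q, (∀ y, c y ≠ 0 → dm y = 0) ∧ ∑ y, c y • g y = v := by
    intro v
    obtain ⟨c, hc⟩ := (Submodule.mem_span_range_iff_exists_fun Q).1
      (hg' ▸ Submodule.mem_top : v ∈ Submodule.span Q (Set.range g))
    refine ⟨fun y => if dm y = 0 then c y else 0, fun y h => by by_contra h'; simp [h'] at h, ?_⟩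
    rw [← hc]
    refine Finset.sum_congr rfl fun y _ => ?_
    by_cases h : g y = 0
    · simp [h]
    · simp [hg y h]
  choose c hc1 hc2 using hc
  let v : Idx σ dn i → N := fun q => Ψ ⟨unitT Q R q.1.1 q.1.2, unitT_mem q.2⟩
  let φ : n × m → MvPolynomial σ Q := fun q =>
    ∑ r : Idx σ dn i, if r.1.1 = q.1 then monomial r.1.2 (c (v r) q.2) else 0
  have hφ : ∀ x y μ, coeff μ (φ (x, y)) =
      if h : dn x + 2 * μ.degree = i then c (v ⟨(x, μ), h⟩) y else 0 := by
    intro x y μ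
    simp only [φ, coeff_sum]
    split_ifs with h
    · rw [Finset.sum_eq_single ⟨(x, μ), h⟩]
      · simp
      · rintro ⟨⟨x', μ'⟩, h'⟩ _ hne
        dsimp only
        split_ifs with h1
        · rw [coeff_monomial, if_neg]
          rintro rfl
          subst h1
          exact hne rfl
        · simp
      · simp
    · refine Finset.sum_eq_zero ?_
      rintro ⟨⟨x', μ'⟩, h'⟩ _
      dsimp only at h' ⊢
      split_ifs with h1
      · rw [coeff_monomial, if_neg]
        rintro rfl
        subst h1
        exact h h'
      · simp
  refine ⟨φ, ?_, ?_⟩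
  · intro x y μ h
    rw [hφ] at h
    split_ifs at h with h'
    · have := hc1 _ _ h
      omega
    · exact absurd rfl h
  · have key : (alp g φ : TC Q σ n R →ₗ[R] N) ∘ₗ (TR Q σ R dn i).subtype = Ψ := by
      refine (Module.Basis.ofEquivFun (equivTR Q σ R dn i)).ext fun q => ?_
      have hq : Module.Basis.ofEquivFun (equivTR Q σ R dn i) q =
          ⟨unitT Q R q.1.1 q.1.2, unitT_mem q.2⟩ := by
        apply (equivTR Q σ R dn i).injective
        funext r
        rw [Module.Basis.coe_ofEquivFun, LinearEquiv.apply_symm_apply]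
        show _ = unitT Q R q.1.1 q.1.2 r.1.1 (monomial r.1.2 1)
        rw [unitT_mono, Pi.single_apply]
        congr 1
        rw [← Prod.ext_iff, Subtype.ext_iff]
      rw [hq]
      show alp g φ (unitT Q R q.1.1 q.1.2) = v q
      rw [alp_apply, Finset.sum_eq_single q.1.1]
      · have h1 : ∀ y, coeff q.1.2 (φ (q.1.1, y)) = c (v q) y := fun y =>
          (hφ _ _ _).trans (dif_pos q.2)
        simp only [unitT_apply, if_true, h1, algebraMap_smul]
        exact hc2 _
      · intro x _ hx
        refine Finset.sum_eq_zero fun y _ => ?_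
        rw [unitT_apply, if_neg hx, zero_smul]
      · simp
    intro z
    exact LinearMap.congr_fun key z

lemma sum_coeff_eq_zero {g : m → N} (hg : ∀ y, g y ≠ 0 → dm y = 0) {p i : ℕ}
    {φ : n × m → MvPolynomial σ Q} (hφ : φ ∈ HB Q σ dm dn p (i + p))
    (h : ∀ z ∈ TR Q σ R dn i, (alp g φ : TC Q σ n R →ₗ[R] N) z = 0) (x : n) (μ : σ →₀ ℕ) :
    ∑ y, coeff μ (φ (x, y)) • g y = 0 := by
  classical
  by_cases hx : dn x + 2 * μ.degree = i
  · have := h _ (unitT_mem hx)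
    rw [alp_apply, Finset.sum_eq_single x] at this
    · simpa only [unitT_apply, if_true, algebraMap_smul] using this
    · intro x' _ hx'
      refine Finset.sum_eq_zero fun y _ => ?_
      rw [unitT_apply, if_neg hx', zero_smul]
    · simp
  · refine Finset.sum_eq_zero fun y _ => ?_
    by_cases hy : g y = 0
    · simp [hy]
    by_cases h' : coeff μ (φ (x, y)) = 0
    · simp [h']
    have := hφ _ _ _ h'
    have := hg y hy
    omega

/-- The cohomology of the complex of maps to `N` is generated by `r` classes. -/
def CocGen {R : Type u} [CommRing R] {P : ℕ → Type u} [∀ i, AddCommGroup (P i)]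
    [∀ i, Module R (P i)] (d : ∀ i, P (i + 1) →ₗ[R] P i) (N : Type u) [AddCommGroup N]
    [Module R N] (i r : ℕ) : Prop :=
  ∃ ψ : Fin r → (P (i + 1) →ₗ[R] N), (∀ j, ψ j ∘ₗ d (i + 1) = 0) ∧
    ∀ ψ', ψ' ∘ₗ d (i + 1) = 0 → ∃ (c : Fin r → R) (θ : P i →ₗ[R] N),
      ψ' = ∑ j, c j • ψ j + θ ∘ₗ d i

end Cochain

open MvPolynomial

section CocGen

variable {Q : Type u} [CommRing Q] {σ : Type} [Fintype σ]
  {m n : Type} [Fintype m] [Fintype n] [DecidableEq m] [DecidableEq n]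
  {R : Type u} [CommRing R] [Algebra Q R]
  {N : Type u} [AddCommGroup N] [Module Q N] [Module R N] [IsScalarTower Q R N]
  {f : σ → Q} {G : FinRes Q N m} (A : MF f G) {dn : n → ℕ} {b : Matrix n n (MvPolynomial σ Q)}

lemma mem_HB_succ {dm : m → ℕ} {p k : ℕ} {φ : n × m → MvPolynomial σ Q} :
    φ ∈ HB Q σ dm dn (p + 1) (k + 1) ↔ φ ∈ HB Q σ dm dn p k :=
  forall₃_congr fun x y μ => imp_congr_right fun _ => by omega

/-- The cycles of given degree in the Hom complex are generated by `r` of them,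
up to boundaries. -/
def HomGen (dm : m → ℕ) (dn : n → ℕ) (D : Matrix (n × m) (n × m) (MvPolynomial σ Q))
    (i r : ℕ) : Prop :=
  ∃ φ : Fin r → (n × m → MvPolynomial σ Q),
    (∀ j, φ j ∈ HB Q σ dm dn 0 i ∧ D.mulVec (φ j) = 0) ∧
    ∀ z ∈ HB Q σ dm dn 0 i, D.mulVec z = 0 →
      ∃ (c : Fin r → Q) (u : _), u ∈ HB Q σ dm dn 1 i ∧ z = ∑ j, c j • φ j + D.mulVec u

include A in
lemma exists_cycle_lift (hb : GrMat dn b) (hb2 : b * b = pot f • 1) {i : ℕ}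
    (Ψ : TR Q σ R dn i →ₗ[R] N) (hΨ : Ψ ∘ₗ dR hb i = 0) :
    ∃ φ ∈ HB Q σ G.deg dn 0 i, (homM G.deg dn A.A b).mulVec φ = 0 ∧
      ∀ z : TR Q σ R dn i, alp G.aug φ z.1 = Ψ z := by
  obtain ⟨φ, hφ, hφΨ⟩ := exists_alp G.aug_deg G.aug_span 0 i Ψ
  have hm : (homM G.deg dn A.A b).mulVec φ ∈ HB Q σ G.deg dn 0 (i + 1) :=
    homM_mem A.gr hb (mem_HB_succ.2 hφ)
  have h0 : (homM G.deg dn A.A b).mulVec ((homM G.deg dn A.A b).mulVec φ) = 0 := by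
    rw [Matrix.mulVec_mulVec, homM_sq A.gr hb A.sq hb2, Matrix.zero_mulVec]
  obtain ⟨u, hu, hu0, hDu⟩ := exists_homM_eq A hb hb2 hm h0
    (sum_coeff_eq_zero (R := R) (i := i + 1) G.aug_deg hm fun z hz => by
      rw [alp_homM A b φ hz]
      have h1 := hφΨ (dR hb i ⟨z, hz⟩)
      rw [dR_coe] at h1
      have h2 := LinearMap.congr_fun hΨ ⟨z, hz⟩
      rw [LinearMap.comp_apply, LinearMap.zero_apply] at h2
      rw [h1, h2, smul_zero])
  refine ⟨φ - u, Submodule.sub_mem _ hφ (mem_HB_succ.1 hu), ?_, fun z => ?_⟩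
  · rw [Matrix.mulVec_sub, hDu, sub_self]
  · rw [← hφΨ z, alp_apply, alp_apply]
    refine Finset.sum_congr rfl fun x _ => Finset.sum_congr rfl fun y _ => ?_
    by_cases hy : G.aug y = 0
    · simp [hy]
    · rw [Pi.sub_apply, hu0 x y (G.aug_deg y hy), sub_zero]

include A in
lemma exists_homM_of_alp (hb : GrMat dn b) (hb2 : b * b = pot f • 1) {i : ℕ}
    {z : n × m → MvPolynomial σ Q} (hz : z ∈ HB Q σ G.deg dn 0 i)
    (h0 : (homM G.deg dn A.A b).mulVec z = 0)
    (ha : ∀ w ∈ TR Q σ R dn i, (alp G.aug z : TC Q σ n R →ₗ[R] N) w = 0) :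
    ∃ u ∈ HB Q σ G.deg dn 1 i, (homM G.deg dn A.A b).mulVec u = z := by
  obtain ⟨u, hu, _, h⟩ := exists_homM_eq A hb hb2 hz h0 (sum_coeff_eq_zero (R := R) G.aug_deg hz ha)
  exact ⟨u, hu, h⟩

include A in
theorem homGen_of_cocGen (hQ : Function.Surjective (algebraMap Q R)) (hb : GrMat dn b)
    (hb2 : b * b = pot f • 1) {i r : ℕ}
    (h : CocGen (P := fun i => TR Q σ R dn i) (dR hb) N i r) :
    HomGen G.deg dn (homM G.deg dn A.A b) (i + 1) r := by
  obtain ⟨ψ, hψ, hs⟩ := h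
  choose φ hφ hφ0 hφψ using fun j => exists_cycle_lift A hb hb2 (ψ j) (hψ j)
  refine ⟨φ, fun j => ⟨hφ j, hφ0 j⟩, fun z hz hz0 => ?_⟩
  obtain ⟨c, θ, hc⟩ := hs ((alp G.aug z : TC Q σ n R →ₗ[R] N) ∘ₗ (TR Q σ R dn (i + 1)).subtype) (by
    refine LinearMap.ext fun w => ?_
    have h1 := alp_homM A b z (i := i + 1 + 1) w.2
    rw [hz0] at h1
    have h2 : (alp G.aug (0 : n × m → MvPolynomial σ Q) : TC Q σ n R →ₗ[R] N) w.1 = 0 := by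
      simp [alp_apply]
    rw [h2] at h1
    have h3 : IsUnit ((-1 : R) ^ (i + 1 + 1)) := (isUnit_one.neg).pow _
    exact (h3.smul_eq_zero).1 h1.symm)
  choose c' hc' using fun j => hQ (c j)
  obtain ⟨w, hw, hwθ⟩ := exists_alp G.aug_deg G.aug_span 0 i θ
  have hw1 : w ∈ HB Q σ G.deg dn 1 (i + 1) := mem_HB_succ.2 hw
  let s : Q := (-1) ^ (i + 1)
  have hDw : (homM G.deg dn A.A b).mulVec (s • w) ∈ HB Q σ G.deg dn 0 (i + 1) :=
    homM_mem A.gr hb (Submodule.smul_mem _ _ hw1)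
  have hDD : ∀ v, (homM G.deg dn A.A b).mulVec ((homM G.deg dn A.A b).mulVec v) = 0 := by
    intro v
    rw [Matrix.mulVec_mulVec, homM_sq A.gr hb A.sq hb2, Matrix.zero_mulVec]
  obtain ⟨u, hu, hDu⟩ := exists_homM_of_alp (R := R) A hb hb2
    (z := z - ∑ j, c' j • φ j - (homM G.deg dn A.A b).mulVec (s • w))
    (Submodule.sub_mem _ (Submodule.sub_mem _ hz (Submodule.sum_mem _ fun j _ =>
      Submodule.smul_mem _ _ (hφ j))) hDw)
    (by
      rw [Matrix.mulVec_sub, Matrix.mulVec_sub, hDD, hz0, Matrix.mulVec_sum]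
      simp [Matrix.mulVec_smul, hφ0]) (by
      intro v hv
      have e : z = (z - ∑ j, c' j • φ j - (homM G.deg dn A.A b).mulVec (s • w)) +
        (∑ j, c' j • φ j + (homM G.deg dn A.A b).mulVec (s • w)) := by abel
      have h1 := LinearMap.congr_fun hc ⟨v, hv⟩
      change alp G.aug z v = _ at h1
      rw [e, alp_add, LinearMap.add_apply, alp_add, alp_sum, LinearMap.add_apply,
        alp_homM A b (s • w) hv, LinearMap.add_apply, LinearMap.comp_apply,
        ← hwθ, dR_coe, LinearMap.sum_apply, LinearMap.sum_apply] at h1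
      have h2 : ∑ j, (alp G.aug (c' j • φ j) : TC Q σ n R →ₗ[R] N) v =
          ∑ j, (c j • ψ j) ⟨v, hv⟩ := by
        refine Finset.sum_congr rfl fun j _ => ?_
        rw [alp_smul, LinearMap.smul_apply, hφψ j ⟨v, hv⟩, LinearMap.smul_apply, ← hc' j,
          algebraMap_smul]
      have h3 : (-1 : R) ^ (i + 1) • (alp G.aug (s • w) : TC Q σ n R →ₗ[R] N) (dT b v) =
          alp G.aug w (dT b v) := by
        rw [alp_smul, LinearMap.smul_apply, ← algebraMap_smul R s, smul_smul, map_pow, map_neg,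
          map_one, ← mul_pow, neg_one_mul, neg_neg, one_pow, one_smul]
      rw [h2, h3] at h1
      exact add_eq_right.1 h1)
  refine ⟨c', s • w + u, Submodule.add_mem _ (Submodule.smul_mem _ _ hw1) hu, ?_⟩
  rw [Matrix.mulVec_add, hDu]
  abel

include A in
theorem cocGen_of_homGen (hb : GrMat dn b) (hb2 : b * b = pot f • 1) {i r : ℕ}
    (h : HomGen G.deg dn (homM G.deg dn A.A b) (i + 1) r) :
    CocGen (P := fun i => TR Q σ R dn i) (dR hb) N i r := by
  obtain ⟨φ, hφ, hs⟩ := h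
  refine ⟨fun j => alp G.aug (φ j) ∘ₗ (TR Q σ R dn (i + 1)).subtype, fun j => ?_, fun ψ' hψ' => ?_⟩
  · refine LinearMap.ext fun w => ?_
    have h1 := alp_homM A b (φ j) (i := i + 1 + 1) w.2
    rw [(hφ j).2] at h1
    have h2 : (alp G.aug (0 : n × m → MvPolynomial σ Q) : TC Q σ n R →ₗ[R] N) w.1 = 0 := by
      simp [alp_apply]
    rw [h2] at h1
    have h3 : IsUnit ((-1 : R) ^ (i + 1 + 1)) := (isUnit_one.neg).pow _
    exact (h3.smul_eq_zero).1 h1.symm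
  · obtain ⟨z, hz, hz0, hzψ⟩ := exists_cycle_lift A hb hb2 ψ' hψ'
    obtain ⟨c, u, hu, rfl⟩ := hs z hz hz0
    refine ⟨fun j => algebraMap Q R (c j), (-1 : R) ^ (i + 1) •
      (alp G.aug u ∘ₗ (TR Q σ R dn i).subtype), LinearMap.ext fun v => ?_⟩
    rw [← hzψ v, alp_add, alp_sum, LinearMap.add_apply, alp_homM A b u v.2, LinearMap.add_apply,
      LinearMap.sum_apply, LinearMap.sum_apply]
    congr 1
    refine Finset.sum_congr rfl fun j _ => ?_
    rw [alp_smul, LinearMap.smul_apply, LinearMap.smul_apply, algebraMap_smul]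
    rfl

end CocGen

open MvPolynomial

section Graded

variable {Q : Type u} [CommRing Q] {σ τ : Type} [Fintype σ] [Fintype τ]

variable (Q σ) in
/-- Vectors of polynomials that are homogeneous for a weight on the index set, the variables
having degree two. -/
def Hw (w : τ → ℕ) (k : ℕ) : Submodule Q (τ → MvPolynomial σ Q) where
  carrier := {φ | ∀ t μ, coeff μ (φ t) ≠ 0 → w t + 2 * μ.degree = k}
  zero_mem' := by simp
  add_mem' := by
    intro z w' hz hw t μ h
    by_cases h0 : coeff μ (z t) = 0
    · exact hw t μ (by simpa [h0] using h)
    · exact hz t μ h0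
  smul_mem' := by
    intro c z hz t μ h
    exact hz t μ (right_ne_zero_of_mul (by simpa using h))

/-- The homogeneous components of a vector of polynomials. -/
def hcomp (w : τ → ℕ) (k : ℕ) : (τ → MvPolynomial σ Q) →ₗ[Q] (τ → MvPolynomial σ Q) where
  toFun φ t := if w t ≤ k ∧ 2 ∣ k - w t then homogeneousComponent ((k - w t) / 2) (φ t) else 0
  map_add' φ ψ := by
    funext t
    simp only [Pi.add_apply, map_add]
    split_ifs <;> simp
  map_smul' c φ := by
    funext t
    simp only [Pi.smul_apply, map_smul, RingHom.id_apply]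
    split_ifs <;> simp

lemma coeff_hcomp (w : τ → ℕ) (k : ℕ) (φ : τ → MvPolynomial σ Q) (t : τ) (μ : σ →₀ ℕ) :
    coeff μ (hcomp w k φ t) = if w t + 2 * μ.degree = k then coeff μ (φ t) else 0 := by
  show coeff μ (if w t ≤ k ∧ 2 ∣ k - w t then
    homogeneousComponent ((k - w t) / 2) (φ t) else 0) = _
  by_cases h : w t ≤ k ∧ 2 ∣ k - w t
  · rw [if_pos h, coeff_homogeneousComponent]
    congr 1
    rw [eq_iff_iff]
    omega
  · rw [if_neg h, coeff_zero, if_neg]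
    omega

lemma hcomp_mem (w : τ → ℕ) (k : ℕ) (φ : τ → MvPolynomial σ Q) :
    hcomp w k φ ∈ Hw Q σ w k := by
  intro t μ h
  rw [coeff_hcomp] at h
  exact (ite_ne_right_iff.1 h).1

lemma hcomp_of_mem {w : τ → ℕ} {k : ℕ} {φ : τ → MvPolynomial σ Q} (h : φ ∈ Hw Q σ w k) (k' : ℕ) :
    hcomp w k' φ = if k = k' then φ else 0 := by
  funext t
  ext μ
  rw [coeff_hcomp]
  by_cases h0 : coeff μ (φ t) = 0
  · split_ifs <;> simp [h0]
  · have := h t μ h0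
    rw [this]
    split_ifs <;> rfl

lemma exists_sum_hcomp (w : τ → ℕ) (φ : τ → MvPolynomial σ Q) :
    ∃ T, ∑ k ∈ Finset.range T, hcomp w k φ = φ := by
  let T := Finset.univ.sup fun t => w t + 2 * (φ t).totalDegree
  refine ⟨T + 1, ?_⟩
  funext t
  ext μ
  rw [Finset.sum_apply, coeff_sum]
  simp only [coeff_hcomp]
  by_cases h0 : coeff μ (φ t) = 0
  · simp [h0]
  · rw [Finset.sum_ite_eq, if_pos]
    rw [Finset.mem_range]
    have h1 : μ.degree ≤ (φ t).totalDegree := by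
      have := le_totalDegree (p := φ t) (s := μ) (mem_support_iff.2 h0)
      exact this
    have h2 : w t + 2 * (φ t).totalDegree ≤ T :=
      Finset.le_sup (f := fun t => w t + 2 * (φ t).totalDegree) (Finset.mem_univ t)
    omega

variable {w : τ → ℕ} {D : Matrix τ τ (MvPolynomial σ Q)}

lemma hcomp_mulVec (hD : GrMat w D.transpose) (k : ℕ) (φ : τ → MvPolynomial σ Q) :
    hcomp w (k + 1) (D.mulVec φ) = D.mulVec (hcomp w k φ) := by
  classical
  funext t
  ext μ
  rw [coeff_hcomp, Matrix.mulVec, dotProduct, Matrix.mulVec, dotProduct, coeff_sum, coeff_sum]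
  have key : ∀ t', coeff μ (D t t' * hcomp w k φ t') =
      if w t + 2 * μ.degree = k + 1 then coeff μ (D t t' * φ t') else 0 := by
    intro t'
    rw [coeff_mul, coeff_mul]
    have h1 : ∀ p ∈ Finset.HasAntidiagonal.antidiagonal μ, coeff p.1 (D t t') * coeff p.2 (hcomp w k φ t') =
        if w t + 2 * μ.degree = k + 1 then coeff p.1 (D t t') * coeff p.2 (φ t') else 0 := by
      rintro ⟨ν, ξ⟩ hp
      rw [Finset.HasAntidiagonal.mem_antidiagonal] at hp
      dsimp only at hp ⊢
      rw [coeff_hcomp]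
      by_cases h0 : coeff ν (D t t') = 0
      · simp [h0]
      · have h2 : w t' + 1 = w t + 2 * ν.degree := hD t' t ν h0
        rw [mul_ite, mul_zero]
        congr 1
        rw [eq_iff_iff, ← hp, map_add]
        omega
    rw [Finset.sum_congr rfl h1]
    split_ifs <;> simp
  simp only [key]
  split_ifs <;> simp

lemma mulVec_hcomp (hD : GrMat w D.transpose) {φ : τ → MvPolynomial σ Q} (h : D.mulVec φ = 0)
    (k : ℕ) : D.mulVec (hcomp w k φ) = 0 := by
  rw [← hcomp_mulVec hD, h, map_zero]

/-- The homogeneous cycles of degree `k + 1` are generated by `r` of them up to boundaries. -/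
def ZGen (w : τ → ℕ) (D : Matrix τ τ (MvPolynomial σ Q)) (k r : ℕ) : Prop :=
  ∃ φ : Fin r → (τ → MvPolynomial σ Q),
    (∀ j, φ j ∈ Hw Q σ w (k + 1) ∧ D.mulVec (φ j) = 0) ∧
    ∀ z ∈ Hw Q σ w (k + 1), D.mulVec z = 0 →
      ∃ (c : Fin r → Q) (u : _), u ∈ Hw Q σ w k ∧ z = ∑ j, c j • φ j + D.mulVec u

lemma monomial_smul_mem {k : ℕ} {φ : τ → MvPolynomial σ Q} (h : φ ∈ Hw Q σ w k) (μ : σ →₀ ℕ)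
    (c : Q) : (monomial μ c : MvPolynomial σ Q) • φ ∈ Hw Q σ w (k + 2 * μ.degree) := by
  classical
  intro t ν hν
  rw [Pi.smul_apply, smul_eq_mul, coeff_monomial_mul'] at hν
  split_ifs at hν with h1
  · have := h t _ (right_ne_zero_of_mul hν)
    have h2 : (ν - μ).degree + μ.degree = ν.degree := by
      rw [← map_add, tsub_add_cancel_of_le h1]
    omega
  · exact absurd rfl hν

/-- The number of generators of the cycles grows polynomially. -/
theorem exists_zGen [IsNoetherianRing Q] (hD : GrMat w D.transpose) :
    ∃ q, ∀ k, ZGen w D k (q * (k + 2) ^ Fintype.card σ) := by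
  classical
  have : IsNoetherianRing (MvPolynomial σ Q) := inferInstance
  obtain ⟨s, hs⟩ : (LinearMap.ker D.mulVecLin).FG := IsNoetherian.noetherian _
  obtain ⟨T, hT⟩ : ∃ T, ∀ g ∈ s, ∑ k ∈ Finset.range T, hcomp w k g = g := by
    choose T hT using exists_sum_hcomp (Q := Q) (σ := σ) w
    refine ⟨s.sup T, fun g hg => ?_⟩
    conv_rhs => rw [← hT g]
    symm
    refine Finset.sum_subset (Finset.range_mono (Finset.le_sup hg)) fun k _ hk => ?_
    rw [← hT g, map_sum]
    refine Finset.sum_eq_zero fun k' hk' => ?_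
    rw [hcomp_of_mem (hcomp_mem w k' g), if_neg]
    rintro rfl
    exact hk hk'
  have hker : ∀ g ∈ s, D.mulVec g = 0 := fun g hg => by
    have : g ∈ LinearMap.ker D.mulVecLin := hs ▸ Submodule.subset_span hg
    exact this
  refine ⟨Fintype.card (s × Fin T), fun k => ?_⟩
  let e2 : Fin (Fintype.card (s × Fin T) * (k + 2) ^ Fintype.card σ) ≃
      (s × Fin T) × (σ → Fin (k + 2)) :=
    (Fintype.equivFinOfCardEq (by simp)).symm
  let ge : s × Fin T → τ → MvPolynomial σ Q := fun p => hcomp w p.2 p.1.1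
  let mo : (σ → Fin (k + 2)) → (σ →₀ ℕ) := fun v => Finsupp.equivFunOnFinite.symm fun i => (v i : ℕ)
  refine ⟨fun j => hcomp w (k + 1) ((monomial (mo (e2 j).2) (1 : Q)) • ge (e2 j).1),
    fun j => ⟨hcomp_mem _ _ _, mulVec_hcomp hD ?_ _⟩, fun z hz hz0 => ?_⟩
  · rw [Matrix.mulVec_smul, mulVec_hcomp hD (hker _ (e2 j).1.1.2), smul_zero]
  · suffices H : z ∈ Submodule.span Q (Set.range fun j : Fin (Fintype.card (s × Fin T) *
        (k + 2) ^ Fintype.card σ) =>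
        hcomp w (k + 1) ((monomial (mo (e2 j).2) (1 : Q)) • ge (e2 j).1)) by
      obtain ⟨c, hc⟩ := (Submodule.mem_span_range_iff_exists_fun Q).1 H
      exact ⟨c, 0, Submodule.zero_mem _, by rw [hc, Matrix.mulVec_zero, add_zero]⟩
    have hz1 : z ∈ Submodule.span (MvPolynomial σ Q) (Set.range ge) := by
      have h1 : z ∈ Submodule.span (MvPolynomial σ Q) (s : Set (τ → MvPolynomial σ Q)) := by
        rw [hs]; exact hz0
      refine (Submodule.span_le.2 fun g hg => ?_) h1
      show g ∈ Submodule.span (MvPolynomial σ Q) (Set.range ge)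
      rw [← hT g hg]
      refine Submodule.sum_mem _ fun k hk => Submodule.subset_span
        ⟨(⟨g, hg⟩, ⟨k, Finset.mem_range.1 hk⟩), rfl⟩
    rw [Submodule.mem_span_range_iff_exists_fun] at hz1
    obtain ⟨c, hc⟩ := hz1
    have hz2 : z = hcomp w (k + 1) z := by rw [hcomp_of_mem hz, if_pos rfl]
    rw [hz2, ← hc, map_sum]
    refine Submodule.sum_mem _ fun p _ => ?_
    have h0 : c p • ge p = ∑ μ ∈ (c p).support, monomial μ (coeff μ (c p)) • ge p := by
      rw [← Finset.sum_smul, ← (c p).as_sum]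
    rw [h0, map_sum]
    refine Submodule.sum_mem _ fun μ _ => ?_
    have h3 : (monomial μ (coeff μ (c p))) • ge p = (coeff μ (c p)) •
        ((monomial μ (1 : Q)) • ge p) := by
      rw [← smul_assoc, smul_monomial, smul_eq_mul, mul_one]
    rw [h3, map_smul]
    refine Submodule.smul_mem _ _ ?_
    by_cases hμ : ∀ i, μ i < k + 2
    · refine Submodule.subset_span ⟨e2.symm (p, fun i => ⟨μ i, hμ i⟩), ?_⟩
      dsimp only
      rw [Equiv.apply_symm_apply]
      have h4 : mo (fun i => ⟨μ i, hμ i⟩) = μ := by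
        ext i
        rfl
      rw [h4]
    · push Not at hμ
      obtain ⟨i, hi⟩ := hμ
      have h4 : μ i ≤ μ.degree := Finsupp.le_degree i μ
      have h5 := monomial_smul_mem (hcomp_mem w p.2 p.1.1) μ (1 : Q)
      rw [hcomp_of_mem h5, if_neg (by omega)]
      exact Submodule.zero_mem _

end Graded

open MvPolynomial

section Cut

variable {Q : Type u} [CommRing Q] {σ : Type} [Fintype σ]

lemma isMaximal_of_finite [IsLocalRing Q] {E : Type u} [AddCommGroup E] [Module Q E]
    [Module (MvPolynomial σ Q) E] [IsScalarTower Q (MvPolynomial σ Q) E] [Module.Finite Q E]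
    {p : Ideal (MvPolynomial σ Q)} (hp : p.IsPrime)
    (hm : ∀ y ∈ IsLocalRing.maximalIdeal Q, (C y : MvPolynomial σ Q) ∈ p)
    (h : ∀ s : MvPolynomial σ Q, (∀ x : E, s • x = 0) → s ∈ p) : p.IsMaximal := by
  have hint : Algebra.IsIntegral Q (MvPolynomial σ Q ⧸ p) := by
    refine ⟨fun a => ?_⟩
    obtain ⟨s, rfl⟩ := Ideal.Quotient.mk_surjective a
    obtain ⟨P, hP, hP0⟩ := Algebra.IsIntegral.isIntegral (R := Q) (Algebra.lsmul Q Q E s)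
    refine ⟨P, hP, ?_⟩
    have h1 : Polynomial.aeval s P ∈ p := by
      refine h _ fun x => ?_
      have h2 : Algebra.lsmul Q Q E (Polynomial.aeval s P) = 0 := by
        rw [← Polynomial.aeval_algHom_apply]
        exact hP0
      exact LinearMap.congr_fun h2 x
    have h3 : Polynomial.aeval (Ideal.Quotient.mk p s) P = Ideal.Quotient.mk p (Polynomial.aeval s P) :=
      Polynomial.aeval_algHom_apply (Ideal.Quotient.mkₐ Q p) s P
    rw [← Polynomial.aeval_def, h3]
    exact Ideal.Quotient.eq_zero_iff_mem.2 h1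
  have hmax : (Ideal.comap (algebraMap Q (MvPolynomial σ Q ⧸ p)) ⊥).IsMaximal := by
    have : Ideal.comap (algebraMap Q (MvPolynomial σ Q ⧸ p)) ⊥ = IsLocalRing.maximalIdeal Q := by
      refine le_antisymm (IsLocalRing.le_maximalIdeal ?_) fun y hy => ?_
      · exact (Ideal.IsPrime.comap (algebraMap Q (MvPolynomial σ Q ⧸ p))).ne_top
      · rw [Ideal.mem_comap, Submodule.mem_bot]
        exact Ideal.Quotient.eq_zero_iff_mem.2 (hm y hy)
    rw [this]
    exact IsLocalRing.maximalIdeal.isMaximal Q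
  have := Ideal.isMaximal_of_isIntegral_of_isMaximal_comap (R := Q)
    (⊥ : Ideal (MvPolynomial σ Q ⧸ p)) hmax
  exact Ideal.bot_quotient_isMaximal_iff p |>.1 this

lemma exists_notMem_of_cut [IsLocalRing Q] [IsNoetherianRing Q] {H : Type u} [AddCommGroup H]
    [Module Q H] [Module (MvPolynomial σ Q) H] [IsScalarTower Q (MvPolynomial σ Q) H]
    [Module.Finite (MvPolynomial σ Q) H] {𝔞 p : Ideal (MvPolynomial σ Q)} (hp : p.IsPrime)
    (hpm : ¬p.IsMaximal) (hap : 𝔞 ≤ p)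
    (hm : ∀ y ∈ IsLocalRing.maximalIdeal Q, (C y : MvPolynomial σ Q) ∈ p)
    (hfin : Module.Finite Q (H ⧸ (𝔞 • (⊤ : Submodule (MvPolynomial σ Q) H)))) :
    ∃ s ∉ p, ∀ x : H, s • x = 0 := by
  by_contra hc
  push Not at hc
  refine hpm (isMaximal_of_finite (E := H ⧸ (𝔞 • (⊤ : Submodule (MvPolynomial σ Q) H))) hp hm
    fun s hs => ?_)
  obtain ⟨P, hP, _, hPc, hP0⟩ :=
    LinearMap.exists_monic_and_natDegree_eq_and_coeff_mem_pow_and_aeval_eq_zero (MvPolynomial σ Q)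
      (Algebra.lsmul (MvPolynomial σ Q) (MvPolynomial σ Q) H s) 𝔞 (by
        rintro _ ⟨x, rfl⟩
        have := hs (Submodule.Quotient.mk x)
        rw [← Submodule.Quotient.mk_smul, Submodule.Quotient.mk_eq_zero] at this
        exact this)
  have h1 : Polynomial.aeval s P ∈ p := by
    by_contra h
    obtain ⟨x, hx⟩ := hc _ h
    apply hx
    have h2 : Algebra.lsmul (MvPolynomial σ Q) (MvPolynomial σ Q) H (Polynomial.aeval s P) = 0 := by
      rw [← Polynomial.aeval_algHom_apply]
      exact hP0
    exact LinearMap.congr_fun h2 x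
  rw [Polynomial.aeval_eq_sum_range, Finset.sum_range_succ, hP.coeff_natDegree, one_smul] at h1
  refine hp.mem_of_pow_mem P.natDegree ((Ideal.add_mem_iff_right _ ?_).1 h1)
  refine Ideal.sum_mem _ fun k hk => Ideal.mul_mem_right _ _ (hap ?_)
  refine Ideal.pow_le_self ?_ (hPc k)
  have := Finset.mem_range.1 hk
  omega

end Cut

section CutHom

variable {Q : Type u} [CommRing Q] {σ τ : Type} [Fintype σ] [Fintype τ]

lemma length_sup_le {E : Type u} [AddCommGroup E] [Module Q E] (U V : Submodule Q E) :
    Module.length Q (U ⊔ V : Submodule Q E) ≤ Module.length Q U + Module.length Q V := by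
  rw [← Module.length_prod]
  let g : (U × V) →ₗ[Q] (U ⊔ V : Submodule Q E) :=
    LinearMap.codRestrict _ (LinearMap.coprod U.subtype V.subtype) fun x =>
      Submodule.add_mem_sup x.1.2 x.2.2
  refine Module.length_le_of_surjective g ?_
  rintro ⟨x, hx⟩
  obtain ⟨u, hu, v, hv, rfl⟩ := Submodule.mem_sup.1 hx
  exact ⟨(⟨u, hu⟩, ⟨v, hv⟩), rfl⟩

lemma length_finset_sup_le {E : Type u} [AddCommGroup E] [Module Q E] (W : ℕ → Submodule Q E)
    (r : ℕ → ℕ) (h : ∀ k, Module.length Q (W k) ≤ (r k : ℕ∞)) (t : ℕ) :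
    Module.length Q ((Finset.range t).sup W : Submodule Q E) ≤
      ((∑ k ∈ Finset.range t, r k : ℕ) : ℕ∞) := by
  induction t with
  | zero =>
    rw [Finset.range_zero, Finset.sup_empty, Module.length_bot]
    exact bot_le
  | succ t ih =>
    rw [Finset.range_add_one, Finset.sup_insert, Finset.sum_insert (by simp), Nat.cast_add]
    exact (length_sup_le _ _).trans (add_le_add (h t) ih)

lemma length_span_range_le [IsLocalRing Q] {E : Type u} [AddCommGroup E] [Module Q E]
    (hE : ∀ y ∈ IsLocalRing.maximalIdeal Q, ∀ x : E, y • x = 0) {n : ℕ} (g : Fin n → E) :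
    Module.length Q (Submodule.span Q (Set.range g)) ≤ (n : ℕ∞) := by
  classical
  let g' : Fin n → Submodule.span Q (Set.range g) :=
    fun j => ⟨g j, Submodule.subset_span ⟨j, rfl⟩⟩
  refine (length_le_card (fun y hy x => Subtype.ext (hE y hy x.1)) (Finset.univ.image g') ?_).trans ?_
  · rw [Finset.coe_image, Finset.coe_univ, Set.image_univ]
    exact (Submodule.span_range_subtype_eq_top_iff _ fun j =>
      Submodule.subset_span (Set.mem_range_self j)).2 rfl
  · exact_mod_cast Finset.card_image_le.trans (by simp)

/-- Linear forms cutting out the support of the homology of a graded square-zero matrix whose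
homology has few generators. -/
theorem exists_cut [IsLocalRing Q] [IsNoetherianRing Q] [Infinite (IsLocalRing.ResidueField Q)]
    {w : τ → ℕ} {D : Matrix τ τ (MvPolynomial σ Q)} (hw : ∀ t, 0 < w t)
    (hD : GrMat w D.transpose) (hD2 : D * D = 0) (r : ℕ → ℕ) (hr : ∀ k, ZGen w D k (r k))
    (K c : ℕ) (hK : ∀ t, ∑ k ∈ Finset.range t, r k ≤ K * (t + 1) ^ c) :
    ∃ l : List (σ → Q), l.length ≤ c ∧ ∀ p : Ideal (MvPolynomial σ Q), p.IsPrime → ¬p.IsMaximal →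
      (∀ y ∈ IsLocalRing.maximalIdeal Q, (C y : MvPolynomial σ Q) ∈ p) → (∀ a ∈ l, lin a ∈ p) →
      ∃ s ∉ p, Kills D s (MvPolynomial σ Q) := by
  classical
  have : IsNoetherianRing (MvPolynomial σ Q) := inferInstance
  let Z : Submodule (MvPolynomial σ Q) (τ → MvPolynomial σ Q) := LinearMap.ker D.mulVecLin
  let B : Submodule (MvPolynomial σ Q) Z := (LinearMap.range D.mulVecLin).submoduleOf Z
  let 𝔪 : Ideal (MvPolynomial σ Q) := (IsLocalRing.maximalIdeal Q).map C
  let E := (Z ⧸ B) ⧸ (𝔪 • (⊤ : Submodule (MvPolynomial σ Q) (Z ⧸ B)))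
  let π : Z →ₗ[MvPolynomial σ Q] E := (Submodule.mkQ _).comp (Submodule.mkQ B)
  have hπ : Function.Surjective π :=
    (Submodule.mkQ_surjective _).comp (Submodule.mkQ_surjective _)
  have hπB : ∀ z : Z, (∃ u, D.mulVec u = z) → π z = 0 := by
    rintro z ⟨u, hu⟩
    have h1 : B.mkQ z = 0 := (Submodule.Quotient.mk_eq_zero _).2 ⟨u, hu⟩
    show Submodule.mkQ _ (B.mkQ z) = 0
    rw [h1, map_zero]
  have hmE : ∀ y ∈ IsLocalRing.maximalIdeal Q, ∀ x : E, y • x = 0 := by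
    intro y hy x
    obtain ⟨x, rfl⟩ := Submodule.Quotient.mk_surjective _ x
    rw [← C_smul (σ := σ), ← Submodule.Quotient.mk_smul, Submodule.Quotient.mk_eq_zero]
    exact Submodule.smul_mem_smul (Ideal.mem_map_of_mem _ hy) trivial
  let W : ℕ → Submodule Q E := fun k =>
    ((Hw Q σ w k).comap (Z.subtype.restrictScalars Q)).map (π.restrictScalars Q)
  have hW0 : W 0 = ⊥ := by
    rw [eq_bot_iff]
    rintro _ ⟨z, hz, rfl⟩
    have : z = 0 := by
      refine Subtype.ext (funext fun t => ?_)
      ext μ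
      by_contra h
      have := hz t μ h
      have := hw t
      omega
    rw [this, map_zero]
    exact Submodule.zero_mem _
  have hWr : ∀ k, Module.length Q (W (k + 1)) ≤ (r k : ℕ∞) := by
    intro k
    obtain ⟨φ, hφ, hz⟩ := hr k
    let g : Fin (r k) → E := fun j => π ⟨φ j, (hφ j).2⟩
    have hg : W (k + 1) ≤ Submodule.span Q (Set.range g) := by
      rintro _ ⟨z, hz1, rfl⟩
      obtain ⟨c, u, -, hu⟩ := hz z.1 hz1 z.2
      have h1 : z = ∑ j, c j • (⟨φ j, (hφ j).2⟩ : Z) +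
          ⟨D.mulVec u, by
            show D.mulVec (D.mulVec u) = 0
            rw [Matrix.mulVec_mulVec, hD2, Matrix.zero_mulVec]⟩ := by
        refine Subtype.ext ?_
        rw [hu]
        simp
      show π.restrictScalars Q z ∈ _
      rw [h1, map_add, map_sum]
      refine Submodule.add_mem _ (Submodule.sum_mem _ fun j _ => ?_) ?_
      · rw [map_smul]
        exact Submodule.smul_mem _ _ (Submodule.subset_span ⟨j, rfl⟩)
      · have := hπB ⟨D.mulVec u, by
            show D.mulVec (D.mulVec u) = 0
            rw [Matrix.mulVec_mulVec, hD2, Matrix.zero_mulVec]⟩ ⟨u, rfl⟩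
        rw [LinearMap.restrictScalars_apply, this]
        exact Submodule.zero_mem _
    exact (length_mono hg).trans (length_span_range_le hmE g)
  let V : ℕ → Submodule Q E := fun t => (Finset.range t).sup fun k => W (k + 1)
  have hWV : ∀ k t, k < t + 1 → W k ≤ V t := by
    intro k t hk
    cases k with
    | zero => rw [hW0]; exact bot_le
    | succ k => exact Finset.le_sup (f := fun k => W (k + 1)) (Finset.mem_range.2 (by omega))
  have hVm : Monotone V := fun i j h => Finset.sup_mono (Finset.range_mono h)
  have hVX : ∀ t j, ∀ x ∈ V t, (X j : MvPolynomial σ Q) • x ∈ V (t + 2) := by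
    intro t j
    suffices H : V t ≤ (V (t + 2)).comap
        ((LinearMap.lsmul (MvPolynomial σ Q) E (X j)).restrictScalars Q) from H
    refine Finset.sup_le fun k hk => ?_
    rintro _ ⟨z, hz, rfl⟩
    refine hWV (k + 1 + 2) _ (by have := Finset.mem_range.1 hk; omega) ?_
    refine ⟨(X j : MvPolynomial σ Q) • z, ?_, map_smul π _ _⟩
    have := monomial_smul_mem (k := k + 1) (φ := z.1) hz (Finsupp.single j 1) (1 : Q)
    rw [Finsupp.degree_single, mul_one] at this
    exact this
  have hVE : ∀ x, ∃ t, x ∈ V t := by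
    intro x
    obtain ⟨z, rfl⟩ := hπ x
    obtain ⟨T, hT⟩ := exists_sum_hcomp w z.1
    refine ⟨T, ?_⟩
    have h1 : z = ∑ k ∈ Finset.range T, (⟨hcomp w k z.1, mulVec_hcomp hD z.2 k⟩ : Z) :=
      Subtype.ext (by simp [hT])
    rw [h1, map_sum]
    refine Submodule.sum_mem _ fun k hk => hWV k T (by have := Finset.mem_range.1 hk; omega) ?_
    exact ⟨_, hcomp_mem w k z.1, rfl⟩
  have hVl : ∀ t, Module.length Q (V t) ≤ ((K * (t + 1) ^ c : ℕ) : ℕ∞) := by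
    exact fun t => (length_finset_sup_le _ r hWr t).trans (Nat.cast_le.2 (hK t))
  obtain ⟨l, hl, U, hU, hUE⟩ := exists_lin_cut c E hmE V hVm hVX hVE K hVl
  refine ⟨l, hl, fun p hp hpm hpC hpl => ?_⟩
  let 𝔩 : Ideal (MvPolynomial σ Q) := Ideal.span {p | ∃ c ∈ l, p = lin c}
  have hfin : Module.Finite Q ((Z ⧸ B) ⧸ ((𝔪 ⊔ 𝔩) • (⊤ : Submodule (MvPolynomial σ Q) (Z ⧸ B)))) := by
    let q : E →ₗ[MvPolynomial σ Q] (Z ⧸ B) ⧸ ((𝔪 ⊔ 𝔩) • (⊤ : Submodule (MvPolynomial σ Q) (Z ⧸ B))) :=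
      Submodule.factor (Submodule.smul_mono_left le_sup_left)
    have hq0 : ∀ x ∈ 𝔩 • (⊤ : Submodule (MvPolynomial σ Q) E), q x = 0 := by
      intro x hx
      refine Submodule.smul_induction_on hx (fun a ha e _ => ?_) fun x y hx hy => by
        rw [map_add, hx, hy, add_zero]
      rw [map_smul]
      obtain ⟨h, hh⟩ := Submodule.Quotient.mk_surjective _ (q e)
      rw [← hh, ← Submodule.Quotient.mk_smul, Submodule.Quotient.mk_eq_zero]
      exact Submodule.smul_mem_smul (Ideal.mem_sup_right ha) trivial
    refine ⟨?_⟩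
    have : (⊤ : Submodule Q ((Z ⧸ B) ⧸ ((𝔪 ⊔ 𝔩) • (⊤ : Submodule (MvPolynomial σ Q) (Z ⧸ B))))) =
        U.map (q.restrictScalars Q) := by
      refine (eq_top_iff.2 fun y _ => ?_).symm
      obtain ⟨x, rfl⟩ := Submodule.factor_surjective
        (Submodule.smul_mono_left (le_sup_left : 𝔪 ≤ 𝔪 ⊔ 𝔩)) y
      obtain ⟨u, hu, hxu⟩ := hUE x
      refine ⟨u, hu, ?_⟩
      have := hq0 _ hxu
      rw [map_sub, sub_eq_zero] at this
      exact this.symm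
    rw [this]
    exact hU.map _
  obtain ⟨s, hs, hsH⟩ := exists_notMem_of_cut hp hpm (𝔞 := 𝔪 ⊔ 𝔩) (sup_le
    (Ideal.map_le_iff_le_comap.2 hpC) (Ideal.span_le.2 (by rintro _ ⟨a, ha, rfl⟩; exact hpl a ha)))
    hpC hfin
  refine ⟨s, hs, fun v hv => ?_⟩
  have h1 := hsH (Submodule.Quotient.mk ⟨v, hv⟩)
  rw [← Submodule.Quotient.mk_smul, Submodule.Quotient.mk_eq_zero] at h1
  obtain ⟨u, hu⟩ := h1
  exact ⟨u, hu.symm⟩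

end CutHom

open MvPolynomial

section Growth

lemma exists_bound_of_eventually {f g : ℕ → ℕ} (hg : ∀ k, 0 < g k) {A : ℕ}
    (h : ∀ᶠ k in Filter.atTop, f k ≤ A * g k) : ∃ K, ∀ k, f k ≤ K * g k := by
  obtain ⟨k0, hk0⟩ := Filter.eventually_atTop.1 h
  refine ⟨A + ∑ k ∈ Finset.range k0, f k, fun k => ?_⟩
  rcases lt_or_ge k k0 with hk | hk
  · have h1 : f k ≤ ∑ k ∈ Finset.range k0, f k :=
      Finset.single_le_sum (f := f) (fun _ _ => Nat.zero_le _) (Finset.mem_range.2 hk)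
    calc f k ≤ (A + ∑ k ∈ Finset.range k0, f k) * 1 := by omega
      _ ≤ _ := Nat.mul_le_mul_left _ (hg k)
  · exact (hk0 k hk).trans (Nat.mul_le_mul_right _ (Nat.le_add_right _ _))

/-- Partial sums of a sequence of polynomial growth. -/
lemma exists_sum_bound {b b' : ℕ → ℕ} {c L : ℕ}
    (hb : ∃ α : ℝ, ∀ᶠ n : ℕ in Filter.atTop, (b n : ℝ) ≤ α * (n : ℝ) ^ ((c : ℝ) - 1))
    (hb' : ∀ᶠ k in Filter.atTop, b' (L + k) = b (k + 1)) :
    ∃ K, ∀ t, ∑ k ∈ Finset.range t, b' k ≤ K * (t + 1) ^ c := by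
  obtain ⟨α, hα⟩ := hb
  obtain ⟨n0, hn0⟩ := Filter.eventually_atTop.1 hα
  obtain ⟨k0, hk0⟩ := Filter.eventually_atTop.1 hb'
  cases c with
  | zero =>
    obtain ⟨n1, hn1⟩ := exists_nat_gt (|α|)
    refine ⟨∑ k ∈ Finset.range (L + k0 + n0 + n1), b' k, fun t => ?_⟩
    rw [pow_zero, mul_one]
    have h0 : ∀ k, k ∉ Finset.range (L + k0 + n0 + n1) → b' k = 0 := by
      intro k hk
      rw [Finset.mem_range, not_lt] at hk
      obtain ⟨j, rfl⟩ : ∃ j, k = L + j := ⟨k - L, by omega⟩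
      rw [hk0 j (by omega)]
      have h1 := hn0 (j + 1) (by omega)
      have h2 : ((j + 1 : ℕ) : ℝ) ^ (((0 : ℕ) : ℝ) - 1) = ((j + 1 : ℕ) : ℝ)⁻¹ := by
        rw [Nat.cast_zero, zero_sub, Real.rpow_neg_one]
      rw [h2] at h1
      have h3 : (0 : ℝ) < ((j + 1 : ℕ) : ℝ) := by positivity
      have h4 : (b (j + 1) : ℝ) * ((j + 1 : ℕ) : ℝ) ≤ α := by
        rwa [← div_eq_mul_inv, le_div_iff₀ h3] at h1
      by_contra hne
      have h5 : (1 : ℝ) ≤ (b (j + 1) : ℝ) := by exact_mod_cast Nat.one_le_iff_ne_zero.2 hne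
      have h6 : ((n1 : ℕ) : ℝ) ≤ ((j + 1 : ℕ) : ℝ) := by exact_mod_cast (by omega : n1 ≤ j + 1)
      have h7 := le_abs_self α
      nlinarith
    rcases le_total t (L + k0 + n0 + n1) with ht | ht
    · exact Finset.sum_le_sum_of_subset (Finset.range_mono ht)
    · refine le_of_eq (Finset.sum_subset (Finset.range_mono ht) fun k _ hk => h0 k hk).symm
  | succ c =>
    have : ∃ K, ∀ k, b' k ≤ K * (k + 1) ^ c := by
      refine exists_bound_of_eventually (g := fun k => (k + 1) ^ c) (fun k => by positivity)
        (A := ⌈|α|⌉₊) ?_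
      refine Filter.eventually_atTop.2 ⟨L + k0 + n0, fun k hk => ?_⟩
      obtain ⟨j, rfl⟩ : ∃ j, k = L + j := ⟨k - L, by omega⟩
      rw [hk0 j (by omega)]
      have h1 := hn0 (j + 1) (by omega)
      rw [Nat.cast_succ c, add_sub_cancel_right, Real.rpow_natCast] at h1
      have h2 : (b (j + 1) : ℝ) ≤ (⌈|α|⌉₊ : ℝ) * ((L + j + 1 : ℕ) : ℝ) ^ c := by
        refine h1.trans ?_
        refine mul_le_mul ((le_abs_self α).trans (Nat.le_ceil _)) ?_ (by positivity) (by positivity)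
        gcongr
        omega
      exact_mod_cast h2
    obtain ⟨K, hK⟩ := this
    refine ⟨K, fun t => ?_⟩
    calc ∑ k ∈ Finset.range t, b' k ≤ ∑ k ∈ Finset.range t, K * (t + 1) ^ c := by
          refine Finset.sum_le_sum fun k hk => (hK k).trans ?_
          gcongr
          exact (Finset.mem_range.1 hk).le
      _ = t * (K * (t + 1) ^ c) := by simp
      _ ≤ (t + 1) * (K * (t + 1) ^ c) := Nat.mul_le_mul_right _ (Nat.le_succ t)
      _ = K * (t + 1) ^ (c + 1) := by ring

end Growth

section CutHomM

variable {Q : Type u} [CommRing Q] {σ : Type} [Fintype σ]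
  {m n : Type} [Fintype m] [Fintype n] [DecidableEq m] [DecidableEq n]
  {dm : m → ℕ} {dn : n → ℕ}

lemma homM_gr {a : Matrix m m (MvPolynomial σ Q)} {b : Matrix n n (MvPolynomial σ Q)}
    (ha : GrMat dm a) (hb : GrMat dn b) {L : ℕ} (hL : ∀ y, dm y < L) :
    GrMat (fun t : n × m => dn t.1 + (L - dm t.2)) (homM dm dn a b).transpose := by
  rintro ⟨i, j⟩ ⟨k, l⟩ μ h
  show dn i + (L - dm j) + 1 = dn k + (L - dm l) + _
  have hj := hL j
  have hl := hL l
  rw [Matrix.transpose_apply, homM, homD, Matrix.add_apply, coeff_add, Matrix.kroneckerMap_apply,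
    Matrix.kroneckerMap_apply, Matrix.transpose_apply, eps, Matrix.mul_diagonal] at h
  by_cases h1 : coeff μ ((1 : Matrix n n (MvPolynomial σ Q)) k i * a l j) = 0
  · rw [h1, zero_add] at h
    have hlj : l = j := by
      by_contra hlj
      rw [eps, Matrix.diagonal_apply_ne _ hlj, mul_zero, coeff_zero] at h
      exact h rfl
    subst hlj
    have h2 : coeff μ (b i k) ≠ 0 := by
      intro h0
      apply h
      have h3 : b i k * (-1) ^ dn k * eps (MvPolynomial σ Q) dm l l =
          C ((-1) ^ dn k * (-1) ^ dm l) * b i k := by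
        rw [eps, Matrix.diagonal_apply_eq]
        simp only [map_mul, map_pow, map_neg, map_one]
        ring
      rw [h3, coeff_C_mul, h0, mul_zero]
    have := hb i k μ h2
    omega
  · have hki : k = i := by
      by_contra hki
      rw [Matrix.one_apply_ne hki, zero_mul, coeff_zero] at h1
      exact h1 rfl
    subst hki
    rw [Matrix.one_apply_eq, one_mul] at h1
    have := ha l j μ h1
    omega

lemma mem_HB_zero_iff {L : ℕ} (hL : ∀ y, dm y < L) (k : ℕ) (φ : n × m → MvPolynomial σ Q) :
    φ ∈ HB Q σ dm dn 0 k ↔ φ ∈ Hw Q σ (fun t : n × m => dn t.1 + (L - dm t.2)) (L + k) := by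
  constructor
  · rintro h ⟨x, y⟩ μ hμ
    have h1 := h x y μ hμ
    have := hL y
    dsimp only
    omega
  · intro h x y μ hμ
    have h1 := h (x, y) μ hμ
    have := hL y
    dsimp only at h1
    omega

lemma zGen_of_homGen {D : Matrix (n × m) (n × m) (MvPolynomial σ Q)} {L : ℕ}
    (hL : ∀ y, dm y < L) {i r : ℕ} (h : HomGen dm dn D (i + 1) r) :
    ZGen (fun t : n × m => dn t.1 + (L - dm t.2)) D (L + i) r := by
  obtain ⟨φ, hφ, hz⟩ := h
  refine ⟨φ, fun j => ⟨(mem_HB_zero_iff hL _ _).1 (hφ j).1, (hφ j).2⟩, fun z hz1 hz0 => ?_⟩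
  obtain ⟨c, u, hu, h⟩ := hz z ((mem_HB_zero_iff hL _ _).2 hz1) hz0
  exact ⟨c, u, (mem_HB_zero_iff hL _ _).1 (mem_HB_succ.1 hu), h⟩

lemma homGen_of_zGen {D : Matrix (n × m) (n × m) (MvPolynomial σ Q)} {L : ℕ}
    (hL : ∀ y, dm y < L) {i r : ℕ}
    (h : ZGen (fun t : n × m => dn t.1 + (L - dm t.2)) D (L + i) r) :
    HomGen dm dn D (i + 1) r := by
  obtain ⟨φ, hφ, hz⟩ := h
  refine ⟨φ, fun j => ⟨(mem_HB_zero_iff hL _ _).2 (hφ j).1, (hφ j).2⟩, fun z hz1 hz0 => ?_⟩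
  obtain ⟨c, u, hu, h⟩ := hz z ((mem_HB_zero_iff hL _ _).1 hz1) hz0
  exact ⟨c, u, mem_HB_succ.2 ((mem_HB_zero_iff hL _ _).2 hu), h⟩

/-- The number of generators of the cohomology of the Hom complex grows polynomially. -/
theorem exists_homGen [IsNoetherianRing Q] {a : Matrix m m (MvPolynomial σ Q)}
    {b : Matrix n n (MvPolynomial σ Q)} (ha : GrMat dm a) (hb : GrMat dn b) :
    ∃ q, ∀ i, HomGen dm dn (homM dm dn a b) (i + 1) (q * (i + 1) ^ Fintype.card σ) := by
  obtain ⟨L, hL⟩ : ∃ L, ∀ y, dm y < L :=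
    ⟨Finset.univ.sup dm + 1, fun y => Nat.lt_succ_of_le (Finset.le_sup (Finset.mem_univ y))⟩
  obtain ⟨q, hq⟩ := exists_zGen (homM_gr ha hb hL)
  refine ⟨q * (L + 2) ^ Fintype.card σ, fun i => homGen_of_zGen hL ?_⟩
  obtain ⟨φ, hφ, hz⟩ := hq (L + i)
  have hle : q * (L + i + 2) ^ Fintype.card σ ≤
      q * (L + 2) ^ Fintype.card σ * (i + 1) ^ Fintype.card σ := by
    rw [mul_assoc, ← mul_pow]
    refine Nat.mul_le_mul_left _ (Nat.pow_le_pow_left ?_ _)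
    nlinarith
  refine ⟨fun j => if h : j.1 < q * (L + i + 2) ^ Fintype.card σ then φ ⟨j, h⟩ else 0,
    fun j => ?_, fun z hz1 hz0 => ?_⟩
  · dsimp only
    split_ifs
    · exact hφ _
    · exact ⟨Submodule.zero_mem _, Matrix.mulVec_zero _⟩
  · obtain ⟨c, u, hu, h⟩ := hz z hz1 hz0
    refine ⟨fun j => if h : j.1 < q * (L + i + 2) ^ Fintype.card σ then c ⟨j, h⟩ else 0, u, hu, ?_⟩
    rw [h]
    congr 1
    refine Fintype.sum_of_injective (Fin.castLE hle) (Fin.castLE_injective hle) _ _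
      (fun j hj => ?_) fun j => ?_
    · have : ¬ j.1 < q * (L + i + 2) ^ Fintype.card σ := fun h => hj ⟨⟨j, h⟩, rfl⟩
      simp [this]
    · simp

theorem exists_cut_homM [IsLocalRing Q] [IsNoetherianRing Q]
    [Infinite (IsLocalRing.ResidueField Q)] {a : Matrix m m (MvPolynomial σ Q)}
    {b : Matrix n n (MvPolynomial σ Q)} (ha : GrMat dm a) (hb : GrMat dn b)
    (h2 : homM dm dn a b * homM dm dn a b = 0) {c : ℕ} (r : ℕ → ℕ)
    (hr : ∃ α : ℝ, ∀ᶠ n : ℕ in Filter.atTop, (r n : ℝ) ≤ α * (n : ℝ) ^ ((c : ℝ) - 1))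
    (hg : ∀ᶠ i in Filter.atTop, HomGen dm dn (homM dm dn a b) (i + 1) (r (i + 1))) :
    ∃ l : List (σ → Q), l.length ≤ c ∧ ∀ p : Ideal (MvPolynomial σ Q), p.IsPrime → ¬p.IsMaximal →
      (∀ y ∈ IsLocalRing.maximalIdeal Q, (C y : MvPolynomial σ Q) ∈ p) → (∀ a ∈ l, lin a ∈ p) →
      ∃ s ∉ p, Kills (homM dm dn a b) s (MvPolynomial σ Q) := by
  obtain ⟨L, hL⟩ : ∃ L, ∀ y, dm y < L :=
    ⟨Finset.univ.sup dm + 1, fun y => Nat.lt_succ_of_le (Finset.le_sup (Finset.mem_univ y))⟩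
  obtain ⟨q, hq⟩ := exists_zGen (homM_gr ha hb hL)
  obtain ⟨i0, hi0⟩ := Filter.eventually_atTop.1 hg
  let r' : ℕ → ℕ := fun k => if k < L + i0 then q * (k + 2) ^ Fintype.card σ else r (k - L + 1)
  obtain ⟨K, hK⟩ := exists_sum_bound (b' := r') (L := L) hr (by
    refine Filter.eventually_atTop.2 ⟨i0, fun k hk => ?_⟩
    show (if L + k < L + i0 then _ else _) = _
    rw [if_neg (by omega), Nat.add_sub_cancel_left])
  refine exists_cut (fun t => ?_) (homM_gr ha hb hL) h2 r' (fun k => ?_) K c hK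
  · have := hL t.2
    omega
  · show ZGen _ _ _ (if k < L + i0 then _ else _)
    split_ifs with hk
    · exact hq k
    · obtain ⟨j, rfl⟩ : ∃ j, k = L + j := ⟨k - L, by omega⟩
      rw [Nat.add_sub_cancel_left]
      exact zGen_of_homGen hL (hi0 j (by omega))

end CutHomM

open MvPolynomial

section Swap

variable {Q : Type u} [CommRing Q] {σ : Type} [Fintype σ] {X : Type u} [AddCommGroup X] [Module Q X]

lemma Acyc.of_signed_equiv {ι κ : Type} [Fintype ι] [Fintype κ] (e : κ ≃ ι) {deg : ι → ℕ}
    {A : Matrix ι ι (MvPolynomial σ Q)} {A' : Matrix κ κ (MvPolynomial σ Q)} (hA : GrMat deg A)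
    (h : ∀ x y, A' x y = (-1) ^ deg (e x) * A (e x) (e y)) {J : Set σ} {i : ℕ}
    (hac : Acyc 1 deg A J X i) : Acyc 1 (fun x => deg (e x)) A' J X i := by
  classical
  rw [acyc_one] at hac ⊢
  have hd : ∀ (k : ℕ) (z : TC Q σ ι X), z ∈ TD deg J (k + 1) →
      dT A' (fun x => z (e x)) = fun x => (-1 : Q) ^ k • dT A z (e x) := by
    intro k z hz
    have hz1 := dT_mem hA hz
    funext x
    refine LinearMap.ext fun s => ?_
    have h1 : dT A' (fun x => z (e x)) x s = dT A z (e x) ((-1) ^ deg (e x) * s) := by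
      rw [dT_apply, dT_apply, ← e.sum_comp]
      refine Finset.sum_congr rfl fun y _ => ?_
      rw [h]
      congr 1
      ring
    have h2 : ((-1) ^ deg (e x) * s : MvPolynomial σ Q) = ((-1 : Q) ^ deg (e x)) • s := by
      rw [smul_eq_C_mul]; simp
    rw [h1, h2, map_smul, LinearMap.smul_apply]
    have h3 : dT A z (e x) = 0 ∨ (-1 : Q) ^ deg (e x) = (-1) ^ k := by
      by_cases h0 : dT A z (e x) = 0
      · exact Or.inl h0
      · right
        obtain ⟨μ, hμ⟩ : ∃ μ, dT A z (e x) (monomial μ 1) ≠ 0 := by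
          by_contra hc
          push Not at hc
          exact h0 ((basisMonomials σ Q).ext fun μ => by simpa using hc μ)
        rw [← (hz1 _ _ hμ).1, pow_add, pow_mul, neg_one_sq, one_pow, mul_one]
    rcases h3 with h3 | h3
    · simp [h3]
    · rw [h3]
  have hu : ∀ k : ℕ, (-1 : Q) ^ k * (-1) ^ k = 1 := fun k => by
    rw [← mul_pow, neg_one_mul, neg_neg, one_pow]
  have hsm : ∀ (deg' : κ → ℕ) (k : ℕ) (z : TC Q σ κ X), z ∈ TD deg' J k →
      (fun x => z (e.symm x)) ∈ (TD (fun x => deg' (e.symm x)) J k : Submodule Q (TC Q σ ι X)) :=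
    fun deg' k z hz x μ hμ => hz _ μ hμ
  intro z hz hz0
  let z' : TC Q σ ι X := fun x => z (e.symm x)
  have hzz : z = fun x => z' (e x) := by funext x; simp [z']
  have hz' : z' ∈ TD deg J i := by
    intro x μ hμ
    have := hz _ μ hμ
    simpa using this
  have hz0' : dT A z' = 0 := by
    cases i with
    | zero => exact dT_zero_deg hA hz'
    | succ k =>
      rw [hzz, hd k z' hz'] at hz0
      funext x
      have := congrFun hz0 (e.symm x)
      rw [Equiv.apply_symm_apply] at this
      have h4 := congrArg (fun w => (-1 : Q) ^ k • w) this
      simpa [smul_smul, hu] using h4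
  obtain ⟨w, hw, hwz⟩ := hac z' hz' hz0'
  refine ⟨fun x => (-1 : Q) ^ i • w (e x), fun x μ hμ => hw (e x) μ ?_, ?_⟩
  · exact right_ne_zero_of_smul (by simpa using hμ)
  · have h5 : (fun x => (-1 : Q) ^ i • w (e x)) = ((-1 : Q) ^ i • fun x => w (e x) : TC Q σ κ X) :=
      rfl
    rw [h5, map_smul, hd i w hw, hwz, hzz]
    funext x
    simp [smul_smul, hu]

variable {m n : Type} [Fintype m] [Fintype n] [DecidableEq m] [DecidableEq n]
  {dm : m → ℕ} {dn : n → ℕ} {a : Matrix m m (MvPolynomial σ Q)} {b : Matrix n n (MvPolynomial σ Q)}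

lemma tenM_swap (ha : GrMat dm a) (hb : GrMat dn b) {J : Set σ} {i : ℕ}
    (h : Acyc 1 (fun x : n × m => dn x.1 + dm x.2) (tenM dm dn a b) J X i) :
    Acyc 1 (fun x : m × n => dm x.1 + dn x.2) (tenM dn dm b a) J X i := by
  have := Acyc.of_signed_equiv (Equiv.prodComm m n) (tenM_gr ha hb)
    (A' := tenM dn dm b a) (fun x y => ?_) h
  · have h2 : (fun x : m × n => dm x.1 + dn x.2) =
        fun x => dn ((Equiv.prodComm m n) x).1 + dm ((Equiv.prodComm m n) x).2 :=
      funext fun x => add_comm _ _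
    rw [h2]
    exact this
  · obtain ⟨x, x'⟩ := x
    obtain ⟨y, y'⟩ := y
    show tenM dn dm b a (x, x') (y, y') = (-1) ^ (dn x' + dm x) * tenM dm dn a b (x', x) (y', y)
    simp only [tenM, tenD, Matrix.add_apply, Matrix.kroneckerMap_apply, eps,
      Matrix.diagonal_mul, Matrix.diagonal_apply, Matrix.one_apply]
    have hu : ∀ k : ℕ, ((-1 : MvPolynomial σ Q) ^ k) * (-1) ^ k = 1 := fun k => by
      rw [← mul_pow, neg_one_mul, neg_neg, one_pow]
    have h1 := hu (dn x')
    have h2 := hu (dm x)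
    rw [pow_add]
    split_ifs
    · linear_combination (-a x y) * ((-1) ^ dm x) ^ 2 * h1 - a x y * h2
    · linear_combination (-a x y) * ((-1) ^ dm x) ^ 2 * h1 - a x y * h2
    · ring
    · ring

end Swap

open MvPolynomial

section Coordinates

variable {Q : Type u} [CommRing Q] {σ : Type} [Fintype σ]

lemma lin_add (c d : σ → Q) : lin (c + d) = lin c + lin d := by
  simp [lin, add_mul, Finset.sum_add_distrib]

lemma lin_smul (r : Q) (c : σ → Q) : lin (r • c) = r • lin c := by
  simp [lin, Finset.smul_sum, smul_eq_C_mul, mul_assoc]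

/-- Vectors can be moved into few coordinates modulo the maximal ideal. -/
lemma exists_coordinates [IsLocalRing Q] (l : List (σ → Q)) :
    ∃ (g : (σ → Q) ≃ₗ[Q] (σ → Q)) (J : Set σ), J.ncard ≤ l.length ∧
      ∀ a ∈ l, ∀ k ∉ J, g a k ∈ IsLocalRing.maximalIdeal Q := by
  classical
  induction l with
  | nil => exact ⟨LinearEquiv.refl _ _, ∅, by simp, by simp⟩
  | cons b l ih =>
    obtain ⟨g, J, hJ, h⟩ := ih
    by_cases hb : ∀ k ∉ J, g b k ∈ IsLocalRing.maximalIdeal Q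
    · refine ⟨g, J, hJ.trans (by simp), fun a ha => ?_⟩
      rcases List.mem_cons.1 ha with rfl | ha
      · exact hb
      · exact h a ha
    · push Not at hb
      obtain ⟨k0, hk0, hu⟩ := hb
      rw [IsLocalRing.mem_maximalIdeal, mem_nonunits_iff, not_not] at hu
      obtain ⟨v, hv⟩ := hu
      let u : σ → Q := fun k => if k = k0 then 0 else ↑v⁻¹ * g b k
      have hu0 : u k0 = 0 := if_pos rfl
      let E : (σ → Q) ≃ₗ[Q] (σ → Q) :=
        { toFun := fun x => x - x k0 • u
          invFun := fun x => x + x k0 • u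
          map_add' := fun x y => by simp only [Pi.add_apply, add_smul]; abel
          map_smul' := fun r x => by simp [smul_sub, smul_smul]
          left_inv := fun x => by simp [hu0]
          right_inv := fun x => by simp [hu0] }
      have hE : ∀ x k, E x k = x k - x k0 * u k := fun x k => rfl
      refine ⟨g.trans E, insert k0 J, (Set.ncard_insert_le _ _).trans (by simpa using hJ),
        fun a ha k hk => ?_⟩
      rw [Set.mem_insert_iff, not_or] at hk
      rw [LinearEquiv.trans_apply, hE]
      rcases List.mem_cons.1 ha with rfl | ha
      · have : u k = ↑v⁻¹ * g a k := if_neg hk.1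
        rw [this, ← hv, ← mul_assoc, Units.mul_inv, one_mul, sub_self]
        exact Ideal.zero_mem _
      · exact Ideal.sub_mem _ (h a ha k hk.2) (Ideal.mul_mem_right _ _ (h a ha k0 hk0))

variable [DecidableEq σ]

/-- The linear substitution given by a linear map. -/
def subLin (g : (σ → Q) →ₗ[Q] (σ → Q)) : MvPolynomial σ Q →ₐ[Q] MvPolynomial σ Q :=
  aeval fun j => lin (g (Pi.single j 1))

lemma lin_single (j : σ) : lin (Pi.single j (1 : Q)) = X j := by
  rw [lin, Finset.sum_eq_single j]
  · simp
  · intro k _ hk; simp [hk]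
  · simp

lemma subLin_lin (g : (σ → Q) →ₗ[Q] (σ → Q)) (c : σ → Q) : subLin g (lin c) = lin (g c) := by
  let L : (σ → Q) →ₗ[Q] MvPolynomial σ Q := ⟨⟨lin, lin_add⟩, lin_smul⟩
  have : (subLin g).toLinearMap ∘ₗ L = L ∘ₗ g := by
    refine LinearMap.pi_ext' fun j => LinearMap.ext_ring ?_
    show subLin g (lin (Pi.single j 1)) = lin (g (Pi.single j 1))
    rw [lin_single, subLin, aeval_X]
  exact LinearMap.congr_fun this c

/-- The linear change of coordinates given by a linear equivalence. -/
def subEquiv (g : (σ → Q) ≃ₗ[Q] (σ → Q)) : MvPolynomial σ Q ≃ₐ[Q] MvPolynomial σ Q :=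
  AlgEquiv.ofAlgHom (subLin g.toLinearMap) (subLin g.symm.toLinearMap)
    (algHom_ext fun j => by
      rw [AlgHom.comp_apply, ← lin_single, subLin_lin, subLin_lin]; simp)
    (algHom_ext fun j => by
      rw [AlgHom.comp_apply, ← lin_single, subLin_lin, subLin_lin]; simp)

lemma subEquiv_lin (g : (σ → Q) ≃ₗ[Q] (σ → Q)) (c : σ → Q) :
    subEquiv g (lin c) = lin (g c) := subLin_lin _ c

lemma subEquiv_symm_lin (g : (σ → Q) ≃ₗ[Q] (σ → Q)) (c : σ → Q) :
    (subEquiv g).symm (lin c) = lin (g.symm c) := subLin_lin _ c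

lemma subEquiv_symm (g : (σ → Q) ≃ₗ[Q] (σ → Q)) : (subEquiv g).symm = subEquiv g.symm := rfl

lemma lin_homogeneous (c : σ → Q) : (lin c).IsHomogeneous 1 := by
  refine IsHomogeneous.sum _ _ _ fun j _ => ?_
  have := (isHomogeneous_C σ (c j)).mul (isHomogeneous_X Q j)
  simpa using this

lemma subEquiv_homogeneous (g : (σ → Q) ≃ₗ[Q] (σ → Q)) {p : MvPolynomial σ Q} {k : ℕ}
    (hp : p.IsHomogeneous k) : (subEquiv g p).IsHomogeneous k := by
  have := hp.aeval (fun j => lin (g (Pi.single j 1))) (n := 1) fun j => lin_homogeneous _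
  rwa [one_mul] at this

lemma degree_of_coeff_subEquiv (g : (σ → Q) ≃ₗ[Q] (σ → Q)) {p : MvPolynomial σ Q} {μ : σ →₀ ℕ}
    (h : coeff μ (subEquiv g p) ≠ 0) : ∃ ν, coeff ν p ≠ 0 ∧ ν.degree = μ.degree := by
  rw [p.as_sum, map_sum, coeff_sum] at h
  obtain ⟨ν, hν, h⟩ := Finset.exists_ne_zero_of_sum_ne_zero h
  refine ⟨ν, mem_support_iff.1 hν, ?_⟩
  by_contra hne
  apply h
  refine (subEquiv_homogeneous g (isHomogeneous_monomial (coeff ν p) rfl)).coeff_eq_zero ?_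
  exact fun h => hne h.symm

variable {N : Type u} [AddCommGroup N] [Module Q N] {ι : Type} [Fintype ι] [DecidableEq ι]
  {f : σ → Q} {G : FinRes Q N ι}

lemma GrMat.subEquiv (g : (σ → Q) ≃ₗ[Q] (σ → Q)) {deg : ι → ℕ}
    {A : Matrix ι ι (MvPolynomial σ Q)} (hA : GrMat deg A) :
    GrMat deg (A.map (subEquiv g)) := by
  intro x y μ h
  obtain ⟨ν, h1, h2⟩ := degree_of_coeff_subEquiv g h
  rw [← h2]
  exact hA x y ν h1

/-- Change of coordinates in a matrix factorization. -/
def MF.sub (F : MF f G) (g : (σ → Q) ≃ₗ[Q] (σ → Q)) : MF (g f) G where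
  A := F.A.map (subEquiv g)
  gr := GrMat.subEquiv g F.gr
  sq := by
    have h1 : (F.A * F.A).map (subEquiv g) = F.A.map (subEquiv g) * F.A.map (subEquiv g) :=
      Matrix.map_mul (f := (subEquiv g : MvPolynomial σ Q →+* MvPolynomial σ Q))
    rw [← h1, F.sq]
    refine Matrix.ext fun x y => ?_
    have h2 : subEquiv g (pot f) = pot (g f) := subEquiv_lin g f
    by_cases hxy : x = y
    · subst hxy; simp [h2]
    · simp [hxy]
  zero_coeff x y := by
    have h0 : coeff 0 (subEquiv g (F.A x y)) = coeff 0 (F.A x y) := by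
      conv_lhs => rw [← sub_add_cancel (F.A x y) (C (coeff 0 (F.A x y))), map_add, coeff_add]
      have h1 : subEquiv g (C (coeff 0 (F.A x y))) = C (coeff 0 (F.A x y)) :=
        (subEquiv g).commutes _
      rw [h1, coeff_C, if_pos rfl, add_eq_right]
      by_contra h
      obtain ⟨ν, h2, h3⟩ := degree_of_coeff_subEquiv g h
      have h4 : ν = 0 := (Finsupp.degree_eq_zero_iff _).1 (by simpa using h3)
      subst h4
      simp at h2
    exact h0.trans (F.zero_coeff x y)

variable {X : Type u} [AddCommGroup X] [Module Q X]

/-- Composition of functionals with a change of coordinates. -/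
def TC.sub (g : (σ → Q) ≃ₗ[Q] (σ → Q)) (z : TC Q σ ι X) : TC Q σ ι X :=
  fun x => z x ∘ₗ (subEquiv g).symm.toLinearMap

lemma dT_sub (g : (σ → Q) ≃ₗ[Q] (σ → Q)) (A : Matrix ι ι (MvPolynomial σ Q)) (z : TC Q σ ι X) :
    dT (A.map (subEquiv g)) (TC.sub g z) = TC.sub g (dT A z) := by
  funext x
  refine LinearMap.ext fun s => ?_
  rw [dT_apply]
  show ∑ y, z y ((subEquiv g).symm (subEquiv g (A x y) * s)) = dT A z x ((subEquiv g).symm s)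
  rw [dT_apply]
  simp

lemma TC.sub_symm (g : (σ → Q) ≃ₗ[Q] (σ → Q)) (z : TC Q σ ι X) :
    TC.sub g (TC.sub g.symm z) = z := by
  funext x
  refine LinearMap.ext fun s => ?_
  show z x ((subEquiv g.symm).symm ((subEquiv g).symm s)) = z x s
  rw [subEquiv_symm g, AlgEquiv.symm_apply_apply]

lemma TC.sub_smul (g : (σ → Q) ≃ₗ[Q] (σ → Q)) (c : Q) (z : TC Q σ ι X) :
    TC.sub g (c • z) = c • TC.sub g z := rfl

lemma TC.sub_zero (g : (σ → Q) ≃ₗ[Q] (σ → Q)) : TC.sub g (0 : TC Q σ ι X) = 0 := rfl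

lemma TC.sub_mem (g : (σ → Q) ≃ₗ[Q] (σ → Q)) {deg : ι → ℕ} {J : Set σ}
    (hJ : J = ∅ ∨ J = Set.univ) {i : ℕ} {z : TC Q σ ι X} (hz : z ∈ TD deg J i) :
    TC.sub g z ∈ TD deg J i := by
  intro x μ h
  have h' : z x ((subEquiv g).symm (monomial μ 1)) ≠ 0 := h
  rw [apply_eq_sum] at h'
  obtain ⟨ν, hν, h1⟩ := Finset.exists_ne_zero_of_sum_ne_zero h'
  have h2 := hz x ν (right_ne_zero_of_smul h1)
  rw [subEquiv_symm] at hν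
  obtain ⟨ξ, h3, h4⟩ := degree_of_coeff_subEquiv g.symm (mem_support_iff.1 hν)
  have h5 : μ = ξ := by
    classical
    rw [coeff_monomial] at h3
    by_contra hne
    simp [hne] at h3
  subst h5
  rw [h4]
  refine ⟨h2.1, ?_⟩
  rcases hJ with rfl | rfl
  · simp
  · have : ν = 0 := Finsupp.ext fun l => h2.2 l trivial
    subst this
    have : μ = 0 := (Finsupp.degree_eq_zero_iff _).1 (by simpa using h4)
    subst this
    simp

lemma TC.sub_mem_Bd (g : (σ → Q) ≃ₗ[Q] (σ → Q)) {deg : ι → ℕ} {J : Set σ}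
    (hJ : J = ∅ ∨ J = Set.univ) {A : Matrix ι ι (MvPolynomial σ Q)} {i : ℕ} {z : TC Q σ ι X}
    (h : z ∈ Bd deg A J i) : TC.sub g z ∈ Bd deg (A.map (subEquiv g)) J i := by
  obtain ⟨w, hw, rfl⟩ := h
  exact ⟨TC.sub g w, TC.sub_mem g hJ hw, dT_sub g A w⟩

lemma exists_sub_eq (g : (σ → Q) ≃ₗ[Q] (σ → Q)) {deg : ι → ℕ} {J : Set σ}
    (hJ : J = ∅ ∨ J = Set.univ) {A : Matrix ι ι (MvPolynomial σ Q)} {i : ℕ} {z : TC Q σ ι X}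
    (hz : z ∈ TD deg J i) (h0 : dT (A.map (subEquiv g)) z = 0) :
    ∃ w ∈ TD deg J i, dT A w = 0 ∧ TC.sub g w = z := by
  refine ⟨TC.sub g.symm z, TC.sub_mem g.symm hJ hz, ?_, TC.sub_symm g z⟩
  have h1 := dT_sub g A (TC.sub g.symm z)
  rw [TC.sub_symm, h0] at h1
  have h2 := TC.sub_symm g.symm (dT A (TC.sub g.symm z))
  rw [LinearEquiv.symm_symm, ← h1] at h2
  exact h2.symm

lemma Acyc.sub (g : (σ → Q) ≃ₗ[Q] (σ → Q)) {deg : ι → ℕ} {J : Set σ}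
    (hJ : J = ∅ ∨ J = Set.univ) {A : Matrix ι ι (MvPolynomial σ Q)} {i : ℕ} {y : Q}
    (h : Acyc y deg A J X i) : Acyc y deg (A.map (subEquiv g)) J X i := by
  intro z hz h0
  obtain ⟨w, hw, hw0, rfl⟩ := exists_sub_eq g hJ hz h0
  obtain ⟨t, ht⟩ := h w hw hw0
  exact ⟨t, TC.sub_mem_Bd g hJ ht⟩

lemma nosoc_sub (g : (σ → Q) ≃ₗ[Q] (σ → Q)) {deg : ι → ℕ} {A : Matrix ι ι (MvPolynomial σ Q)}
    {i : ℕ} {m : Set Q}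
    (h : ∀ z : TC Q σ ι X, z ∈ TD deg Set.univ i → dT A z = 0 →
      (∀ y ∈ m, y • z ∈ Bd deg A Set.univ i) → z ∈ Bd deg A Set.univ i) :
    ∀ z : TC Q σ ι X, z ∈ TD deg Set.univ i → dT (A.map (subEquiv g)) z = 0 →
      (∀ y ∈ m, y • z ∈ Bd deg (A.map (subEquiv g)) Set.univ i) →
      z ∈ Bd deg (A.map (subEquiv g)) Set.univ i := by
  intro z hz h0 hy
  obtain ⟨w, hw, hw0, rfl⟩ := exists_sub_eq g (Or.inr rfl) hz h0
  refine TC.sub_mem_Bd g (Or.inr rfl) (h w hw hw0 fun y hym => ?_)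
  obtain ⟨v, hv, hvy⟩ := hy y hym
  refine ⟨TC.sub g.symm v, TC.sub_mem g.symm (Or.inr rfl) hv, ?_⟩
  have h1 := dT_sub g A (TC.sub g.symm v)
  rw [TC.sub_symm, hvy, ← TC.sub_smul] at h1
  have h2 := congrArg (TC.sub g.symm) h1
  have h3 : ∀ u : TC Q σ ι X, TC.sub g.symm (TC.sub g u) = u := TC.sub_symm g.symm
  rw [h3, h3] at h2
  exact h2.symm

end Coordinates

open MvPolynomial

section Coordinates

variable {Q : Type u} [CommRing Q] {σ : Type} [Fintype σ] [DecidableEq σ]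

lemma Kills.map_equiv {A : Type*} [CommRing A] {n : Type} [Fintype n] (φ : A ≃+* A)
    {D : Matrix n n A} {s : A} (h : Kills D s A) : Kills (D.map φ) (φ s) A := by
  intro v hv
  obtain ⟨w, hw⟩ := h (fun i => φ.symm (v i)) (funext fun i => φ.injective (by
    have := congrFun hv i
    simpa [mv] using this))
  refine ⟨fun i => φ (w i), funext fun i => ?_⟩
  have := congrArg φ (congrFun hw i)
  simpa [mv] using this

lemma homM_map_subEquiv {m n : Type} [Fintype m] [Fintype n] [DecidableEq m] [DecidableEq n]
    (g : (σ → Q) ≃ₗ[Q] (σ → Q)) (dm : m → ℕ) (dn : n → ℕ) (a : Matrix m m (MvPolynomial σ Q))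
    (b : Matrix n n (MvPolynomial σ Q)) :
    (homM dm dn a b).map (subEquiv g) = homM dm dn (a.map (subEquiv g)) (b.map (subEquiv g)) := by
  have h1 := homD_map ((subEquiv g : MvPolynomial σ Q ≃ₐ[Q] MvPolynomial σ Q) :
    MvPolynomial σ Q →+* MvPolynomial σ Q) (eps _ dm) a (eps _ dn) b
  rw [eps_map, eps_map] at h1
  exact h1

lemma lin_mem_cutI [IsLocalRing Q] {J : Set σ} {c : σ → Q}
    (h : ∀ k ∉ J, c k ∈ IsLocalRing.maximalIdeal Q) : lin c ∈ cutI Q J := by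
  intro μ hμ
  have : coeff μ (lin c) = ∑ j, if Finsupp.single j 1 = μ then c j else 0 := coeff_pot c μ
  rw [this]
  refine sum_mem fun j _ => ?_
  split_ifs with hj
  · refine h j fun hJ => ?_
    have := hμ j hJ
    rw [← hj] at this
    simp at this
  · exact zero_mem _

lemma map_apply_mem (g : (σ → Q) →ₗ[Q] (σ → Q)) {f : σ → Q} {I : Ideal Q} (hf : ∀ j, f j ∈ I)
    (k : σ) : g f k ∈ I := by
  rw [LinearMap.pi_apply_eq_sum_univ, Finset.sum_apply]
  exact sum_mem fun j _ => I.mul_mem_right _ (hf j)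

variable [IsLocalRing Q] [IsNoetherianRing Q] [Infinite (IsLocalRing.ResidueField Q)]
  {M N : Type u} [AddCommGroup M] [Module Q M] [AddCommGroup N] [Module Q N]
  {m n : Type} [Fintype m] [Fintype n] [DecidableEq m] [DecidableEq n]
  {G : FinRes Q M n} {H : FinRes Q N m} {f : σ → Q}

theorem exists_acyc_sub (A : MF f G) (B : MF f H) (hf : ∀ j, f j ∈ IsLocalRing.maximalIdeal Q)
    {rs : List Q} (hrs : RingTheory.Sequence.IsWeaklyRegular Q rs)
    (hrm : Ideal.ofList rs = IsLocalRing.maximalIdeal Q) {c : ℕ} (r : ℕ → ℕ)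
    (hr : ∃ α : ℝ, ∀ᶠ n : ℕ in Filter.atTop, (r n : ℝ) ≤ α * (n : ℝ) ^ ((c : ℝ) - 1))
    (hg : ∀ᶠ i in Filter.atTop,
      HomGen H.deg G.deg (homM H.deg G.deg B.A A.A) (i + 1) (r (i + 1))) :
    ∃ (g : (σ → Q) ≃ₗ[Q] (σ → Q)) (J : Set σ), J.ncard ≤ c ∧
      ∃ i₀, ∀ i ≥ i₀, Acyc 1 G.deg (A.sub g).A J N i := by
  obtain ⟨l, hl, hp⟩ := exists_cut_homM B.gr A.gr (homM_sq B.gr A.gr B.sq A.sq) r hr hg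
  obtain ⟨g, J, hJ, hgJ⟩ := exists_coordinates l
  refine ⟨g, J, hJ.trans hl, ?_⟩
  have hgf : ∀ k, g f k ∈ IsLocalRing.maximalIdeal Q := map_apply_mem g.toLinearMap hf
  suffices hp' : ∀ p : Ideal (MvPolynomial σ Q), p.IsPrime → ¬p.IsMaximal → cutI Q J ≤ p →
      ∃ s ∉ p, Kills (homM H.deg G.deg (B.sub g).A (A.sub g).A) s (MvPolynomial σ Q) by
    obtain ⟨i₀, h⟩ := tenM_acyc (B.sub g).gr (A.sub g).gr (B.sub g).sq (A.sub g).sq (J := J)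
      (lin_mem_cutI fun k _ => hgf k) hrs hrm hp'
    exact ⟨i₀, fun i hi => acyc_of_tenM (F := B.sub g) (A.sub g).gr (A.sub g).sq
      (tenM_swap (B.sub g).gr (A.sub g).gr (h i hi))⟩
  intro p hpp hpm hJp
  let φ : MvPolynomial σ Q ≃+* MvPolynomial σ Q := (subEquiv g).toRingEquiv
  have h1 : ¬(p.comap φ).IsMaximal := fun hmax => hpm (by
    rw [← Ideal.map_comap_of_surjective φ φ.surjective p]
    exact Ideal.IsMaximal.map_bijective φ φ.bijective hmax)
  have h2 : ∀ y ∈ IsLocalRing.maximalIdeal Q, (C y : MvPolynomial σ Q) ∈ p.comap φ := by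
    intro y hy
    have h : φ (C y) = C y := (subEquiv g).commutes _
    rw [Ideal.mem_comap, h]
    exact hJp (C_mem_cutI J hy)
  have h3 : ∀ a ∈ l, (lin a : MvPolynomial σ Q) ∈ p.comap φ := by
    intro a ha
    have h : φ (lin a) = lin (g a) := subEquiv_lin g a
    rw [Ideal.mem_comap, h]
    exact hJp (lin_mem_cutI (hgJ a ha))
  obtain ⟨s, hs, hk⟩ := hp (p.comap φ) (Ideal.IsPrime.comap φ) h1 h2 h3
  refine ⟨φ s, hs, ?_⟩
  show Kills (homM H.deg G.deg (B.A.map (subEquiv g)) (A.A.map (subEquiv g))) _ _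
  rw [← homM_map_subEquiv]
  exact hk.map_equiv φ

end Coordinates

section Core

open scoped TensorProduct

variable {Q : Type u} [CommRing Q] {M : Type u} [AddCommGroup M] [Module Q M]

/-- Base change along a surjection does nothing to modules over the target. -/
def tensorEquivOfSurjective {R : Type u} [CommRing R] [Algebra Q R] [Module R M]
    [IsScalarTower Q R M] (hs : Function.Surjective (algebraMap Q R)) : R ⊗[Q] M ≃ₗ[Q] M :=
  LinearEquiv.ofLinearMap
    (TensorProduct.lift ((Algebra.lsmul Q Q M).toLinearMap : R →ₗ[Q] M →ₗ[Q] M))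
    (TensorProduct.mk Q R M 1)
    (by ext x; simp)
    (by
      refine TensorProduct.ext' fun x y => ?_
      obtain ⟨c, rfl⟩ := hs x
      simp [Algebra.algebraMap_eq_smul_one, TensorProduct.smul_tmul])

variable [IsLocalRing Q] [IsNoetherianRing Q] [Infinite (IsLocalRing.ResidueField Q)]
  {Nf : ℕ → Type u} [∀ j, AddCommGroup (Nf j)] [∀ j, Module Q (Nf j)]
  {m n : Type} [Fintype m] [Fintype n] [DecidableEq m] [DecidableEq n]
  {G : FinRes Q M n} {H : FinRes Q (Nf 0) m} {e : ℕ} {f : Fin e → Q}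

theorem core_completeIntersection (A : MF f G) (B : MF f H)
    (hf : ∀ j, f j ∈ IsLocalRing.maximalIdeal Q) (hreg : IsRegFam f)
    {rs : List Q} (hrs : RingTheory.Sequence.IsWeaklyRegular Q rs)
    (hrm : Ideal.ofList rs = IsLocalRing.maximalIdeal Q)
    (R : Type u) [CommRing R] [Algebra Q R] [Module R M] [IsScalarTower Q R M]
    [∀ j, Module R (Nf j)] [∀ j, IsScalarTower Q R (Nf j)]
    (hs : Function.Surjective (algebraMap Q R))
    (hk : RingHom.ker (algebraMap Q R) = Ideal.span (Set.range f))
    {c : ℕ} (r : ℕ → ℕ)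
    (hr : ∃ α : ℝ, ∀ᶠ n : ℕ in Filter.atTop, (r n : ℝ) ≤ α * (n : ℝ) ^ ((c : ℝ) - 1))
    (hg : ∀ᶠ i in Filter.atTop,
      HomGen H.deg G.deg (homM H.deg G.deg B.A A.A) (i + 1) (r (i + 1)))
    {b d L : ℕ} (hc : c + 1 ≤ d) (hL : ∀ x, G.deg x ≤ L) (hd : d < b) (ht : d + 1 + L ≤ b + e)
    {I : ℕ → Type u} {p : ∀ j, Nf j →ₗ[R] (I j →₀ R)} {q : ∀ j, (I j →₀ R) →ₗ[R] Nf (j + 1)}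
    (hp : ∀ j < b, Function.Injective (p j)) (hq : ∀ j < b, Function.Surjective (q j))
    (hpq : ∀ j < b, Function.Exact (p j) (q j))
    (htor : ∃ n, ∀ i, n ≤ i → ∀ y ∈ IsLocalRing.maximalIdeal Q, Acyc y G.deg A.A ∅ (Nf 0) i)
    {ss : List Q} (hss : ∀ s ∈ ss, s ∈ IsLocalRing.maximalIdeal Q)
    (hM : RingTheory.Sequence.IsWeaklyRegular M ss) (hdl : d < ss.length)
    (hE : ∀ i < d, EV (IsLocalRing.maximalIdeal Q) (Nf 0 ⊗[Q] M) i)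
    (hEd : ¬ EV (IsLocalRing.maximalIdeal Q) (Nf 0 ⊗[Q] M) d) : False := by
  classical
  obtain ⟨g, J, hJ, hJe⟩ := exists_acyc_sub A B hf hrs hrm r hr hg
  have hkill : ∀ (X : Type u) [AddCommGroup X] [Module Q X] [Module R X] [IsScalarTower Q R X]
      (l : Fin e) (x : X), g f l • x = 0 := by
    intro X _ _ _ _ l x
    have h1 : g f l ∈ RingHom.ker (algebraMap Q R) := by
      rw [hk]
      exact map_apply_mem g.toLinearMap (fun j => Ideal.subset_span (Set.mem_range_self j)) l
    rw [← algebraMap_smul R, (RingHom.mem_ker).1 h1, zero_smul]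
  have hsoc : ∀ x : M, (∀ y ∈ IsLocalRing.maximalIdeal Q, y • x = 0) → x = 0 :=
    EV.zero_iff.1 (EV.of_isWeaklyRegular' hss hM (by omega))
  have hst := fun j => stage_free (m := IsLocalRing.maximalIdeal Q) hreg hsoc A R hs hk (I j)
  refine core (m := IsLocalRing.maximalIdeal Q) (F := A.sub g) (M := Nf)
    (Fr := fun j => I j →₀ R) (p := fun j => (p j).restrictScalars Q)
    (q := fun j => (q j).restrictScalars Q) (J := J) (IsNoetherian.noetherian _) hL hd
    (by simpa using ht) hp hq hpq (fun j _ l x => hkill _ l x) (fun j _ l x => hkill _ l x)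
    (fun j _ i hi => ?_) (fun j _ i hi => ?_) (fun j _ => ?_) ?_ (by omega) hJe
    (fun j _ i hi => ?_) hE hEd
  · have := (hst j).exact i hi
    rw [Jge_self] at this
    exact this.sub g (Or.inl rfl)
  · exact ((hst j).van i (by simpa using hi)).sub g (Or.inr rfl)
  · rw [Fintype.card_fin]
    exact nosoc_sub g (hst j).nosoc
  · obtain ⟨n, hn⟩ := htor
    exact ⟨n, fun i hi y hy => (hn i hi y hy).sub g (Or.inl rfl)⟩
  · exact (EV.of_isWeaklyRegular (I j) hss hM (by omega)).of_equiv
      ((TensorProduct.finsuppLeft Q Q R M (I j)) ≪≫ₗ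
        Finsupp.mapRange.linearEquiv (tensorEquivOfSurjective hs)).symm

end Core

open MvPolynomial Abelian

section Links

variable {R : Type u} [CommRing R]

/-- A projective resolution given by concrete modules and linear maps. -/
structure Res {P : ℕ → Type u} [∀ i, AddCommGroup (P i)] [∀ i, Module R (P i)]
    (d : ∀ i, P (i + 1) →ₗ[R] P i) {X : Type u} [AddCommGroup X] [Module R X]
    (ε : P 0 →ₗ[R] X) : Prop where
  proj : ∀ i, Module.Projective R (P i)
  surj : Function.Surjective ε
  exact_zero : Function.Exact (d 0) ε
  exact_succ : ∀ i, Function.Exact (d (i + 1)) (d i)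

variable {P : ℕ → Type u} [∀ i, AddCommGroup (P i)] [∀ i, Module R (P i)]
  {d : ∀ i, P (i + 1) →ₗ[R] P i} {X : Type u} [AddCommGroup X] [Module R X] {ε : P 0 →ₗ[R] X}

/-- The chain complex of a concrete resolution. -/
def Res.cpx (h : Res d ε) : ChainComplex (ModuleCat.{u} R) ℕ :=
  ChainComplex.of (fun i => ModuleCat.of R (P i)) (fun i => ModuleCat.ofHom (d i)) fun i => by
    ext x
    exact (h.exact_succ i).apply_apply_eq_zero x

lemma Res.cpx_d (h : Res d ε) (i : ℕ) : h.cpx.d (i + 1) i = ModuleCat.ofHom (d i) :=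
  ChainComplex.of_d (fun i => ModuleCat.of R (P i)) (fun i => ModuleCat.ofHom (d i)) i

/-- The projective resolution of a concrete resolution. -/
def Res.toResolution (h : Res d ε) : ProjectiveResolution (ModuleCat.of R X) where
  complex := h.cpx
  projective i := by
    have := h.proj i
    exact (IsProjective.iff_projective (R := R) (P i)).1 this
  π := (ChainComplex.toSingle₀Equiv _ _).symm ⟨ModuleCat.ofHom ε, by
    rw [h.cpx_d]
    ext x
    exact h.exact_zero.apply_apply_eq_zero x⟩
  quasiIso := ⟨fun n => by
    cases n with
    | zero =>
      rw [ChainComplex.quasiIsoAt₀_iff, ShortComplex.quasiIso_iff_of_zeros' _ rfl rfl rfl]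
      have hw : ModuleCat.ofHom (d 0) ≫ ModuleCat.ofHom ε = 0 := by
        ext x
        exact h.exact_zero.apply_apply_eq_zero x
      refine (ShortComplex.exact_and_epi_g_iff_of_iso
        (S₂ := ShortComplex.mk (ModuleCat.ofHom (d 0)) (ModuleCat.ofHom ε) hw) ?_).2 ⟨?_, ?_⟩
      · refine ShortComplex.isoMk (Iso.refl _) (Iso.refl _) (Iso.refl _) ?_ ?_
        · exact (Category.id_comp _).trans ((h.cpx_d 0).symm.trans (Category.comp_id _).symm)
        · refine (Category.id_comp _).trans (Eq.trans ?_ (Category.comp_id _).symm)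
          exact (ChainComplex.toSingle₀Equiv_symm_apply_f_zero (C := h.cpx)
            (X := ModuleCat.of R X) (ModuleCat.ofHom ε) _).symm
      · rw [ShortComplex.ShortExact.moduleCat_exact_iff_function_exact]
        exact h.exact_zero
      · exact (ModuleCat.epi_iff_surjective _).2 h.surj
    | succ n =>
      rw [quasiIsoAt_iff_exactAt']
      · rw [HomologicalComplex.exactAt_iff' _ (n + 1 + 1) (n + 1) n (by simp) (by simp),
          ShortComplex.ShortExact.moduleCat_exact_iff_function_exact]
        have h1 := h.cpx_d n
        have h2 := h.cpx_d (n + 1)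
        change Function.Exact (h.cpx.d (n + 1 + 1) (n + 1)).hom (h.cpx.d (n + 1) n).hom
        rw [h1, h2]
        exact h.exact_succ n
      · apply ChainComplex.exactAt_succ_single_obj⟩

lemma span_homology_iff (S : ShortComplex (ModuleCat.{u} R)) (r : ℕ) :
    (∃ ψ : Fin r → S.homology, Submodule.span R (Set.range ψ) = ⊤) ↔
      ∃ ψ : Fin r → S.X₂, (∀ j, S.g (ψ j) = 0) ∧
        ∀ z, S.g z = 0 → ∃ (c : Fin r → R) (w : S.X₁), z = ∑ j, c j • ψ j + S.f w := by
  let e : S.homology ≃ₗ[R] S.moduleCatLeftHomologyData.H := S.moduleCatHomologyIso.toLinearEquiv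
  let q : LinearMap.ker S.g.hom →ₗ[R] S.moduleCatLeftHomologyData.H :=
    Submodule.mkQ (LinearMap.range S.moduleCatToCycles)
  have hq : Function.Surjective q := Submodule.mkQ_surjective _
  have hq0 (z) : q z = 0 ↔ ∃ w, S.f w = z.1 := by
    refine (Submodule.Quotient.mk_eq_zero _).trans (LinearMap.mem_range.trans ?_)
    exact exists_congr fun w => Subtype.ext_iff
  constructor
  · rintro ⟨ψ, hψ⟩
    choose φ hφ using fun j => hq (e (ψ j))
    refine ⟨fun j => (φ j).1, fun j => (φ j).2, fun z hz => ?_⟩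
    have hz' : e.symm (q ⟨z, hz⟩) ∈ Submodule.span R (Set.range ψ) := hψ ▸ Submodule.mem_top
    obtain ⟨c, hc⟩ := (Submodule.mem_span_range_iff_exists_fun R).1 hz'
    have : q (⟨z, hz⟩ - ∑ j, c j • φ j) = 0 := by
      rw [map_sub, map_sum, sub_eq_zero, ← e.apply_symm_apply (q ⟨z, hz⟩), ← hc, map_sum]
      exact Finset.sum_congr rfl fun j _ => by rw [map_smul, map_smul, hφ]
    obtain ⟨w, hw⟩ := (hq0 _).1 this
    refine ⟨c, w, ?_⟩
    rw [hw]
    simp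
  · rintro ⟨ψ, hψ, h⟩
    refine ⟨fun j => e.symm (q ⟨ψ j, hψ j⟩), eq_top_iff.2 fun x _ => ?_⟩
    obtain ⟨⟨z, hz⟩, hx⟩ := hq (e x)
    obtain ⟨c, w, hw⟩ := h z hz
    refine (Submodule.mem_span_range_iff_exists_fun R).2 ⟨c, e.injective ?_⟩
    have : q (⟨z, hz⟩ - ∑ j, c j • ⟨ψ j, hψ j⟩) = 0 := (hq0 _).2 ⟨w, by simp [hw]⟩
    rw [← hx, map_sum, eq_comm, ← sub_eq_zero, ← this, map_sub, map_sum]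
    simp

lemma smul_homology_iff (S : ShortComplex (ModuleCat.{u} R)) (a : R) :
    (∀ x : S.homology, a • x = 0) ↔ ∀ z, S.g z = 0 → ∃ w, S.f w = a • z := by
  let e : S.homology ≃ₗ[R] S.moduleCatLeftHomologyData.H := S.moduleCatHomologyIso.toLinearEquiv
  let q : LinearMap.ker S.g.hom →ₗ[R] S.moduleCatLeftHomologyData.H :=
    Submodule.mkQ (LinearMap.range S.moduleCatToCycles)
  have hq : Function.Surjective q := Submodule.mkQ_surjective _
  have hq0 (z) : q z = 0 ↔ ∃ w, S.f w = z.1 := by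
    refine (Submodule.Quotient.mk_eq_zero _).trans (LinearMap.mem_range.trans ?_)
    exact exists_congr fun w => Subtype.ext_iff
  constructor
  · intro h z hz
    refine (hq0 (a • ⟨z, hz⟩)).1 ?_
    rw [map_smul, ← e.apply_symm_apply (q _), ← map_smul, h, map_zero]
  · intro h x
    obtain ⟨⟨z, hz⟩, hx⟩ := hq (e x)
    refine e.injective ?_
    rw [map_smul, ← hx, ← map_smul, map_zero]
    exact (hq0 _).2 (h z hz)

lemma span_equiv_iff {A B : Type u} [AddCommGroup A] [Module R A] [AddCommGroup B] [Module R B]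
    (e : A ≃ₗ[R] B) (r : ℕ) : (∃ ψ : Fin r → A, Submodule.span R (Set.range ψ) = ⊤) ↔
      ∃ ψ : Fin r → B, Submodule.span R (Set.range ψ) = ⊤ := by
  have key {A B : Type u} [AddCommGroup A] [Module R A] [AddCommGroup B] [Module R B]
      (e : A ≃ₗ[R] B) {ψ : Fin r → A} (h : Submodule.span R (Set.range ψ) = ⊤) :
      Submodule.span R (Set.range (e ∘ ψ)) = ⊤ := by
    have := congrArg (Submodule.map (e : A →ₗ[R] B)) h
    rwa [Submodule.map_span, Submodule.map_top, LinearEquiv.range, ← Set.range_comp] at this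
  exact ⟨fun ⟨ψ, h⟩ => ⟨_, key e h⟩, fun ⟨ψ, h⟩ => ⟨_, key e.symm h⟩⟩

lemma smul_equiv_iff {A B : Type u} [AddCommGroup A] [Module R A] [AddCommGroup B] [Module R B]
    (e : A ≃ₗ[R] B) (a : R) : (∀ x : A, a • x = 0) ↔ ∀ x : B, a • x = 0 := by
  refine ⟨fun H x => e.symm.injective ?_, fun H x => e.injective ?_⟩
  · rw [map_smul, H, map_zero]
  · rw [map_smul, H, map_zero]

lemma Res.cocGen_iff (h : Res d ε) (N : Type u) [AddCommGroup N] [Module R N] (i r : ℕ) :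
    CocGen d N i r ↔ ∃ ψ : Fin r → ExtMod R (i + 1) (ModuleCat.of R X) (ModuleCat.of R N),
      Submodule.span R (Set.range ψ) = ⊤ := by
  let K := h.cpx.linearYonedaObj R (ModuleCat.of R N)
  let e := h.toResolution.isoExt (R := R) (i + 1) (ModuleCat.of R N) ≪≫
    ShortComplex.homologyMapIso (K.isoSc' i (i + 1) (i + 2) (by simp) (by simp))
  rw [span_equiv_iff e.toLinearEquiv, span_homology_iff]
  let L (j : ℕ) : (P j →ₗ[R] N) ≃ₗ[R] K.X j :=
    (ModuleCat.homLinearEquiv (S := R) (M := ModuleCat.of R (P j)) (N := ModuleCat.of R N)).symm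
  have hf (w : P i →ₗ[R] N) : (K.sc' i (i + 1) (i + 2)).f (L i w) = L (i + 1) (w ∘ₗ d i) := by
    change h.cpx.d (i + 1) i ≫ ModuleCat.ofHom w = _
    rw [h.cpx_d]
    rfl
  have hg (w : P (i + 1) →ₗ[R] N) : (K.sc' i (i + 1) (i + 2)).g (L (i + 1) w) =
      L (i + 2) (w ∘ₗ d (i + 1)) := by
    change h.cpx.d (i + 2) (i + 1) ≫ ModuleCat.ofHom w = _
    rw [h.cpx_d]
    rfl
  have hg0 (w : P (i + 1) →ₗ[R] N) : (K.sc' i (i + 1) (i + 2)).g (L (i + 1) w) = 0 ↔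
      w ∘ₗ d (i + 1) = 0 := by
    rw [hg]
    exact (L (i + 2)).map_eq_zero_iff
  constructor
  · rintro ⟨ψ, hψ, H⟩
    refine ⟨fun j => L (i + 1) (ψ j), fun j => (hg0 _).2 (hψ j), fun z hz => ?_⟩
    obtain ⟨z, rfl⟩ := (L (i + 1)).surjective z
    obtain ⟨c, w, hw⟩ := H z ((hg0 z).1 hz)
    refine ⟨c, L i w, ?_⟩
    rw [hf, hw, map_add, map_sum]
    simp only [map_smul]
    rfl
  · rintro ⟨ψ, hψ, H⟩
    choose φ hφ using fun j => (L (i + 1)).surjective (ψ j)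
    obtain rfl : (fun j => L (i + 1) (φ j)) = ψ := funext hφ
    refine ⟨φ, fun j => (hg0 _).1 (hψ j), fun z hz => ?_⟩
    obtain ⟨c, w, hw⟩ := H (L (i + 1) z) ((hg0 z).2 hz)
    obtain ⟨w, rfl⟩ := (L i).surjective w
    refine ⟨c, w, (L (i + 1)).injective (hw.trans ?_)⟩
    rw [hf, map_add, map_sum]
    simp only [map_smul]
    rfl

open scoped TensorProduct in
lemma Res.smul_tor_iff (h : Res d ε) (N : Type u) [AddCommGroup N] [Module R N] (i : ℕ) (a : R) :
    (∀ x : TorMod R (i + 1) (ModuleCat.of R X) (ModuleCat.of R N), a • x = 0) ↔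
      ∀ z : P (i + 1) ⊗[R] N, (d i).rTensor N z = 0 → ∃ w, (d (i + 1)).rTensor N w = a • z := by
  let F := (MonoidalCategory.tensoringRight (ModuleCat.{u} R)).obj (ModuleCat.of R N)
  let K := (F.mapHomologicalComplex _).obj h.cpx
  let e := (h.toResolution.isoLeftDerivedObj F (i + 1)) ≪≫
    ShortComplex.homologyMapIso (K.isoSc' (i + 2) (i + 1) i (by simp) (by simp))
  have hf (w : P (i + 2) ⊗[R] N) : (K.sc' (i + 2) (i + 1) i).f w = (d (i + 1)).rTensor N w := by
    change F.map (h.cpx.d (i + 2) (i + 1)) w = _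
    rw [h.cpx_d]
    rfl
  have hg (w : P (i + 1) ⊗[R] N) : (K.sc' (i + 2) (i + 1) i).g w = (d i).rTensor N w := by
    change F.map (h.cpx.d (i + 1) i) w = _
    rw [h.cpx_d]
    rfl
  refine Iff.trans ?_ ((smul_homology_iff (K.sc' (i + 2) (i + 1) i) a).trans ?_)
  · exact smul_equiv_iff e.toLinearEquiv a
  · exact ⟨fun H z hz => (H z ((hg z).trans hz)).imp fun w hw => (hf w).symm.trans hw,
      fun H z hz => (H z ((hg z).symm.trans hz)).imp fun w hw => (hf w).trans hw⟩


end Links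

open MvPolynomial Abelian

section TateRes

variable {Q : Type u} [CommRing Q] {M : Type u} [AddCommGroup M] [Module Q M] {n : Type}
  [Fintype n] [DecidableEq n] {G : FinRes Q M n} {e : ℕ} {f : Fin e → Q} {R : Type u} [CommRing R]
  [Algebra Q R] [Module R M] [IsScalarTower Q R M]

/-- The augmentation of the resolution attached to a matrix factorization. -/
def augR (G : FinRes Q M n) (σ : Type) : TR Q σ R G.deg 0 →ₗ[R] M where
  toFun z := ∑ x, z.1 x 1 • G.aug x
  map_add' z w := by
    rw [← Finset.sum_add_distrib]
    exact Finset.sum_congr rfl fun x _ => add_smul _ _ _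
  map_smul' a z := by
    rw [RingHom.id_apply, Finset.smul_sum]
    exact Finset.sum_congr rfl fun x _ => mul_smul _ _ _

lemma augR_apply (G : FinRes Q M n) (σ : Type) (z : TR Q σ R G.deg 0) :
    augR G σ z = ∑ x, z.1 x 1 • G.aug x := rfl

lemma exists_TD_const {σ : Type} [Fintype σ] {X : Type u} [AddCommGroup X] [Module Q X]
    (dn : n → ℕ) (i : ℕ) (w : n → X) : ∃ z ∈ TD (Q := Q) (σ := σ) dn ∅ i, ∀ x s,
      z x s = if dn x = i then coeff 0 s • w x else 0 := by
  classical
  let z : TC Q σ n X := fun x => if dn x = i then (lcoeff Q 0).smulRight (w x) else 0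
  have hz (x s) : z x s = if dn x = i then coeff 0 s • w x else 0 := by
    simp only [z]
    split_ifs <;> rfl
  refine ⟨z, mem_TD.2 fun x μ h => ?_, hz⟩
  rw [hz] at h
  by_cases hx : dn x = i
  · rw [if_pos hx, coeff_monomial] at h
    obtain rfl : μ = 0 := by
      by_contra hμ
      rw [if_neg hμ, zero_smul] at h
      exact h rfl
    simp [hx]
  · exact absurd (if_neg hx) h

lemma TD_small {σ : Type} [Fintype σ] {X : Type u} [AddCommGroup X] [Module Q X] {dn : n → ℕ}
    {i : ℕ} (hi : i ≤ 1) {z : TC Q σ n X} (hz : z ∈ TD dn ∅ i) (x : n) (s : MvPolynomial σ Q) :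
    z x s = coeff 0 s • z x 1 := by
  classical
  let t : TC Q σ n X := fun x => (lcoeff Q 0).smulRight (z x 1)
  suffices h : z = t from congrFun (congrArg (fun z => (fun s => (z x s : X))) h) s
  refine TC.ext_mono fun x μ => ?_
  have ht : t x (monomial μ 1) = coeff 0 (monomial μ (1 : Q)) • z x 1 := rfl
  rw [ht, coeff_monomial]
  split_ifs with hμ
  · rw [hμ, one_smul]
    rfl
  · rw [zero_smul]
    refine not_ne_iff.1 fun h => hμ ((Finsupp.degree_eq_zero_iff μ).1 ?_)
    have := (hz x μ h).1
    omega

lemma res_TR (A : MF f G) (hf : IsRegFam f) (hs : Function.Surjective (algebraMap Q R))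
    (hk : RingHom.ker (algebraMap Q R) = Ideal.span (Set.range f)) :
    Res (P := fun i => TR Q (Fin e) R G.deg i) (dR A.gr) (augR G (Fin e)) where
  proj i := inferInstance
  surj m := by
    have hm : m ∈ Submodule.span Q (Set.range G.aug) := G.aug_span ▸ Submodule.mem_top
    obtain ⟨c, rfl⟩ := (Submodule.mem_span_range_iff_exists_fun Q).1 hm
    obtain ⟨z, hz, hz'⟩ := exists_TD_const (Q := Q) (σ := Fin e) G.deg 0
      fun x => algebraMap Q R (c x)
    refine ⟨⟨z, hz⟩, Finset.sum_congr rfl fun x _ => ?_⟩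
    rw [show (⟨z, hz⟩ : TR Q (Fin e) R G.deg 0).1 x 1 = _ from hz' x 1]
    by_cases hx : G.deg x = 0
    · rw [if_pos hx, coeff_zero_one, one_smul, algebraMap_smul]
    · rw [not_ne_iff.1 fun h => hx (G.aug_deg x h), smul_zero, smul_zero]
  exact_zero z := by
    constructor
    · intro h
      rw [augR_apply] at h
      choose v hv using fun x => hs (z.1 x 1)
      have hz0 (x) (hx : G.deg x ≠ 0) : z.1 x 1 = 0 :=
        not_ne_iff.1 fun h => hx (by have := (z.2 x 0 h).1; simpa using this)
      obtain ⟨w, hw⟩ := G.exact (fun x => if G.deg x = 0 then v x else 0) (funext fun x => by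
        refine Finset.sum_eq_zero fun y _ => ?_
        by_cases hy : G.deg y = 0
        · have h0 : G.del x y = 0 := not_ne_iff.1 fun h => absurd (G.del_deg x y h) (by omega)
          exact mul_eq_zero_of_left h0 _
        · exact mul_eq_zero_of_right _ (if_neg hy)) (by
        rw [← h]
        refine Finset.sum_congr rfl fun x _ => ?_
        by_cases hx : G.deg x = 0
        · rw [if_pos hx, ← hv, algebraMap_smul]
        · rw [not_ne_iff.1 fun h => hx (G.aug_deg x h), smul_zero, smul_zero])
      obtain ⟨t, ht, ht'⟩ := exists_TD_const (Q := Q) (σ := Fin e) G.deg 1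
        fun x => algebraMap Q R (w x)
      refine ⟨⟨t, ht⟩, Subtype.ext (TC.ext_mono fun x μ => ?_)⟩
      refine (TD_small zero_le_one (dT_mem A.gr ht) x _).trans
        (Eq.trans ?_ (TD_small zero_le_one z.2 x _).symm)
      congr 1
      by_cases hx : G.deg x = 0
      · have hwx := congrArg (algebraMap Q R) (congrFun hw x)
        rw [dT_apply, ← hv]
        rw [if_pos hx] at hwx
        rw [← hwx, Matrix.mulVec, dotProduct, map_sum]
        refine Finset.sum_congr rfl fun y _ => ?_
        rw [ht', mul_one, A.zero_coeff, map_mul, Algebra.smul_def]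
        split_ifs with hy
        · rfl
        · rw [not_ne_iff.1 fun h => hy ((G.del_deg x y h).trans (by rw [hx])), map_zero, zero_mul]
      · rw [hz0 x hx]
        exact not_ne_iff.1 fun h => hx (by have := (dT_mem A.gr ht x 0 h).1; simpa using this)
    · rintro ⟨w, rfl⟩
      have hc (x) : (dR A.gr 0 w).1 x 1 = ∑ y, G.del x y • w.1 y 1 := by
        refine (dT_apply A.A w.1 x 1).trans (Finset.sum_congr rfl fun y _ => ?_)
        rw [mul_one, TD_small le_rfl w.2, A.zero_coeff]
      rw [augR_apply]
      simp only [hc, Finset.sum_smul]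
      rw [Finset.sum_comm]
      refine Finset.sum_eq_zero fun y _ => ?_
      refine Eq.trans ?_ ((congrArg (w.1 y 1 • ·) (G.aug_del y)).trans (smul_zero _))
      rw [Finset.smul_sum]
      exact Finset.sum_congr rfl fun x _ => by rw [smul_assoc, smul_comm]
  exact_succ i z := by
    have hst := (stage_free (m := {1}) hf (fun n h => by simpa using h 1 rfl) A R hs hk
      PUnit.{u + 1}).of_equiv (Finsupp.uniqueLinearEquiv Q R PUnit.unit)
    have hex := hst.exact (i + 1) (by omega)
    rw [Jge_self, acyc_one] at hex
    constructor
    · intro h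
      obtain ⟨w, hw, hw'⟩ := hex z.1 z.2 (congrArg Subtype.val h)
      exact ⟨⟨w, hw⟩, Subtype.ext hw'⟩
    · rintro ⟨w, rfl⟩
      refine Subtype.ext (dT_sq_zero A.sq (fun j x => ?_) w.1)
      have hj : f j ∈ RingHom.ker (algebraMap Q R) := hk ▸ Ideal.subset_span (Set.mem_range_self j)
      rw [Algebra.smul_def, RingHom.mem_ker.1 hj, zero_mul]

end TateRes

open MvPolynomial Abelian
open scoped TensorProduct

section BaseChange

variable {A : Type u} [CommRing A]

/-- Generation of the homology of `C₀ → C₁ → C₂` by `r` elements. -/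
def HGen {C₀ C₁ C₂ : Type u} [AddCommGroup C₀] [Module A C₀] [AddCommGroup C₁] [Module A C₁]
    [AddCommGroup C₂] [Module A C₂] (f : C₀ →ₗ[A] C₁) (g : C₁ →ₗ[A] C₂) (r : ℕ) : Prop :=
  ∃ ψ : Fin r → C₁, (∀ j, g (ψ j) = 0) ∧
    ∀ z, g z = 0 → ∃ (c : Fin r → A) (w : C₀), z = ∑ j, c j • ψ j + f w

lemma HGen.of_equiv {C₀ C₁ C₂ D₀ D₁ D₂ : Type u} [AddCommGroup C₀] [Module A C₀]
    [AddCommGroup C₁] [Module A C₁] [AddCommGroup C₂] [Module A C₂] [AddCommGroup D₀]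
    [Module A D₀] [AddCommGroup D₁] [Module A D₁] [AddCommGroup D₂] [Module A D₂]
    {f : C₀ →ₗ[A] C₁} {g : C₁ →ₗ[A] C₂} {f' : D₀ →ₗ[A] D₁} {g' : D₁ →ₗ[A] D₂} {r : ℕ}
    (e₀ : C₀ ≃ₗ[A] D₀) (e₁ : C₁ ≃ₗ[A] D₁) (e₂ : C₂ ≃ₗ[A] D₂)
    (hf : ∀ x, f' (e₀ x) = e₁ (f x)) (hg : ∀ x, g' (e₁ x) = e₂ (g x)) (h : HGen f g r) :
    HGen f' g' r := by
  obtain ⟨ψ, hψ, H⟩ := h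
  refine ⟨fun j => e₁ (ψ j), fun j => by rw [hg, hψ, map_zero], fun z hz => ?_⟩
  obtain ⟨z, rfl⟩ := e₁.surjective z
  obtain ⟨c, w, hw⟩ := H z (e₂.injective (by rw [← hg, hz, map_zero]))
  exact ⟨c, e₀ w, by rw [hf, hw, map_add, map_sum]; simp only [map_smul]⟩

variable {B : Type u} [CommRing B] [Algebra A B]
  {C₀ C₁ C₂ : Type u} [AddCommGroup C₀] [Module A C₀] [AddCommGroup C₁] [Module A C₁]
    [AddCommGroup C₂] [Module A C₂] {f : C₀ →ₗ[A] C₁} {g : C₁ →ₗ[A] C₂} {r : ℕ}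

lemma HGen.baseChange [Module.Flat A B] (hfg : ∀ x, g (f x) = 0) (h : HGen f g r) :
    HGen (f.baseChange B) (g.baseChange B) r := by
  obtain ⟨ψ, hψ, H⟩ := h
  let φ : ((Fin r → A) × C₀) →ₗ[A] C₁ := (Fintype.linearCombination A ψ).coprod f
  have hex : Function.Exact φ g := by
    intro z
    constructor
    · intro hz
      obtain ⟨c, w, hw⟩ := H z hz
      exact ⟨(c, w), by simp [φ, hw, Fintype.linearCombination_apply]⟩
    · rintro ⟨⟨c, w⟩, rfl⟩
      simp [φ, hfg, hψ, Fintype.linearCombination_apply]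
  have hex' := Module.Flat.lTensor_exact B hex
  refine ⟨fun j => 1 ⊗ₜ ψ j, fun j => by simp [hψ], fun z hz => ?_⟩
  obtain ⟨t, rfl⟩ := (hex' z).1 hz
  clear hz
  induction t using TensorProduct.induction_on with
  | zero => exact ⟨0, 0, by simp⟩
  | tmul b p =>
    refine ⟨fun j => b * algebraMap A B (p.1 j), b ⊗ₜ p.2, ?_⟩
    simp [φ, Fintype.linearCombination_apply, TensorProduct.tmul_add, TensorProduct.tmul_sum,
      TensorProduct.smul_tmul', Algebra.smul_def, mul_comm b]
  | add x y hx hy =>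
    obtain ⟨c, w, hw⟩ := hx
    obtain ⟨c', w', hw'⟩ := hy
    exact ⟨c + c', w + w', by
      rw [map_add, hw, hw', map_add]
      simp only [Pi.add_apply, add_smul, Finset.sum_add_distrib]
      abel⟩

lemma span_of_baseChange {H : Type u} [AddCommGroup H] [Module A H] [Module.Finite A H]
    [IsLocalRing A] (hm : (IsLocalRing.maximalIdeal A).map (algebraMap A B) ≠ ⊤)
    (h : ∃ ξ : Fin r → B ⊗[A] H, Submodule.span B (Set.range ξ) = ⊤) :
    ∃ ξ : Fin r → H, Submodule.span A (Set.range ξ) = ⊤ := by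
  obtain ⟨ξ, hξ⟩ := h
  obtain ⟨𝔫, h𝔫, hle⟩ := Ideal.exists_le_maximal _ hm
  let k := IsLocalRing.ResidueField A
  let κ := B ⧸ 𝔫
  let _ : Field κ := Ideal.Quotient.field 𝔫
  let _ : Algebra k κ := (Ideal.Quotient.lift (IsLocalRing.maximalIdeal A) (algebraMap A κ)
    fun a ha => Ideal.Quotient.eq_zero_iff_mem.2 (hle (Ideal.mem_map_of_mem _ ha))).toAlgebra
  have : IsScalarTower A k κ := IsScalarTower.of_algebraMap_eq fun a => rfl
  have hr : Module.finrank κ (κ ⊗[A] H) ≤ r := by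
    let p : B ⊗[A] H →ₗ[A] κ ⊗[A] H := (Algebra.linearMap B κ).restrictScalars A |>.rTensor H
    have hps : Function.Surjective p :=
      LinearMap.rTensor_surjective _ Ideal.Quotient.mk_surjective
    have hp (c : B) (x) : p (c • x) = algebraMap B κ c • p x := by
      induction x using TensorProduct.induction_on with
      | zero => simp
      | tmul b y => simp [p, TensorProduct.smul_tmul', Algebra.smul_def]
      | add x y hx hy => rw [smul_add, map_add, hx, hy, map_add, smul_add]
    have htop : Submodule.span κ (Set.range fun j => p (ξ j)) = ⊤ := by
      refine eq_top_iff.2 fun x _ => ?_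
      obtain ⟨x, rfl⟩ := hps x
      have hx : x ∈ Submodule.span B (Set.range ξ) := hξ ▸ Submodule.mem_top
      obtain ⟨c, rfl⟩ := (Submodule.mem_span_range_iff_exists_fun B).1 hx
      refine (Submodule.mem_span_range_iff_exists_fun κ).2 ⟨fun j => algebraMap B κ (c j), ?_⟩
      rw [map_sum]
      exact Finset.sum_congr rfl fun j _ => (hp _ _).symm
    have := finrank_range_le_card (R := κ) fun j => p (ξ j)
    rwa [Set.finrank, htop, finrank_top, Fintype.card_fin] at this
  rw [← (TensorProduct.AlgebraTensorModule.cancelBaseChange A k κ κ H).finrank_eq,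
    Module.finrank_baseChange] at hr
  let b := Module.finBasis k (k ⊗[A] H)
  choose φ hφ using fun j => TensorProduct.mk_surjective A H k Ideal.Quotient.mk_surjective (b j)
  have hs := IsLocalRing.span_eq_top_of_tmul_eq_basis φ b hφ
  refine ⟨fun j => if hj : j.1 < Module.finrank k (k ⊗[A] H) then φ ⟨j, hj⟩ else 0,
    top_le_iff.1 (hs ▸ Submodule.span_mono ?_)⟩
  rintro _ ⟨j, rfl⟩
  exact ⟨⟨j, j.2.trans_le hr⟩, dif_pos j.2⟩

lemma HGen.of_baseChange [Module.Flat A B] [IsLocalRing A] [IsNoetherianRing A]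
    (hm : (IsLocalRing.maximalIdeal A).map (algebraMap A B) ≠ ⊤)
    [Module.Finite A C₁] (hfg : ∀ x, g (f x) = 0)
    (h : HGen (f.baseChange B) (g.baseChange B) r) : HGen f g r := by
  let F : C₀ →ₗ[A] LinearMap.ker g := f.codRestrict _ hfg
  let q := (LinearMap.range F).mkQ
  have hq : Function.Surjective q := Submodule.mkQ_surjective _
  have hq0 (z) : q z = 0 ↔ ∃ w, f w = z.1 := by
    refine (Submodule.Quotient.mk_eq_zero _).trans (LinearMap.mem_range.trans ?_)
    exact exists_congr fun w => Subtype.ext_iff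
  obtain ⟨ψ, hψ, H⟩ := h
  have hex := Module.Flat.lTensor_exact B
    (show Function.Exact (LinearMap.ker g).subtype g from g.exact_subtype_ker_map)
  have hinj := Module.Flat.lTensor_preserves_injective_linearMap (M := B)
    (LinearMap.ker g).subtype (LinearMap.ker g).injective_subtype
  choose ξ hξ using fun j => (hex (ψ j)).1 (hψ j)
  obtain ⟨φ, hφ⟩ := span_of_baseChange (B := B) (r := r) (H := _ ⧸ LinearMap.range F) hm
    ⟨fun j => q.baseChange B (ξ j), eq_top_iff.2 fun x _ => by
      obtain ⟨x, rfl⟩ := LinearMap.lTensor_surjective B hq x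
      obtain ⟨c, w, hw⟩ := H ((LinearMap.ker g).subtype.baseChange B x)
        ((hex _).2 (Set.mem_range_self x))
      refine (Submodule.mem_span_range_iff_exists_fun B).2 ⟨c, ?_⟩
      have hx : x = ∑ j, c j • ξ j + F.baseChange B w := by
        apply hinj
        change (LinearMap.ker g).subtype.baseChange B x =
          (LinearMap.ker g).subtype.baseChange B _
        rw [hw, map_add, map_sum]
        congr 1
        · refine Finset.sum_congr rfl fun j _ => ?_
          rw [map_smul, ← hξ]
          rfl
        · rw [← LinearMap.comp_apply, ← LinearMap.baseChange_comp]
          rfl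
      have hqF : q.baseChange B (F.baseChange B w) = 0 := by
        rw [← LinearMap.comp_apply, ← LinearMap.baseChange_comp]
        have : q ∘ₗ F = 0 := LinearMap.ext fun w => (hq0 _).2 ⟨w, rfl⟩
        rw [this]
        simp
      change _ = q.baseChange B x
      rw [hx, map_add, hqF, add_zero, map_sum]
      simp only [map_smul]⟩
  choose θ hθ using fun j => hq (φ j)
  refine ⟨fun j => (θ j).1, fun j => (θ j).2, fun z hz => ?_⟩
  have hz' : q ⟨z, hz⟩ ∈ Submodule.span A (Set.range φ) := hφ ▸ Submodule.mem_top
  obtain ⟨c, hc⟩ := (Submodule.mem_span_range_iff_exists_fun A).1 hz'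
  have : q (⟨z, hz⟩ - ∑ j, c j • θ j) = 0 := by
    rw [map_sub, map_sum, sub_eq_zero, ← hc]
    exact Finset.sum_congr rfl fun j _ => by rw [map_smul, hθ]
  obtain ⟨w, hw⟩ := (hq0 _).1 this
  refine ⟨c, w, ?_⟩
  rw [hw]
  simp

/-- Base change of homomorphisms out of a finite free module. -/
def homBaseChange (P N : Type u) [AddCommGroup P] [Module A P] [AddCommGroup N] [Module A N]
    [Module.Free A P] [Module.Finite A P] : B ⊗[A] (P →ₗ[A] N) ≃ₗ[B] (B ⊗[A] P →ₗ[B] B ⊗[A] N) :=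
  LinearEquiv.ofBijective ((LinearMap.baseChangeHom A B P N).liftBaseChange B) <| by
    have h (x) : (LinearMap.liftBaseChangeEquiv B).symm
        ((LinearMap.baseChangeHom A B P N).liftBaseChange B x) =
        lTensorHomEquivHomLTensor A P B N x := by
      rw [lTensorHomEquivHomLTensor_apply]
      induction x using TensorProduct.induction_on with
      | zero => simp
      | tmul b φ =>
        ext p
        simp [TensorProduct.smul_tmul']
      | add x y hx hy => rw [map_add, map_add, hx, hy, map_add]
    have h' : ⇑(LinearMap.liftBaseChangeEquiv B).symm ∘
      ((LinearMap.baseChangeHom A B P N).liftBaseChange B) =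
        lTensorHomEquivHomLTensor A P B N := funext h
    refine ((LinearMap.liftBaseChangeEquiv B).symm.bijective.of_comp_iff' _).1 ?_
    rw [h']
    exact LinearEquiv.bijective _

end BaseChange

open MvPolynomial Abelian
open scoped TensorProduct

section ExtBaseChange

variable {A : Type u} [CommRing A]

lemma exists_finite_free_res [IsNoetherianRing A] (X : Type u) [AddCommGroup X] [Module A X]
    [Module.Finite A X] : ∃ (k : ℕ → ℕ) (d : ∀ i, (Fin (k (i + 1)) → A) →ₗ[A] (Fin (k i) → A))
      (ε : (Fin (k 0) → A) →ₗ[A] X), Res (P := fun i => Fin (k i) → A) d ε := by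
  obtain ⟨k₀, ε, hε⟩ := Module.Finite.exists_fin' A X
  have key (s : Σ k : ℕ, Submodule A (Fin k → A)) :
      ∃ (n : ℕ) (φ : (Fin n → A) →ₗ[A] (Fin s.1 → A)), LinearMap.range φ = s.2 := by
    obtain ⟨n, φ, hφ⟩ := Module.Finite.exists_fin' A s.2
    exact ⟨n, s.2.subtype ∘ₗ φ, by
      rw [LinearMap.range_comp, LinearMap.range_eq_top.2 hφ, Submodule.map_top,
        Submodule.range_subtype]⟩
  choose n φ hφ using key
  let s : ℕ → Σ k : ℕ, Submodule A (Fin k → A) :=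
    Nat.rec ⟨k₀, LinearMap.ker ε⟩ fun _ s => ⟨n s, LinearMap.ker (φ s)⟩
  refine ⟨fun i => (s i).1, fun i => φ (s i), ε, fun i => inferInstance, hε, ?_, fun i => ?_⟩
  · exact LinearMap.exact_iff.2 (hφ (s 0)).symm
  · exact LinearMap.exact_iff.2 (hφ (s (i + 1))).symm

lemma numGen_le_iff (H : ModuleCat.{u} A) [Module.Finite A H] (r : ℕ) :
    numGen A H ≤ r ↔ ∃ ψ : Fin r → H, Submodule.span A (Set.range ψ) = ⊤ := by
  classical
  have hne : {n | ∃ s : Finset H, s.card = n ∧ Submodule.span A (s : Set H) = ⊤}.Nonempty := by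
    obtain ⟨s, hs⟩ := Module.Finite.fg_top (R := A) (M := H)
    exact ⟨_, s, rfl, hs⟩
  constructor
  · intro h
    obtain ⟨s, hs, hs'⟩ := Nat.sInf_mem hne
    replace hs : s.card ≤ r := hs.trans_le h
    refine ⟨fun j => if hj : j.1 < s.card then s.equivFin.symm ⟨j, hj⟩ else 0,
      top_le_iff.1 (hs' ▸ Submodule.span_mono fun x hx => ?_)⟩
    have hlt := (s.equivFin ⟨x, hx⟩).2
    exact ⟨⟨s.equivFin ⟨x, hx⟩, hlt.trans_le hs⟩, by simp⟩
  · rintro ⟨ψ, hψ⟩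
    refine (show numGen A H ≤ (Finset.univ.image ψ).card from
      Nat.sInf_le ⟨Finset.univ.image ψ, rfl, by simpa using hψ⟩).trans ?_
    exact Finset.card_image_le.trans (by simp)

variable {B : Type u} [CommRing B] [Algebra A B] [Module.Flat A B] {X Y : Type u} [AddCommGroup X]
  [Module A X] [AddCommGroup Y] [Module A Y]

lemma Res.baseChange {P : ℕ → Type u} [∀ i, AddCommGroup (P i)] [∀ i, Module A (P i)]
    {d : ∀ i, P (i + 1) →ₗ[A] P i} {ε : P 0 →ₗ[A] X} (h : Res d ε) :
    Res (P := fun i => B ⊗[A] P i) (fun i => (d i).baseChange B) (ε.baseChange B) where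
  proj i := by
    have := h.proj i
    infer_instance
  surj := LinearMap.lTensor_surjective B h.surj
  exact_zero := Module.Flat.lTensor_exact B h.exact_zero
  exact_succ i := Module.Flat.lTensor_exact B (h.exact_succ i)

lemma homBaseChange_lcomp {P P' : Type u} [AddCommGroup P] [Module A P] [AddCommGroup P']
    [Module A P'] [Module.Free A P] [Module.Finite A P] [Module.Free A P'] [Module.Finite A P']
    (φ : P →ₗ[A] P') (x : B ⊗[A] (P' →ₗ[A] Y)) :
    LinearMap.lcomp B (B ⊗[A] Y) (φ.baseChange B) (homBaseChange P' Y x) =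
      homBaseChange P Y ((LinearMap.lcomp A Y φ).baseChange B x) := by
  induction x using TensorProduct.induction_on with
  | zero => simp
  | tmul b ψ =>
    ext p
    simp [homBaseChange]
  | add x y hx hy => simp only [map_add, hx, hy]

lemma cocGen_iff_hGen {P : ℕ → Type u} [∀ i, AddCommGroup (P i)] [∀ i, Module A (P i)]
    (d : ∀ i, P (i + 1) →ₗ[A] P i) (Y : Type u) [AddCommGroup Y] [Module A Y] (i r : ℕ) :
    CocGen d Y i r ↔ HGen (LinearMap.lcomp A Y (d i)) (LinearMap.lcomp A Y (d (i + 1))) r := Iff.rfl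

lemma cocGen_baseChange_iff [IsLocalRing A] [IsNoetherianRing A]
    (hm : (IsLocalRing.maximalIdeal A).map (algebraMap A B) ≠ ⊤) [Module.Finite A X]
    [Module.Finite A Y] {P : ℕ → Type u} [∀ i, AddCommGroup (P i)] [∀ i, Module B (P i)]
    {d : ∀ i, P (i + 1) →ₗ[B] P i} {ε : P 0 →ₗ[B] B ⊗[A] X} (h : Res d ε) (i r : ℕ) :
    CocGen d (B ⊗[A] Y) i r ↔ numGen A (ExtMod A (i + 1) (ModuleCat.of A X) (ModuleCat.of A Y)) ≤ r
    := by
  obtain ⟨k, d₀, ε₀, h₀⟩ := exists_finite_free_res (A := A) X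
  have hfg (x : (Fin (k i) → A) →ₗ[A] Y) :
      LinearMap.lcomp A Y (d₀ (i + 1)) (LinearMap.lcomp A Y (d₀ i) x) = 0 :=
    LinearMap.ext fun z => (congrArg x ((h₀.exact_succ i).apply_apply_eq_zero z)).trans (map_zero x)
  have hfin : Module.Finite A (ExtMod A (i + 1) (ModuleCat.of A X) (ModuleCat.of A Y)) := by
    let g := LinearMap.lcomp A Y (d₀ (i + 1))
    obtain ⟨s, ψ, hψ⟩ := Module.Finite.exists_fin (R := A) (M := LinearMap.ker g)
    have : CocGen (P := fun i => Fin (k i) → A) d₀ Y i s := (cocGen_iff_hGen (P := fun i => Fin (k i) → A) d₀ Y i s).2 ⟨fun j => (ψ j).1, fun j => (ψ j).2, fun z hz => by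
      have hz' : (⟨z, hz⟩ : LinearMap.ker g) ∈ Submodule.span A (Set.range ψ) :=
        hψ ▸ Submodule.mem_top
      obtain ⟨c, hc⟩ := (Submodule.mem_span_range_iff_exists_fun A).1 hz'
      exact ⟨c, 0, by rw [map_zero, add_zero]; simpa using (congrArg Subtype.val hc).symm⟩⟩
    obtain ⟨ξ, hξ⟩ := (h₀.cocGen_iff Y i s).1 this
    exact ⟨hξ ▸ Submodule.fg_span (Set.finite_range ξ)⟩
  let E (j : ℕ) := homBaseChange (A := A) (B := B) (Fin (k j) → A) Y
  have hE (j : ℕ) := homBaseChange_lcomp (B := B) (Y := Y) (d₀ j)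
  rw [h.cocGen_iff, ← (h₀.baseChange (B := B)).cocGen_iff, numGen_le_iff, ← h₀.cocGen_iff,
    cocGen_iff_hGen, cocGen_iff_hGen]
  constructor
  · intro H
    refine HGen.of_baseChange (B := B) hm hfg (HGen.of_equiv (E i).symm (E (i + 1)).symm
      (E (i + 2)).symm (fun x => ?_) (fun x => ?_) H)
    · obtain ⟨x, rfl⟩ := (E i).surjective x
      rw [LinearEquiv.symm_apply_apply, LinearEquiv.eq_symm_apply]
      exact (hE i x).symm
    · obtain ⟨x, rfl⟩ := (E (i + 1)).surjective x
      rw [LinearEquiv.symm_apply_apply, LinearEquiv.eq_symm_apply]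
      exact (hE (i + 1) x).symm
  · intro H
    exact HGen.of_equiv (E i) (E (i + 1)) (E (i + 2)) (hE i) (hE (i + 1))
      (H.baseChange (B := B) hfg)

lemma exists_pow_smul_eq_zero [IsLocalRing A] {H : Type u} [AddCommGroup H] [Module A H]
    (h : IsFiniteLength A H) :
    ∃ T : ℕ, ∀ a ∈ IsLocalRing.maximalIdeal A ^ T, ∀ x : H, a • x = 0 := by
  induction h with
  | of_subsingleton => exact ⟨0, fun a _ x => Subsingleton.elim _ _⟩
  | @of_simple_quotient M _ _ N _ hN ih =>
    obtain ⟨T, hT⟩ := ih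
    have hmax := IsLocalRing.eq_maximalIdeal (IsSimpleModule.annihilator_isMaximal (R := A)
      (M := M ⧸ N))
    refine ⟨T + 1, fun a ha x => ?_⟩
    rw [pow_succ] at ha
    refine Submodule.mul_induction_on ha (fun b hb c hc => ?_) fun b c hb hc => by
      rw [add_smul, hb, hc, add_zero]
    rw [← hmax] at hc
    have hcx : c • x ∈ N := by
      rw [← Submodule.Quotient.mk_eq_zero, Submodule.Quotient.mk_smul]
      exact Module.mem_annihilator.1 hc _
    rw [mul_smul]
    exact congrArg Subtype.val (hT b hb ⟨_, hcx⟩)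

lemma smul_baseChange {C₀ C₁ C₂ : Type u} [AddCommGroup C₀] [Module A C₀] [AddCommGroup C₁]
    [Module A C₁] [AddCommGroup C₂] [Module A C₂] {f : C₀ →ₗ[A] C₁} {g : C₁ →ₗ[A] C₂} {a : A}
    (H : ∀ z, g z = 0 → ∃ w, f w = a • z) (z : B ⊗[A] C₁) (hz : g.baseChange B z = 0) :
    ∃ w, f.baseChange B w = algebraMap A B a • z := by
  obtain ⟨t, rfl⟩ := (Module.Flat.lTensor_exact B g.exact_subtype_ker_map z).1 hz
  clear hz
  induction t using TensorProduct.induction_on with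
  | zero => exact ⟨0, by simp⟩
  | add x y hx hy =>
    obtain ⟨w, hw⟩ := hx
    obtain ⟨w', hw'⟩ := hy
    exact ⟨w + w', by rw [map_add, hw, hw', map_add, smul_add]⟩
  | tmul b x =>
    obtain ⟨w, hw⟩ := H x.1 x.2
    exact ⟨b ⊗ₜ w, by simp [hw]⟩

lemma smul_tor_baseChange {P : ℕ → Type u} [∀ i, AddCommGroup (P i)] [∀ i, Module B (P i)]
    [IsNoetherianRing A] [Module.Finite A X]
    {d : ∀ i, P (i + 1) →ₗ[B] P i} {ε : P 0 →ₗ[B] B ⊗[A] X} (h : Res d ε) (i : ℕ) {I : Ideal A}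
    (hI : ∀ a ∈ I, ∀ x : TorMod A (i + 1) (ModuleCat.of A X) (ModuleCat.of A Y), a • x = 0)
    {y : B} (hy : y ∈ I.map (algebraMap A B)) (z : P (i + 1) ⊗[B] (B ⊗[A] Y))
    (hz : (d i).rTensor (B ⊗[A] Y) z = 0) : ∃ w, (d (i + 1)).rTensor (B ⊗[A] Y) w = y • z := by
  obtain ⟨k, d₀, ε₀, h₀⟩ := exists_finite_free_res (A := A) X
  refine (h.smul_tor_iff (B ⊗[A] Y) i y).1 ?_ z hz
  suffices hle : I.map (algebraMap A B) ≤ Module.annihilator B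
      (TorMod B (i + 1) (ModuleCat.of B (B ⊗[A] X)) (ModuleCat.of B (B ⊗[A] Y))) from
    Module.mem_annihilator.1 (hle hy)
  refine Ideal.map_le_iff_le_comap.2 fun a ha => Ideal.mem_comap.2 (Module.mem_annihilator.2 ?_)
  refine ((h₀.baseChange (B := B)).smul_tor_iff _ _ _).2 fun z hz => ?_
  have H := (h₀.smul_tor_iff Y i a).1 (hI a ha)
  let E (j : ℕ) := TensorProduct.AlgebraTensorModule.distribBaseChange A B (Fin (k j) → A) Y
  have hE (j : ℕ) (x : B ⊗[A] ((Fin (k (j + 1)) → A) ⊗[A] Y)) :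
      ((d₀ j).baseChange B).rTensor (B ⊗[A] Y) (E (j + 1) x) =
        E j (((d₀ j).rTensor Y).baseChange B x) := by
    induction x using TensorProduct.induction_on with
    | zero => simp
    | add x y hx hy => simp only [map_add, hx, hy]
    | tmul b x =>
      induction x using TensorProduct.induction_on with
      | zero => simp
      | add x y hx hy => simp only [TensorProduct.tmul_add, map_add, hx, hy]
      | tmul p q => simp [E]
  obtain ⟨z, rfl⟩ := (E (i + 1)).surjective z
  have hz' := (E i).injective ((hE i z).symm.trans (hz.trans (map_zero _).symm))
  obtain ⟨w, hw⟩ := smul_baseChange H z hz'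
  exact ⟨E _ w, by rw [hE, hw, map_smul]⟩

end ExtBaseChange

section TorTR

variable {Q : Type u} [CommRing Q] {σ : Type} [Fintype σ] {n : Type} [Fintype n] [DecidableEq n]
  {R : Type u} [CommRing R] [Algebra Q R] {N : Type u} [AddCommGroup N] [Module Q N] [Module R N]
  [IsScalarTower Q R N]

variable (Q σ R N) in
/-- Tuples of functionals with values in a module from those with values in the ring. -/
def tensorTR (dn : n → ℕ) (i : ℕ) : TR Q σ R dn i ⊗[R] N →ₗ[R] TC Q σ n N :=
  TensorProduct.lift (LinearMap.mk₂ R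
    (fun z y x => ((LinearMap.toSpanSingleton R N y).restrictScalars Q) ∘ₗ z.1 x)
    (fun _ _ _ => funext fun _ => LinearMap.ext fun _ => add_smul _ _ _)
    (fun _ _ _ => funext fun _ => LinearMap.ext fun _ => mul_smul _ _ _)
    (fun _ _ _ => funext fun _ => LinearMap.ext fun _ => smul_add _ _ _)
    (fun _ _ _ => funext fun _ => LinearMap.ext fun _ => smul_comm _ _ _))

lemma tensorTR_tmul (dn : n → ℕ) (i : ℕ) (z : TR Q σ R dn i) (y : N) (x : n)
    (s : MvPolynomial σ Q) : tensorTR Q σ R N dn i (z ⊗ₜ y) x s = z.1 x s • y := rfl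

lemma tensorTR_mem (dn : n → ℕ) (i : ℕ) (z : TR Q σ R dn i ⊗[R] N) :
    tensorTR Q σ R N dn i z ∈ TD (Q := Q) (σ := σ) dn ∅ i := by
  induction z using TensorProduct.induction_on with
  | zero => rw [map_zero]; exact Submodule.zero_mem _
  | add x y hx hy => rw [map_add]; exact Submodule.add_mem _ hx hy
  | tmul z y =>
    intro x μ h
    exact z.2 x μ fun h0 => h (by rw [tensorTR_tmul, h0, zero_smul])

lemma tensorTR_dT {dn : n → ℕ} {b : Matrix n n (MvPolynomial σ Q)} (hb : GrMat dn b) (i : ℕ)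
    (z : TR Q σ R dn (i + 1) ⊗[R] N) :
    dT b (tensorTR Q σ R N dn (i + 1) z) = tensorTR Q σ R N dn i ((dR hb i).rTensor N z) := by
  induction z using TensorProduct.induction_on with
  | zero => simp only [map_zero]
  | add x y hx hy => simp only [map_add, hx, hy]
  | tmul z y =>
    refine funext fun x => LinearMap.ext fun s => ?_
    rw [dT_apply, LinearMap.rTensor_tmul, tensorTR_tmul, dR_coe, dT_apply, Finset.sum_smul]
    rfl

lemma tensorTR_injective (dn : n → ℕ) (i : ℕ) : Function.Injective (tensorTR Q σ R N dn i) ∧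
    ∀ t ∈ TD (Q := Q) (σ := σ) (X := N) dn ∅ i, ∃ z, tensorTR Q σ R N dn i z = t := by
  classical
  let _ : Fintype (Idx σ dn i) := Fintype.ofFinite _
  let e : TR Q σ R dn i ⊗[R] N ≃ₗ[R] (Idx σ dn i → N) :=
    TensorProduct.congr (equivTR Q σ R dn i) (LinearEquiv.refl R N) ≪≫ₗ
      TensorProduct.comm R _ _ ≪≫ₗ TensorProduct.piScalarRight R R N _
  have he (z) (p : Idx σ dn i) : e z p = tensorTR Q σ R N dn i z p.1.1 (monomial p.1.2 1) := by
    induction z using TensorProduct.induction_on with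
    | zero => simp only [map_zero]; rfl
    | add x y hx hy => simp only [map_add, Pi.add_apply, hx, hy]; rfl
    | tmul z y => simp [e, tensorTR_tmul]; rfl
  constructor
  · intro z w h
    exact e.injective (funext fun p => by rw [he, he, h])
  · intro t ht
    refine ⟨e.symm fun p => t p.1.1 (monomial p.1.2 1), TC.ext_mono fun x μ => ?_⟩
    by_cases hx : dn x + 2 * μ.degree = i
    · rw [← he _ ⟨(x, μ), hx⟩, LinearEquiv.apply_symm_apply]
    · rw [not_ne_iff.1 fun h => hx (tensorTR_mem dn i _ x μ h).1,
        not_ne_iff.1 fun h => hx (ht x μ h).1]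

lemma acyc_of_tor {dn : n → ℕ} {b : Matrix n n (MvPolynomial σ Q)} (hb : GrMat dn b) (i t : ℕ)
    (y : Q) (h : ∀ z : TR Q σ R dn (i + 1) ⊗[R] N, (dR hb i).rTensor N z = 0 →
      ∃ w, (dR hb (i + 1)).rTensor N w = algebraMap Q R (y ^ t) • z) :
    Acyc y dn b ∅ N (i + 1) := by
  intro z hz hz0
  obtain ⟨z, rfl⟩ := (tensorTR_injective (R := R) dn (i + 1)).2 z hz
  obtain ⟨w, hw⟩ := h z ((tensorTR_injective dn i).1 (by rw [← tensorTR_dT hb, hz0, map_zero]))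
  refine ⟨t, mem_Bd.2 ⟨_, tensorTR_mem dn _ w, ?_⟩⟩
  rw [tensorTR_dT hb, hw, map_smul]
  exact funext fun x => LinearMap.ext fun s => algebraMap_smul R (y ^ t) _

end TorTR

open MvPolynomial Abelian
open scoped TensorProduct

section Syz

open RingTheory.Sequence
open scoped Pointwise

/-- An iterated syzygy with respect to modules on which `ss` is weakly regular. -/
def Syz (A : Type u) [CommRing A] (ss : List A) : ℕ → ∀ (Z : Type u) [AddCommGroup Z] [Module A Z],
    Prop
  | 0, _, _, _ => True
  | n + 1, Z, _, _ => ∃ (F C : ModuleCat.{u} A) (p : Z →ₗ[A] F) (q : F →ₗ[A] C),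
      Function.Injective p ∧ Function.Exact p q ∧ Function.Surjective q ∧
      IsWeaklyRegular F ss ∧ Syz A ss n C

variable {A : Type u} [CommRing A]

lemma Syz.quot {s : A} {ss : List A} (n : ℕ) {Z : Type u} [AddCommGroup Z] [Module A Z]
    (h : Syz A (s :: ss) (n + 1) Z) : Syz A ss n (QuotSMulTop s Z) := by
  induction n generalizing Z with
  | zero => trivial
  | succ n ih =>
    obtain ⟨F, C, p, q, hp, hpq, hq, hF, hC⟩ := h
    have hs : IsSMulRegular C s := by
      obtain ⟨F', C', p', q', hp', -, -, hF', -⟩ := hC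
      exact ((isWeaklyRegular_cons_iff _ _ _).1 hF').1.of_injective p' hp'
    refine ⟨ModuleCat.of A (QuotSMulTop s F), ModuleCat.of A (QuotSMulTop s C),
      QuotSMulTop.map s p, QuotSMulTop.map s q, ?_, QuotSMulTop.map_exact s hpq hq,
      QuotSMulTop.map_surjective s hq, ((isWeaklyRegular_cons_iff _ _ _).1 hF).2, ih hC⟩
    have h1 : Function.Exact (0 : PUnit.{u+1} →ₗ[A] Z) p := by
      rw [LinearMap.exact_zero_iff_injective]; exact hp
    have h2 := QuotSMulTop.map_first_exact_on_four_term_exact_of_isSMulRegular_last h1 hpq hs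
    rw [← LinearMap.ker_eq_bot, h2.linearMap_ker_eq, map_zero, LinearMap.range_zero]

lemma Syz.isWeaklyRegular {ss : List A} {Z : Type u} [AddCommGroup Z] [Module A Z]
    (h : Syz A ss ss.length Z) : IsWeaklyRegular Z ss := by
  induction ss generalizing Z with
  | nil => exact .nil _ _
  | cons s ss ih =>
    refine (isWeaklyRegular_cons_iff _ _ _).2 ⟨?_, ih (Syz.quot _ h)⟩
    obtain ⟨F, C, p, q, hp, -, -, hF, -⟩ := h
    exact ((isWeaklyRegular_cons_iff _ _ _).1 hF).1.of_injective p hp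

lemma isWeaklyRegular_of_flat (F : Type u) [AddCommGroup F] [Module A F] [Module.Flat A F]
    {ss : List A} (h : IsWeaklyRegular A ss) : IsWeaklyRegular F ss :=
  ((TensorProduct.rid A F).isWeaklyRegular_congr ss).1 h.isWeaklyRegular_lTensor

lemma syz_of_isNthSyzygy {ss : List A} (h : IsWeaklyRegular A ss) (n : ℕ) {Z : ModuleCat.{u} A}
    (hZ : IsNthSyzygy A n Z) : Syz A ss n Z := by
  induction n generalizing Z with
  | zero => trivial
  | succ n ih =>
    obtain ⟨F, C, f, g, w, hF, hS, hC⟩ := hZ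
    refine ⟨F, C, f.hom, g.hom, ?_, ?_, ?_, isWeaklyRegular_of_flat F h, ih hC⟩
    · exact (ModuleCat.mono_iff_injective f).1 hS.mono_f
    · exact (ShortComplex.ShortExact.moduleCat_exact_iff_function_exact _).1 hS.exact
    · exact (ModuleCat.epi_iff_surjective g).1 hS.epi_g

variable [IsLocalRing A] [IsNoetherianRing A]

lemma free_of_isWeaklyRegular {xs : List A}
    (hx : Ideal.ofList xs = IsLocalRing.maximalIdeal A) (X : Type u) [AddCommGroup X] [Module A X]
    [Module.Finite A X] (h : IsWeaklyRegular X xs) : Module.Free A X := by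
  obtain ⟨r, q, hq⟩ := Module.Finite.exists_fin' A X
  have h1 := map_first_exact_on_four_term_right_exact_of_isSMulRegular_last
    (f₁ := (0 : PUnit.{u+1} →ₗ[A] LinearMap.ker q)) (f₂ := (LinearMap.ker q).subtype) (f₃ := q)
    (by rw [LinearMap.exact_zero_iff_injective]; exact Subtype.val_injective)
    (LinearMap.exact_subtype_ker_map q) hq h
  refine Module.free_of_lTensor_residueField_injective (LinearMap.ker q).subtype q hq
    (LinearMap.exact_subtype_ker_map q) ?_
  refine (injective_iff_map_eq_zero _).2 fun z hz => ?_
  obtain ⟨z, rfl⟩ := TensorProduct.mk_surjective A (LinearMap.ker q)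
    (IsLocalRing.ResidueField A) Ideal.Quotient.mk_surjective z
  have key (Y : Type u) [AddCommGroup Y] [Module A Y] (y : Y) :
      (1 : IsLocalRing.ResidueField A) ⊗ₜ[A] y = 0 ↔
        y ∈ Ideal.ofList xs • (⊤ : Submodule A Y) := by
    rw [hx, ← Submodule.Quotient.mk_eq_zero,
      ← TensorProduct.quotTensorEquivQuotSMul_mk_one_tmul, LinearEquiv.map_eq_zero_iff]
    rfl
  obtain ⟨t, ht⟩ := (h1 (Submodule.Quotient.mk z)).1
    ((Submodule.Quotient.mk_eq_zero _).2 ((key _ _).1 hz))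
  obtain ⟨t, rfl⟩ := Submodule.Quotient.mk_surjective _ t
  exact (key _ _).2 ((Submodule.Quotient.mk_eq_zero _).1 (ht.symm.trans (by simp)))

lemma hasProjectiveDimensionLT_of_syz {xs : List A} (hA : IsWeaklyRegular A xs)
    (hx : Ideal.ofList xs = IsLocalRing.maximalIdeal A) (k j : ℕ) (hj : j + k = xs.length)
    (X : Type u) [AddCommGroup X] [Module A X] [Module.Finite A X] (h : Syz A xs j X) :
    HasProjectiveDimensionLT (ModuleCat.of A X) (k + 1) := by
  induction k generalizing j X with
  | zero =>
    have : Module.Free A X := free_of_isWeaklyRegular hx X (by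
      subst hj; exact Syz.isWeaklyRegular h)
    exact projective_iff_hasProjectiveDimensionLT_one.1
      ((IsProjective.iff_projective X).1 inferInstance)
  | succ k ih =>
    obtain ⟨r, q, hq⟩ := Module.Finite.exists_fin' A X
    have hs : (sc (LinearMap.ker q).subtype q (LinearMap.exact_subtype_ker_map q)).ShortExact :=
      sc_shortExact Subtype.val_injective _ hq
    have h1 := ih (j + 1) (by omega) (LinearMap.ker q)
      ⟨ModuleCat.of A (Fin r → A), ModuleCat.of A X, (LinearMap.ker q).subtype, q,
        Subtype.val_injective, LinearMap.exact_subtype_ker_map q, hq,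
        isWeaklyRegular_of_flat _ hA, h⟩
    have h2 : Projective (ModuleCat.of A (Fin r → A)) :=
      (IsProjective.iff_projective _).1 inferInstance
    exact (hs.hasProjectiveDimensionLT_X₃_iff k h2).2 h1

lemma hasProjectiveDimensionLT_of_isWeaklyRegular {xs ss : List A} (hA : IsWeaklyRegular A xs)
    (hx : Ideal.ofList xs = IsLocalRing.maximalIdeal A) (X : Type u) [AddCommGroup X] [Module A X]
    [Module.Finite A X] [Nontrivial X] (hss : ∀ s ∈ ss, s ∈ IsLocalRing.maximalIdeal A)
    (h : IsWeaklyRegular X ss) {L : ℕ} (hL : L + ss.length = xs.length) :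
    HasProjectiveDimensionLT (ModuleCat.of A X) (L + 1) := by
  have h1 := hasProjectiveDimensionLT_of_syz hA hx xs.length 0 (by simp)
    (X ⧸ Ideal.ofList ss • (⊤ : Submodule A X)) trivial
  have h2 := ModuleCat.projectiveDimension_quotient_eq_add_length_of_isWeaklyRegular
    (ModuleCat.of A X) ss h hss
  have h3 := (projectiveDimension_le_iff _ _).2 h1
  rw [← hL] at h3
  refine (projectiveDimension_le_iff _ _).1 ?_
  have h4 := h2.symm.trans_le h3
  rw [Nat.cast_add] at h4
  exact (ENat.WithBot.add_le_add_natCast_right_iff).1 h4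

namespace FinRes

/-- Splice a finite resolution of the kernel of a free cover. -/
def cover {A : Type u} [CommRing A] {X : Type u} [AddCommGroup X] [Module A X] {r : ℕ}
    (q : (Fin r → A) →ₗ[A] X) (hq : Function.Surjective q) {ι : Type} [Fintype ι]
    (G : FinRes A (LinearMap.ker q) ι) : FinRes A X (Fin r ⊕ ι) where
  deg := Sum.elim 0 (fun x => G.deg x + 1)
  del := Matrix.fromBlocks 0 (Matrix.of fun i x => (G.aug x : Fin r → A) i) 0 G.del
  aug := Sum.elim (fun i => q (Pi.single i 1)) 0
  del_deg := by
    rintro (x | x) (y | y) h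
    · simp at h
    · have h1 : G.aug y ≠ 0 := fun h2 => h (by simp [h2])
      simp [G.aug_deg y h1]
    · simp at h
    · simpa using G.del_deg x y h
  del_sq := by
    rw [Matrix.fromBlocks_multiply, G.del_sq]
    have : (Matrix.of fun i x => (G.aug x : Fin r → A) i) * G.del = 0 := by
      ext i y
      have := congrFun (congrArg Subtype.val (G.aug_del y)) i
      simpa [Matrix.mul_apply, mul_comm] using this
    simp [this]
  aug_deg := by
    rintro (x | x) h
    · rfl
    · simp at h
  aug_del := by
    rintro (y | y)
    · simp
    · have : q (G.aug y) = 0 := (G.aug y).2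
      rw [LinearMap.pi_apply_eq_sum_univ] at this
      simpa [← Pi.single_apply, Pi.single_comm] using this
  aug_span := by
    refine eq_top_iff.2 fun x _ => ?_
    obtain ⟨v, rfl⟩ := hq x
    rw [LinearMap.pi_apply_eq_sum_univ]
    refine Submodule.sum_mem _ fun i _ => Submodule.smul_mem _ _ (Submodule.subset_span
      ⟨Sum.inl i, ?_⟩)
    simp only [Sum.elim_inl]
    congr 1
    ext j
    simp [Pi.single_apply, eq_comm]
  exact := by
    intro v hv hv'
    have h1 : ∑ x, v (Sum.inr x) • G.aug x = 0 := by
      refine Subtype.ext (funext fun i => ?_)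
      have := congrFun hv (Sum.inl i)
      simpa [Matrix.mulVec, dotProduct, mul_comm] using this
    have h2 : G.del.mulVec (fun x => v (Sum.inr x)) = 0 := by
      funext x
      have := congrFun hv (Sum.inr x)
      simpa [Matrix.mulVec, dotProduct] using this
    obtain ⟨u, hu⟩ := G.exact _ h2 h1
    have h3 : q (fun i => v (Sum.inl i)) = 0 := by
      rw [LinearMap.pi_apply_eq_sum_univ]
      simpa [← Pi.single_apply, Pi.single_comm] using hv'
    let z : LinearMap.ker q := ⟨fun i => v (Sum.inl i), h3⟩ - ∑ x, u x • G.aug x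
    have hz : z ∈ Submodule.span A (Set.range G.aug) := by rw [G.aug_span]; trivial
    obtain ⟨s, hs⟩ := (Submodule.mem_span_range_iff_exists_fun A).1 hz
    let s' : ι → A := fun x => if G.deg x = 0 then s x else 0
    have hs1 : ∑ x, s' x • G.aug x = z := by
      rw [← hs]
      refine Finset.sum_congr rfl fun x _ => ?_
      by_cases hx : G.deg x = 0
      · simp [s', hx]
      · rw [show G.aug x = 0 by by_contra h; exact hx (G.aug_deg x h), smul_zero, smul_zero]
    have hs2 : G.del.mulVec s' = 0 := by
      funext x
      refine Finset.sum_eq_zero fun y _ => ?_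
      by_cases hx : G.del x y = 0
      · simp [hx]
      · simp [s', G.del_deg x y hx]
    refine ⟨Sum.elim 0 (u + s'), ?_⟩
    rw [Matrix.fromBlocks_mulVec]
    funext x
    rcases x with i | x
    · have h4 : ∑ x, (u + s') x • G.aug x = ⟨fun i => v (Sum.inl i), h3⟩ := by
        simp only [Pi.add_apply, add_smul, Finset.sum_add_distrib, hs1, z]
        abel
      have := congrFun (congrArg Subtype.val h4) i
      simpa [Matrix.mulVec, dotProduct, mul_comm] using this
    · simpa [Matrix.mulVec_add, hs2] using congrFun hu x

end FinRes

lemma exists_finRes (L : ℕ) (X : Type u) [AddCommGroup X] [Module A X] [Module.Finite A X]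
    (h : HasProjectiveDimensionLT (ModuleCat.of A X) (L + 1)) :
    ∃ (n : Type) (_ : Fintype n) (_ : DecidableEq n) (G : FinRes A X n), ∀ x, G.deg x ≤ L := by
  induction L generalizing X with
  | zero =>
    have h1 : Module.Projective A X := (IsProjective.iff_projective X).2
      (projective_iff_hasProjectiveDimensionLT_one.2 h)
    have h2 : Module.Free A X := Module.free_of_flat_of_isLocalRing
    let b := Module.finBasis A X
    exact ⟨_, inferInstance, inferInstance,
      { deg := 0
        del := 0
        aug := b
        del_deg := by simp
        del_sq := by simp
        aug_deg := by simp
        aug_del := by simp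
        aug_span := b.span_eq
        exact := fun v _ hv => ⟨0, funext fun x => by
          simpa using (Fintype.linearIndependent_iff.1 b.linearIndependent v hv x).symm⟩ },
      fun x => le_rfl⟩
  | succ L ih =>
    obtain ⟨r, q, hq⟩ := Module.Finite.exists_fin' A X
    have hs : (sc (LinearMap.ker q).subtype q (LinearMap.exact_subtype_ker_map q)).ShortExact :=
      sc_shortExact Subtype.val_injective _ hq
    have h2 : Projective (ModuleCat.of A (Fin r → A)) :=
      (IsProjective.iff_projective _).1 inferInstance
    obtain ⟨n, _, _, G, hG⟩ := ih (LinearMap.ker q) ((hs.hasProjectiveDimensionLT_X₃_iff L h2).1 h)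
    refine ⟨_, inferInstance, inferInstance, G.cover q hq, ?_⟩
    rintro (x | x)
    · exact Nat.zero_le _
    · exact Nat.succ_le_succ (hG x)


end Syz

open MvPolynomial Abelian
open scoped TensorProduct

section Presentation

open RingTheory.Sequence IsLocalRing

/-- A presentation of an extension `R` of the local ring `R₀` as a quotient of `Q`, whose maximal
ideal is generated by a regular sequence, by a regular sequence. -/
structure Pres (R₀ Q R : Type u) [CommRing R₀] [CommRing Q] [CommRing R] [IsLocalRing R₀]
    [IsLocalRing Q] [Algebra Q R] [Algebra R₀ R] where
  xs : List Q
  fs : List Q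
  xs_reg : IsWeaklyRegular Q xs
  ofList_xs : Ideal.ofList xs = maximalIdeal Q
  fs_reg : IsWeaklyRegular Q fs
  fs_mem : ∀ f ∈ fs, f ∈ maximalIdeal Q
  surj : Function.Surjective (algebraMap Q R)
  ker : RingHom.ker (algebraMap Q R) = Ideal.ofList fs
  map_ne_top : (maximalIdeal R₀).map (algebraMap R₀ R) ≠ ⊤
  map_eq : (maximalIdeal R₀).map (algebraMap R₀ R) = (maximalIdeal Q).map (algebraMap Q R)

lemma ker_includeRight {Q S T : Type u} [CommRing Q] [CommRing S] [CommRing T] [Algebra Q S]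
    [Algebra Q T] (hs : Function.Surjective (algebraMap Q S)) :
    RingHom.ker (Algebra.TensorProduct.includeRight : T →ₐ[Q] S ⊗[Q] T) =
      (RingHom.ker (algebraMap Q S)).map (algebraMap Q T) := by
  apply le_antisymm
  · intro t ht
    have h1 : (1 : Q) ⊗ₜ[Q] t ∈ RingHom.ker
        (Algebra.TensorProduct.map (Algebra.ofId Q S) (AlgHom.id Q T)) := by
      rw [RingHom.mem_ker] at ht ⊢
      simpa using ht
    rw [Algebra.TensorProduct.rTensor_ker _ hs] at h1
    have h2 : (RingHom.ker (Algebra.ofId Q S)).map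
        (Algebra.TensorProduct.includeLeft : Q →ₐ[Q] Q ⊗[Q] T) ≤
        ((RingHom.ker (algebraMap Q S)).map (algebraMap Q T)).comap
          (Algebra.TensorProduct.lid Q T) := by
      rw [Ideal.map_le_iff_le_comap]
      intro x hx
      rw [Ideal.mem_comap, Ideal.mem_comap]
      have hx : x ∈ RingHom.ker (algebraMap Q S) := hx
      simpa [Algebra.algebraMap_eq_smul_one] using Ideal.mem_map_of_mem (algebraMap Q T) hx
    simpa using h2 h1
  · rw [Ideal.map_le_iff_le_comap]
    intro x hx
    have hx : algebraMap Q S x = 0 := hx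
    rw [Ideal.mem_comap, RingHom.mem_ker, AlgHom.commutes, Algebra.TensorProduct.algebraMap_apply,
      hx, TensorProduct.zero_tmul]

lemma map_maximalIdeal_ne_top {Q S : Type u} [CommRing Q] [CommRing S] [IsLocalRing Q]
    (f : Q →+* S) (hf : Function.Surjective f) (hk : RingHom.ker f ≤ maximalIdeal Q) :
    (maximalIdeal Q).map f ≠ ⊤ := by
  intro h
  have h1 := congrArg (Ideal.comap f) h
  rw [Ideal.comap_map_of_surjective' _ hf, Ideal.comap_top, sup_eq_left.2 hk] at h1
  exact (maximalIdeal.isMaximal Q).ne_top h1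

/-- Local base change with infinite residue field. -/
lemma exists_infinite_residueField (Q : Type u) [CommRing Q] [IsLocalRing Q]
    [IsNoetherianRing Q] : ∃ (T : Type u) (_ : CommRing T) (_ : IsLocalRing T)
      (_ : IsNoetherianRing T) (_ : Infinite (ResidueField T)) (_ : Algebra Q T),
      Module.Flat Q T ∧ (maximalIdeal Q).map (algebraMap Q T) = maximalIdeal T := by
  let P : Ideal (Polynomial Q) := (maximalIdeal Q).map Polynomial.C
  have hP : P.IsPrime := Ideal.isPrime_map_C_of_isPrime
  have hfl : Module.Flat (Polynomial Q) (Localization.AtPrime P) :=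
    IsLocalization.flat _ P.primeCompl
  refine ⟨Localization.AtPrime P, inferInstance, inferInstance,
    IsLocalization.isNoetherianRing P.primeCompl _ inferInstance, ?_, inferInstance,
    Module.Flat.trans Q (Polynomial Q) _, ?_⟩
  · refine Infinite.of_injective (fun i : ℕ => residue (Localization.AtPrime P)
      (algebraMap (Polynomial Q) _ (Polynomial.X ^ i))) fun i j hij => ?_
    by_contra hne
    have h1 := sub_eq_zero.2 hij
    rw [← map_sub, ← map_sub, residue_eq_zero_iff,
      IsLocalization.AtPrime.to_map_mem_maximal_iff _ P, Ideal.mem_map_C_iff] at h1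
    have h2 := h1 i
    rw [Polynomial.coeff_sub, Polynomial.coeff_X_pow, Polynomial.coeff_X_pow, if_pos rfl,
      if_neg hne, sub_zero] at h2
    exact (maximalIdeal.isMaximal Q).ne_top ((Ideal.eq_top_iff_one _).2 h2)
  · rw [IsScalarTower.algebraMap_eq Q (Polynomial Q), ← Ideal.map_map]
    exact Localization.AtPrime.map_eq_maximalIdeal

lemma exists_pres (R₀ : Type u) [CommRing R₀] [IsLocalRing R₀] [IsNoetherianRing R₀]
    (h : IsCompleteIntersectionLocal R₀) : ∃ (T R : Type u) (_ : CommRing T) (_ : CommRing R)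
      (_ : IsLocalRing T) (_ : IsNoetherianRing T) (_ : Infinite (ResidueField T))
      (_ : Algebra T R) (_ : Algebra R₀ R), Module.Flat R₀ R ∧ Nonempty (Pres R₀ T R) := by
  obtain ⟨Q, φ, ⟨hQ, hQN, xs, hxs, hxm⟩, hφ, fs, hfs, hker⟩ := h
  obtain ⟨T, _, hT, _, _, _, hfl, hm⟩ := exists_infinite_residueField Q
  let _ : Algebra Q (AdicCompletion (maximalIdeal R₀) R₀) := φ.toAlgebra
  let S := AdicCompletion (maximalIdeal R₀) R₀
  have : SMulCommClass R₀ Q S := ⟨fun a b c => by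
    rw [Algebra.smul_def, Algebra.smul_def, Algebra.smul_def, Algebra.smul_def, mul_left_comm]⟩
  have hS : Function.Surjective (algebraMap Q S) := hφ
  have hkerS : RingHom.ker (algebraMap Q S) = Ideal.ofList fs := hker
  have hfl' : Module.Flat S (S ⊗[Q] T) := inferInstance
  let _ : Algebra T (S ⊗[Q] T) := Algebra.TensorProduct.rightAlgebra
  have hsurj : Function.Surjective (algebraMap T (S ⊗[Q] T)) :=
    Algebra.TensorProduct.includeRight_surjective T hS
  have hk : RingHom.ker (algebraMap T (S ⊗[Q] T)) = Ideal.ofList (fs.map (algebraMap Q T)) := by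
    rw [← Ideal.map_ofList, ← hkerS]
    exact ker_includeRight hS
  have hfm : ∀ f ∈ fs, f ∈ maximalIdeal Q := fun f hf => by
    refine le_maximalIdeal (RingHom.ker_ne_top (algebraMap Q S)) ?_
    rw [hkerS]; exact Ideal.subset_span hf
  have hfm' : ∀ f ∈ fs.map (algebraMap Q T), f ∈ maximalIdeal T := fun f hf => by
    obtain ⟨x, hx, rfl⟩ := List.mem_map.1 hf
    rw [← hm]
    exact Ideal.mem_map_of_mem _ (hfm x hx)
  have heq : (maximalIdeal R₀).map (algebraMap R₀ (S ⊗[Q] T)) =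
      (maximalIdeal T).map (algebraMap T (S ⊗[Q] T)) := by
    have h1 : (maximalIdeal R₀).map (algebraMap R₀ S) = (maximalIdeal Q).map (algebraMap Q S) := by
      rw [← AdicCompletion.maximalIdeal_eq_map]
      exact (eq_maximalIdeal ((Ideal.map_eq_top_or_isMaximal_of_surjective _ hS inferInstance
        ).resolve_left (map_maximalIdeal_ne_top _ hS (le_maximalIdeal
        (RingHom.ker_ne_top (algebraMap Q S)))))).symm
    have h2 : algebraMap R₀ (S ⊗[Q] T) = (algebraMap S (S ⊗[Q] T)).comp (algebraMap R₀ S) := rfl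
    have h3 : (algebraMap S (S ⊗[Q] T)).comp (algebraMap Q S) =
        (algebraMap T (S ⊗[Q] T)).comp (algebraMap Q T) :=
      Algebra.TensorProduct.algebraMap_def.symm.trans
        (Algebra.TensorProduct.includeRight (R := Q) (A := S) (B := T)).comp_algebraMap.symm
    rw [h2, ← Ideal.map_map, h1, Ideal.map_map, h3, ← Ideal.map_map, hm]
  refine ⟨T, S ⊗[Q] T, inferInstance, inferInstance, hT, inferInstance, inferInstance,
    inferInstance, inferInstance, Module.Flat.trans R₀ S _,
    ⟨⟨xs.map (algebraMap Q T), fs.map (algebraMap Q T), hxs.1.of_flat, ?_, hfs.1.of_flat,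
    hfm', hsurj, hk, ?_, heq⟩⟩⟩
  · rw [← Ideal.map_ofList, ← hm]
    congr 1
    exact IsLocalRing.eq_maximalIdeal hxm
  · rw [heq]
    refine map_maximalIdeal_ne_top _ hsurj ?_
    rw [hk]; exact Ideal.span_le.2 hfm'

end Presentation

open MvPolynomial Abelian
open scoped TensorProduct

section Descent

open RingTheory.Sequence IsLocalRing

section Quot

open scoped Pointwise

variable {Q : Type u} [CommRing Q] {m : Ideal Q}

lemma EV.quot {A : Type u} [AddCommGroup A] [Module Q A] {rs : List Q} (h : IsWeaklyRegular A rs)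
    (j : ℕ) (hE : ∀ i < rs.length + j, EV m A i) (i : ℕ) (hi : i < j) :
    EV m (A ⧸ Ideal.ofList rs • (⊤ : Submodule Q A)) i := by
  induction rs generalizing A i with
  | nil => exact (hE i (by simpa)).of_equiv (Submodule.quotEquivOfEqBot _ (by simp)).symm
  | cons r rs ih =>
    obtain ⟨h1, h2⟩ := (isWeaklyRegular_cons_iff A r rs).1 h
    rw [List.length_cons] at hE
    refine (ih h2 (fun i hi => EV.right (p := LinearMap.lsmul Q A r)
      (q := Submodule.mkQ (r • (⊤ : Submodule Q A))) h1 (fun v => ?_)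
      (Submodule.mkQ_surjective _) (hE i (by lia)) (hE (i + 1) (by lia))) i hi).of_equiv
      (Submodule.quotOfListConsSMulTopEquivQuotSMulTopInner A r rs).symm
    rw [Submodule.mkQ_apply, Submodule.Quotient.mk_eq_zero,
      Submodule.mem_smul_pointwise_iff_exists]
    simp

end Quot

section Depth

variable {A : Type u} [CommRing A] [IsLocalRing A] [IsNoetherianRing A]

lemma exists_depth (X : Type u) [AddCommGroup X] [Module A X] [Module.Finite A X] [Nontrivial X]
    (h : BddAbove {n | ∃ rs : List A, rs.length = n ∧ (∀ r ∈ rs, r ∈ maximalIdeal A) ∧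
      IsRegular X rs}) : ∃ rs : List A, rs.length = depth A (ModuleCat.of A X) ∧
      (∀ r ∈ rs, r ∈ maximalIdeal A) ∧ IsWeaklyRegular X rs ∧
      ∃ x ∉ Ideal.ofList rs • (⊤ : Submodule A X),
        ∀ y ∈ maximalIdeal A, y • x ∈ Ideal.ofList rs • (⊤ : Submodule A X) := by
  obtain ⟨rs, hl, hm, hr⟩ := Nat.sSup_mem (s := {n | ∃ rs : List A, rs.length = n ∧
    (∀ r ∈ rs, r ∈ maximalIdeal A) ∧ IsRegular X rs}) ⟨0, [], rfl, by simp, .nil A X⟩ h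
  refine ⟨rs, hl, hm, hr.1, ?_⟩
  by_contra! hc
  have hE : ⋃ p ∈ associatedPrimes A (X ⧸ Ideal.ofList rs • (⊤ : Submodule A X)), (p : Set A) = _ :=
    biUnion_associatedPrimes_eq_compl_regular A _
  by_cases hs : (maximalIdeal A : Set A) ⊆
      ⋃ p ∈ associatedPrimes A (X ⧸ Ideal.ofList rs • (⊤ : Submodule A X)), (p : Set A)
  · obtain ⟨p, hp, hle⟩ := ((maximalIdeal A).subset_union_prime_finite
      (associatedPrimes.finite ..) (f := id) 0 0 fun _ h _ _ => h.1).1 hs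
    rw [AssociatedPrimes.mem_iff, isAssociatedPrime_iff] at hp
    obtain ⟨hpp, x, rfl⟩ := hp
    obtain ⟨x, rfl⟩ := Submodule.Quotient.mk_surjective _ x
    have h0 : x ∉ Ideal.ofList rs • (⊤ : Submodule A X) := fun hx => hpp.ne_top (by
      simp [(Submodule.Quotient.mk_eq_zero _).2 hx])
    obtain ⟨y, hy, hyx⟩ := hc x h0
    have h2 := hle hy
    rw [id, Submodule.mem_colon_singleton, Submodule.mem_bot, ← Submodule.Quotient.mk_smul] at h2
    exact hyx ((Submodule.Quotient.mk_eq_zero _).1 h2)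
  · obtain ⟨y, hy, hyr⟩ := Set.not_subset.1 hs
    rw [hE, Set.mem_compl_iff, not_not] at hyr
    have h3 : IsWeaklyRegular X (rs ++ [y]) := (isWeaklyRegular_append_iff ..).2
      ⟨hr.1, (isWeaklyRegular_singleton_iff ..).2 hyr⟩
    have h4 : ∀ r ∈ rs ++ [y], r ∈ maximalIdeal A := fun r h => by
      rcases List.mem_append.1 h with h | h
      · exact hm r h
      · rwa [List.mem_singleton.1 h]
    have := le_csSup h ⟨rs ++ [y], rfl, h4, .of_isWeaklyRegular_of_mem_maximalIdeal _ h4 h3⟩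
    rw [← hl, List.length_append, List.length_singleton] at this
    lia

end Depth

variable {R₀ Q R : Type u} [CommRing R₀] [CommRing Q] [CommRing R] [IsLocalRing R₀]
  [IsNoetherianRing R₀] [IsLocalRing Q] [Algebra Q R] [Algebra R₀ R] [Module.Flat R₀ R]
  [SMulCommClass R₀ Q R] (P : Pres R₀ Q R) {X : Type u} [AddCommGroup X] [Module R₀ X]

include P

lemma Pres.exists_lift : ∃ f : R₀ → Q, ∀ r ∈ maximalIdeal R₀,
    f r ∈ maximalIdeal Q ∧ algebraMap Q R (f r) = algebraMap R₀ R r := by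
  have (r : R₀) : ∃ y, r ∈ maximalIdeal R₀ → y ∈ maximalIdeal Q ∧
      algebraMap Q R y = algebraMap R₀ R r := by
    by_cases hr : r ∈ maximalIdeal R₀
    · obtain ⟨y, hy⟩ := (Ideal.mem_map_iff_of_surjective _ P.surj).1
        (P.map_eq ▸ Ideal.mem_map_of_mem (algebraMap R₀ R) hr)
      exact ⟨y, fun _ => hy⟩
    · exact ⟨0, fun h => absurd h hr⟩
  exact ⟨_, fun r => (this r).choose_spec⟩

lemma Pres.faithfullyFlat : Module.FaithfullyFlat R₀ R where
  submodule_ne_top m hm h := P.map_ne_top (by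
    rwa [eq_maximalIdeal hm, Ideal.smul_top_eq_map, Submodule.restrictScalars_eq_top_iff] at h)

lemma Pres.exists_list {rs : List R₀} (hm : ∀ r ∈ rs, r ∈ maximalIdeal R₀) :
    ∃ ys : List Q, ys.length = rs.length ∧ (∀ y ∈ ys, y ∈ maximalIdeal Q) ∧
      ys.map (algebraMap Q R) = rs.map (algebraMap R₀ R) := by
  obtain ⟨f, hf⟩ := P.exists_lift
  refine ⟨rs.map f, by simp, fun y hy => ?_, ?_⟩
  · obtain ⟨r, hr, rfl⟩ := List.mem_map.1 hy
    exact (hf r (hm r hr)).1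
  · rw [List.map_map]
    exact List.map_congr_left fun r hr => (hf r (hm r hr)).2

omit P in
lemma isWeaklyRegular_baseChange {rs : List R₀} {ys : List Q}
    (h : ys.map (algebraMap Q R) = rs.map (algebraMap R₀ R)) (hX : IsWeaklyRegular X rs) :
    IsWeaklyRegular (R ⊗[R₀] X) ys :=
  (isWeaklyRegular_map_algebraMap_iff R _ ys).1
    (h ▸ hX.of_flat_of_isBaseChange (TensorProduct.isBaseChange R₀ X R))

lemma Pres.ev_baseChange {rs : List R₀} (hm : ∀ r ∈ rs, r ∈ maximalIdeal R₀)
    (hX : IsWeaklyRegular X rs) {x : X} (hx : x ∉ Ideal.ofList rs • (⊤ : Submodule R₀ X))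
    (hs : ∀ y ∈ maximalIdeal R₀, y • x ∈ Ideal.ofList rs • (⊤ : Submodule R₀ X)) :
    (∀ i < rs.length, EV (maximalIdeal Q) (R ⊗[R₀] X) i) ∧
      ¬ EV (maximalIdeal Q) (R ⊗[R₀] X) rs.length := by
  obtain ⟨ys, hl, hy, he⟩ := P.exists_list hm
  have hw := isWeaklyRegular_baseChange he hX
  have hff := P.faithfullyFlat
  rw [← hl]
  refine ⟨fun i hi => EV.of_isWeaklyRegular' hy hw hi, EV.not_of_isWeaklyRegular hy hw
    ⟨Submodule.Quotient.mk (1 ⊗ₜ x), ?_, fun y hy => ?_⟩⟩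
  all_goals
    have hK : ∀ z : R ⊗[R₀] X, z ∈ Ideal.ofList ys • (⊤ : Submodule Q (R ⊗[R₀] X)) ↔
        z ∈ (Ideal.ofList rs).map (algebraMap R₀ R) • (⊤ : Submodule R (R ⊗[R₀] X)) := fun z => by
      have h1 := Ideal.smul_restrictScalars (Ideal.ofList ys) (⊤ : Submodule R (R ⊗[R₀] X))
      rw [Ideal.map_ofList, he, ← Ideal.map_ofList] at h1
      rw [← Submodule.restrictScalars_top Q R, ← h1, Submodule.restrictScalars_mem]
    have hK' : ∀ z : R ⊗[R₀] X, z ∈ Ideal.ofList rs • (⊤ : Submodule R₀ (R ⊗[R₀] X)) ↔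
        z ∈ (Ideal.ofList rs).map (algebraMap R₀ R) • (⊤ : Submodule R (R ⊗[R₀] X)) := fun z => by
      rw [← Submodule.restrictScalars_top R₀ R, ← Ideal.smul_restrictScalars,
        Submodule.restrictScalars_mem]
  · rw [ne_eq, Submodule.Quotient.mk_eq_zero, hK, ← hK']
    intro h
    have h1 : ∀ z ∈ Ideal.ofList rs • (⊤ : Submodule R₀ (R ⊗[R₀] X)),
        (Submodule.mkQ (Ideal.ofList rs • (⊤ : Submodule R₀ X))).lTensor R z = 0 := fun z hz => by
      induction hz using Submodule.smul_induction_on' with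
      | smul r hr n _ =>
        have : r • Submodule.mkQ (Ideal.ofList rs • (⊤ : Submodule R₀ X)) = 0 :=
          LinearMap.ext fun v => (Submodule.Quotient.mk_eq_zero _).2
            (Submodule.smul_mem_smul hr Submodule.mem_top)
        rw [map_smul, ← LinearMap.smul_apply, ← LinearMap.lTensor_smul, this,
          LinearMap.lTensor_zero, LinearMap.zero_apply]
      | add a _ b _ ha hb => rw [map_add, ha, hb, add_zero]
    exact hx ((Submodule.Quotient.mk_eq_zero _).1
      (Module.FaithfullyFlat.tensorProduct_mk_injective _
        ((h1 _ h).trans (TensorProduct.tmul_zero _ _).symm)))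
  · rw [← Submodule.Quotient.mk_smul, Submodule.Quotient.mk_eq_zero, hK]
    have h1 : (maximalIdeal R₀).map (algebraMap R₀ R) ≤
        ((Ideal.ofList rs).map (algebraMap R₀ R) • (⊤ : Submodule R (R ⊗[R₀] X))).comap
          (LinearMap.toSpanSingleton R _ (1 ⊗ₜ x)) := by
      rw [Ideal.map_le_iff_le_comap]
      intro r hr
      rw [Ideal.mem_comap, Submodule.mem_comap, LinearMap.toSpanSingleton_apply,
        algebraMap_smul, ← TensorProduct.tmul_smul, ← hK']
      have h2 := Submodule.mem_map_of_mem (f := TensorProduct.mk R₀ R X 1) (hs r hr)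
      rw [Submodule.map_smul''] at h2
      exact Submodule.smul_mono le_rfl le_top h2
    have h2 := h1 (P.map_eq ▸ Ideal.mem_map_of_mem _ hy :
      algebraMap Q R y ∈ (maximalIdeal R₀).map (algebraMap R₀ R))
    rwa [Submodule.mem_comap, LinearMap.toSpanSingleton_apply, algebraMap_smul] at h2

end Descent

open MvPolynomial Abelian
open scoped TensorProduct

section Assembly

open RingTheory.Sequence IsLocalRing

lemma isRegFam_of_isWeaklyRegular {Q : Type u} [CommRing Q] {fs : List Q}
    (h : IsWeaklyRegular Q fs) : IsRegFam (fun j : Fin fs.length => fs[j]) := by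
  intro j x hx
  have hI : Ideal.ofList (fs.take j) • (⊤ : Submodule Q Q) =
      Ideal.span ((fun j : Fin fs.length => fs[j]) '' {l | l < j}) := by
    rw [smul_eq_mul, Ideal.mul_top, Ideal.ofList]
    congr 1
    ext y
    simp only [Set.mem_ofPred_eq, List.mem_take_iff_getElem, Set.mem_image]
    exact ⟨fun ⟨i, hi, h⟩ => ⟨⟨i, by lia⟩, Fin.lt_def.2 (by simpa using (lt_min_iff.1 hi).1), h⟩,
      fun ⟨i, hi, h⟩ => ⟨i, lt_min hi i.2, h⟩⟩
  have h1 := isSMulRegular_iff_right_eq_zero_of_smul.1 (h.regular_mod_prev j j.2)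
    (Submodule.Quotient.mk x)
  rw [← Submodule.Quotient.mk_smul, Submodule.Quotient.mk_eq_zero, Submodule.Quotient.mk_eq_zero,
    hI] at h1
  exact h1 hx

variable {R₀ : Type u} [CommRing R₀]

lemma exists_free_chain (n : ℕ) {N : ModuleCat.{u} R₀} (h : IsNthSyzygy R₀ n N) :
    ∃ C : ℕ → ModuleCat.{u} R₀, C 0 = N ∧ ∀ j, ∃ (I : Type u) (p : C j →ₗ[R₀] (I →₀ R₀))
      (q : (I →₀ R₀) →ₗ[R₀] C (j + 1)),
      j < n → Function.Injective p ∧ Function.Exact p q ∧ Function.Surjective q := by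
  induction n generalizing N with
  | zero => exact ⟨fun _ => N, rfl, fun j => ⟨PUnit, 0, 0, fun h => absurd h j.not_lt_zero⟩⟩
  | succ n ih =>
    obtain ⟨F, C, f, g, w, hF, hS, hC⟩ := h
    obtain ⟨C, rfl, h⟩ := ih hC
    refine ⟨fun j => Nat.casesOn j N C, rfl, fun j => ?_⟩
    cases j with
    | zero =>
      let e := (Module.Free.chooseBasis R₀ F).repr
      refine ⟨_, e.toLinearMap ∘ₗ f.hom, g.hom ∘ₗ e.symm.toLinearMap, fun _ => ⟨?_, ?_, ?_⟩⟩
      · exact e.injective.comp ((ModuleCat.mono_iff_injective f).1 hS.mono_f)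
      · refine fun y => (((ShortComplex.ShortExact.moduleCat_exact_iff_function_exact _).1 hS.exact)
          (e.symm y)).trans ⟨fun ⟨x, hx⟩ => ⟨x, ?_⟩, fun ⟨x, hx⟩ => ⟨x, ?_⟩⟩
        · exact (congrArg e hx).trans (e.apply_symm_apply y)
        · exact (e.symm_apply_apply _).symm.trans (congrArg e.symm hx)
      · exact ((ModuleCat.epi_iff_surjective g).1 hS.epi_g).comp e.symm.surjective
    | succ j =>
      obtain ⟨I, p, q, h⟩ := h j
      exact ⟨I, p, q, fun hj => h (by lia)⟩

lemma exists_free_baseChange {R : Type u} [CommRing R] [Algebra R₀ R] [Module.Flat R₀ R] {X Y I : Type u}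
    [AddCommGroup X] [Module R₀ X] [AddCommGroup Y] [Module R₀ Y] (p : X →ₗ[R₀] (I →₀ R₀))
    (q : (I →₀ R₀) →ₗ[R₀] Y) : ∃ (p' : R ⊗[R₀] X →ₗ[R] (I →₀ R)) (q' : (I →₀ R) →ₗ[R] R ⊗[R₀] Y),
      Function.Injective p ∧ Function.Exact p q ∧ Function.Surjective q →
      Function.Injective p' ∧ Function.Exact p' q' ∧ Function.Surjective q' := by
  classical
  let e := TensorProduct.finsuppScalarRight R₀ R R I
  refine ⟨e.toLinearMap ∘ₗ p.baseChange R, q.baseChange R ∘ₗ e.symm.toLinearMap,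
    fun ⟨hp, hpq, hq⟩ => ⟨?_, ?_, ?_⟩⟩
  · exact e.injective.comp (Module.Flat.lTensor_preserves_injective_linearMap p hp)
  · refine fun y => (Module.Flat.lTensor_exact R hpq (e.symm y)).trans
      ⟨fun ⟨x, hx⟩ => ⟨x, ?_⟩, fun ⟨x, hx⟩ => ⟨x, ?_⟩⟩
    · exact (congrArg e hx).trans (e.apply_symm_apply y)
    · exact (e.symm_apply_apply _).symm.trans (congrArg e.symm hx)
  · exact (LinearMap.lTensor_surjective R hq).comp e.symm.surjective

/-- Base change of a tensor product, computed over a ring surjecting onto the new base. -/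
def distribEquiv {Q R : Type u} [CommRing Q] [CommRing R] [Algebra Q R] [Algebra R₀ R]
    [SMulCommClass R₀ Q R] (hs : Function.Surjective (algebraMap Q R)) (X Y : Type u)
    [AddCommGroup X] [Module R₀ X] [AddCommGroup Y] [Module R₀ Y] :
    R ⊗[R₀] (X ⊗[R₀] Y) ≃ₗ[Q] (R ⊗[R₀] Y) ⊗[Q] (R ⊗[R₀] X) :=
  have : TensorProduct.CompatibleSMul Q R (R ⊗[R₀] Y) (R ⊗[R₀] X) := ⟨fun r x y => by
    obtain ⟨c, rfl⟩ := hs r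
    rw [algebraMap_smul, algebraMap_smul, TensorProduct.smul_tmul]⟩
  ((TensorProduct.comm R₀ X Y).baseChange R₀ R _ _ ≪≫ₗ
    TensorProduct.AlgebraTensorModule.distribBaseChange R₀ R Y X).restrictScalars Q ≪≫ₗ
    TensorProduct.equivOfCompatibleSMul Q R Q (R ⊗[R₀] Y) (R ⊗[R₀] X)

variable {Q R : Type u} [CommRing Q] [CommRing R] [IsLocalRing R₀]
  [IsNoetherianRing R₀] [IsLocalRing Q] [Algebra Q R] [Algebra R₀ R] [Module.Flat R₀ R]
  [SMulCommClass R₀ Q R] (P : Pres R₀ Q R)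

lemma Pres.length_le (h : BddAbove {n | ∃ rs : List R₀, rs.length = n ∧
    (∀ r ∈ rs, r ∈ maximalIdeal R₀) ∧ IsRegular R₀ rs}) :
    P.xs.length ≤ depth R₀ (ModuleCat.of R₀ R₀) + P.fs.length := by
  obtain ⟨rs, hl, hm, hw, x, hx, hs⟩ := exists_depth R₀ h
  by_contra! hlt
  rw [← hl] at hlt
  let e : (Q ⧸ Ideal.ofList P.fs • (⊤ : Submodule Q Q)) ≃ₗ[Q] R :=
    (Submodule.quotEquivOfEq _ _ (by
      rw [smul_eq_mul, Ideal.mul_top, ← P.ker]; rfl)).trans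
    ((Algebra.linearMap Q R).quotKerEquivOfSurjective P.surj)
  refine (P.ev_baseChange hm hw hx hs).2 (((EV.quot P.fs_reg (rs.length + 1) (fun i hi => ?_) _
    (Nat.lt_succ_self _)).of_equiv e).of_equiv
    ((TensorProduct.AlgebraTensorModule.rid R₀ R R).symm.restrictScalars Q))
  exact EV.of_isWeaklyRegular' (fun r hr => P.ofList_xs ▸ Ideal.subset_span hr) P.xs_reg (by lia)

end Assembly

section Main

open RingTheory.Sequence IsLocalRing

variable {R₀ Q R : Type u} [CommRing R₀] [CommRing Q] [CommRing R] [IsLocalRing R₀]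
  [IsNoetherianRing R₀] [IsLocalRing Q] [IsNoetherianRing Q] [Algebra Q R] [Algebra R₀ R]
  [Module.Flat R₀ R] [SMulCommClass R₀ Q R] (P : Pres R₀ Q R)

include P

lemma Pres.exists_mf (X : Type u) [AddCommGroup X] [Module R₀ X] [Module.Finite R₀ X]
    [Nontrivial X] {ss : List Q} (hs : ∀ s ∈ ss, s ∈ maximalIdeal Q)
    (h : IsWeaklyRegular (R ⊗[R₀] X) ss) : ∃ (n : Type) (_ : Fintype n) (_ : DecidableEq n)
      (G : FinRes Q (R ⊗[R₀] X) n) (_ : MF (fun j : Fin P.fs.length => P.fs[j]) G),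
      ∀ x, G.deg x ≤ P.xs.length - ss.length := by
  have := P.faithfullyFlat
  have : Module.Finite Q R := .of_surjective (Algebra.linearMap Q R) P.surj
  have : Module.Finite Q (R ⊗[R₀] X) := .trans R _
  obtain ⟨n, i₁, i₂, G, hG⟩ := exists_finRes (P.xs.length - ss.length) _
    (hasProjectiveDimensionLT_of_isWeaklyRegular P.xs_reg P.ofList_xs (R ⊗[R₀] X)
      (ss := ss.take P.xs.length) (fun s h => hs s (List.mem_of_mem_take h))
      ((isWeaklyRegular_append_iff _ _ (ss.drop P.xs.length)).1
        (by rwa [List.take_append_drop])).1 (by rw [List.length_take]; lia))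
  obtain ⟨A⟩ := MF.exists (fun j : Fin P.fs.length => P.fs[j]) G fun j n => by
    have : algebraMap Q R P.fs[j] = 0 := by
      rw [← RingHom.mem_ker, P.ker]
      exact Ideal.subset_span (List.getElem_mem _)
    rw [← algebraMap_smul R, this, zero_smul]
  exact ⟨n, i₁, i₂, G, A, hG⟩

lemma Pres.ker_range :
    RingHom.ker (algebraMap Q R) = Ideal.span (Set.range fun j : Fin P.fs.length => P.fs[j]) := by
  rw [P.ker, Ideal.ofList]
  congr 1
  ext y
  exact List.mem_iff_get

variable {M N : ModuleCat.{u} R₀} [Module.Finite R₀ M] [Module.Finite R₀ N] {m n : Type}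
  [Fintype m] [DecidableEq m] [Fintype n] [DecidableEq n] {G : FinRes Q (R ⊗[R₀] M) n}
  {H : FinRes Q (R ⊗[R₀] N) m} (A : MF (fun j : Fin P.fs.length => P.fs[j]) G)
  (B : MF (fun j : Fin P.fs.length => P.fs[j]) H)

lemma Pres.res : Res (P := fun i => TR Q (Fin P.fs.length) R G.deg i) (dR A.gr)
    (augR G (Fin P.fs.length)) :=
  res_TR A (isRegFam_of_isWeaklyRegular P.fs_reg) P.surj P.ker_range

lemma Pres.homGen_iff (i r : ℕ) : HomGen H.deg G.deg (homM H.deg G.deg B.A A.A) (i + 1) r ↔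
    numGen R₀ (ExtMod R₀ (i + 1) M N) ≤ r :=
  Iff.trans ⟨cocGen_of_homGen B A.gr A.sq, homGen_of_cocGen B P.surj A.gr A.sq⟩
    (cocGen_baseChange_iff (X := M) (Y := N) P.map_ne_top (P.res A) i r)

include A B in
lemma Pres.numGen_le : ∃ α : ℝ, ∀ᶠ k : ℕ in Filter.atTop,
    (numGen R₀ (ExtMod R₀ k M N) : ℝ) ≤ α * (k : ℝ) ^ ((cx R₀ M N : ℝ) - 1) := by
  obtain ⟨q, hq⟩ := exists_homGen B.gr A.gr
  refine Nat.sInf_mem (s := {r : ℕ | ∃ α : ℝ, ∀ᶠ k : ℕ in Filter.atTop,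
    (numGen R₀ (ExtMod R₀ k M N) : ℝ) ≤ α * (k : ℝ) ^ ((r : ℝ) - 1)})
    ⟨P.fs.length + 1, q, (Filter.eventually_ge_atTop 1).mono fun k hk => ?_⟩
  obtain ⟨i, rfl⟩ := Nat.exists_eq_add_of_le' hk
  have := (P.homGen_iff A B i _).1 (hq i)
  rw [Fintype.card_fin] at this
  rw [Nat.cast_succ P.fs.length, add_sub_cancel_right, Real.rpow_natCast]
  exact_mod_cast this

lemma Pres.acyc (h : ∃ k, ∀ i, k ≤ i → IsFiniteLength R₀ (TorMod R₀ i M N)) :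
    ∃ k, ∀ i, k ≤ i → ∀ y ∈ maximalIdeal Q, Acyc y G.deg A.A ∅ (R ⊗[R₀] N) i := by
  obtain ⟨k, hk⟩ := h
  refine ⟨k + 1, fun i hi y hy => ?_⟩
  obtain ⟨i, rfl⟩ := Nat.exists_eq_add_of_le' (Nat.one_le_of_lt hi)
  obtain ⟨T, hT⟩ := exists_pow_smul_eq_zero (hk (i + 1) (by lia))
  refine acyc_of_tor (R := R) A.gr i T y
    (smul_tor_baseChange (X := M) (Y := N) (P.res A) i hT ?_)
  rw [map_pow, Ideal.map_pow, P.map_eq]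
  exact Ideal.pow_mem_pow (Ideal.mem_map_of_mem _ hy) _

omit [Module.Finite R₀ M] [Module.Finite R₀ N] in
theorem Pres.add_le [Infinite (ResidueField Q)] [hM : Module.Finite R₀ M] [hN : Module.Finite R₀ N]
    [Nontrivial M] [Nontrivial N]
    (htor : ∃ k, ∀ i, k ≤ i → IsFiniteLength R₀ (TorMod R₀ i M N))
    (hdep : cx R₀ M N + 1 ≤ depth R₀ (ModuleCat.of R₀ (M ⊗[R₀] N)))
    (hR : BddAbove {n | ∃ rs : List R₀, rs.length = n ∧
      (∀ r ∈ rs, r ∈ maximalIdeal R₀) ∧ IsRegular R₀ rs})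
    (hMN : BddAbove {n | ∃ rs : List R₀, rs.length = n ∧
      (∀ r ∈ rs, r ∈ maximalIdeal R₀) ∧ IsRegular (M ⊗[R₀] N) rs}) [Nontrivial (M ⊗[R₀] N)]
    {a b : ℕ} (ha : a ≤ depth R₀ (ModuleCat.of R₀ R₀)) (hb : b ≤ depth R₀ (ModuleCat.of R₀ R₀))
    (hMa : IsNthSyzygy R₀ a M) (hNb : IsNthSyzygy R₀ b N) :
    a + b ≤ depth R₀ (ModuleCat.of R₀ (M ⊗[R₀] N)) + depth R₀ (ModuleCat.of R₀ R₀) := by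
  have hD := P.length_le hR
  obtain ⟨rs, hl, hm, hw, -⟩ := exists_depth R₀ hR
  obtain ⟨us, hul, hum, huw, x, hx, hs⟩ := exists_depth (M ⊗[R₀] N) hMN
  obtain ⟨hE, hEd⟩ := P.ev_baseChange hum huw hx hs
  by_contra! hlt
  have hta : (rs.take a).length = a := by rw [List.length_take]; lia
  obtain ⟨ss, hsl, hsm, hse⟩ := P.exists_list fun r h => hm r (List.mem_of_mem_take (i := a) h)
  have hMs : IsWeaklyRegular (R ⊗[R₀] M) ss := isWeaklyRegular_baseChange hse
    (Syz.isWeaklyRegular (by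
      rw [hta]
      exact syz_of_isNthSyzygy ((isWeaklyRegular_append_iff _ _ (rs.drop a)).1
        (by rwa [List.take_append_drop])).1 a hMa))
  obtain ⟨C, rfl, hC⟩ := exists_free_chain b hNb
  choose I p q hpq using hC
  have hC' := fun j => exists_free_baseChange (R := R) (p j) (q j)
  choose p' q' hpq' using hC'
  obtain ⟨n, _, _, G, A, hG⟩ := P.exists_mf M hsm hMs
  obtain ⟨m, _, _, H, B, -⟩ := P.exists_mf (C 0) (ss := []) (by simp) (.nil ..)
  let e := distribEquiv (R₀ := R₀) (Q := Q) (R := R) P.surj M (C 0)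
  exact core_completeIntersection (Nf := fun j => R ⊗[R₀] C j) A B
    (fun j => P.fs_mem _ (List.getElem_mem _)) (isRegFam_of_isWeaklyRegular P.fs_reg)
    P.xs_reg P.ofList_xs R P.surj P.ker_range _ (P.numGen_le A B)
    (.of_forall fun i => (P.homGen_iff A B i _).2 le_rfl) (hul ▸ hdep) hG (b := b)
    (by lia) (by lia) (p := p') (q := q') (fun j hj => (hpq' j (hpq j hj)).1)
    (fun j hj => (hpq' j (hpq j hj)).2.2) (fun j hj => (hpq' j (hpq j hj)).2.1)
    (P.acyc A htor) hsm hMs (by lia) (fun i hi => (hE i hi).of_equiv e)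
    (fun h => hEd (h.of_equiv e.symm))

end Main

end MatFac

open scoped TensorProduct in
theorem stmt18 (R : Type u) [CommRing R] [IsLocalRing R] [IsNoetherianRing R]
    (hci : IsCompleteIntersectionLocal R)
    (M N : ModuleCat.{u} R) (hM : Module.Finite R M) (hN : Module.Finite R N)
    (hM0 : Nontrivial M) (hN0 : Nontrivial N)
    (htor : ∃ n : ℕ, ∀ i : ℕ, n ≤ i → IsFiniteLength R (TorMod R i M N))
    (hdep : cx R M N + 1 ≤ depth R (ModuleCat.of R (↥M ⊗[R] ↥N))) :
    syz R M + syz R N ≤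
      depth R (ModuleCat.of R (↥M ⊗[R] ↥N)) + depth R (ModuleCat.of R R) := by
  have : Nontrivial M := hM0
  have : Nontrivial N := hN0
  set D := {n | ∃ rs : List R, rs.length = n ∧
      (∀ r ∈ rs, r ∈ IsLocalRing.maximalIdeal R) ∧ RingTheory.Sequence.IsRegular R rs} with hD
  have key (X : ModuleCat.{u} R) :
      syz R X ≤ depth R (ModuleCat.of R R) ∧ IsNthSyzygy R (syz R X) X :=
    Nat.sSup_mem (s := {t | t ≤ depth R (ModuleCat.of R R) ∧ IsNthSyzygy R t X})
      ⟨0, Nat.zero_le _, trivial⟩ ⟨_, fun _ h => h.1⟩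
  by_cases hR : BddAbove D
  · set E := {n | ∃ rs : List R, rs.length = n ∧ (∀ r ∈ rs, r ∈ IsLocalRing.maximalIdeal R) ∧
      RingTheory.Sequence.IsRegular (↥M ⊗[R] ↥N) rs} with hE
    have hpos : 0 < sSup E := (Nat.succ_pos _).trans_le hdep
    have hMN : BddAbove E := by
      by_contra h
      exact hpos.ne' (Nat.sSup_of_not_bddAbove h)
    have hne : E.Nonempty := by
      by_contra h
      rw [Set.not_nonempty_iff_eq_empty] at h
      exact hpos.ne' (by rw [h, csSup_empty]; rfl)
    obtain ⟨-, rs, -, -, hrs⟩ := hne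
    have : Nontrivial (↥M ⊗[R] ↥N) := hrs.nontrivial
    obtain ⟨T, S, _, _, _, _, _, _, _, hfl, ⟨P⟩⟩ := MatFac.exists_pres R hci
    have : SMulCommClass R T S := ⟨fun a b c => by
      rw [Algebra.smul_def, Algebra.smul_def, Algebra.smul_def, Algebra.smul_def, mul_left_comm]⟩
    exact P.add_le htor hdep hR hMN (key M).1 (key N).1 (key M).2 (key N).2
  · have h0 : depth R (ModuleCat.of R R) = 0 := Nat.sSup_of_not_bddAbove hR
    have h1 := (key M).1
    have h2 := (key N).1
    lia
end
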